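/- Let M ≠ {0} be a closed subspace of D(μ) invariant under multiplication by z, and let Θ_M be the greatest common inner divisor of M. Then there exists an outer function f ∈ D(μ) ∩ H^∞ such that M = Θ_M H² ∩ [f]_{D(μ)}; moreover f can be chosen so that both f and Θ_M f are multipliers of D(μ). -/

import Mathlib

open MeasureTheory Metric Filter Complex Set
open scoped ENNReal Topology

noncomputable section

namespace DirichletMu

/-- The open unit disc in `ℂ`. -/
def disc : Set ℂ := Metric.ball 0 1

/-- The unit circle `𝕋`. -/
def circleT : Set ℂ := Metric.sphere 0 1

/-- The boundary point `e^{it}`. -/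
def bpt (t : ℝ) : ℂ := Complex.exp (Complex.I * (t : ℂ))

/-- Arc-length parametrizing measure on `(0, 2π]`. -/
def θm : Measure ℝ := volume.restrict (Set.Ioc 0 (2 * Real.pi))

/-- A measure is carried by the unit circle. -/
def OnCircle (μ : Measure ℂ) : Prop := μ circleTᶜ = 0

/-- The mean-square integrals of `f` over circles of radius `r < 1`. -/
def hardySet (f : ℂ → ℂ) : Set ℝ :=
  {x | ∃ r : ℝ, 0 < r ∧ r < 1 ∧
    x = (1 / (2 * Real.pi)) * ∫ t in (0:ℝ)..(2 * Real.pi), ‖f ((r : ℂ) * bpt t)‖ ^ 2}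

/-- Membership in the Hardy space `H²`. -/
def MemHardy2 (f : ℂ → ℂ) : Prop :=
  DifferentiableOn ℂ f disc ∧ BddAbove (hardySet f)

/-- The squared Hardy norm. -/
def hardyNormSq (f : ℂ → ℂ) : ℝ := sSup (hardySet f)

/-- Membership in `H^∞`. -/
def MemHinf (f : ℂ → ℂ) : Prop :=
  DifferentiableOn ℂ f disc ∧ ∃ C : ℝ, ∀ z ∈ disc, ‖f z‖ ≤ C

/-- The sup norm over the disc. -/
def supNorm (f : ℂ → ℂ) : ℝ := sSup ((fun z => ‖f z‖) '' disc)

/-- The Poisson integral of the measure `μ`. -/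
def poissonMu (μ : Measure ℂ) (z : ℂ) : ℝ :=
  ∫ ζ, (1 - ‖z‖ ^ 2) / ‖1 - (starRingEnd ℂ) ζ * z‖ ^ 2 ∂μ

/-- The integrand of the Dirichlet integral. -/
def dirichletDensity (μ : Measure ℂ) (f : ℂ → ℂ) (z : ℂ) : ℝ :=
  ‖deriv f z‖ ^ 2 * poissonMu μ z

/-- The Dirichlet integral `D_μ(f)`. -/
def dirichletIntegral (μ : Measure ℂ) (f : ℂ → ℂ) : ℝ :=
  (1 / Real.pi) * ∫ z in disc, dirichletDensity μ f z

/-- Membership in the Dirichlet-type space `D(μ)`. -/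
def MemD (μ : Measure ℂ) (f : ℂ → ℂ) : Prop :=
  MemHardy2 f ∧ IntegrableOn (dirichletDensity μ f) disc

/-- The squared norm `‖f‖_μ²` of `D(μ)`. -/
def dNormSq (μ : Measure ℂ) (f : ℂ → ℂ) : ℝ :=
  hardyNormSq f + dirichletIntegral μ f

/-- `f` has radial limit `L` at `ζ`. -/
def HasRadialLimitAt (f : ℂ → ℂ) (ζ L : ℂ) : Prop :=
  Tendsto (fun r : ℝ => f ((r : ℂ) * ζ)) (nhdsWithin 1 (Set.Iio 1)) (nhds L)

/-- The modulus of `f` has radial limit `m` at `e^{it}`. -/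
def BoundaryAbs (f : ℂ → ℂ) (t : ℝ) (m : ℝ) : Prop :=
  Tendsto (fun r : ℝ => ‖f ((r : ℂ) * bpt t)‖) (nhdsWithin 1 (Set.Iio 1)) (nhds m)

/-- The boundary zero set `Z_𝕋(f)`. -/
def ZT (f : ℂ → ℂ) : Set ℂ :=
  {ζ | ζ ∈ circleT ∧ HasRadialLimitAt f ζ 0}

/-- The set `Z̲(f)`. -/
def Zlow (f : ℂ → ℂ) : Set ℂ :=
  {ζ | ζ ∈ Metric.closedBall (0 : ℂ) 1 ∧
    Filter.liminf (fun z => ‖f z‖) (nhdsWithin ζ disc) = 0}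

def ZlowSet (S : Set (ℂ → ℂ)) : Set ℂ := ⋂ f ∈ S, Zlow f

def ZTSet (S : Set (ℂ → ℂ)) : Set ℂ := ⋂ f ∈ S, ZT f

/-- `[f]_{D(μ)}`: the closure in `D(μ)` of the polynomial multiples of `f`. -/
def closedSpan (μ : Measure ℂ) (f : ℂ → ℂ) : Set (ℂ → ℂ) :=
  {g | MemD μ g ∧ ∀ ε > 0, ∃ q : Polynomial ℂ,
    dNormSq μ (fun z => g z - q.eval z * f z) < ε}

/-- `f` is cyclic for `D(μ)`. -/
def IsCyclic (μ : Measure ℂ) (f : ℂ → ℂ) : Prop :=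
  closedSpan μ f = {g | MemD μ g}

/-- `f` is the outer function with boundary modulus `φ` (parametrized by `e^{it}`). -/
def OuterWith (f : ℂ → ℂ) (φ : ℝ → ℝ) : Prop :=
  (∀ t, 0 ≤ φ t) ∧
  IntervalIntegrable (fun t => Real.log (φ t)) volume 0 (2 * Real.pi) ∧
  ∀ z ∈ disc, f z = Complex.exp (((2 * Real.pi : ℝ) : ℂ)⁻¹ *
    ∫ t in (0:ℝ)..(2 * Real.pi), ((bpt t + z) / (bpt t - z)) * (Real.log (φ t) : ℂ))

/-- `f` is an outer function. -/
def IsOuter (f : ℂ → ℂ) : Prop := ∃ φ, OuterWith f φ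

/-- Inner functions. -/
def IsInner (f : ℂ → ℂ) : Prop :=
  DifferentiableOn ℂ f disc ∧ (∀ z ∈ disc, ‖f z‖ ≤ 1) ∧
  ∀ᵐ t ∂θm, BoundaryAbs f t 1

/-- `f / Θ ∈ H²`. -/
def InnerDivides (Θ f : ℂ → ℂ) : Prop :=
  ∃ g, MemHardy2 g ∧ ∀ z ∈ disc, f z = Θ z * g z

/-- `Θ / Θ'` is bounded on the disc. -/
def DividesBdd (Θ' Θ : ℂ → ℂ) : Prop :=
  ∃ g, MemHinf g ∧ ∀ z ∈ disc, Θ z = Θ' z * g z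

/-- `Θ` is the greatest common inner divisor of the family `M`. -/
def IsGCDInner (M : Set (ℂ → ℂ)) (Θ : ℂ → ℂ) : Prop :=
  IsInner Θ ∧ (∀ f ∈ M, InnerDivides Θ f) ∧
  ∀ Θ', IsInner Θ' → (∀ f ∈ M, InnerDivides Θ' f) → DividesBdd Θ' Θ

/-- The set `Θ H²`. -/
def innerMulH2 (Θ : ℂ → ℂ) : Set (ℂ → ℂ) :=
  {h | ∃ g, MemHardy2 g ∧ ∀ z ∈ disc, h z = Θ z * g z}

/-- Poisson extension of a boundary function (parametrized by `e^{it}`). -/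
def poissonExt (u : ℝ → ℝ) (z : ℂ) : ℝ :=
  (1 / (2 * Real.pi)) * ∫ t in (0:ℝ)..(2 * Real.pi),
    ((1 - ‖z‖ ^ 2) / ‖bpt t - z‖ ^ 2) * u t

/-- `|∇ P[u]|² P_μ`. -/
def gradDensity (μ : Measure ℂ) (u : ℝ → ℝ) (z : ℂ) : ℝ :=
  ‖fderiv ℝ (poissonExt u) z‖ ^ 2 * poissonMu μ z

/-- Membership in the harmonic Dirichlet space `D^h(μ)`. -/
def MemDh (μ : Measure ℂ) (u : ℝ → ℝ) : Prop :=
  IntegrableOn (fun t => (u t) ^ 2) (Set.Ioc 0 (2 * Real.pi)) volume ∧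
  IntegrableOn (gradDensity μ u) disc

/-- The squared norm of `D^h(μ)`. -/
def dhNormSq (μ : Measure ℂ) (u : ℝ → ℝ) : ℝ :=
  (1 / (2 * Real.pi)) * (∫ t in Set.Ioc 0 (2 * Real.pi), (u t) ^ 2) +
  (1 / Real.pi) * ∫ z in disc, gradDensity μ u z

/-- Relatively open subsets of the circle. -/
def RelOpen (U : Set ℂ) : Prop := ∃ V : Set ℂ, IsOpen V ∧ U = V ∩ circleT

/-- Capacity of a relatively open subset of the circle. -/
def capOpen (μ : Measure ℂ) (U : Set ℂ) : ℝ≥0∞ :=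
  ⨅ (u : ℝ → ℝ) (_ : MemDh μ u ∧ (∀ t, 0 ≤ u t) ∧
      ∀ᵐ t ∂θm, bpt t ∈ U → 1 ≤ u t),
    ENNReal.ofReal (dhNormSq μ u)

/-- The capacity `c_μ` of an arbitrary subset of the circle. -/
def cap (μ : Measure ℂ) (F : Set ℂ) : ℝ≥0∞ :=
  ⨅ (U : Set ℂ) (_ : RelOpen U ∧ F ⊆ U), capOpen μ U

/-- The (closed) support of a measure on `ℂ`. -/
def msupport (μ : Measure ℂ) : Set ℂ :=
  {x | ∀ r > 0, 0 < μ (Metric.ball x r)}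

/-- `M_μ(E)`: functions of `D(μ)` whose radial limits vanish `c_μ`-q.e. on `E`. -/
def Mspace (μ : Measure ℂ) (E : Set ℂ) : Set (ℂ → ℂ) :=
  {g | MemD μ g ∧ ∃ N : Set ℂ, cap μ N = 0 ∧ ∀ ζ ∈ E \ N, HasRadialLimitAt g ζ 0}

/-- Closed shift-invariant subspaces of `D(μ)` (closedness for the `D(μ)` norm). -/
structure ClosedInvSubspace (μ : Measure ℂ) (M : Set (ℂ → ℂ)) : Prop where
  subset : M ⊆ {f | MemD μ f}
  zero_mem : (fun _ => (0 : ℂ)) ∈ M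
  add_mem : ∀ f ∈ M, ∀ g ∈ M, (fun z => f z + g z) ∈ M
  smul_mem : ∀ (c : ℂ), ∀ f ∈ M, (fun z => c * f z) ∈ M
  shift_mem : ∀ f ∈ M, (fun z => z * f z) ∈ M
  closed : ∀ g, MemD μ g →
    (∀ ε > 0, ∃ h ∈ M, dNormSq μ (fun z => g z - h z) < ε) → g ∈ M

/-- The norm `‖f‖_{∞,μ}` of the Banach algebra `D(μ) ∩ H^∞`. -/
def algNorm (μ : Measure ℂ) (f : ℂ → ℂ) : ℝ :=
  supNorm f + Real.sqrt (dirichletIntegral μ f)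

/-- Membership in the Banach algebra `D(μ) ∩ H^∞`. -/
def MemA (μ : Measure ℂ) (f : ℂ → ℂ) : Prop := MemD μ f ∧ MemHinf f

/-- Closed ideals of `D(μ) ∩ H^∞`. -/
structure ClosedIdeal (μ : Measure ℂ) (J : Set (ℂ → ℂ)) : Prop where
  subset : J ⊆ {f | MemA μ f}
  zero_mem : (fun _ => (0 : ℂ)) ∈ J
  add_mem : ∀ f ∈ J, ∀ g ∈ J, (fun z => f z + g z) ∈ J
  mul_mem : ∀ f, MemA μ f → ∀ g ∈ J, (fun z => f z * g z) ∈ J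
  closed : ∀ g, MemA μ g →
    (∀ ε > 0, ∃ h ∈ J, algNorm μ (fun z => g z - h z) < ε) → g ∈ J

/-- A multiplier of `D(μ)`. -/
def IsMultiplier (μ : Measure ℂ) (φ : ℂ → ℂ) : Prop :=
  DifferentiableOn ℂ φ disc ∧ ∀ g, MemD μ g → MemD μ (fun z => φ z * g z)

/-- Distance between two subsets of `ℂ`. -/
def setDist (A B : Set ℂ) : ℝ :=
  sInf ((fun p : ℂ × ℂ => dist p.1 p.2) '' (A ×ˢ B))

lemma mem_disc {z : ℂ} : z ∈ disc ↔ ‖z‖ < 1 := by simp [disc]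

lemma isOpen_disc : IsOpen disc := Metric.isOpen_ball

lemma zero_mem_disc : (0 : ℂ) ∈ disc := by simp [disc]

lemma norm_bpt (t : ℝ) : ‖bpt t‖ = 1 := by
  rw [bpt, mul_comm]; exact Complex.norm_exp_ofReal_mul_I t

@[fun_prop]
lemma continuous_bpt : Continuous bpt := by unfold bpt; fun_prop

lemma circleMap_eq (r t : ℝ) : circleMap 0 r t = r * bpt t := by
  simp [circleMap, bpt, mul_comm]

lemma mul_bpt_mem_disc {r : ℝ} (h0 : 0 ≤ r) (h1 : r < 1) (t : ℝ) : (r : ℂ) * bpt t ∈ disc := by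
  rw [mem_disc, norm_mul, norm_bpt, mul_one, Complex.norm_real, Real.norm_of_nonneg h0]
  exact h1

lemma bpt_sub_ne {z : ℂ} (hz : z ∈ disc) (t : ℝ) : bpt t - z ≠ 0 := by
  intro h
  rw [sub_eq_zero] at h
  rw [mem_disc, ← h, norm_bpt] at hz
  exact lt_irrefl _ hz

/-- Normalized arc length on the circle, in the parameter `t ∈ (0, 2π]`. -/
def cm : Measure ℝ := ENNReal.ofReal (2 * Real.pi)⁻¹ • θm

instance : IsProbabilityMeasure cm where
  measure_univ := by
    simp only [cm, θm, Measure.smul_apply, MeasurableSet.univ, Measure.restrict_apply,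
      Set.univ_inter, Real.volume_Ioc, sub_zero, smul_eq_mul]
    rw [← ENNReal.ofReal_mul (by positivity), inv_mul_cancel₀ (by positivity), ENNReal.ofReal_one]

lemma integral_cm {E : Type*} [NormedAddCommGroup E] [NormedSpace ℝ E] (f : ℝ → E) :
    ∫ t, f t ∂cm = (2 * Real.pi)⁻¹ • ∫ t in (0:ℝ)..(2 * Real.pi), f t := by
  rw [cm, integral_smul_measure, intervalIntegral.integral_of_le (by positivity), θm,
    ENNReal.toReal_ofReal (by positivity)]

lemma ofReal_two_pi_inv_ne_zero : ENNReal.ofReal (2 * Real.pi)⁻¹ ≠ 0 := by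
  rw [Ne, ENNReal.ofReal_eq_zero, not_le]; positivity

lemma ae_cm : ae cm = ae θm :=
  Measure.ae_ennreal_smul_measure_eq ofReal_two_pi_inv_ne_zero _

lemma integrable_cm_iff {E : Type*} [NormedAddCommGroup E] {f : ℝ → E} :
    Integrable f cm ↔ IntegrableOn f (Set.Ioc 0 (2 * Real.pi)) volume := by
  rw [cm, integrable_smul_measure ofReal_two_pi_inv_ne_zero ENNReal.ofReal_ne_top, θm,
    IntegrableOn]

lemma integral_cm_eq_circleAverage {E : Type*} [NormedAddCommGroup E] [NormedSpace ℝ E]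
    (f : ℂ → E) : ∫ t, f (bpt t) ∂cm = Real.circleAverage f 0 1 := by
  rw [integral_cm, Real.circleAverage_def]
  simp [circleMap_eq]

/-- The Poisson kernel. -/
def pk (z : ℂ) (t : ℝ) : ℝ := (1 - ‖z‖ ^ 2) / ‖bpt t - z‖ ^ 2

lemma norm_sq_lt_one {z : ℂ} (hz : z ∈ disc) : ‖z‖ ^ 2 < 1 := by
  rw [mem_disc] at hz
  nlinarith [norm_nonneg z]

lemma one_sub_norm_sq_pos {z : ℂ} (hz : z ∈ disc) : 0 < 1 - ‖z‖ ^ 2 := by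
  linarith [norm_sq_lt_one hz]

lemma pk_pos {z : ℂ} (hz : z ∈ disc) (t : ℝ) : 0 < pk z t :=
  div_pos (one_sub_norm_sq_pos hz) (by have := bpt_sub_ne hz t; positivity)

lemma continuous_pk {z : ℂ} (hz : z ∈ disc) : Continuous (pk z) := by
  unfold pk
  refine Continuous.div (by fun_prop) (by fun_prop) fun t => ?_
  have := bpt_sub_ne hz t; positivity

lemma pk_le {z : ℂ} (hz : z ∈ disc) (t : ℝ) : pk z t ≤ (1 + ‖z‖) / (1 - ‖z‖) := by
  have h1 : ‖z‖ < 1 := mem_disc.1 hz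
  have h2 : 1 - ‖z‖ ≤ ‖bpt t - z‖ := by
    have := norm_sub_norm_le (bpt t) z; rwa [norm_bpt] at this
  rw [pk, div_le_div_iff₀ (by nlinarith) (by linarith)]
  have : (1 - ‖z‖) * (1 - ‖z‖) ≤ ‖bpt t - z‖ ^ 2 := by nlinarith
  nlinarith [mul_le_mul_of_nonneg_left this (by positivity : 0 ≤ 1 + ‖z‖)]

lemma le_pk {z : ℂ} (hz : z ∈ disc) (t : ℝ) : (1 - ‖z‖) / (1 + ‖z‖) ≤ pk z t := by
  have h1 : ‖z‖ < 1 := mem_disc.1 hz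
  have h2 : ‖bpt t - z‖ ≤ 1 + ‖z‖ := by
    have := norm_sub_le (bpt t) z; rwa [norm_bpt] at this
  have h3 := bpt_sub_ne hz t
  rw [pk, div_le_div_iff₀ (by positivity) (by positivity)]
  have : ‖bpt t - z‖ ^ 2 ≤ (1 + ‖z‖) * (1 + ‖z‖) := by nlinarith [norm_nonneg (bpt t - z)]
  nlinarith [mul_le_mul_of_nonneg_left this (by linarith : 0 ≤ 1 - ‖z‖)]

/-- Harmonic measure at `z`. -/
def pm (z : ℂ) : Measure ℝ := cm.withDensity fun t => ENNReal.ofReal (pk z t)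

lemma integral_pm {E : Type*} [NormedAddCommGroup E] [NormedSpace ℝ E] {z : ℂ} (hz : z ∈ disc)
    (f : ℝ → E) : ∫ t, f t ∂(pm z) = ∫ t, pk z t • f t ∂cm := by
  rw [pm, integral_withDensity_eq_integral_toReal_smul
    (continuous_pk hz).measurable.ennreal_ofReal (by simp)]
  simp only [ENNReal.toReal_ofReal (pk_pos hz _).le]

lemma ae_pm {z : ℂ} (hz : z ∈ disc) : ae (pm z) = ae cm := by
  refine le_antisymm (withDensity_absolutelyContinuous _ _).ae_le ?_
  refine (withDensity_absolutelyContinuous' (continuous_pk hz).measurable.ennreal_ofReal.aemeasurable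
    (ae_of_all _ fun t => ?_)).ae_le
  rw [Ne, ENNReal.ofReal_eq_zero, not_le]
  exact pk_pos hz t

lemma pm_le_smul {z : ℂ} (hz : z ∈ disc) :
    pm z ≤ ENNReal.ofReal ((1 + ‖z‖) / (1 - ‖z‖)) • cm := by
  rw [pm, ← withDensity_const]
  exact withDensity_mono (ae_of_all _ fun t => ENNReal.ofReal_le_ofReal (pk_le hz t))

lemma smul_le_pm {z : ℂ} (hz : z ∈ disc) :
    ENNReal.ofReal ((1 - ‖z‖) / (1 + ‖z‖)) • cm ≤ pm z := by
  rw [pm, ← withDensity_const]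
  exact withDensity_mono (ae_of_all _ fun t => ENNReal.ofReal_le_ofReal (le_pk hz t))

lemma memLp_pm_iff {E : Type*} [NormedAddCommGroup E] {z : ℂ} (hz : z ∈ disc) {f : ℝ → E}
    {p : ℝ≥0∞} : MemLp f p (pm z) ↔ MemLp f p cm := by
  refine ⟨fun h => ?_, fun h => ?_⟩
  · have h1 := h.mono_measure (smul_le_pm hz)
    have hc : ENNReal.ofReal ((1 - ‖z‖) / (1 + ‖z‖)) ≠ 0 := by
      rw [Ne, ENNReal.ofReal_eq_zero, not_le]
      have := mem_disc.1 hz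
      exact div_pos (by linarith) (by positivity)
    have h2 := h1.smul_measure (c := (ENNReal.ofReal ((1 - ‖z‖) / (1 + ‖z‖)))⁻¹) (by simp [hc])
    rwa [smul_smul, ENNReal.inv_mul_cancel hc ENNReal.ofReal_ne_top, one_smul] at h2
  · exact (h.smul_measure ENNReal.ofReal_ne_top).mono_measure (pm_le_smul hz)

lemma integrable_pm_iff {E : Type*} [NormedAddCommGroup E] {z : ℂ} (hz : z ∈ disc) {f : ℝ → E} :
    Integrable f (pm z) ↔ Integrable f cm := by
  rw [← memLp_one_iff_integrable, ← memLp_one_iff_integrable, memLp_pm_iff hz]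

/-- Poisson's formula for functions continuous up to the circle. -/
lemma poisson_formula {E : Type*} [NormedAddCommGroup E] [NormedSpace ℂ E] [CompleteSpace E]
    {f : ℂ → E} (hf : DiffContOnCl ℂ f disc) {z : ℂ} (hz : z ∈ disc) :
    ∫ t, f (bpt t) ∂(pm z) = f z := by
  rw [integral_pm hz, ← hf.circleAverage_poissonKernel_smul hz, ← integral_cm_eq_circleAverage]
  congr 1; ext t
  simp [pk, poissonKernel, norm_bpt]

lemma isProbabilityMeasure_pm {z : ℂ} (hz : z ∈ disc) : IsProbabilityMeasure (pm z) := by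
  have h := poisson_formula (f := fun _ => (1 : ℂ)) diffContOnCl_const hz
  have : IsFiniteMeasure (pm z) := by
    have := (integrable_pm_iff hz (f := fun _ => (1:ℝ))).2 (integrable_const 1)
    rw [integrable_const_iff] at this
    simpa using this
  constructor
  simp only [integral_const, real_smul, mul_one] at h
  have h' : (pm z).real univ = 1 := by exact_mod_cast h
  rw [Measure.real] at h'
  rwa [ENNReal.toReal_eq_one_iff] at h'

lemma diffContOnCl_dilate {E : Type*} [NormedAddCommGroup E] [NormedSpace ℂ E] {f : ℂ → E}
    (hf : DifferentiableOn ℂ f disc) {r : ℝ} (h0 : 0 ≤ r) (h1 : r < 1) :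
    DiffContOnCl ℂ (fun z => f (r * z)) disc := by
  have hm : ∀ z ∈ closedBall (0 : ℂ) 1, (r : ℂ) * z ∈ disc := by
    intro z hz
    rw [mem_closedBall_zero_iff] at hz
    rw [mem_disc, norm_mul, Complex.norm_real, Real.norm_of_nonneg h0]
    nlinarith [norm_nonneg z]
  refine ⟨hf.comp (by fun_prop) fun z hz => hm z (ball_subset_closedBall hz), ?_⟩
  rw [disc, closure_ball _ one_ne_zero]
  exact hf.continuousOn.comp (by fun_prop) hm

lemma poisson_dilate {E : Type*} [NormedAddCommGroup E] [NormedSpace ℂ E] [CompleteSpace E]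
    {f : ℂ → E} (hf : DifferentiableOn ℂ f disc) {r : ℝ} (h0 : 0 ≤ r) (h1 : r < 1) {z : ℂ}
    (hz : z ∈ disc) : ∫ t, f (r * bpt t) ∂(pm z) = f (r * z) :=
  poisson_formula (diffContOnCl_dilate hf h0 h1) hz

lemma continuous_dilate {E : Type*} [NormedAddCommGroup E] [NormedSpace ℂ E] {f : ℂ → E}
    (hf : DifferentiableOn ℂ f disc) {r : ℝ} (h0 : 0 ≤ r) (h1 : r < 1) :
    Continuous fun t : ℝ => f (r * bpt t) :=
  hf.continuousOn.comp_continuous (by fun_prop) fun t => mul_bpt_mem_disc h0 h1 t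

lemma pk_zero (t : ℝ) : pk 0 t = 1 := by simp [pk, norm_bpt]

lemma pm_zero : pm 0 = cm := by simp [pm, pk_zero]

lemma norm_bpt_sub_sq (r s t : ℝ) :
    ‖bpt s - r * bpt t‖ ^ 2 = (1 - r) ^ 2 + r * (4 * Real.sin ((s - t) / 2) ^ 2) := by
  have hb : ∀ t : ℝ, bpt t = ⟨Real.cos t, Real.sin t⟩ := by
    intro t
    rw [bpt, mul_comm, Complex.exp_mul_I, ← Complex.ofReal_cos, ← Complex.ofReal_sin]
    apply Complex.ext <;> simp only [add_re, add_im, mul_re, mul_im, ofReal_re, ofReal_im, I_re, I_im] <;> ring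
  rw [← Complex.normSq_eq_norm_sq, hb, hb, Complex.normSq_apply]
  have h1 : Real.sin ((s - t) / 2) ^ 2 = 1 / 2 - Real.cos (s - t) / 2 := by
    rw [Real.sin_sq_eq_half_sub]; congr 2; ring_nf
  rw [h1, Real.cos_sub]
  simp
  linear_combination Real.sin_sq_add_cos_sq s + r ^ 2 * Real.sin_sq_add_cos_sq t

lemma pk_near {r s t : ℝ} (hr : 1 / 2 ≤ r) (hr1 : r < 1) (hst : |s - t| ≤ Real.pi) :
    pk (r * bpt t) s ≤ 10 * ((1 - r) / ((1 - r) ^ 2 + (s - t) ^ 2)) := by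
  have hp := Real.pi_pos
  have hsin : |s - t| / Real.pi ≤ |Real.sin ((s - t) / 2)| := by
    have := Real.mul_abs_le_abs_sin (x := (s - t) / 2) (by rw [abs_div, abs_two]; linarith)
    refine le_trans (le_of_eq ?_) this
    rw [abs_div, abs_two]; field_simp
  have h2 : (s - t) ^ 2 / 10 ≤ Real.sin ((s - t) / 2) ^ 2 := by
    rw [← sq_abs (Real.sin _), ← sq_abs (s - t)]
    have h3 : (|s - t| / Real.pi) ^ 2 ≤ |Real.sin ((s - t) / 2)| ^ 2 := by gcongr
    refine le_trans ?_ h3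
    rw [div_pow]
    have : Real.pi ^ 2 ≤ 10 := by nlinarith [Real.pi_lt_d2]
    gcongr
  rw [pk, norm_bpt_sub_sq, norm_mul, norm_bpt, mul_one, Complex.norm_real,
    Real.norm_of_nonneg (by linarith), ← mul_div_assoc]
  have hη : 0 < 1 - r := by linarith
  rw [div_le_div_iff₀ (by nlinarith [sq_nonneg (Real.sin ((s-t)/2))]) (by positivity)]
  have e1 : 1 - r ^ 2 = (1 - r) * (1 + r) := by ring
  rw [e1, mul_assoc, mul_comm (10:ℝ), mul_assoc]
  apply mul_le_mul_of_nonneg_left _ hη.le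
  have h4 : (s - t) ^ 2 / 5 ≤ r * (4 * Real.sin ((s - t) / 2) ^ 2) := by
    nlinarith [sq_nonneg (s-t), sq_nonneg (Real.sin ((s-t)/2))]
  nlinarith [sq_nonneg (s-t), sq_nonneg (1-r)]

lemma dyadic_kernel_bound {η δ x : ℝ} (hη : 0 < η) (hηδ : η ≤ δ) (hx : |x| ≤ δ / 2) :
    ∃ k : ℕ, |x| ≤ 2 ^ k * η ∧ 2 ^ k * η ≤ δ ∧ η / (η ^ 2 + x ^ 2) ≤ 4 * (η⁻¹ * (4 ^ k)⁻¹) := by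
  by_cases hs : |x| ≤ η
  · refine ⟨0, by simpa using hs, by simpa using hηδ, ?_⟩
    rw [div_le_iff₀ (by positivity)]
    field_simp
    nlinarith [sq_nonneg x]
  · push Not at hs
    obtain ⟨n, hn⟩ := pow_unbounded_of_one_lt (|x| / η) (one_lt_two)
    have hex : ∃ n : ℕ, |x| ≤ 2 ^ n * η := ⟨n, by rw [div_lt_iff₀ hη] at hn; exact hn.le⟩
    classical
    have hk := Nat.find_spec hex
    have hmin := fun m => Nat.find_min hex (m := m)
    set k := Nat.find hex
    rcases Nat.eq_zero_or_pos k with h0 | h0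
    · rw [h0] at hk; simp at hk; linarith
    · obtain ⟨j, hj⟩ : ∃ j, k = j + 1 := ⟨k - 1, by omega⟩
      have h1 := hmin j (by omega)
      push Not at h1
      refine ⟨k, hk, by rw [hj, pow_succ]; linarith, ?_⟩
      have h2 : (2 ^ j * η) ^ 2 ≤ x ^ 2 := by rw [← sq_abs x]; gcongr
      have h4 : (4 : ℝ) ^ k = 4 * (2 ^ j) ^ 2 := by
        rw [hj, pow_succ, ← pow_mul, mul_comm j 2, pow_mul]; norm_num [mul_comm]
      rw [h4, div_le_iff₀ (by positivity)]
      field_simp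
      nlinarith [sq_nonneg η]

lemma lintegral_dyadic_le {G : ℝ → ℝ≥0∞} (hG : Measurable G) {t η δ : ℝ} {ε : ℝ≥0∞} (hη : 0 < η)
    (hηδ : η ≤ δ)
    (hΦ : ∀ ρ, 0 < ρ → ρ ≤ δ → ∫⁻ s in closedBall t ρ, G s ≤ ENNReal.ofReal ρ * ε) :
    ∫⁻ s in closedBall t (δ / 2), ENNReal.ofReal (η / (η ^ 2 + (s - t) ^ 2)) * G s ≤ 8 * ε := by
  have hpt : ∀ s ∈ closedBall t (δ / 2), ENNReal.ofReal (η / (η ^ 2 + (s - t) ^ 2)) * G s ≤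
      ∑' k : ℕ, if 2 ^ k * η ≤ δ then ENNReal.ofReal (4 * (η⁻¹ * (4 ^ k)⁻¹)) *
        (closedBall t (2 ^ k * η)).indicator G s else 0 := by
    intro s hs
    obtain ⟨k, h1, h2, h3⟩ := dyadic_kernel_bound hη hηδ (x := s - t)
      (by rwa [mem_closedBall, Real.dist_eq] at hs)
    refine le_trans ?_ (ENNReal.le_tsum k)
    rw [if_pos h2, indicator_of_mem (by rwa [mem_closedBall, Real.dist_eq])]
    gcongr
  have hI : ∀ k : ℕ, Measurable ((closedBall t (2 ^ k * η)).indicator G) := fun k =>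
    hG.indicator measurableSet_closedBall
  calc _ ≤ ∫⁻ s in closedBall t (δ / 2), ∑' k : ℕ, if 2 ^ k * η ≤ δ then
          ENNReal.ofReal (4 * (η⁻¹ * (4 ^ k)⁻¹)) *
          (closedBall t (2 ^ k * η)).indicator G s else 0 := by
        refine lintegral_mono_ae ?_
        filter_upwards [ae_restrict_mem measurableSet_closedBall] with s hs using hpt s hs
    _ ≤ ∫⁻ s, ∑' k : ℕ, if 2 ^ k * η ≤ δ then ENNReal.ofReal (4 * (η⁻¹ * (4 ^ k)⁻¹)) *
          (closedBall t (2 ^ k * η)).indicator G s else 0 := setLIntegral_le_lintegral _ _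
    _ = ∑' k : ℕ, ∫⁻ s, if 2 ^ k * η ≤ δ then ENNReal.ofReal (4 * (η⁻¹ * (4 ^ k)⁻¹)) *
          (closedBall t (2 ^ k * η)).indicator G s else 0 := by
        refine lintegral_tsum fun k => ?_
        split_ifs
        · exact ((hI k).const_mul _).aemeasurable
        · exact aemeasurable_const
    _ ≤ ∑' k : ℕ, ENNReal.ofReal (4 * (1 / 2) ^ k) * ε := by
        refine ENNReal.tsum_le_tsum fun k => ?_
        split_ifs with h
        · rw [lintegral_const_mul _ (hI k), lintegral_indicator measurableSet_closedBall]
          calc _ ≤ ENNReal.ofReal (4 * (η⁻¹ * (4 ^ k)⁻¹)) * (ENNReal.ofReal (2 ^ k * η) * ε) := by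
                gcongr; exact hΦ _ (by positivity) h
            _ = ENNReal.ofReal (4 * (1 / 2) ^ k) * ε := by
                rw [← mul_assoc, ← ENNReal.ofReal_mul (by positivity)]
                congr 2
                have : (4 : ℝ) ^ k = 2 ^ k * 2 ^ k := by rw [← mul_pow]; norm_num
                rw [this, one_div, inv_pow]; field_simp
        · simp
    _ = 8 * ε := by
        rw [ENNReal.tsum_mul_right, ← ENNReal.ofReal_tsum_of_nonneg (fun k => by positivity)
          (summable_geometric_two.mul_left 4), tsum_mul_left, tsum_geometric_two]
        norm_num

lemma bpt_ne_of_ne {s t : ℝ} (hs : s ∈ Icc 0 (2 * Real.pi)) (ht : t ∈ Ioo 0 (2 * Real.pi))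
    (hst : s ≠ t) : bpt s ≠ bpt t := by
  intro h
  rw [bpt, bpt, Complex.exp_eq_exp_iff_exists_int] at h
  obtain ⟨n, hn⟩ := h
  have hn' : s = t + n * (2 * Real.pi) := by
    have h2 : Complex.I * (s : ℂ) = Complex.I * ((t + n * (2 * Real.pi) : ℝ) : ℂ) := by
      rw [hn]; push_cast; ring
    exact_mod_cast mul_left_cancel₀ Complex.I_ne_zero h2
  have hp := Real.pi_pos
  have h1 : n < 1 := by
    by_contra hc
    push Not at hc
    have : (1:ℝ) ≤ n := by exact_mod_cast hc
    nlinarith [hs.2, ht.1]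
  have h2 : -1 < n := by
    by_contra hc
    push Not at hc
    have : (n:ℝ) ≤ -1 := by exact_mod_cast hc
    nlinarith [hs.1, ht.2]
  have : n = 0 := by omega
  subst this
  simp at hn'
  exact hst hn'

lemma exists_far_bound {t δ : ℝ} (ht : t ∈ Ioo 0 (2 * Real.pi)) (hδ : 0 < δ) :
    ∃ c > 0, ∀ s ∈ Icc 0 (2 * Real.pi), δ ≤ |s - t| → c ≤ ‖bpt s - bpt t‖ := by
  have hK : IsCompact (Icc 0 (2 * Real.pi) ∩ {s | δ ≤ |s - t|}) :=
    isCompact_Icc.inter_right (isClosed_le (by fun_prop) (by fun_prop))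
  rcases (Icc 0 (2 * Real.pi) ∩ {s | δ ≤ |s - t|}).eq_empty_or_nonempty with he | hne
  · refine ⟨1, one_pos, fun s hs hd => ?_⟩
    have : s ∈ (∅ : Set ℝ) := he ▸ ⟨hs, hd⟩
    simp at this
  · obtain ⟨s₀, hs₀, hmin⟩ := hK.exists_isMinOn hne
      (f := fun s => ‖bpt s - bpt t‖) (by fun_prop)
    refine ⟨‖bpt s₀ - bpt t‖, ?_, fun s hs hd => hmin ⟨hs, hd⟩⟩
    have h1 : s₀ ≠ t := by
      rintro rfl
      have := hs₀.2
      simp at this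
      linarith
    have := sub_ne_zero.2 (bpt_ne_of_ne hs₀.1 ht h1)
    positivity

lemma pk_far {r s t c : ℝ} (hr : 1 / 2 ≤ r) (hr1 : r < 1) (hc : 0 < c)
    (h : c ≤ ‖bpt s - bpt t‖) : pk (r * bpt t) s ≤ (4 / c ^ 2) * (1 - r) := by
  have h1 := norm_bpt_sub_sq 1 s t
  simp only [ofReal_one, one_mul, sub_self] at h1
  have h2 : c ^ 2 ≤ 4 * Real.sin ((s - t) / 2) ^ 2 := by
    have : c ^ 2 ≤ ‖bpt s - bpt t‖ ^ 2 := by gcongr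
    linarith
  rw [pk, norm_bpt_sub_sq, norm_mul, norm_bpt, mul_one, Complex.norm_real,
    Real.norm_of_nonneg (by linarith)]
  have hc2 : 0 < c ^ 2 := by positivity
  rw [div_mul_eq_mul_div, div_le_div_iff₀ (by nlinarith [sq_nonneg (1-r)]) hc2]
  have h3 : c ^ 2 / 2 ≤ (1 - r) ^ 2 + r * (4 * Real.sin ((s - t) / 2) ^ 2) := by
    nlinarith [sq_nonneg (1-r)]
  have h5 : (1 - r ^ 2) ≤ 2 * (1 - r) := by nlinarith
  calc (1 - r ^ 2) * c ^ 2 ≤ 2 * (1 - r) * c ^ 2 := by gcongr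
    _ = 4 * (1 - r) * (c ^ 2 / 2) := by ring
    _ ≤ _ := by gcongr

lemma fatou_of_lebesgue_point {v : ℝ → ℂ} (hv : StronglyMeasurable v) (hvi : Integrable v cm)
    {t : ℝ} (ht : t ∈ Ioo 0 (2 * Real.pi)) (hvl : LocallyIntegrable v volume)
    (hL : Tendsto (fun ρ => ⨍ y in closedBall t ρ, ‖v y - v t‖) (𝓝[>] 0) (𝓝 0)) :
    Tendsto (fun r : ℝ => ∫ s, v s ∂(pm (r * bpt t))) (𝓝[<] 1) (𝓝 (v t)) := by
  have hp := Real.pi_pos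
  set G : ℝ → ℝ≥0∞ := fun s => ‖v s - v t‖ₑ with hG
  have hGm : Measurable G := (hv.sub stronglyMeasurable_const).measurable.enorm
  set I : ℝ≥0∞ := ∫⁻ s in Ioc 0 (2 * Real.pi), G s with hI
  have hIt : I ≠ ⊤ := by
    have : Integrable (fun s => v s - v t) cm := hvi.sub (integrable_const _)
    rw [integrable_cm_iff] at this
    exact this.2.ne
  rw [tendsto_iff_edist_tendsto_0, ENNReal.tendsto_nhds_zero]
  intro ε' hε'
  obtain ⟨e, he, hee⟩ : ∃ e : ℝ, 0 < e ∧ ENNReal.ofReal e ≤ ε' := by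
    rcases eq_or_ne ε' ⊤ with h | h
    · exact ⟨1, one_pos, by simp [h]⟩
    · exact ⟨ε'.toReal, ENNReal.toReal_pos hε'.ne' h, by rw [ENNReal.ofReal_toReal h]⟩
  have h400 : 0 < e / 400 := by positivity
  obtain ⟨δ₀, hδ₀, hδ₀'⟩ : ∃ δ₀ > 0, ∀ ρ, 0 < ρ → ρ < δ₀ →
      ⨍ y in closedBall t ρ, ‖v y - v t‖ < e / 400 := by
    have := hL.eventually (gt_mem_nhds h400)
    rw [eventually_nhdsWithin_iff, Metric.eventually_nhds_iff] at this
    obtain ⟨δ₀, hδ₀, h⟩ := this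
    exact ⟨δ₀, hδ₀, fun ρ h1 h2 => h (by simpa [abs_of_pos h1] using h2) h1⟩
  set δ := min (δ₀ / 2) Real.pi with hδdef
  have hδ : 0 < δ := by positivity
  have hΦ : ∀ ρ, 0 < ρ → ρ ≤ δ →
      ∫⁻ s in closedBall t ρ, G s ≤ ENNReal.ofReal ρ * ENNReal.ofReal (e / 200) := by
    intro ρ h1 h2
    have h3 := hδ₀' ρ h1 (by have := min_le_left (δ₀ / 2) Real.pi; linarith)
    rw [setAverage_eq, Real.volume_real_closedBall h1.le, smul_eq_mul,
      inv_mul_lt_iff₀ (by positivity)] at h3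
    have hinteg : IntegrableOn (fun s => v s - v t) (closedBall t ρ) volume :=
      ((hvl.integrableOn_isCompact (isCompact_closedBall _ _)).sub 
        (integrableOn_const measure_closedBall_lt_top.ne))
    have h4 := ofReal_integral_norm_eq_lintegral_enorm hinteg
    rw [hG, ← h4, ← ENNReal.ofReal_mul h1.le]
    refine ENNReal.ofReal_le_ofReal (h3.le.trans (le_of_eq (by ring)))
  obtain ⟨c, hc, hcf⟩ := exists_far_bound ht (half_pos hδ)
  have hlim : Tendsto (fun r : ℝ => ENNReal.ofReal ((4 / c ^ 2) * (1 - r)) * I) (𝓝[<] 1) (𝓝 0) := by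
    have h1 : Tendsto (fun r : ℝ => ENNReal.ofReal ((4 / c ^ 2) * (1 - r))) (𝓝[<] 1) (𝓝 0) := by
      have : Tendsto (fun r : ℝ => (4 / c ^ 2) * (1 - r)) (𝓝[<] 1) (𝓝 ((4 / c ^ 2) * (1 - 1))) :=
        ((continuous_const.mul (continuous_const.sub continuous_id)).tendsto 1).mono_left
          nhdsWithin_le_nhds
      simpa using ENNReal.tendsto_ofReal this
    simpa using ENNReal.Tendsto.mul_const h1 (Or.inr hIt)
  have hev : ∀ᶠ r : ℝ in 𝓝[<] 1, 1 / 2 ≤ r ∧ 1 - r ≤ δ ∧ r < 1 := by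
    have h1 : ∀ᶠ r : ℝ in 𝓝 1, 1 / 2 < r ∧ 1 - δ < r :=
      (lt_mem_nhds (by norm_num)).and (lt_mem_nhds (by linarith))
    filter_upwards [nhdsWithin_le_nhds h1, self_mem_nhdsWithin] with r h h'
    exact ⟨h.1.le, by linarith [h.2], h'⟩
  rw [ENNReal.tendsto_nhds_zero] at hlim
  filter_upwards [hev, hlim (ENNReal.ofReal (e / 2)) (by simpa using he)] with r ⟨hr, hrδ, hr1⟩ hfar
  have hz : (r : ℂ) * bpt t ∈ disc := mul_bpt_mem_disc (by linarith) hr1 t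
  have := isProbabilityMeasure_pm hz
  have hvi' : Integrable v (pm (r * bpt t)) := (integrable_pm_iff hz).2 hvi
  have hsub : ∫ s, v s ∂(pm (r * bpt t)) - v t = ∫ s, (v s - v t) ∂(pm (r * bpt t)) := by
    rw [integral_sub hvi' (integrable_const _)]; simp
  have hpkm : Measurable fun s => ENNReal.ofReal (pk (r * bpt t) s) :=
    (continuous_pk hz).measurable.ennreal_ofReal
  have hball : ∀ s ∈ closedBall t (δ / 2),
      ENNReal.ofReal (pk (r * bpt t) s) * G s ≤
        10 * (ENNReal.ofReal ((1 - r) / ((1 - r) ^ 2 + (s - t) ^ 2)) * G s) := by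
    intro s hs
    rw [mem_closedBall, Real.dist_eq] at hs
    have := pk_near hr hr1 (s := s) (t := t)
      (by have := min_le_right (δ₀ / 2) Real.pi; linarith)
    rw [← mul_assoc]
    gcongr
    refine (ENNReal.ofReal_le_ofReal this).trans ?_
    rw [ENNReal.ofReal_mul (by norm_num)]
    norm_num
  calc edist (∫ s, v s ∂(pm (r * bpt t))) (v t)
      = ‖∫ s, (v s - v t) ∂(pm (r * bpt t))‖ₑ := by rw [edist_eq_enorm_sub, hsub]
    _ ≤ ∫⁻ s, G s ∂(pm (r * bpt t)) := enorm_integral_le_lintegral_enorm _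
    _ = ENNReal.ofReal (2 * Real.pi)⁻¹ *
        ∫⁻ s in Ioc 0 (2 * Real.pi), ENNReal.ofReal (pk (r * bpt t) s) * G s := by
        rw [pm, lintegral_withDensity_eq_lintegral_mul _ hpkm hGm, cm, lintegral_smul_measure, θm]
        rfl
    _ ≤ 1 * ∫⁻ s in Ioc 0 (2 * Real.pi), ENNReal.ofReal (pk (r * bpt t) s) * G s := by
        gcongr
        rw [ENNReal.ofReal_le_one]
        exact inv_le_one_of_one_le₀ (by linarith [Real.pi_gt_three])
    _ = ∫⁻ s in Ioc 0 (2 * Real.pi), ENNReal.ofReal (pk (r * bpt t) s) * G s := one_mul _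
    _ ≤ (∫⁻ s in closedBall t (δ / 2), ENNReal.ofReal (pk (r * bpt t) s) * G s) +
        ∫⁻ s in Ioc 0 (2 * Real.pi) \ closedBall t (δ / 2),
          ENNReal.ofReal (pk (r * bpt t) s) * G s := by
        refine le_trans (lintegral_mono_set ?_) (lintegral_union_le
          (fun s => ENNReal.ofReal (pk (r * bpt t) s) * G s)
          (closedBall t (δ / 2)) (Ioc 0 (2 * Real.pi) \ closedBall t (δ / 2)))
        rw [union_sdiff_self]
        exact subset_union_right
    _ ≤ 10 * (8 * ENNReal.ofReal (e / 200)) + ENNReal.ofReal ((4 / c ^ 2) * (1 - r)) * I := by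
        refine add_le_add ?_ ?_
        · refine le_trans (lintegral_mono_ae (g := fun s =>
            10 * (ENNReal.ofReal ((1 - r) / ((1 - r) ^ 2 + (s - t) ^ 2)) * G s)) ?_) ?_
          · filter_upwards [ae_restrict_mem measurableSet_closedBall] with s hs using hball s hs
          · rw [lintegral_const_mul']
            · gcongr
              exact lintegral_dyadic_le hGm (by linarith) hrδ hΦ
            · norm_num
        · rw [hI, ← lintegral_const_mul _ hGm]
          refine le_trans (lintegral_mono_ae (g := fun s =>
            ENNReal.ofReal ((4 / c ^ 2) * (1 - r)) * G s) ?_) (lintegral_mono_set sdiff_subset)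
          filter_upwards [ae_restrict_mem (measurableSet_Ioc.diff measurableSet_closedBall)]
            with s hs
          gcongr
          refine pk_far hr hr1 hc (hcf s (Ioc_subset_Icc_self hs.1) ?_)
          have := hs.2
          rw [mem_closedBall, Real.dist_eq, not_le] at this
          exact this.le
    _ ≤ ENNReal.ofReal (e / 2) + ENNReal.ofReal (e / 2) := by
        gcongr
        rw [show (10 : ℝ≥0∞) = ENNReal.ofReal 10 by norm_num,
          show (8 : ℝ≥0∞) = ENNReal.ofReal 8 by norm_num, ← ENNReal.ofReal_mul (by norm_num),
          ← ENNReal.ofReal_mul (by norm_num)]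
        exact ENNReal.ofReal_le_ofReal (by linarith)
    _ = ENNReal.ofReal e := by rw [← ENNReal.ofReal_add (by positivity) (by positivity)]; simp
    _ ≤ ε' := hee

lemma ae_cm_of_ae_Ioo {p : ℝ → Prop}
    (h : ∀ᵐ t ∂(volume : Measure ℝ), t ∈ Ioo 0 (2 * Real.pi) → p t) : ∀ᵐ t ∂cm, p t := by
  rw [ae_cm, θm, restrict_Ioo_eq_restrict_Ioc.symm]
  exact (ae_restrict_iff' measurableSet_Ioo).2 h

/-- Fatou's theorem for Poisson integrals. -/
theorem fatou_radial {u : ℝ → ℂ} (hu : Integrable u cm) :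
    ∀ᵐ t ∂cm, Tendsto (fun r : ℝ => ∫ s, u s ∂(pm (r * bpt t))) (𝓝[<] 1) (𝓝 (u t)) := by
  set u' := hu.1.mk u with hu'
  have hae : u =ᵐ[cm] u' := hu.1.ae_eq_mk
  set v := (Ioc 0 (2 * Real.pi)).indicator u' with hv
  have hvm : StronglyMeasurable v := hu.1.stronglyMeasurable_mk.indicator measurableSet_Ioc
  have hvae : u =ᵐ[cm] v := by
    have h1 : ∀ᵐ t ∂cm, t ∈ Ioc 0 (2 * Real.pi) := by
      rw [ae_cm, θm]; exact ae_restrict_mem measurableSet_Ioc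
    filter_upwards [hae, h1] with t h1 h2
    rw [h1, hv, indicator_of_mem h2]
  have hvi : Integrable v cm := hu.congr hvae
  have hvl : Integrable v volume := by
    rw [hv, integrable_indicator_iff measurableSet_Ioc, ← integrable_cm_iff]
    exact hu.congr hae
  have h2 : ∀ᵐ t ∂cm, Tendsto (fun r : ℝ => ∫ s, v s ∂(pm (r * bpt t))) (𝓝[<] 1) (𝓝 (v t)) := by
    refine ae_cm_of_ae_Ioo ?_
    filter_upwards [IsUnifLocDoublingMeasure.ae_tendsto_average_norm_sub volume
      hvl.locallyIntegrable 1] with t ht htI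
    refine fatou_of_lebesgue_point hvm hvi htI hvl.locallyIntegrable
      (ht (fun _ => t) id tendsto_id ?_)
    filter_upwards [self_mem_nhdsWithin] with ρ hρ
    simpa using le_of_lt hρ
  filter_upwards [h2, hvae] with t h1 h2
  rw [h2]
  refine h1.congr' ?_
  have : ∀ᶠ r : ℝ in 𝓝[<] 1, 0 ≤ r ∧ r < 1 := by
    filter_upwards [nhdsWithin_le_nhds (lt_mem_nhds (zero_lt_one' ℝ)), self_mem_nhdsWithin]
      with r h h' using ⟨h.le, h'⟩
  filter_upwards [this] with r hr
  refine integral_congr_ae ?_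
  rw [EventuallyEq, ae_pm (mul_bpt_mem_disc hr.1 hr.2 t)]
  exact hvae.symm

lemma eventually_left_one : ∀ᶠ r : ℝ in 𝓝[<] 1, 0 < r ∧ r < 1 := by
  filter_upwards [nhdsWithin_le_nhds (lt_mem_nhds (zero_lt_one' ℝ)), self_mem_nhdsWithin]
    with r h h' using ⟨h, h'⟩

lemma ae_eq_of_poisson_eq {u v : ℝ → ℂ} (hu : Integrable u cm) (hv : Integrable v cm)
    (h : ∀ z ∈ disc, ∫ t, u t ∂(pm z) = ∫ t, v t ∂(pm z)) : u =ᵐ[cm] v := by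
  filter_upwards [fatou_radial hu, fatou_radial hv] with t h1 h2
  refine tendsto_nhds_unique h1 (h2.congr' ?_)
  filter_upwards [eventually_left_one] with r hr
  rw [h _ (mul_bpt_mem_disc hr.1.le hr.2 t)]

lemma integral_bpt_pow (k : ℕ) : ∫ t, bpt t ^ k ∂cm = if k = 0 then 1 else 0 := by
  have h := poisson_formula (f := fun z : ℂ => z ^ k)
    (Differentiable.diffContOnCl (by fun_prop)) zero_mem_disc
  rw [pm_zero] at h
  rw [h]
  rcases eq_or_ne k 0 with rfl | hk <;> simp [*]

lemma conj_bpt_mul (t : ℝ) : (starRingEnd ℂ) (bpt t) * bpt t = 1 := by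
  rw [Complex.conj_mul', norm_bpt]; simp

lemma integral_conj_bpt_pow_mul (m n : ℕ) :
    ∫ t, (starRingEnd ℂ) (bpt t ^ m) * bpt t ^ n ∂cm = if m = n then 1 else 0 := by
  rcases le_total m n with h | h
  · obtain ⟨k, rfl⟩ := Nat.exists_eq_add_of_le h
    have : ∀ t, (starRingEnd ℂ) (bpt t ^ m) * bpt t ^ (m + k) = bpt t ^ k := fun t => by
      rw [pow_add, ← mul_assoc, map_pow, ← mul_pow, conj_bpt_mul, one_pow, one_mul]
    simp_rw [this, integral_bpt_pow]
    simp
  · obtain ⟨k, rfl⟩ := Nat.exists_eq_add_of_le h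
    have : ∀ t, (starRingEnd ℂ) (bpt t ^ (n + k)) * bpt t ^ n = (starRingEnd ℂ) (bpt t ^ k) :=
      fun t => by
        rw [pow_add, map_mul, mul_comm, ← mul_assoc, map_pow, ← map_pow, mul_comm (bpt t ^ n),
          map_pow, ← mul_pow, conj_bpt_mul, one_pow, one_mul]
    simp_rw [this]
    rw [integral_conj, integral_bpt_pow]
    split_ifs <;> simp_all

lemma memLp_of_continuous {E : Type*} [NormedAddCommGroup E] {g : ℝ → E}
    (hg : Continuous g) (p : ℝ≥0∞) : MemLp g p cm := by
  obtain ⟨C, hC⟩ := isCompact_Icc.exists_bound_of_continuousOn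
    (s := Icc 0 (2 * Real.pi)) hg.continuousOn
  have hm : ∀ᵐ t ∂cm, t ∈ Ioc 0 (2 * Real.pi) := by
    rw [ae_cm, θm]; exact ae_restrict_mem measurableSet_Ioc
  refine MemLp.of_bound ?_ C (hm.mono fun t ht => hC t (Ioc_subset_Icc_self ht))
  exact hg.aestronglyMeasurable

/-- The monomial `e^{int}` as an element of `L²`. -/
def fmono (n : ℕ) : Lp ℂ 2 cm :=
  (memLp_of_continuous (by fun_prop : Continuous fun t => bpt t ^ n) 2).toLp _

lemma coeFn_fmono (n : ℕ) : fmono n =ᵐ[cm] fun t => bpt t ^ n := MemLp.coeFn_toLp _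

lemma orthonormal_fmono : Orthonormal ℂ fmono := by
  rw [orthonormal_iff_ite]
  intro m n
  rw [L2.inner_def, ← integral_conj_bpt_pow_mul]
  refine integral_congr_ae ?_
  filter_upwards [coeFn_fmono m, coeFn_fmono n] with t h1 h2
  rw [h1, h2, RCLike.inner_apply, mul_comm]

lemma Lp_norm_sq (F : Lp ℂ 2 cm) : ‖F‖ ^ 2 = ∫ t, ‖F t‖ ^ 2 ∂cm := by
  have h : (inner ℂ F F : ℂ) = ((∫ t, ‖F t‖ ^ 2 ∂cm : ℝ) : ℂ) := by
    rw [L2.inner_def, ← integral_complex_ofReal]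
    congr 1; ext t
    rw [inner_self_eq_norm_sq_to_K]; push_cast; rfl
  rw [inner_self_eq_norm_sq_to_K] at h
  exact Complex.ofReal_injective (by rw [← h]; push_cast; rfl)

/-- The Poisson kernel as an element of `L²`. -/
def pkLp (z : ℂ) (hz : z ∈ disc) : Lp ℂ 2 cm :=
  (memLp_of_continuous (Complex.continuous_ofReal.comp (continuous_pk hz)) 2).toLp _

lemma inner_pkLp {z : ℂ} (hz : z ∈ disc) (F : Lp ℂ 2 cm) :
    inner ℂ (pkLp z hz) F = ∫ t, F t ∂(pm z) := by
  rw [L2.inner_def, integral_pm hz]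
  refine integral_congr_ae ?_
  filter_upwards [MemLp.coeFn_toLp
    (memLp_of_continuous (Complex.continuous_ofReal.comp (continuous_pk hz)) 2)] with t h
  rw [pkLp, h, RCLike.inner_apply, Function.comp_apply, Complex.conj_ofReal, real_smul, mul_comm]

lemma integral_fmono_pm {z : ℂ} (hz : z ∈ disc) (n : ℕ) : ∫ t, fmono n t ∂(pm z) = z ^ n := by
  rw [← poisson_formula (f := fun z : ℂ => z ^ n) (Differentiable.diffContOnCl (by fun_prop)) hz]
  refine integral_congr_ae ?_
  rw [EventuallyEq, ae_pm hz]
  exact coeFn_fmono n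

lemma riesz_fischer {b : ℕ → ℂ} (hb : Summable fun n => ‖b n‖ ^ 2) :
    ∃ F : ℝ → ℂ, MemLp F 2 cm ∧ ∫ t, ‖F t‖ ^ 2 ∂cm = ∑' n, ‖b n‖ ^ 2 ∧
      ∀ z ∈ disc, HasSum (fun n => b n * z ^ n) (∫ t, F t ∂(pm z)) := by
  have hO := orthonormal_fmono.orthogonalFamily
  have hs := (hO.summable_iff_norm_sq_summable b).2 hb
  obtain ⟨F, hF⟩ := hs
  refine ⟨F, Lp.memLp F, ?_, fun z hz => ?_⟩
  · rw [← Lp_norm_sq]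
    have h1 : HasSum (fun n => ‖b n‖ ^ 2) (‖F‖ ^ 2) := by
      have : Tendsto (fun s : Finset ℕ => ‖∑ i ∈ s, (LinearIsometry.toSpanSingleton ℂ
        (Lp ℂ 2 cm) (orthonormal_fmono.1 i)) (b i)‖ ^ 2) atTop (𝓝 (‖F‖ ^ 2)) :=
        (Filter.Tendsto.norm hF).pow 2
      refine this.congr fun s => ?_
      rw [hO.norm_sum]
    exact h1.tsum_eq.symm
  · have h2 := (innerSL ℂ (pkLp z hz)).hasSum hF
    simp only [innerSL_apply_apply, LinearIsometry.toSpanSingleton_apply, inner_smul_right,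
      inner_pkLp, integral_fmono_pm hz] at h2
    exact h2

/-- Taylor coefficients at the origin. -/
def tc (f : ℂ → ℂ) (n : ℕ) : ℂ := (n.factorial : ℂ)⁻¹ * iteratedDeriv n f 0

lemma hasSum_tc {f : ℂ → ℂ} (hf : DifferentiableOn ℂ f disc) {z : ℂ} (hz : z ∈ disc) :
    HasSum (fun n => tc f n * z ^ n) (f z) := by
  have := Complex.hasSum_taylorSeries_on_ball hf hz
  refine this.congr_fun fun n => ?_
  simp only [tc, sub_zero, smul_eq_mul]; ring

lemma summable_tc_sq {f : ℂ → ℂ} (hf : DifferentiableOn ℂ f disc) {r : ℝ} (h0 : 0 ≤ r)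
    (h1 : r < 1) : Summable fun n => ‖tc f n * (r : ℂ) ^ n‖ ^ 2 := by
  have hr : (r : ℂ) ∈ disc := by
    rw [mem_disc, Complex.norm_real, Real.norm_of_nonneg h0]; exact h1
  have h := (hasSum_tc hf hr).summable.norm
  have ht := h.tendsto_atTop_zero
  refine Summable.of_norm_bounded_eventually_nat h ?_
  filter_upwards [ht.eventually (gt_mem_nhds one_pos)] with n hn
  rw [Real.norm_of_nonneg (by positivity)]
  nlinarith [norm_nonneg (tc f n * (r : ℂ) ^ n)]

lemma parseval_circle {f : ℂ → ℂ} (hf : DifferentiableOn ℂ f disc) {r : ℝ} (h0 : 0 ≤ r)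
    (h1 : r < 1) :
    HasSum (fun n => ‖tc f n‖ ^ 2 * r ^ (2 * n)) (∫ t, ‖f (r * bpt t)‖ ^ 2 ∂cm) := by
  have hs := summable_tc_sq hf h0 h1
  obtain ⟨F, hF, hn, hP⟩ := riesz_fischer hs
  have hae : F =ᵐ[cm] fun t => f (r * bpt t) := by
    refine ae_eq_of_poisson_eq (hF.integrable one_le_two)
      ((memLp_of_continuous (continuous_dilate hf h0 h1) 1).integrable le_rfl) fun z hz => ?_
    rw [poisson_dilate hf h0 h1 hz]
    have hz' : (r : ℂ) * z ∈ disc := by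
      rw [mem_disc] at hz ⊢
      rw [norm_mul, Complex.norm_real, Real.norm_of_nonneg h0]
      nlinarith [norm_nonneg z]
    have h2 := hasSum_tc hf hz'
    simp only [mul_pow, ← mul_assoc] at h2
    exact (hP z hz).unique h2
  have e1 : ∫ t, ‖F t‖ ^ 2 ∂cm = ∫ t, ‖f (r * bpt t)‖ ^ 2 ∂cm :=
    integral_congr_ae (by filter_upwards [hae] with t h; rw [h])
  rw [← e1, hn]
  have := hs.hasSum
  convert this using 2 with n
  rw [norm_mul, mul_pow, norm_pow, Complex.norm_real, Real.norm_of_nonneg h0, ← pow_mul,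
    mul_comm 2 n]

lemma mem_hardySet {f : ℂ → ℂ} {x : ℝ} :
    x ∈ hardySet f ↔ ∃ r : ℝ, 0 < r ∧ r < 1 ∧ x = ∫ t, ‖f (r * bpt t)‖ ^ 2 ∂cm := by
  simp only [hardySet, mem_ofPred_eq, integral_cm, smul_eq_mul, one_div]

lemma hardySet_nonempty (f : ℂ → ℂ) : (hardySet f).Nonempty :=
  ⟨_, mem_hardySet.2 ⟨1 / 2, by norm_num, by norm_num, rfl⟩⟩

lemma MemHardy2.summable {f : ℂ → ℂ} (hf : MemHardy2 f) : Summable fun n => ‖tc f n‖ ^ 2 := by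
  obtain ⟨C, hC⟩ := hf.2
  refine summable_of_sum_le (c := C) (fun n => by positivity) fun s => ?_
  have hlim : Tendsto (fun r : ℝ => ∑ n ∈ s, ‖tc f n‖ ^ 2 * r ^ (2 * n)) (𝓝[<] 1)
      (𝓝 (∑ n ∈ s, ‖tc f n‖ ^ 2)) := by
    have : Continuous fun r : ℝ => ∑ n ∈ s, ‖tc f n‖ ^ 2 * r ^ (2 * n) := by fun_prop
    simpa using (this.tendsto 1).mono_left nhdsWithin_le_nhds
  refine le_of_tendsto hlim ?_
  filter_upwards [eventually_left_one] with r hr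
  have hp := parseval_circle hf.1 hr.1.le hr.2
  exact (sum_le_hasSum s (fun n _ => by have := hr.1; positivity) hp).trans
    (hC (mem_hardySet.2 ⟨r, hr.1, hr.2, rfl⟩))

lemma hardySet_le {f : ℂ → ℂ} (hf : DifferentiableOn ℂ f disc)
    (hs : Summable fun n => ‖tc f n‖ ^ 2) : ∀ x ∈ hardySet f, x ≤ ∑' n, ‖tc f n‖ ^ 2 := by
  intro x hx
  obtain ⟨r, h0, h1, rfl⟩ := mem_hardySet.1 hx
  refine hasSum_le (fun n => ?_) (parseval_circle hf h0.le h1) hs.hasSum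
  exact mul_le_of_le_one_right (by positivity) (pow_le_one₀ h0.le h1.le)

lemma MemHardy2.hardyNormSq_eq {f : ℂ → ℂ} (hf : MemHardy2 f) :
    hardyNormSq f = ∑' n, ‖tc f n‖ ^ 2 := by
  refine le_antisymm (csSup_le (hardySet_nonempty f) (hardySet_le hf.1 hf.summable)) ?_
  refine hf.summable.tsum_le_of_sum_le fun s => ?_
  have hlim : Tendsto (fun r : ℝ => ∑ n ∈ s, ‖tc f n‖ ^ 2 * r ^ (2 * n)) (𝓝[<] 1)
      (𝓝 (∑ n ∈ s, ‖tc f n‖ ^ 2)) := by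
    have : Continuous fun r : ℝ => ∑ n ∈ s, ‖tc f n‖ ^ 2 * r ^ (2 * n) := by fun_prop
    simpa using (this.tendsto 1).mono_left nhdsWithin_le_nhds
  refine le_of_tendsto hlim ?_
  filter_upwards [eventually_left_one] with r hr
  have hp := parseval_circle hf.1 hr.1.le hr.2
  exact (sum_le_hasSum s (fun n _ => by have := hr.1; positivity) hp).trans
    (le_csSup hf.2 (mem_hardySet.2 ⟨r, hr.1, hr.2, rfl⟩))

/-- The boundary function, defined by radial limits. -/
def bdv (f : ℂ → ℂ) (t : ℝ) : ℂ := limUnder (𝓝[<] 1) fun r : ℝ => f (r * bpt t)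

lemma HasRadialLimitAt.bdv_eq {f : ℂ → ℂ} {t : ℝ} {L : ℂ} (h : HasRadialLimitAt f (bpt t) L) :
    bdv f t = L := h.limUnder_eq

lemma MemHardy2.boundary_aux {f : ℂ → ℂ} (hf : MemHardy2 f) :
    ∃ F : ℝ → ℂ, MemLp F 2 cm ∧ ∫ t, ‖F t‖ ^ 2 ∂cm = hardyNormSq f ∧
      (∀ z ∈ disc, f z = ∫ t, F t ∂(pm z)) ∧ ∀ᵐ t ∂cm, HasRadialLimitAt f (bpt t) (F t) := by
  obtain ⟨F, hF, hn, hP⟩ := riesz_fischer hf.summable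
  have hP' : ∀ z ∈ disc, f z = ∫ t, F t ∂(pm z) := fun z hz => (hasSum_tc hf.1 hz).unique (hP z hz)
  refine ⟨F, hF, by rw [hn, hf.hardyNormSq_eq], hP', ?_⟩
  filter_upwards [fatou_radial (hF.integrable one_le_two)] with t ht
  refine Tendsto.congr' ?_ ht
  filter_upwards [eventually_left_one] with r hr
  rw [hP' _ (mul_bpt_mem_disc hr.1.le hr.2 t)]

lemma MemHardy2.ae_radial {f : ℂ → ℂ} (hf : MemHardy2 f) :
    ∀ᵐ t ∂cm, HasRadialLimitAt f (bpt t) (bdv f t) := by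
  obtain ⟨F, -, -, -, h⟩ := hf.boundary_aux
  filter_upwards [h] with t ht
  rwa [ht.bdv_eq]

lemma MemHardy2.bdv_spec {f : ℂ → ℂ} (hf : MemHardy2 f) :
    MemLp (bdv f) 2 cm ∧ ∫ t, ‖bdv f t‖ ^ 2 ∂cm = hardyNormSq f ∧
      (∀ z ∈ disc, f z = ∫ t, bdv f t ∂(pm z)) := by
  obtain ⟨F, h1, h2, h3, h⟩ := hf.boundary_aux
  have hae : F =ᵐ[cm] bdv f := by
    filter_upwards [h] with t ht
    rw [ht.bdv_eq]
  refine ⟨h1.ae_eq hae, ?_, fun z hz => ?_⟩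
  · rw [← h2]
    refine integral_congr_ae ?_
    filter_upwards [hae] with t ht
    rw [ht]
  · rw [h3 z hz]
    refine integral_congr_ae ?_
    rwa [EventuallyEq, ae_pm hz]

lemma MemHardy2.memLp {f : ℂ → ℂ} (hf : MemHardy2 f) : MemLp (bdv f) 2 cm := hf.bdv_spec.1

lemma MemHardy2.norm_eq {f : ℂ → ℂ} (hf : MemHardy2 f) :
    hardyNormSq f = ∫ t, ‖bdv f t‖ ^ 2 ∂cm := hf.bdv_spec.2.1.symm

lemma MemHardy2.poisson {f : ℂ → ℂ} (hf : MemHardy2 f) {z : ℂ} (hz : z ∈ disc) :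
    f z = ∫ t, bdv f t ∂(pm z) := hf.bdv_spec.2.2 z hz

lemma MemHardy2.integrable {f : ℂ → ℂ} (hf : MemHardy2 f) : Integrable (bdv f) cm :=
  hf.memLp.integrable one_le_two

lemma MemHardy2.integrable_sq {f : ℂ → ℂ} (hf : MemHardy2 f) :
    Integrable (fun t => ‖bdv f t‖ ^ 2) cm :=
  (memLp_two_iff_integrable_sq_norm hf.memLp.1).1 hf.memLp

lemma pk_symm (r s t : ℝ) : pk (r * bpt t) s = pk (r * bpt s) t := by
  rw [pk, pk, norm_bpt_sub_sq, norm_bpt_sub_sq, norm_mul, norm_mul, norm_bpt, norm_bpt]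
  congr 3
  rw [show (t - s) / 2 = -((s - t) / 2) by ring, Real.sin_neg, neg_sq]

lemma integral_pk {z : ℂ} (hz : z ∈ disc) : ∫ t, pk z t ∂cm = 1 := by
  have h := integral_pm hz (fun _ => (1 : ℝ))
  have := isProbabilityMeasure_pm hz
  simpa using h.symm

lemma continuous_pk_radial {r : ℝ} (h0 : 0 ≤ r) (h1 : r < 1) :
    Continuous fun p : ℝ × ℝ => pk (r * bpt p.1) p.2 := by
  unfold pk
  refine Continuous.div (by fun_prop) (by fun_prop) fun p => ?_
  have := bpt_sub_ne (mul_bpt_mem_disc h0 h1 p.1) p.2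
  positivity

lemma integrable_pk_mul {v : ℝ → ℝ} (hv : Integrable v cm) {r : ℝ} (h0 : 0 ≤ r) (h1 : r < 1) :
    Integrable (fun p : ℝ × ℝ => pk (r * bpt p.1) p.2 * v p.2) (cm.prod cm) := by
  have h2 : Integrable (fun p : ℝ × ℝ => v p.2) (cm.prod cm) := hv.comp_snd cm
  refine h2.bdd_mul (c := (1 + r) / (1 - r)) (continuous_pk_radial h0 h1).aestronglyMeasurable
    (ae_of_all _ fun p => ?_)
  have hz := mul_bpt_mem_disc h0 h1 p.1
  rw [Real.norm_of_nonneg (pk_pos hz _).le]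
  refine (pk_le hz _).trans (le_of_eq ?_)
  simp [norm_bpt, abs_of_nonneg h0]

lemma integral_poisson_circle {v : ℝ → ℝ} (hv : Integrable v cm) {r : ℝ} (h0 : 0 ≤ r) (h1 : r < 1) :
    Integrable (fun t => ∫ s, v s ∂(pm (r * bpt t))) cm ∧
    ∫ t, ∫ s, v s ∂(pm (r * bpt t)) ∂cm = ∫ s, v s ∂cm := by
  have hi := integrable_pk_mul hv h0 h1
  have e : ∀ t, ∫ s, v s ∂(pm (r * bpt t)) = ∫ s, pk (r * bpt t) s * v s ∂cm := fun t =>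
    integral_pm (mul_bpt_mem_disc h0 h1 t) v
  simp_rw [e]
  refine ⟨hi.integral_prod_left, ?_⟩
  rw [integral_integral_swap hi]
  refine integral_congr_ae (ae_of_all _ fun s => ?_)
  simp only
  rw [integral_mul_const]
  simp_rw [pk_symm r s]
  rw [integral_pk (mul_bpt_mem_disc h0 h1 s), one_mul]

/-- A holomorphic function whose squared modulus has a harmonic majorant belongs to `H²`. -/
lemma memHardy2_of_le_poisson {f : ℂ → ℂ} (hf : DifferentiableOn ℂ f disc) {v : ℝ → ℝ}
    (hv : Integrable v cm) (h : ∀ z ∈ disc, ‖f z‖ ^ 2 ≤ ∫ t, v t ∂(pm z)) : MemHardy2 f := by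
  refine ⟨hf, ∫ s, v s ∂cm, ?_⟩
  intro x hx
  obtain ⟨r, h0, h1, rfl⟩ := mem_hardySet.1 hx
  obtain ⟨hi, he⟩ := integral_poisson_circle hv h0.le h1
  rw [← he]
  refine integral_mono ?_ hi fun t => h _ (mul_bpt_mem_disc h0.le h1 t)
  exact (memLp_of_continuous ((continuous_dilate hf h0.le h1).norm.pow 2) 1).integrable le_rfl

lemma MemHinf.memHardy2 {f : ℂ → ℂ} (hf : MemHinf f) : MemHardy2 f := by
  obtain ⟨hd, C, hC⟩ := hf
  refine memHardy2_of_le_poisson hd (v := fun _ => C ^ 2) (integrable_const _) fun z hz => ?_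
  have := isProbabilityMeasure_pm hz
  simp only [integral_const, probReal_univ, one_smul]
  have := hC z hz
  gcongr

lemma integral_norm_sub_sq {P : Measure ℝ} [IsProbabilityMeasure P] {F : ℝ → ℂ} (hF : MemLp F 2 P) :
    ∫ t, ‖F t - ∫ s, F s ∂P‖ ^ 2 ∂P = ∫ t, ‖F t‖ ^ 2 ∂P - ‖∫ s, F s ∂P‖ ^ 2 := by
  set c := ∫ s, F s ∂P with hc
  have hi : Integrable F P := hF.integrable one_le_two
  have hi2 : Integrable (fun t => ‖F t‖ ^ 2) P := (memLp_two_iff_integrable_sq_norm hF.1).1 hF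
  have e : ∀ t, ‖F t - c‖ ^ 2 = ‖F t‖ ^ 2 - 2 * ((starRingEnd ℂ) c * F t).re + ‖c‖ ^ 2 := by
    intro t
    rw [← Complex.normSq_eq_norm_sq, ← Complex.normSq_eq_norm_sq, ← Complex.normSq_eq_norm_sq,
      Complex.normSq_sub]
    rw [mul_comm (F t)]; ring
  have hre : Integrable (fun t => ((starRingEnd ℂ) c * F t).re) P := (hi.const_mul _).re
  have hre2 : ∫ t, ((starRingEnd ℂ) c * F t).re ∂P = ‖c‖ ^ 2 := by
    have h1 := integral_re (hi.const_mul ((starRingEnd ℂ) c))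
    simp only [RCLike.re_to_complex] at h1
    rw [h1, integral_const_mul, ← hc, Complex.conj_mul']
    norm_cast
  simp_rw [e]
  have hs : Integrable (fun t => ‖F t‖ ^ 2 - 2 * ((starRingEnd ℂ) c * F t).re) P :=
    hi2.sub (hre.const_mul 2)
  rw [integral_add hs (integrable_const _), integral_sub hi2 (hre.const_mul 2),
    integral_const_mul, hre2]
  simp
  ring

lemma MemHardy2.memLp_pm {f : ℂ → ℂ} (hf : MemHardy2 f) {w : ℂ} (hw : w ∈ disc) :
    MemLp (bdv f) 2 (pm w) := (memLp_pm_iff hw).2 hf.memLp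

lemma MemHardy2.integrable_pm {f : ℂ → ℂ} (hf : MemHardy2 f) {w : ℂ} (hw : w ∈ disc) :
    Integrable (bdv f) (pm w) := (integrable_pm_iff hw).2 hf.integrable

lemma MemHardy2.integrable_sq_pm {f : ℂ → ℂ} (hf : MemHardy2 f) {w : ℂ} (hw : w ∈ disc) :
    Integrable (fun t => ‖bdv f t‖ ^ 2) (pm w) := (integrable_pm_iff hw).2 hf.integrable_sq

lemma MemHardy2.variance {f : ℂ → ℂ} (hf : MemHardy2 f) {w : ℂ} (hw : w ∈ disc) :
    ∫ t, ‖bdv f t - f w‖ ^ 2 ∂(pm w) = ∫ t, ‖bdv f t‖ ^ 2 ∂(pm w) - ‖f w‖ ^ 2 := by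
  have := isProbabilityMeasure_pm hw
  rw [hf.poisson hw]
  exact integral_norm_sub_sq (hf.memLp_pm hw)

lemma MemHardy2.sq_le {f : ℂ → ℂ} (hf : MemHardy2 f) {w : ℂ} (hw : w ∈ disc) :
    ‖f w‖ ^ 2 ≤ ∫ t, ‖bdv f t‖ ^ 2 ∂(pm w) := by
  have h1 := hf.variance hw
  have h2 : 0 ≤ ∫ t, ‖bdv f t - f w‖ ^ 2 ∂(pm w) := integral_nonneg fun t => by positivity
  linarith

lemma HasRadialLimitAt.add {f g : ℂ → ℂ} {ζ a b : ℂ} (hf : HasRadialLimitAt f ζ a)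
    (hg : HasRadialLimitAt g ζ b) : HasRadialLimitAt (fun z => f z + g z) ζ (a + b) :=
  Tendsto.add hf hg

lemma HasRadialLimitAt.mul {f g : ℂ → ℂ} {ζ a b : ℂ} (hf : HasRadialLimitAt f ζ a)
    (hg : HasRadialLimitAt g ζ b) : HasRadialLimitAt (fun z => f z * g z) ζ (a * b) :=
  Tendsto.mul hf hg

lemma hasRadialLimitAt_of_continuousAt {f : ℂ → ℂ} {ζ : ℂ} (hf : ContinuousAt f ζ) :
    HasRadialLimitAt f ζ (f ζ) := by
  have h1 : Tendsto (fun r : ℝ => (r : ℂ) * ζ) (𝓝[<] 1) (𝓝 ζ) := by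
    have : Continuous fun r : ℝ => (r : ℂ) * ζ := by fun_prop
    simpa using (this.tendsto 1).mono_left nhdsWithin_le_nhds
  exact hf.tendsto.comp h1

lemma bdv_congr {f g : ℂ → ℂ} (h : ∀ z ∈ disc, f z = g z) : bdv f = bdv g := by
  funext t
  rw [bdv, bdv, limUnder, limUnder]
  congr 1
  refine Filter.map_congr ?_
  filter_upwards [eventually_left_one] with r hr using h _ (mul_bpt_mem_disc hr.1.le hr.2 t)

lemma hardySet_congr {f g : ℂ → ℂ} (h : ∀ z ∈ disc, f z = g z) : hardySet f = hardySet g := by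
  ext x
  rw [mem_hardySet, mem_hardySet]
  refine exists_congr fun r => and_congr_right fun h0 => and_congr_right fun h1 => ?_
  rw [show (fun t => ‖f (r * bpt t)‖ ^ 2) = fun t => ‖g (r * bpt t)‖ ^ 2 from
    funext fun t => by rw [h _ (mul_bpt_mem_disc h0.le h1 t)]]

lemma MemHardy2.congr {f g : ℂ → ℂ} (hf : MemHardy2 f) (h : ∀ z ∈ disc, f z = g z) :
    MemHardy2 g :=
  ⟨hf.1.congr fun z hz => (h z hz).symm, hardySet_congr h ▸ hf.2⟩

lemma hardyNormSq_congr {f g : ℂ → ℂ} (h : ∀ z ∈ disc, f z = g z) :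
    hardyNormSq f = hardyNormSq g := by rw [hardyNormSq, hardySet_congr h, hardyNormSq]

lemma MemHardy2.add {f g : ℂ → ℂ} (hf : MemHardy2 f) (hg : MemHardy2 g) :
    MemHardy2 fun z => f z + g z := by
  refine memHardy2_of_le_poisson (hf.1.add hg.1) (v := fun t => 2 * ‖bdv f t‖ ^ 2 + 2 * ‖bdv g t‖ ^ 2)
    ((hf.integrable_sq.const_mul 2).add (hg.integrable_sq.const_mul 2)) fun z hz => ?_
  rw [integral_add ((hf.integrable_sq_pm hz).const_mul 2) ((hg.integrable_sq_pm hz).const_mul 2),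
    integral_const_mul, integral_const_mul]
  have h1 := hf.sq_le hz
  have h2 := hg.sq_le hz
  have h3 : ‖f z + g z‖ ^ 2 ≤ (‖f z‖ + ‖g z‖) ^ 2 := by gcongr; exact norm_add_le _ _
  nlinarith [sq_nonneg (‖f z‖ - ‖g z‖)]

lemma MemHardy2.bdd_mul {f g : ℂ → ℂ} (hf : MemHardy2 f) (hg : DifferentiableOn ℂ g disc) {C : ℝ}
    (hC : ∀ z ∈ disc, ‖g z‖ ≤ C) : MemHardy2 fun z => g z * f z := by
  refine memHardy2_of_le_poisson (hg.mul hf.1) (v := fun t => C ^ 2 * ‖bdv f t‖ ^ 2)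
    (hf.integrable_sq.const_mul _) fun z hz => ?_
  rw [integral_const_mul, norm_mul, mul_pow]
  have h1 := hf.sq_le hz
  have := hC z hz
  gcongr

lemma MemHardy2.const_mul {f : ℂ → ℂ} (hf : MemHardy2 f) (c : ℂ) : MemHardy2 fun z => c * f z :=
  hf.bdd_mul (differentiableOn_const c) (C := ‖c‖) fun _ _ => le_rfl

lemma memHardy2_const (c : ℂ) : MemHardy2 fun _ => c :=
  MemHinf.memHardy2 ⟨differentiableOn_const c, ‖c‖, fun _ _ => le_rfl⟩

lemma MemHardy2.sub {f g : ℂ → ℂ} (hf : MemHardy2 f) (hg : MemHardy2 g) :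
    MemHardy2 fun z => f z - g z := by
  refine (hf.add (hg.const_mul (-1))).congr fun z _ => by ring

lemma MemHardy2.id_mul {f : ℂ → ℂ} (hf : MemHardy2 f) : MemHardy2 fun z => z * f z :=
  hf.bdd_mul differentiableOn_id (C := 1) fun _ hz => (mem_disc.1 hz).le

lemma bdv_add {f g : ℂ → ℂ} (hf : MemHardy2 f) (hg : MemHardy2 g) :
    ∀ᵐ t ∂cm, bdv (fun z => f z + g z) t = bdv f t + bdv g t := by
  filter_upwards [hf.ae_radial, hg.ae_radial] with t h1 h2 using (h1.add h2).bdv_eq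

lemma bdv_mul {f g : ℂ → ℂ} (hf : MemHardy2 f) (hg : MemHardy2 g) :
    ∀ᵐ t ∂cm, bdv (fun z => f z * g z) t = bdv f t * bdv g t := by
  filter_upwards [hf.ae_radial, hg.ae_radial] with t h1 h2 using (h1.mul h2).bdv_eq

lemma bdv_of_continuous {f : ℂ → ℂ} (hf : Continuous f) (t : ℝ) : bdv f t = f (bpt t) :=
  (hasRadialLimitAt_of_continuousAt hf.continuousAt).bdv_eq

lemma bdv_const_mul {f : ℂ → ℂ} (hf : MemHardy2 f) (c : ℂ) :
    ∀ᵐ t ∂cm, bdv (fun z => c * f z) t = c * bdv f t := by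
  filter_upwards [bdv_mul (memHardy2_const c) hf] with t h
  rw [h, bdv_of_continuous (f := fun _ => c) continuous_const]

lemma bdv_id_mul {f : ℂ → ℂ} (hf : MemHardy2 f) :
    ∀ᵐ t ∂cm, bdv (fun z => z * f z) t = bpt t * bdv f t := by
  filter_upwards [hf.ae_radial] with t h1
  exact ((hasRadialLimitAt_of_continuousAt continuousAt_id).mul h1).bdv_eq

lemma bdv_sub {f g : ℂ → ℂ} (hf : MemHardy2 f) (hg : MemHardy2 g) :
    ∀ᵐ t ∂cm, bdv (fun z => f z - g z) t = bdv f t - bdv g t := by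
  filter_upwards [hf.ae_radial, hg.ae_radial] with t h1 h2
  have h : HasRadialLimitAt (fun z => f z - g z) (bpt t) (bdv f t - bdv g t) := Tendsto.sub h1 h2
  exact h.bdv_eq

lemma norm_bdv_le {f : ℂ → ℂ} (hf : MemHardy2 f) {C : ℝ} (hC : ∀ z ∈ disc, ‖f z‖ ≤ C) :
    ∀ᵐ t ∂cm, ‖bdv f t‖ ≤ C := by
  filter_upwards [hf.ae_radial] with t h
  refine le_of_tendsto (Tendsto.norm h) ?_
  filter_upwards [eventually_left_one] with r hr using hC _ (mul_bpt_mem_disc hr.1.le hr.2 t)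

lemma MemHardy2.norm_le_of_bdv {f : ℂ → ℂ} (hf : MemHardy2 f) {C : ℝ}
    (hC : ∀ᵐ t ∂cm, ‖bdv f t‖ ≤ C) {z : ℂ} (hz : z ∈ disc) : ‖f z‖ ≤ C := by
  have := isProbabilityMeasure_pm hz
  rw [hf.poisson hz]
  refine (norm_integral_le_of_norm_le_const (C := C) ?_).trans (by simp)
  rwa [ae_pm hz]

/-- The Herglotz integral of a boundary function. -/
def herg (u : ℝ → ℝ) (z : ℂ) : ℂ := ∫ t, ((bpt t + z) / (bpt t - z)) * (u t : ℂ) ∂cm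

/-- The outer function with boundary modulus `exp ∘ u`. -/
def outr (u : ℝ → ℝ) (z : ℂ) : ℂ := Complex.exp (herg u z)

lemma continuous_herg_kernel {z : ℂ} (hz : z ∈ disc) :
    Continuous fun t => (bpt t + z) / (bpt t - z) :=
  Continuous.div (by fun_prop) (by fun_prop) fun t => bpt_sub_ne hz t

lemma integrable_continuous_mul {k : ℝ → ℂ} (hk : Continuous k) {u : ℝ → ℂ} (hu : Integrable u cm) :
    Integrable (fun t => k t * u t) cm :=
  (memLp_one_iff_integrable.2 hu).mul (memLp_of_continuous hk ⊤) |>.integrable le_rfl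

lemma integrable_herg {u : ℝ → ℝ} (hu : Integrable u cm) {z : ℂ} (hz : z ∈ disc) :
    Integrable (fun t => ((bpt t + z) / (bpt t - z)) * (u t : ℂ)) cm :=
  integrable_continuous_mul (continuous_herg_kernel hz) hu.ofReal

lemma differentiableOn_herg {u : ℝ → ℝ} (hu : Integrable u cm) :
    DifferentiableOn ℂ (herg u) disc := by
  intro z0 hz0
  have hz1 : ‖z0‖ < 1 := mem_disc.1 hz0
  set δ := (1 - ‖z0‖) / 2 with hδ
  have hδ0 : 0 < δ := by linarith
  have hb : ∀ t, ∀ z ∈ ball z0 δ, δ ≤ ‖bpt t - z‖ := by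
    intro t z hz
    rw [mem_ball_iff_norm] at hz
    have h1 : ‖bpt t‖ ≤ ‖bpt t - z‖ + ‖z - z0‖ + ‖z0‖ := by
      calc ‖bpt t‖ = ‖(bpt t - z) + (z - z0) + z0‖ := by ring_nf
        _ ≤ _ := norm_add₃_le
    rw [norm_bpt] at h1
    linarith
  have hsub : ball z0 δ ⊆ disc := by
    intro z hz
    rw [mem_ball_iff_norm] at hz
    rw [mem_disc]
    have := norm_add_le (z - z0) z0
    rw [sub_add_cancel] at this
    linarith
  have key := hasDerivAt_integral_of_dominated_loc_of_deriv_le (μ := cm) (𝕜 := ℂ)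
    (F := fun z t => ((bpt t + z) / (bpt t - z)) * (u t : ℂ))
    (F' := fun z t => (2 * bpt t / (bpt t - z) ^ 2) * (u t : ℂ))
    (bound := fun t => 2 / δ ^ 2 * ‖u t‖) (x₀ := z0) (s := ball z0 δ) (ball_mem_nhds _ hδ0)
    (by
      filter_upwards [ball_mem_nhds z0 hδ0] with z hz
      exact (integrable_herg hu (hsub hz)).1)
    (integrable_herg hu hz0)
    (by
      refine (Continuous.aestronglyMeasurable ?_).mul hu.ofReal.1
      exact Continuous.div (by fun_prop) (by fun_prop) fun t => pow_ne_zero 2 (bpt_sub_ne hz0 t))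
    (ae_of_all _ fun t z hz => by
      rw [norm_mul, norm_div, norm_mul, norm_pow, norm_bpt, Complex.norm_real]
      have := hb t z hz
      simp only [Complex.norm_ofNat, mul_one]
      gcongr)
    (hu.norm.const_mul _)
    (ae_of_all _ fun t z hz => by
      have h0 := bpt_sub_ne (hsub hz) t
      refine HasDerivAt.mul_const ?_ _
      have h1 : HasDerivAt (fun z => bpt t + z) 1 z := (hasDerivAt_id z).const_add _
      have h2 : HasDerivAt (fun z => bpt t - z) (-1) z := (hasDerivAt_id z).const_sub _
      refine (h1.div h2 h0).congr_deriv ?_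
      congr 1
      ring)
  exact key.2.differentiableAt.differentiableWithinAt

lemma re_herg {u : ℝ → ℝ} (hu : Integrable u cm) {z : ℂ} (hz : z ∈ disc) :
    (herg u z).re = ∫ t, u t ∂(pm z) := by
  have h := integral_re (integrable_herg hu hz)
  simp only [RCLike.re_to_complex] at h
  rw [herg, ← h, integral_pm hz]
  refine integral_congr_ae (ae_of_all _ fun t => ?_)
  simp only [smul_eq_mul]
  rw [Complex.re_mul_ofReal]
  congr 1
  rw [pk, Complex.div_re, ← Complex.normSq_eq_norm_sq, ← Complex.normSq_eq_norm_sq]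
  have h1 : (bpt t).re * (bpt t).re + (bpt t).im * (bpt t).im = 1 := by
    rw [← Complex.normSq_apply, Complex.normSq_eq_norm_sq, norm_bpt, one_pow]
  rw [← add_div]
  congr 1
  rw [← h1, Complex.normSq_apply]
  simp only [add_re, sub_re, add_im, sub_im]
  ring

lemma differentiableOn_outr {u : ℝ → ℝ} (hu : Integrable u cm) :
    DifferentiableOn ℂ (outr u) disc := (differentiableOn_herg hu).cexp

lemma outr_ne_zero (u : ℝ → ℝ) (z : ℂ) : outr u z ≠ 0 := Complex.exp_ne_zero _

lemma norm_outr {u : ℝ → ℝ} (hu : Integrable u cm) {z : ℂ} (hz : z ∈ disc) :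
    ‖outr u z‖ = Real.exp (∫ t, u t ∂(pm z)) := by
  rw [outr, Complex.norm_exp, re_herg hu hz]

lemma outr_add {u v : ℝ → ℝ} (hu : Integrable u cm) (hv : Integrable v cm) {z : ℂ}
    (hz : z ∈ disc) : outr (fun t => u t + v t) z = outr u z * outr v z := by
  rw [outr, outr, outr, ← Complex.exp_add, herg, herg, herg,
    ← integral_add (integrable_herg hu hz) (integrable_herg hv hz)]
  congr 2; ext t; push_cast; ring

lemma outr_congr {u v : ℝ → ℝ} (h : ∀ᵐ t ∂cm, u t = v t) (z : ℂ) : outr u z = outr v z := by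
  rw [outr, outr, herg, herg]
  congr 1
  refine integral_congr_ae ?_
  filter_upwards [h] with t ht
  rw [ht]

lemma outr_zero (z : ℂ) : outr (fun _ => 0) z = 1 := by simp [outr, herg]

lemma outr_neg_mul {u : ℝ → ℝ} (hu : Integrable u cm) {z : ℂ} (hz : z ∈ disc) :
    outr (fun t => -u t) z * outr u z = 1 := by
  rw [← outr_add (u := fun t => -u t) hu.neg hu hz]
  simp [outr_zero]

lemma norm_outr_mono {u v : ℝ → ℝ} (hu : Integrable u cm) (hv : Integrable v cm)
    (h : ∀ᵐ t ∂cm, u t ≤ v t) {z : ℂ} (hz : z ∈ disc) : ‖outr u z‖ ≤ ‖outr v z‖ := by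
  rw [norm_outr hu hz, norm_outr hv hz, Real.exp_le_exp]
  exact integral_mono_ae ((integrable_pm_iff hz).2 hu) ((integrable_pm_iff hz).2 hv)
    (by rwa [EventuallyLE, ae_pm hz])

lemma norm_outr_le {u : ℝ → ℝ} (hu : Integrable u cm) {c : ℝ}
    (h : ∀ᵐ t ∂cm, u t ≤ c) {z : ℂ} (hz : z ∈ disc) : ‖outr u z‖ ≤ Real.exp c := by
  have := isProbabilityMeasure_pm hz
  refine (norm_outr_mono hu (integrable_const c) h hz).trans ?_
  rw [norm_outr (integrable_const c) hz]
  simp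

lemma memHinf_outr {u : ℝ → ℝ} (hu : Integrable u cm) {c : ℝ}
    (h : ∀ᵐ t ∂cm, u t ≤ c) : MemHinf (outr u) :=
  ⟨differentiableOn_outr hu, _, fun _ hz => norm_outr_le hu h hz⟩

lemma fatou_real {u : ℝ → ℝ} (hu : Integrable u cm) :
    ∀ᵐ t ∂cm, Tendsto (fun r : ℝ => ∫ s, u s ∂(pm (r * bpt t))) (𝓝[<] 1) (𝓝 (u t)) := by
  filter_upwards [fatou_radial hu.ofReal] with t ht
  have := (Complex.continuous_re.tendsto _).comp ht
  refine this.congr fun r => ?_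
  rw [Function.comp_apply]
  have h := integral_complex_ofReal (μ := pm (r * bpt t)) (f := u)
  exact (congrArg Complex.re h).trans (Complex.ofReal_re _)

lemma boundaryAbs_outr {u : ℝ → ℝ} (hu : Integrable u cm) :
    ∀ᵐ t ∂cm, BoundaryAbs (outr u) t (Real.exp (u t)) := by
  filter_upwards [fatou_real hu] with t ht
  refine ((Real.continuous_exp.tendsto _).comp ht).congr' ?_
  filter_upwards [eventually_left_one] with r hr
  rw [Function.comp_apply, norm_outr hu (mul_bpt_mem_disc hr.1.le hr.2 t)]

lemma memHardy2_outr {u : ℝ → ℝ} (hu : Integrable u cm)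
    (h2 : Integrable (fun t => Real.exp (2 * u t)) cm) : MemHardy2 (outr u) := by
  refine memHardy2_of_le_poisson (differentiableOn_outr hu) h2 fun z hz => ?_
  have := isProbabilityMeasure_pm hz
  rw [norm_outr hu hz, ← Real.exp_nat_mul, Nat.cast_ofNat, ← integral_const_mul]
  exact convexOn_exp.map_integral_le (μ := pm z) (f := fun t => 2 * u t)
    Real.continuous_exp.continuousOn isClosed_univ
    (ae_of_all _ fun _ => mem_univ _) (((integrable_pm_iff hz).2 hu).const_mul 2)
    ((integrable_pm_iff hz).2 h2)

lemma BoundaryAbs.norm_bdv {f : ℂ → ℂ} {t m : ℝ} (h : BoundaryAbs f t m)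
    (hf : HasRadialLimitAt f (bpt t) (bdv f t)) : ‖bdv f t‖ = m :=
  tendsto_nhds_unique (Tendsto.norm hf) h

lemma norm_bdv_outr {u : ℝ → ℝ} (hu : Integrable u cm) (h : MemHardy2 (outr u)) :
    ∀ᵐ t ∂cm, ‖bdv (outr u) t‖ = Real.exp (u t) := by
  filter_upwards [boundaryAbs_outr hu, h.ae_radial] with t h1 h2 using h1.norm_bdv h2

lemma isOuter_outr {u : ℝ → ℝ} (hu : Integrable u cm) : IsOuter (outr u) := by
  refine ⟨fun t => Real.exp (u t), fun t => (Real.exp_pos _).le, ?_, fun z _ => ?_⟩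
  · simp only [Real.log_exp]
    rw [intervalIntegrable_iff_integrableOn_Ioc_of_le (by positivity)]
    exact integrable_cm_iff.1 hu
  · simp only [Real.log_exp, outr, herg, integral_cm]
    congr 1
    rw [Complex.real_smul]; push_cast; rfl

lemma integrable_log_add {v : ℝ → ℝ} (hv : Integrable v cm) (h0 : ∀ t, 0 ≤ v t) {ε : ℝ}
    (hε : 0 < ε) : Integrable (fun t => Real.log (v t + ε)) cm := by
  have hm : AEStronglyMeasurable (fun t => Real.log (v t + ε)) cm :=
    (hv.1.aemeasurable.add_const ε).log.aestronglyMeasurable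
  refine ((hv.add (integrable_const (ε + |Real.log ε|)))).mono' hm (ae_of_all _ fun t => ?_)
  have h1 : Real.log ε ≤ Real.log (v t + ε) := Real.log_le_log hε (by linarith [h0 t])
  have h2 := Real.log_le_sub_one_of_pos (x := v t + ε) (by linarith [h0 t])
  have h3 := neg_abs_le (Real.log ε)
  have h4 := abs_nonneg (Real.log ε)
  rw [Real.norm_eq_abs, abs_le]
  simp only [Pi.add_apply]
  constructor <;> linarith [h0 t]

lemma MemHardy2.norm_le_exp_eps {g : ℂ → ℂ} (hg : MemHardy2 g) {ε : ℝ} (hε : 0 < ε) {w : ℂ}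
    (hw : w ∈ disc) : ‖g w‖ ≤ Real.exp (∫ t, Real.log (‖bdv g t‖ + ε) ∂(pm w)) := by
  have hi := integrable_log_add hg.integrable.norm (fun t => norm_nonneg _) hε
  have hin : Integrable (fun t => -Real.log (‖bdv g t‖ + ε)) cm := hi.neg
  have hle : ∀ᵐ t ∂cm, -Real.log (‖bdv g t‖ + ε) ≤ -Real.log ε := ae_of_all _ fun t =>
    neg_le_neg (Real.log_le_log hε (by linarith [norm_nonneg (bdv g t)]))
  have ho := memHinf_outr hin hle
  obtain ⟨hd, C, hC⟩ := ho
  have hH := hg.bdd_mul hd hC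
  have ho2 := MemHinf.memHardy2 ⟨hd, C, hC⟩
  have key := hH.norm_le_of_bdv (C := 1) (by
    filter_upwards [bdv_mul ho2 hg, norm_bdv_outr hin ho2] with t h1 h2
    have hp : 0 < ‖bdv g t‖ + ε := by positivity
    rw [h1, norm_mul, h2, Real.exp_neg, Real.exp_log hp, inv_mul_le_one₀ hp]
    linarith) hw
  rw [← norm_outr hi hw]
  have h3 := outr_neg_mul hi hw
  calc ‖g w‖ = ‖outr (fun t => -Real.log (‖bdv g t‖ + ε)) w * g w‖ *
        ‖outr (fun t => Real.log (‖bdv g t‖ + ε)) w‖ := by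
          rw [← norm_mul, mul_right_comm, h3, one_mul]
    _ ≤ 1 * _ := by gcongr
    _ = _ := one_mul _

/-- The logarithm of the boundary modulus. -/
def lg (g : ℂ → ℂ) (t : ℝ) : ℝ := Real.log ‖bdv g t‖

lemma MemHardy2.lg_aux {g : ℂ → ℂ} (hg : MemHardy2 g) {w : ℂ} (hw : w ∈ disc) (hgw : g w ≠ 0) :
    (∀ᵐ t ∂cm, bdv g t ≠ 0) ∧ Integrable (lg g) cm ∧
      ‖g w‖ ≤ Real.exp (∫ t, lg g t ∂(pm w)) := by
  have := isProbabilityMeasure_pm hw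
  set v : ℝ → ℝ := fun t => ‖bdv g t‖ with hv
  have hvi : Integrable v cm := hg.integrable.norm
  have hvw : Integrable v (pm w) := (integrable_pm_iff hw).2 hvi
  have hv0 : ∀ t, 0 ≤ v t := fun t => norm_nonneg _
  set ψ : ℕ → ℝ → ℝ := fun n t => v t + 1 - Real.log (v t + 1 / (n + 1 : ℝ)) with hψ
  have he : ∀ n : ℕ, (0 : ℝ) < 1 / (n + 1 : ℝ) := fun n => by positivity
  have hli : ∀ n : ℕ, Integrable (fun t => Real.log (v t + 1 / (n + 1 : ℝ))) (pm w) := fun n =>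
    (integrable_pm_iff hw).2 (integrable_log_add hvi hv0 (he n))
  have hvi1 : Integrable (fun t => v t + 1) (pm w) := hvw.add (integrable_const 1)
  have hψi : ∀ n, Integrable (ψ n) (pm w) := fun n => hvi1.sub (hli n)
  have hψ0 : ∀ n t, 0 ≤ ψ n t := fun n t => by
    have h1 := Real.log_le_sub_one_of_pos (x := v t + 1 / (n + 1 : ℝ)) (by linarith [hv0 t, he n])
    have h2 : 1 / (n + 1 : ℝ) ≤ 1 := by
      rw [div_le_one (by positivity)]; linarith [(Nat.cast_nonneg n : (0:ℝ) ≤ n)]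
    simp only [hψ]; linarith
  set K := ∫ t, (v t + 1) ∂(pm w) - Real.log ‖g w‖ with hK
  have hψb : ∀ n, ∫ t, ψ n t ∂(pm w) ≤ K := fun n => by
    have h1 := hg.norm_le_exp_eps (he n) hw
    rw [← Real.log_le_iff_le_exp (norm_pos_iff.2 hgw)] at h1
    have : ∫ t, ψ n t ∂(pm w) = ∫ t, (v t + 1) ∂(pm w) -
      ∫ t, Real.log (v t + 1 / (n + 1 : ℝ)) ∂(pm w) := integral_sub hvi1 (hli n)
    rw [this]; linarith
  have hlim0 : Tendsto (fun n : ℕ => 1 / (n + 1 : ℝ)) atTop (𝓝 0) :=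
    tendsto_one_div_add_atTop_nhds_zero_nat
  have hfat : ∫⁻ t, liminf (fun n => ENNReal.ofReal (ψ n t)) atTop ∂(pm w) ≤ ENNReal.ofReal K := by
    refine (lintegral_liminf_le' fun n => (hψi n).1.aemeasurable.ennreal_ofReal).trans ?_
    refine liminf_le_of_le (by isBoundedDefault) fun b hb => ?_
    obtain ⟨n, hn⟩ := hb.exists
    refine hn.trans ?_
    rw [← ofReal_integral_eq_lintegral_ofReal (hψi n) (ae_of_all _ (hψ0 n))]
    exact ENNReal.ofReal_le_ofReal (hψb n)
  have hmeas : AEMeasurable (fun t => liminf (fun n => ENNReal.ofReal (ψ n t)) atTop) (pm w) := by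
    simp_rw [liminf_eq_iSup_iInf_of_nat']
    exact .iSup fun n => .iInf fun i => (hψi _).1.aemeasurable.ennreal_ofReal
  have hfin := ae_lt_top' hmeas (ne_top_of_le_ne_top ENNReal.ofReal_ne_top hfat)
  have hne : ∀ᵐ t ∂(pm w), v t ≠ 0 := by
    filter_upwards [hfin] with t ht h0
    refine ht.ne ?_
    refine Tendsto.liminf_eq ?_
    refine ENNReal.tendsto_ofReal_atTop.comp ?_
    simp only [hψ, h0, zero_add]
    have h1 : Tendsto (fun n : ℕ => Real.log (1 / (n + 1 : ℝ))) atTop atBot :=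
      Real.tendsto_log_nhdsGT_zero.comp (tendsto_nhdsWithin_iff.2 ⟨hlim0, Eventually.of_forall he⟩)
    have h2 := tendsto_neg_atBot_atTop.comp h1
    exact (tendsto_atTop_add_const_left _ 1 h2).congr fun n => by simp [sub_eq_add_neg]
  have hlimeq : ∀ᵐ t ∂(pm w), liminf (fun n => ENNReal.ofReal (ψ n t)) atTop =
      ENNReal.ofReal (v t + 1 - lg g t) := by
    filter_upwards [hne] with t ht
    refine Tendsto.liminf_eq (ENNReal.tendsto_ofReal ?_)
    have h1 : Tendsto (fun n : ℕ => v t + 1 / (n + 1 : ℝ)) atTop (𝓝 (v t)) := by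
      simpa using hlim0.const_add (v t)
    exact (((Real.continuousAt_log ht).tendsto.comp h1).const_sub (v t + 1))
  rw [lintegral_congr_ae hlimeq] at hfat
  have hlm : AEStronglyMeasurable (lg g) (pm w) := hvw.1.aemeasurable.log.aestronglyMeasurable
  have hnn : ∀ t, 0 ≤ v t + 1 - lg g t := fun t => by
    by_cases h0 : v t = 0
    · have : lg g t = 0 := by simp only [lg]; rw [show ‖bdv g t‖ = 0 from h0, Real.log_zero]
      rw [this, h0]; norm_num
    · have := Real.log_le_sub_one_of_pos (lt_of_le_of_ne (hv0 t) (Ne.symm h0))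
      simp only [lg]; simp only [hv] at this ⊢; linarith
  have hinteg : Integrable (fun t => v t + 1 - lg g t) (pm w) := by
    refine ⟨hvi1.1.sub hlm, ?_⟩
    rw [hasFiniteIntegral_iff_ofReal (ae_of_all _ hnn)]
    exact hfat.trans_lt ENNReal.ofReal_lt_top
  have hlg : Integrable (lg g) (pm w) := by
    refine (hvi1.sub hinteg).congr (ae_of_all _ fun t => ?_)
    simp
  rw [ae_pm hw] at hne
  refine ⟨hne.mono fun t ht => by simpa [hv] using ht, (integrable_pm_iff hw).1 hlg, ?_⟩
  rw [← Real.log_le_iff_le_exp (norm_pos_iff.2 hgw)]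
  rw [← ofReal_integral_eq_lintegral_ofReal hinteg (ae_of_all _ hnn)] at hfat
  have hK0 : 0 ≤ K := (integral_nonneg fun t => hψ0 0 t).trans (hψb 0)
  rw [ENNReal.ofReal_le_ofReal_iff hK0, integral_sub hvi1 hlg] at hfat
  linarith

/-- The function does not vanish identically on the disc. -/
def NZ (g : ℂ → ℂ) : Prop := ∃ z ∈ disc, g z ≠ 0

lemma MemHardy2.bdv_ne {g : ℂ → ℂ} (hg : MemHardy2 g) (h : NZ g) : ∀ᵐ t ∂cm, bdv g t ≠ 0 := by
  obtain ⟨w, hw, hgw⟩ := h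
  exact (hg.lg_aux hw hgw).1

lemma MemHardy2.integrable_lg {g : ℂ → ℂ} (hg : MemHardy2 g) (h : NZ g) : Integrable (lg g) cm := by
  obtain ⟨w, hw, hgw⟩ := h
  exact (hg.lg_aux hw hgw).2.1

lemma MemHardy2.norm_le_outr {g : ℂ → ℂ} (hg : MemHardy2 g) (h : NZ g) {w : ℂ} (hw : w ∈ disc) :
    ‖g w‖ ≤ ‖outr (lg g) w‖ := by
  by_cases hgw : g w = 0
  · rw [hgw, norm_zero]; exact norm_nonneg _
  · rw [norm_outr (hg.integrable_lg h) hw]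
    exact (hg.lg_aux hw hgw).2.2

/-- The inner factor. -/
def gin (g : ℂ → ℂ) (z : ℂ) : ℂ := outr (fun t => -lg g t) z * g z

lemma MemHardy2.gin_mul {g : ℂ → ℂ} (hg : MemHardy2 g) (h : NZ g) {w : ℂ} (hw : w ∈ disc) :
    g w = gin g w * outr (lg g) w := by
  rw [gin, mul_right_comm, outr_neg_mul (hg.integrable_lg h) hw, one_mul]

lemma MemHardy2.norm_gin_le {g : ℂ → ℂ} (hg : MemHardy2 g) (h : NZ g) {w : ℂ} (hw : w ∈ disc) :
    ‖gin g w‖ ≤ 1 := by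
  have h1 := hg.norm_le_outr h hw
  rw [hg.gin_mul h hw, norm_mul] at h1
  have h2 := norm_pos_iff.2 (outr_ne_zero (lg g) w)
  exact (mul_le_iff_le_one_left h2).1 h1

lemma MemHardy2.exp_lg {g : ℂ → ℂ} (hg : MemHardy2 g) (h : NZ g) :
    ∀ᵐ t ∂cm, Real.exp (lg g t) = ‖bdv g t‖ := by
  filter_upwards [hg.bdv_ne h] with t ht
  rw [lg, Real.exp_log (norm_pos_iff.2 ht)]

lemma MemHardy2.outr_lg {g : ℂ → ℂ} (hg : MemHardy2 g) (h : NZ g) : MemHardy2 (outr (lg g)) := by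
  refine memHardy2_outr (hg.integrable_lg h) (hg.integrable_sq.congr ?_)
  filter_upwards [hg.exp_lg h] with t ht
  rw [two_mul, Real.exp_add, ht, sq]

lemma MemHardy2.norm_bdv_outr_lg {g : ℂ → ℂ} (hg : MemHardy2 g) (h : NZ g) :
    ∀ᵐ t ∂cm, ‖bdv (outr (lg g)) t‖ = ‖bdv g t‖ := by
  filter_upwards [norm_bdv_outr (hg.integrable_lg h) (hg.outr_lg h), hg.exp_lg h] with t h1 h2
  rw [h1, h2]

lemma MemHardy2.gin_memHinf {g : ℂ → ℂ} (hg : MemHardy2 g) (h : NZ g) : MemHinf (gin g) :=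
  ⟨(differentiableOn_outr (hg.integrable_lg h).neg).mul hg.1, 1, fun _ hw => hg.norm_gin_le h hw⟩

lemma MemHardy2.isInner_gin {g : ℂ → ℂ} (hg : MemHardy2 g) (h : NZ g) : IsInner (gin g) := by
  refine ⟨(hg.gin_memHinf h).1, fun _ hw => hg.norm_gin_le h hw, ?_⟩
  rw [← ae_cm]
  have hn : Integrable (fun t => -lg g t) cm := (hg.integrable_lg h).neg
  filter_upwards [boundaryAbs_outr hn, hg.ae_radial, hg.bdv_ne h] with t h1 h2 h3
  have h4 : Tendsto (fun r : ℝ => ‖g (r * bpt t)‖) (𝓝[<] 1) (𝓝 ‖bdv g t‖) := Tendsto.norm h2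
  have h5 := Tendsto.mul h1 h4
  rw [lg, Real.exp_neg, Real.exp_log (norm_pos_iff.2 h3),
    inv_mul_cancel₀ (norm_ne_zero_iff.2 h3)] at h5
  exact h5.congr fun r => by rw [gin, norm_mul]

lemma IsInner.memHinf {I : ℂ → ℂ} (h : IsInner I) : MemHinf I := ⟨h.1, 1, h.2.1⟩

lemma IsInner.memHardy2 {I : ℂ → ℂ} (h : IsInner I) : MemHardy2 I := h.memHinf.memHardy2

lemma IsInner.norm_bdv {I : ℂ → ℂ} (h : IsInner I) : ∀ᵐ t ∂cm, ‖bdv I t‖ = 1 := by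
  have h1 := h.2.2
  rw [← ae_cm] at h1
  filter_upwards [h1, h.memHardy2.ae_radial] with t h1 h2 using h1.norm_bdv h2

/-- The local Dirichlet integral at `w`. -/
def Dw (f : ℂ → ℂ) (w : ℂ) : ℝ := (∫ t, ‖bdv f t - f w‖ ^ 2 ∂(pm w)) / (1 - ‖w‖ ^ 2)

lemma Dw_nonneg (f : ℂ → ℂ) {w : ℂ} (hw : w ∈ disc) : 0 ≤ Dw f w :=
  div_nonneg (integral_nonneg fun _ => by positivity) (one_sub_norm_sq_pos hw).le

lemma Dw_congr {f g : ℂ → ℂ} (h : ∀ z ∈ disc, f z = g z) {w : ℂ} (hw : w ∈ disc) :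
    Dw f w = Dw g w := by
  rw [Dw, Dw, bdv_congr h, h w hw]

lemma MemHardy2.Dw_mul {f : ℂ → ℂ} (hf : MemHardy2 f) {w : ℂ} (hw : w ∈ disc) :
    Dw f w * (1 - ‖w‖ ^ 2) = ∫ t, ‖bdv f t‖ ^ 2 ∂(pm w) - ‖f w‖ ^ 2 := by
  rw [Dw, div_mul_cancel₀ _ (one_sub_norm_sq_pos hw).ne', hf.variance hw]

lemma MemHardy2.memLp_sub {f : ℂ → ℂ} (hf : MemHardy2 f) (c : ℂ) {w : ℂ} (hw : w ∈ disc) :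
    MemLp (fun t => bdv f t - c) 2 (pm w) := by
  have := isProbabilityMeasure_pm hw
  exact (hf.memLp_pm hw).sub (memLp_const c)

lemma MemHardy2.integrable_sub_sq {f : ℂ → ℂ} (hf : MemHardy2 f) (c : ℂ) {w : ℂ} (hw : w ∈ disc) :
    Integrable (fun t => ‖bdv f t - c‖ ^ 2) (pm w) :=
  (memLp_two_iff_integrable_sq_norm (hf.memLp_sub c hw).1).1 (hf.memLp_sub c hw)

lemma Dw_eq (f : ℂ → ℂ) {w : ℂ} (hw : w ∈ disc) :
    Dw f w = ∫ t, ‖bdv f t - f w‖ ^ 2 / ‖bpt t - w‖ ^ 2 ∂cm := by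
  rw [Dw, integral_pm hw, ← integral_div]
  congr 1; ext t
  have h1 := (one_sub_norm_sq_pos hw).ne'
  have h2 := norm_ne_zero_iff.2 (bpt_sub_ne hw t)
  rw [pk, smul_eq_mul]
  field_simp

lemma Dw_const (c : ℂ) (w : ℂ) : Dw (fun _ => c) w = 0 := by
  have : ∀ t, bdv (fun _ => c) t = c := fun t => bdv_of_continuous (f := fun _ => c) continuous_const t
  simp [Dw, this]

lemma Dw_add_le {f g : ℂ → ℂ} (hf : MemHardy2 f) (hg : MemHardy2 g) {w : ℂ} (hw : w ∈ disc) :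
    Dw (fun z => f z + g z) w ≤ 2 * Dw f w + 2 * Dw g w := by
  have h0 := one_sub_norm_sq_pos hw
  rw [Dw, Dw, Dw, ← mul_div_assoc, ← mul_div_assoc, ← add_div]
  refine div_le_div_of_nonneg_right ?_ h0.le
  have i1 := hf.integrable_sub_sq (f w) hw
  have i2 := hg.integrable_sub_sq (g w) hw
  rw [← integral_const_mul, ← integral_const_mul, ← integral_add (i1.const_mul 2) (i2.const_mul 2)]
  refine integral_mono_ae ((hf.add hg).integrable_sub_sq _ hw) ((i1.const_mul 2).add (i2.const_mul 2)) ?_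
  rw [EventuallyLE, ae_pm hw]
  filter_upwards [bdv_add hf hg] with t ht
  rw [ht, add_sub_add_comm]
  have h3 : ‖(bdv f t - f w) + (bdv g t - g w)‖ ^ 2 ≤
    (‖bdv f t - f w‖ + ‖bdv g t - g w‖) ^ 2 := by gcongr; exact norm_add_le _ _
  nlinarith [sq_nonneg (‖bdv f t - f w‖ - ‖bdv g t - g w‖)]

lemma Dw_const_mul {f : ℂ → ℂ} (hf : MemHardy2 f) (c : ℂ) {w : ℂ} (hw : w ∈ disc) :
    Dw (fun z => c * f z) w = ‖c‖ ^ 2 * Dw f w := by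
  rw [Dw, Dw, ← mul_div_assoc, ← integral_const_mul]
  congr 1
  refine integral_congr_ae ?_
  rw [EventuallyEq, ae_pm hw]
  filter_upwards [bdv_const_mul hf c] with t ht
  rw [ht, ← mul_sub, norm_mul, mul_pow]

lemma norm_add_real_mul_sq (a b : ℂ) (t : ℝ) : ‖a + t * b‖ ^ 2 =
    ‖a‖ ^ 2 + t * (‖a + b‖ ^ 2 - ‖a‖ ^ 2 - ‖b‖ ^ 2) + t ^ 2 * ‖b‖ ^ 2 := by
  simp only [← Complex.normSq_eq_norm_sq, Complex.normSq_apply, add_re, add_im, mul_re, mul_im,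
    ofReal_re, ofReal_im]
  ring

lemma Dw_quadratic {f g : ℂ → ℂ} (hf : MemHardy2 f) (hg : MemHardy2 g) (x : ℝ) {w : ℂ}
    (hw : w ∈ disc) : Dw (fun z => f z + x * g z) w =
      Dw f w + x * (Dw (fun z => f z + g z) w - Dw f w - Dw g w) + x ^ 2 * Dw g w := by
  have h0 := (one_sub_norm_sq_pos hw).ne'
  have i1 := hf.integrable_sub_sq (f w) hw
  have i2 := hg.integrable_sub_sq (g w) hw
  have i3 := (hf.add hg).integrable_sub_sq (f w + g w) hw
  have key : ∫ t, ‖bdv (fun z => f z + x * g z) t - (f w + x * g w)‖ ^ 2 ∂(pm w) =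
      ∫ t, ‖bdv f t - f w‖ ^ 2 ∂(pm w) + x * (∫ t, ‖bdv (fun z => f z + g z) t - (f w + g w)‖ ^ 2 ∂(pm w)
        - ∫ t, ‖bdv f t - f w‖ ^ 2 ∂(pm w) - ∫ t, ‖bdv g t - g w‖ ^ 2 ∂(pm w)) +
        x ^ 2 * ∫ t, ‖bdv g t - g w‖ ^ 2 ∂(pm w) := by
    have i4 : Integrable (fun t => ‖bdv (fun z => f z + g z) t - (f w + g w)‖ ^ 2
      - ‖bdv f t - f w‖ ^ 2) (pm w) := i3.sub i1
    have i5 : Integrable (fun t => ‖bdv (fun z => f z + g z) t - (f w + g w)‖ ^ 2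
      - ‖bdv f t - f w‖ ^ 2 - ‖bdv g t - g w‖ ^ 2) (pm w) := i4.sub i2
    have i6 : Integrable (fun t => ‖bdv f t - f w‖ ^ 2 + x * (‖bdv (fun z => f z + g z) t -
      (f w + g w)‖ ^ 2 - ‖bdv f t - f w‖ ^ 2 - ‖bdv g t - g w‖ ^ 2)) (pm w) := i1.add (i5.const_mul x)
    rw [← integral_sub i3 i1, ← integral_sub i4 i2, ← integral_const_mul, ← integral_const_mul,
      ← integral_add i1 (i5.const_mul x), ← integral_add i6 (i2.const_mul _)]
    refine integral_congr_ae ?_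
    rw [EventuallyEq, ae_pm hw]
    filter_upwards [bdv_add hf (hg.const_mul x), bdv_add hf hg, bdv_const_mul hg x] with t h1 h2 h3
    rw [h1, h2, h3, add_sub_add_comm, ← mul_sub, norm_add_real_mul_sq, add_sub_add_comm]
  rw [Dw, Dw, Dw, Dw, key]
  field_simp

lemma Dw_id_mul {f : ℂ → ℂ} (hf : MemHardy2 f) {w : ℂ} (hw : w ∈ disc) :
    Dw (fun z => z * f z) w = Dw f w + ‖f w‖ ^ 2 := by
  have h0 := (one_sub_norm_sq_pos hw).ne'
  refine mul_right_cancel₀ h0 ?_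
  rw [hf.id_mul.Dw_mul hw, add_mul, hf.Dw_mul hw, norm_mul]
  have : ∫ t, ‖bdv (fun z => z * f z) t‖ ^ 2 ∂(pm w) = ∫ t, ‖bdv f t‖ ^ 2 ∂(pm w) := by
    refine integral_congr_ae ?_
    rw [EventuallyEq, ae_pm hw]
    filter_upwards [bdv_id_mul hf] with t ht
    rw [ht, norm_mul, norm_bpt, one_mul]
  rw [this]; ring

lemma Dw_le_of_lipschitz {k : ℂ → ℂ} (hk : MemHardy2 k) {C : ℝ} {w : ℂ} (hw : w ∈ disc)
    (h : ∀ z ∈ disc, ‖k z - k w‖ ≤ C * ‖z - w‖) : Dw k w ≤ C ^ 2 := by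
  rw [Dw_eq k hw]
  have hb : ∀ᵐ t ∂cm, ‖bdv k t - k w‖ ^ 2 / ‖bpt t - w‖ ^ 2 ≤ C ^ 2 := by
    filter_upwards [hk.ae_radial] with t ht
    have h1 : ‖bdv k t - k w‖ ≤ C * ‖bpt t - w‖ := by
      have l1 : Tendsto (fun r : ℝ => ‖k (r * bpt t) - k w‖) (𝓝[<] 1) (𝓝 ‖bdv k t - k w‖) :=
        (Tendsto.sub_const ht _).norm
      have l2 : Tendsto (fun r : ℝ => C * ‖(r : ℂ) * bpt t - w‖) (𝓝[<] 1) (𝓝 (C * ‖bpt t - w‖)) :=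
        ((Tendsto.sub_const (hasRadialLimitAt_of_continuousAt
          (f := id) continuousAt_id) w).norm).const_mul C
      refine le_of_tendsto_of_tendsto l1 l2 ?_
      filter_upwards [eventually_left_one] with r hr using h _ (mul_bpt_mem_disc hr.1.le hr.2 t)
    rw [← div_pow]
    have h2 := norm_pos_iff.2 (bpt_sub_ne hw t)
    have : ‖bdv k t - k w‖ / ‖bpt t - w‖ ≤ C := by rwa [div_le_iff₀ h2]
    gcongr
  calc _ ≤ ∫ t, C ^ 2 ∂cm := integral_mono_of_nonneg (ae_of_all _ fun t => by positivity)
        (integrable_const _) hb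
    _ = _ := by simp

lemma MemHardy2.integrable_quot {f : ℂ → ℂ} (hf : MemHardy2 f) {w : ℂ} (hw : w ∈ disc) :
    Integrable (fun t => ‖bdv f t - f w‖ ^ 2 / ‖bpt t - w‖ ^ 2) cm := by
  have h := (integrable_pm_iff hw).1 (hf.integrable_sub_sq (f w) hw)
  have hc : Continuous fun t => (‖bpt t - w‖ ^ 2)⁻¹ :=
    Continuous.inv₀ (by fun_prop) fun t => by have := bpt_sub_ne hw t; positivity
  exact ((memLp_one_iff_integrable.2 h).mul (memLp_of_continuous hc ⊤) |>.integrable le_rfl).congr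
    (ae_of_all _ fun t => by simp [div_eq_inv_mul])

lemma norm_sq_le_hardy_Dw {f : ℂ → ℂ} (hf : MemHardy2 f) {w : ℂ} (hw : w ∈ disc) :
    ‖f w‖ ^ 2 ≤ 2 * hardyNormSq f + 8 * Dw f w := by
  rw [hf.norm_eq, Dw_eq f hw, ← integral_const_mul, ← integral_const_mul,
    ← integral_add (hf.integrable_sq.const_mul 2) ((hf.integrable_quot hw).const_mul 8)]
  have : ‖f w‖ ^ 2 = ∫ t, ‖f w‖ ^ 2 ∂cm := by simp
  rw [this]
  refine integral_mono (integrable_const _)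
    ((hf.integrable_sq.const_mul 2).add ((hf.integrable_quot hw).const_mul 8)) fun t => ?_
  have h1 : ‖f w‖ ≤ ‖bdv f t‖ + ‖bdv f t - f w‖ := by
    have := norm_sub_le (bdv f t) (bdv f t - f w)
    rwa [sub_sub_cancel] at this
  have h2 : ‖bpt t - w‖ ≤ 2 := by
    have := norm_sub_le (bpt t) w
    rw [norm_bpt] at this; linarith [mem_disc.1 hw]
  have h3 := norm_pos_iff.2 (bpt_sub_ne hw t)
  have h4 : ‖bdv f t - f w‖ ^ 2 ≤ 4 * (‖bdv f t - f w‖ ^ 2 / ‖bpt t - w‖ ^ 2) := by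
    rw [← mul_div_assoc, le_div_iff₀ (by positivity), mul_comm]
    gcongr
    nlinarith
  have h5 : ‖f w‖ ^ 2 ≤ (‖bdv f t‖ + ‖bdv f t - f w‖) ^ 2 := by gcongr
  simp only
  nlinarith [sq_nonneg (‖bdv f t‖ - ‖bdv f t - f w‖)]

lemma Dw_inner_mul {I f : ℂ → ℂ} (hI : IsInner I) (hf : MemHardy2 f) {w : ℂ} (hw : w ∈ disc) :
    Dw (fun z => I z * f z) w = Dw f w + ‖f w‖ ^ 2 * ((1 - ‖I w‖ ^ 2) / (1 - ‖w‖ ^ 2)) := by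
  have h0 := (one_sub_norm_sq_pos hw).ne'
  refine mul_right_cancel₀ h0 ?_
  have hIf := hf.bdd_mul hI.1 hI.2.1
  rw [hIf.Dw_mul hw, add_mul, hf.Dw_mul hw, norm_mul]
  have : ∫ t, ‖bdv (fun z => I z * f z) t‖ ^ 2 ∂(pm w) = ∫ t, ‖bdv f t‖ ^ 2 ∂(pm w) := by
    refine integral_congr_ae ?_
    rw [EventuallyEq, ae_pm hw]
    filter_upwards [bdv_mul hI.memHardy2 hf, hI.norm_bdv] with t ht h2
    rw [ht, norm_mul, h2, one_mul]
  rw [this]; field_simp; ring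

lemma Dw_le_inner_mul {I f : ℂ → ℂ} (hI : IsInner I) (hf : MemHardy2 f) {w : ℂ} (hw : w ∈ disc) :
    Dw f w ≤ Dw (fun z => I z * f z) w := by
  rw [Dw_inner_mul hI hf hw]
  have h1 := one_sub_norm_sq_pos hw
  have h2 := hI.2.1 w hw
  have h3 : 0 ≤ 1 - ‖I w‖ ^ 2 := by nlinarith [norm_nonneg (I w)]
  have : 0 ≤ ‖f w‖ ^ 2 * ((1 - ‖I w‖ ^ 2) / (1 - ‖w‖ ^ 2)) := by positivity
  linarith

lemma disc_mem_nhds {w : ℂ} (hw : w ∈ disc) : disc ∈ 𝓝 w := isOpen_disc.mem_nhds hw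

lemma differentiableOn_dslope_disc {f : ℂ → ℂ} (hf : DifferentiableOn ℂ f disc) {w : ℂ}
    (hw : w ∈ disc) : DifferentiableOn ℂ (dslope f w) disc :=
  (Complex.differentiableOn_dslope (disc_mem_nhds hw)).2 hf

lemma MemHardy2.dslope {f : ℂ → ℂ} (hf : MemHardy2 f) {w : ℂ} (hw : w ∈ disc) :
    MemHardy2 (dslope f w) := by
  have hd := differentiableOn_dslope_disc hf.1 hw
  have hw1 := mem_disc.1 hw
  set δ := (1 - ‖w‖) / 2 with hδ
  have hδ0 : 0 < δ := by linarith
  have hsub : closedBall w δ ⊆ disc := by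
    intro z hz
    rw [mem_closedBall_iff_norm] at hz
    rw [mem_disc]
    have := norm_add_le (z - w) w
    rw [sub_add_cancel] at this
    linarith
  obtain ⟨C, hC⟩ := (isCompact_closedBall w δ).exists_bound_of_continuousOn
    (hd.continuousOn.mono hsub)
  refine memHardy2_of_le_poisson hd
    (v := fun t => (2 / δ ^ 2) * ‖bdv f t‖ ^ 2 + (C ^ 2 + 2 / δ ^ 2 * ‖f w‖ ^ 2))
    ((hf.integrable_sq.const_mul _).add (integrable_const _)) fun z hz => ?_
  have := isProbabilityMeasure_pm hz
  rw [integral_add ((hf.integrable_sq_pm hz).const_mul _) (integrable_const _), integral_const_mul]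
  simp only [integral_const, probReal_univ, one_smul]
  have h1 := hf.sq_le hz
  by_cases hzw : z ∈ closedBall w δ
  · have h2 : ‖_root_.dslope f w z‖ ^ 2 ≤ C ^ 2 := by have := hC z hzw; gcongr
    have h3 : 0 ≤ 2 / δ ^ 2 * ‖f w‖ ^ 2 := by positivity
    have h4 : 0 ≤ 2 / δ ^ 2 * ∫ t, ‖bdv f t‖ ^ 2 ∂(pm z) :=
      mul_nonneg (by positivity) (integral_nonneg fun _ => by positivity)
    linarith
  · rw [mem_closedBall_iff_norm, not_le] at hzw
    have hne : z ≠ w := by rintro rfl; simp at hzw; linarith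
    rw [dslope_of_ne _ hne, slope_def_field, norm_div, div_pow]
    have h2 : ‖f z - f w‖ ^ 2 ≤ 2 * ‖f z‖ ^ 2 + 2 * ‖f w‖ ^ 2 := by
      have : ‖f z - f w‖ ^ 2 ≤ (‖f z‖ + ‖f w‖) ^ 2 := by gcongr; exact norm_sub_le _ _
      nlinarith [sq_nonneg (‖f z‖ - ‖f w‖)]
    have h3 : ‖f z - f w‖ ^ 2 / ‖z - w‖ ^ 2 ≤ ‖f z - f w‖ ^ 2 / δ ^ 2 := by gcongr
    refine h3.trans ?_
    rw [div_le_iff₀ (by positivity)]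
    have e : (2 / δ ^ 2 * ∫ t, ‖bdv f t‖ ^ 2 ∂(pm z) + (C ^ 2 + 2 / δ ^ 2 * ‖f w‖ ^ 2)) * δ ^ 2 =
      2 * ∫ t, ‖bdv f t‖ ^ 2 ∂(pm z) + C ^ 2 * δ ^ 2 + 2 * ‖f w‖ ^ 2 := by
      field_simp; ring
    rw [e]
    have : 0 ≤ C ^ 2 * δ ^ 2 := by positivity
    linarith

lemma sub_mul_dslope (f : ℂ → ℂ) (w z : ℂ) : f z = f w + (z - w) * dslope f w z := by
  have := sub_smul_dslope f w z
  rw [smul_eq_mul] at this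
  rw [this]; ring

lemma MemHardy2.bdv_dslope {f : ℂ → ℂ} (hf : MemHardy2 f) {w : ℂ} (hw : w ∈ disc) :
    ∀ᵐ t ∂cm, bdv f t - f w = (bpt t - w) * bdv (_root_.dslope f w) t := by
  filter_upwards [hf.ae_radial, (hf.dslope hw).ae_radial] with t h1 h2
  have h3 : HasRadialLimitAt f (bpt t) (f w + (bpt t - w) * bdv (_root_.dslope f w) t) := by
    have h4 : HasRadialLimitAt (fun z => f w + (z - w)) (bpt t) (f w + (bpt t - w)) :=
      hasRadialLimitAt_of_continuousAt (f := fun z => f w + (z - w)) (by fun_prop)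
    have h5 := ((hasRadialLimitAt_of_continuousAt (f := fun z : ℂ => z - w) (ζ := bpt t)
      (by fun_prop)).mul h2)
    have h6 := (hasRadialLimitAt_of_continuousAt (f := fun _ : ℂ => f w) (ζ := bpt t)
      (by fun_prop)).add h5
    refine Tendsto.congr (fun r => ?_) h6
    exact (sub_mul_dslope f w _).symm
  rw [h3.bdv_eq]; ring

lemma MemHardy2.hardyNormSq_dslope {f : ℂ → ℂ} (hf : MemHardy2 f) {w : ℂ} (hw : w ∈ disc) :
    hardyNormSq (_root_.dslope f w) = Dw f w := by
  rw [(hf.dslope hw).norm_eq, Dw_eq f hw]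
  refine integral_congr_ae ?_
  filter_upwards [hf.bdv_dslope hw] with t ht
  have h3 := norm_pos_iff.2 (bpt_sub_ne hw t)
  rw [ht, norm_mul, mul_pow, mul_div_cancel_left₀ _ (by positivity)]

lemma tc_unique {f : ℂ → ℂ} {a : ℕ → ℂ} (h : ∀ z ∈ disc, HasSum (fun n => a n * z ^ n) (f z))
    (n : ℕ) : tc f n = a n := by
  have hp : HasFPowerSeriesAt f (FormalMultilinearSeries.ofScalars ℂ a) 0 := by
    rw [hasFPowerSeriesAt_iff]
    filter_upwards [disc_mem_nhds zero_mem_disc] with z hz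
    simpa [FormalMultilinearSeries.coeff_ofScalars, mul_comm] using h z hz
  have := hp.eq_formalMultilinearSeries hp.analyticAt.hasFPowerSeriesAt
  have h2 := congrArg (fun p => p.coeff n) this
  simp only [FormalMultilinearSeries.coeff_ofScalars] at h2
  rw [h2, tc, div_eq_inv_mul]

lemma tc_add {f g : ℂ → ℂ} (hf : DifferentiableOn ℂ f disc) (hg : DifferentiableOn ℂ g disc)
    (n : ℕ) : tc (fun z => f z + g z) n = tc f n + tc g n := by
  refine tc_unique (a := fun n => tc f n + tc g n) (fun z hz => ?_) n
  exact ((hasSum_tc hf hz).add (hasSum_tc hg hz)).congr_fun fun n => by ring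

lemma tc_const_mul {f : ℂ → ℂ} (hf : DifferentiableOn ℂ f disc) (c : ℂ)
    (n : ℕ) : tc (fun z => c * f z) n = c * tc f n := by
  refine tc_unique (a := fun n => c * tc f n) (fun z hz => ?_) n
  exact ((hasSum_tc hf hz).mul_left c).congr_fun fun n => by ring

lemma tc_zero (f : ℂ → ℂ) : tc f 0 = f 0 := by simp [tc]

lemma tc_id_mul_succ {f : ℂ → ℂ} (hf : DifferentiableOn ℂ f disc) (n : ℕ) :
    tc (fun z => z * f z) (n + 1) = tc f n := by
  refine tc_unique (a := fun n => if n = 0 then 0 else tc f (n - 1)) (fun z hz => ?_) (n + 1)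
  rw [← hasSum_nat_add_iff' 1]
  simp only [Nat.add_sub_cancel, Finset.range_one, Finset.sum_singleton, if_true, zero_mul, sub_zero,
    Nat.succ_ne_zero, if_false]
  exact ((hasSum_tc hf hz).mul_left z).congr_fun fun n => by ring

lemma tc_congr {f g : ℂ → ℂ} (hf : DifferentiableOn ℂ f disc) (h : ∀ z ∈ disc, f z = g z) (n : ℕ) :
    tc f n = tc g n :=
  (tc_unique (fun z hz => by rw [← h z hz]; exact hasSum_tc hf hz) n).symm

lemma eq_add_mul_dslope (f : ℂ → ℂ) (z : ℂ) : f z = f 0 + z * dslope f 0 z := by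
  simpa using sub_mul_dslope f 0 z

lemma tc_const_succ (c : ℂ) (n : ℕ) : tc (fun _ => c) (n + 1) = 0 := by
  simp [tc, iteratedDeriv_const]

lemma tc_dslope {f : ℂ → ℂ} (hf : DifferentiableOn ℂ f disc) (n : ℕ) :
    tc (dslope f 0) n = tc f (n + 1) := by
  have hd := differentiableOn_dslope_disc hf zero_mem_disc
  have hd' : DifferentiableOn ℂ (fun z => z * dslope f 0 z) disc := differentiableOn_id.mul hd
  rw [← tc_id_mul_succ hd, tc_congr hf (g := fun z => f 0 + z * dslope f 0 z)
    (fun z _ => eq_add_mul_dslope f z), tc_add (differentiableOn_const _)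
    hd', tc_const_succ, zero_add]

lemma MemHardy2.tc_sq_le {f : ℂ → ℂ} (hf : MemHardy2 f) (n : ℕ) : ‖tc f n‖ ^ 2 ≤ hardyNormSq f := by
  rw [hf.hardyNormSq_eq]
  exact hf.summable.le_tsum n fun _ _ => by positivity

lemma Dw_dslope_zero {f : ℂ → ℂ} (hf : MemHardy2 f) {w : ℂ} (hw : w ∈ disc) :
    Dw f w = Dw (dslope f 0) w + ‖dslope f 0 w‖ ^ 2 := by
  have hB := hf.dslope zero_mem_disc
  rw [← Dw_id_mul hB hw]
  have h1 : ∀ t, bdv (fun z => z * dslope f 0 z) t = bdv (fun z => f z - f 0) t := fun t =>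
    congrFun (bdv_congr fun z _ => by rw [eq_add_mul_dslope f z]; ring) t
  rw [Dw, Dw]
  congr 1
  refine integral_congr_ae ?_
  rw [EventuallyEq, ae_pm hw]
  filter_upwards [bdv_sub hf (memHardy2_const (f 0))] with t ht
  rw [h1, ht, bdv_of_continuous (f := fun _ => f 0) continuous_const]
  congr 2
  nth_rewrite 1 [eq_add_mul_dslope f w]
  ring

lemma integral_le_of_tendsto {α : Type*} [MeasurableSpace α] {P : Measure α} {F : ℕ → α → ℝ}
    {G : α → ℝ} {c : ℕ → ℝ} {L : ℝ} (h0 : ∀ n t, 0 ≤ F n t) (hF : ∀ n, Integrable (F n) P)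
    (hlim : ∀ᵐ t ∂P, Tendsto (fun n => F n t) atTop (𝓝 (G t))) (hc : ∀ n, ∫ t, F n t ∂P ≤ c n)
    (hL : Tendsto c atTop (𝓝 L)) : Integrable G P ∧ ∫ t, G t ∂P ≤ L := by
  have hG : AEStronglyMeasurable G P :=
    aestronglyMeasurable_of_tendsto_ae atTop (fun n => (hF n).aestronglyMeasurable) hlim
  have hG0 : 0 ≤ᵐ[P] G := by
    filter_upwards [hlim] with t ht
    exact ge_of_tendsto' ht fun n => h0 n t
  have hc0 : ∀ n, 0 ≤ c n := fun n => (integral_nonneg (h0 n)).trans (hc n)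
  have hL0 : 0 ≤ L := ge_of_tendsto' hL hc0
  have key : ∫⁻ t, ENNReal.ofReal (G t) ∂P ≤ ENNReal.ofReal L := by
    calc ∫⁻ t, ENNReal.ofReal (G t) ∂P
        = ∫⁻ t, liminf (fun n => ENNReal.ofReal (F n t)) atTop ∂P := by
          refine lintegral_congr_ae ?_
          filter_upwards [hlim] with t ht
          exact ((ENNReal.continuous_ofReal.tendsto _).comp ht).liminf_eq.symm
      _ ≤ liminf (fun n => ∫⁻ t, ENNReal.ofReal (F n t) ∂P) atTop :=
          lintegral_liminf_le' fun n => (hF n).aestronglyMeasurable.aemeasurable.ennreal_ofReal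
      _ ≤ liminf (fun n => ENNReal.ofReal (c n)) atTop := by
          refine liminf_le_liminf (Eventually.of_forall fun n => ?_)
          rw [← ofReal_integral_eq_lintegral_ofReal (hF n) (Eventually.of_forall (h0 n))]
          exact ENNReal.ofReal_le_ofReal (hc n)
      _ = ENNReal.ofReal L := ((ENNReal.continuous_ofReal.tendsto _).comp hL).liminf_eq
  refine ⟨⟨hG, ?_⟩, ?_⟩
  · rw [hasFiniteIntegral_iff_ofReal hG0]
    exact key.trans_lt ENNReal.ofReal_lt_top
  · rw [integral_eq_lintegral_of_nonneg_ae hG0 hG]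
    exact ENNReal.toReal_le_of_le_ofReal hL0 key

/-- A sequence of radii increasing to `1`. -/
def rn (n : ℕ) : ℝ := 1 - (1 / 2) ^ (n + 1)

lemma rn_lt_one (n : ℕ) : rn n < 1 := by simp [rn]

lemma rn_nonneg (n : ℕ) : 0 ≤ rn n := by
  have : ((1:ℝ) / 2) ^ (n + 1) ≤ 1 := pow_le_one₀ (by norm_num) (by norm_num)
  simp only [rn]; linarith

lemma tendsto_rn : Tendsto rn atTop (𝓝[<] 1) := by
  refine tendsto_nhdsWithin_iff.2 ⟨?_, Eventually.of_forall rn_lt_one⟩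
  have h : Tendsto (fun n : ℕ => ((1:ℝ) / 2) ^ (n + 1)) atTop (𝓝 0) :=
    (tendsto_pow_atTop_nhds_zero_of_lt_one (by norm_num) (by norm_num)).comp (tendsto_add_atTop_nat 1)
  have h2 := h.const_sub (1:ℝ)
  rwa [sub_zero] at h2

lemma tendsto_dilate_at {f : ℂ → ℂ} (hf : DifferentiableOn ℂ f disc) {w : ℂ} (hw : w ∈ disc) :
    Tendsto (fun r : ℝ => f (r * w)) (𝓝[<] 1) (𝓝 (f w)) := by
  have h1 : ContinuousAt f w := (hf.differentiableAt (disc_mem_nhds hw)).continuousAt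
  have h2 : Tendsto (fun r : ℝ => (r : ℂ) * w) (𝓝 1) (𝓝 w) := by
    have : Continuous fun r : ℝ => (r : ℂ) * w := by fun_prop
    simpa using this.tendsto 1
  exact h1.tendsto.comp (h2.mono_left nhdsWithin_le_nhds)

lemma mul_mem_disc {r : ℝ} (h0 : 0 ≤ r) (h1 : r < 1) {w : ℂ} (hw : w ∈ disc) :
    (r : ℂ) * w ∈ disc := by
  rw [mem_disc] at *
  rw [norm_mul, Complex.norm_real, Real.norm_of_nonneg h0]
  nlinarith [norm_nonneg w]

lemma integral_dilate_sq_le {f V : ℂ → ℂ} (hf : DifferentiableOn ℂ f disc)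
    (hV : DifferentiableOn ℂ V disc) (h : ∀ z ∈ disc, ‖f z‖ ^ 2 ≤ (V z).re) {w : ℂ}
    (hw : w ∈ disc) {r : ℝ} (h0 : 0 ≤ r) (h1 : r < 1) :
    ∫ t, ‖f (r * bpt t)‖ ^ 2 ∂(pm w) ≤ (V (r * w)).re := by
  have hP := isProbabilityMeasure_pm hw
  have hVi : Integrable (fun t => V (r * bpt t)) (pm w) := (integrable_pm_iff hw).2
    ((memLp_one_iff_integrable).1 (memLp_of_continuous (continuous_dilate hV h0 h1) 1))
  rw [← poisson_dilate hV h0 h1 hw]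
  have e : (∫ t, V (r * bpt t) ∂(pm w)).re = ∫ t, (V (r * bpt t)).re ∂(pm w) :=
    (integral_re hVi).symm
  rw [e]
  refine integral_mono ?_ hVi.re fun t => h _ (mul_bpt_mem_disc h0 h1 t)
  exact (integrable_pm_iff hw).2
    ((memLp_one_iff_integrable).1 (memLp_of_continuous ((continuous_dilate hf h0 h1).norm.pow 2) 1))

lemma memHardy2_of_majorant {f V : ℂ → ℂ} (hf : DifferentiableOn ℂ f disc)
    (hV : DifferentiableOn ℂ V disc) (h : ∀ z ∈ disc, ‖f z‖ ^ 2 ≤ (V z).re) : MemHardy2 f := by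
  refine ⟨hf, (V 0).re, fun x hx => ?_⟩
  obtain ⟨r, h0, h1, rfl⟩ := mem_hardySet.1 hx
  have := integral_dilate_sq_le hf hV h zero_mem_disc h0.le h1
  rwa [mul_zero, pm_zero] at this

lemma MemHardy2.le_majorant {f V : ℂ → ℂ} (hf : MemHardy2 f)
    (hV : DifferentiableOn ℂ V disc) (h : ∀ z ∈ disc, ‖f z‖ ^ 2 ≤ (V z).re) {w : ℂ}
    (hw : w ∈ disc) : ∫ t, ‖bdv f t‖ ^ 2 ∂(pm w) ≤ (V w).re := by
  refine (integral_le_of_tendsto (F := fun n t => ‖f (rn n * bpt t)‖ ^ 2) (fun n t => by positivity)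
    (fun n => (integrable_pm_iff hw).2 ((memLp_one_iff_integrable).1 (memLp_of_continuous
      ((continuous_dilate hf.1 (rn_nonneg n) (rn_lt_one n)).norm.pow 2) 1))) ?_
    (fun n => integral_dilate_sq_le hf.1 hV h hw (rn_nonneg n) (rn_lt_one n)) ?_).2
  · rw [ae_pm hw]
    filter_upwards [hf.ae_radial] with t ht
    exact ((ht.comp tendsto_rn).norm.pow 2)
  · exact (Complex.continuous_re.tendsto _).comp ((tendsto_dilate_at hV hw).comp tendsto_rn)

/-- The involutive automorphism of the disc exchanging `0` and `w`. -/
def mob (w z : ℂ) : ℂ := (w - z) / (1 - (starRingEnd ℂ) w * z)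

lemma one_sub_conj_mul_ne {w z : ℂ} (hw : w ∈ disc) (hz : z ∈ disc) :
    1 - (starRingEnd ℂ) w * z ≠ 0 := by
  intro h
  rw [mem_disc] at hw hz
  have : ‖(starRingEnd ℂ) w * z‖ = 1 := by rw [← sub_eq_zero.1 h]; simp
  rw [norm_mul, Complex.norm_conj] at this
  nlinarith [norm_nonneg w, norm_nonneg z]

lemma one_sub_mob_sq {w z : ℂ} (hw : w ∈ disc) (hz : z ∈ disc) :
    1 - ‖mob w z‖ ^ 2 =
      (1 - ‖z‖ ^ 2) * (1 - ‖w‖ ^ 2) / ‖1 - (starRingEnd ℂ) w * z‖ ^ 2 := by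
  have h := norm_pos_iff.2 (one_sub_conj_mul_ne hw hz)
  rw [mob, norm_div, div_pow, eq_div_iff (by positivity), sub_mul, div_mul_cancel₀ _ (by positivity)]
  simp only [← Complex.normSq_eq_norm_sq, Complex.normSq_apply]
  simp
  ring

lemma mob_mem {w z : ℂ} (hw : w ∈ disc) (hz : z ∈ disc) : mob w z ∈ disc := by
  have h := norm_pos_iff.2 (one_sub_conj_mul_ne hw hz)
  have : 0 < 1 - ‖mob w z‖ ^ 2 := by
    rw [one_sub_mob_sq hw hz]
    have := one_sub_norm_sq_pos hz
    have := one_sub_norm_sq_pos hw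
    positivity
  rw [mem_disc]
  nlinarith [norm_nonneg (mob w z)]

lemma one_sub_conj_mul_mob {w z : ℂ} (hw : w ∈ disc) (hz : z ∈ disc) :
    1 - (starRingEnd ℂ) w * mob w z =
      ((1 - ‖w‖ ^ 2 : ℝ) : ℂ) / (1 - (starRingEnd ℂ) w * z) := by
  have h := one_sub_conj_mul_ne hw hz
  have hc : (starRingEnd ℂ) w * w = ((‖w‖ ^ 2 : ℝ) : ℂ) := by
    rw [mul_comm, Complex.mul_conj, Complex.normSq_eq_norm_sq]
  rw [mob]
  field_simp
  push_cast at hc ⊢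
  linear_combination -hc

lemma mob_mob {w z : ℂ} (hw : w ∈ disc) (hz : z ∈ disc) : mob w (mob w z) = z := by
  have h := one_sub_conj_mul_ne hw hz
  have h2 : ((1 - ‖w‖ ^ 2 : ℝ) : ℂ) ≠ 0 := by
    exact_mod_cast (one_sub_norm_sq_pos hw).ne'
  have hc : (starRingEnd ℂ) w * w = ((‖w‖ ^ 2 : ℝ) : ℂ) := by
    rw [mul_comm, Complex.mul_conj, Complex.normSq_eq_norm_sq]
  have e : mob w (mob w z) = (w - mob w z) / (1 - (starRingEnd ℂ) w * mob w z) := rfl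
  rw [e, one_sub_conj_mul_mob hw hz, div_eq_iff (div_ne_zero h2 h), mob,
    ← mul_div_assoc, eq_div_iff h, sub_mul, div_mul_cancel₀ _ h]
  push_cast at hc ⊢
  linear_combination (-z) * hc

lemma mob_zero (w : ℂ) : mob w 0 = w := by simp [mob]

lemma mob_self (w : ℂ) : mob w w = 0 := by simp [mob]

lemma hasDerivAt_mob {w z : ℂ} (hw : w ∈ disc) (hz : z ∈ disc) :
    HasDerivAt (mob w) (-((1 - ‖w‖ ^ 2 : ℝ) : ℂ) / (1 - (starRingEnd ℂ) w * z) ^ 2) z := by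
  have h := one_sub_conj_mul_ne hw hz
  have hc : (starRingEnd ℂ) w * w = ((‖w‖ ^ 2 : ℝ) : ℂ) := by
    rw [mul_comm, Complex.mul_conj, Complex.normSq_eq_norm_sq]
  have := ((hasDerivAt_id z).const_sub w).div (((hasDerivAt_id z).const_mul
    ((starRingEnd ℂ) w)).const_sub 1) h
  refine this.congr_deriv ?_
  congr 1
  push_cast at hc ⊢
  linear_combination hc

lemma differentiableOn_comp_mob {f : ℂ → ℂ} (hf : DifferentiableOn ℂ f disc) {w : ℂ}
    (hw : w ∈ disc) : DifferentiableOn ℂ (fun z => f (mob w z)) disc :=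
  hf.comp (fun _ hz => (hasDerivAt_mob hw hz).differentiableAt.differentiableWithinAt)
    fun _ hz => mob_mem hw hz

lemma MemHardy2.norm_sq_le_re_herg {f : ℂ → ℂ} (hf : MemHardy2 f) {z : ℂ} (hz : z ∈ disc) :
    ‖f z‖ ^ 2 ≤ (herg (fun t => ‖bdv f t‖ ^ 2) z).re := by
  rw [re_herg hf.integrable_sq hz]
  exact hf.sq_le hz

lemma MemHardy2.comp_mob {f : ℂ → ℂ} (hf : MemHardy2 f) {w : ℂ} (hw : w ∈ disc) :
    MemHardy2 fun z => f (mob w z) :=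
  memHardy2_of_majorant (differentiableOn_comp_mob hf.1 hw)
    (differentiableOn_comp_mob (differentiableOn_herg hf.integrable_sq) hw)
    fun _ hz => hf.norm_sq_le_re_herg (mob_mem hw hz)

lemma MemHardy2.comp_mob_le {f : ℂ → ℂ} (hf : MemHardy2 f) {w z : ℂ} (hw : w ∈ disc)
    (hz : z ∈ disc) : ∫ t, ‖bdv (fun z => f (mob w z)) t‖ ^ 2 ∂(pm z) ≤
      ∫ t, ‖bdv f t‖ ^ 2 ∂(pm (mob w z)) := by
  rw [← re_herg hf.integrable_sq (mob_mem hw hz)]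
  exact (hf.comp_mob hw).le_majorant
    (differentiableOn_comp_mob (differentiableOn_herg hf.integrable_sq) hw)
    (fun _ hu => hf.norm_sq_le_re_herg (mob_mem hw hu)) hz

lemma MemHardy2.hardyNormSq_comp_mob {f : ℂ → ℂ} (hf : MemHardy2 f) {w : ℂ} (hw : w ∈ disc) :
    hardyNormSq (fun z => f (mob w z)) = ∫ t, ‖bdv f t‖ ^ 2 ∂(pm w) := by
  rw [(hf.comp_mob hw).norm_eq]
  refine le_antisymm ?_ ?_
  · have := hf.comp_mob_le hw zero_mem_disc
    rwa [mob_zero, pm_zero] at this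
  · have := (hf.comp_mob hw).comp_mob_le hw hw
    rw [mob_self, pm_zero] at this
    rwa [bdv_congr (g := f) fun z hz => by simp only [mob_mob hw hz]] at this

lemma tc_deriv (k : ℂ → ℂ) (n : ℕ) : tc (deriv k) n = (n + 1) * tc k (n + 1) := by
  have h : ((n : ℂ) + 1) ≠ 0 := by exact_mod_cast n.succ_ne_zero
  have h2 : (n.factorial : ℂ) ≠ 0 := by exact_mod_cast n.factorial_ne_zero
  rw [tc, tc, iteratedDeriv_succ', Nat.factorial_succ]
  push_cast
  field_simp

lemma polarCoord_symm_eq (p : ℝ × ℝ) : Complex.polarCoord.symm p = p.1 * bpt p.2 := by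
  rw [Complex.polarCoord_symm_apply, bpt, mul_comm Complex.I, Complex.exp_mul_I]
  push_cast
  ring

lemma bpt_periodic : Function.Periodic bpt (2 * Real.pi) := by
  intro t
  simp only [bpt]
  push_cast
  rw [mul_add, Complex.exp_add, mul_comm Complex.I (2 * (Real.pi : ℂ)), Complex.exp_two_pi_mul_I,
    mul_one]

lemma lintegral_disc_polar {g : ℂ → ℝ≥0∞} (hg : Measurable g) :
    ∫⁻ z in disc, g z = ∫⁻ r in Ioo (0:ℝ) 1, ENNReal.ofReal r *
      ∫⁻ t in Ioo (-Real.pi) Real.pi, g (r * bpt t) := by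
  have hm : Measurable (disc.indicator g) := hg.indicator isOpen_disc.measurableSet
  have hm2 : Measurable fun p : ℝ × ℝ => disc.indicator g (p.1 * bpt p.2) := by
    refine hm.comp (Continuous.measurable ?_)
    fun_prop
  rw [← lintegral_indicator isOpen_disc.measurableSet, ← Complex.lintegral_comp_polarCoord_symm]
  simp only [polarCoord_symm_eq, smul_eq_mul, polarCoord_target]
  rw [show (volume : Measure (ℝ × ℝ)) = (volume : Measure ℝ).prod volume from rfl,
    setLIntegral_prod _ (by fun_prop)]
  rw [← lintegral_indicator measurableSet_Ioi, ← lintegral_indicator measurableSet_Ioo]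
  refine lintegral_congr fun r => ?_
  by_cases h0 : 0 < r
  · by_cases h1 : r < 1
    · rw [indicator_of_mem (mem_Ioi.2 h0), indicator_of_mem (mem_Ioo.2 ⟨h0, h1⟩),
        ← lintegral_const_mul]
      · refine lintegral_congr fun t => ?_
        rw [indicator_of_mem (mul_bpt_mem_disc h0.le h1 t)]
      · exact hg.comp (by fun_prop)
    · rw [indicator_of_mem (mem_Ioi.2 h0), indicator_of_notMem (fun h => h1 h.2)]
      rw [lintegral_eq_zero_iff (by fun_prop)]
      refine Eventually.of_forall fun t => ?_
      have : (r : ℂ) * bpt t ∉ disc := by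
        rw [mem_disc, norm_mul, norm_bpt, mul_one, Complex.norm_real, Real.norm_of_nonneg h0.le]
        exact h1
      simp [this]
  · rw [indicator_of_notMem (show r ∉ Ioi 0 from h0), indicator_of_notMem (fun h => h0 h.1)]

lemma lintegral_Ioo_circle {h : ℝ → ℝ} (hh : Continuous h) (hp : Function.Periodic h (2 * Real.pi))
    (h0 : ∀ t, 0 ≤ h t) :
    ∫⁻ t in Ioo (-Real.pi) Real.pi, ENNReal.ofReal (h t) =
      ENNReal.ofReal (2 * Real.pi * ∫ t, h t ∂cm) := by
  rw [setLIntegral_congr Ioo_ae_eq_Ioc, ← ofReal_integral_eq_lintegral_ofReal]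
  · congr 1
    rw [← intervalIntegral.integral_of_le (by linarith [Real.pi_pos]), integral_cm, smul_eq_mul,
      ← mul_assoc, mul_inv_cancel₀ (by positivity), one_mul]
    have := hp.intervalIntegral_add_eq (-Real.pi) 0
    rw [zero_add] at this
    rw [← this]
    congr 1
    ring
  · exact hh.integrableOn_Ioc
  · exact Eventually.of_forall h0

lemma integral_radial (n : ℕ) : ∫⁻ r in Ioo (0:ℝ) 1, ENNReal.ofReal (r * (1 - r ^ 2) * r ^ (2 * n)) =
    ENNReal.ofReal (1 / (2 * (n + 1) * (n + 2))) := by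
  rw [setLIntegral_congr Ioo_ae_eq_Ioc, ← ofReal_integral_eq_lintegral_ofReal]
  · congr 1
    rw [← intervalIntegral.integral_of_le zero_le_one]
    have : ∀ r : ℝ, r * (1 - r ^ 2) * r ^ (2 * n) = r ^ (2 * n + 1) - r ^ (2 * n + 3) := by
      intro r; ring
    simp_rw [this]
    rw [intervalIntegral.integral_sub (by simp) (by simp), integral_pow, integral_pow]
    push_cast
    have : (n:ℝ) + 1 ≠ 0 := by positivity
    have : (n:ℝ) + 2 ≠ 0 := by positivity
    simp
    field_simp
    ring_nf
  · exact (Continuous.integrableOn_Ioc (by fun_prop))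
  · refine (ae_restrict_iff' measurableSet_Ioc).2 (Eventually.of_forall fun r hr => ?_)
    have := hr.1
    have : 0 ≤ 1 - r ^ 2 := by nlinarith [hr.2]
    simp only [Pi.zero_apply]
    positivity

lemma area_formula {k : ℂ → ℂ} (hk : DifferentiableOn ℂ k disc) :
    ∫⁻ z in disc, ENNReal.ofReal (‖deriv k z‖ ^ 2 * (1 - ‖z‖ ^ 2)) =
      ∑' n : ℕ, ENNReal.ofReal (Real.pi * ((n + 1) / (n + 2)) * ‖tc k (n + 1)‖ ^ 2) := by
  have hd : DifferentiableOn ℂ (deriv k) disc := hk.deriv isOpen_disc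
  have hm : Measurable fun z => ENNReal.ofReal (‖deriv k z‖ ^ 2 * (1 - ‖z‖ ^ 2)) := by
    have := measurable_deriv k
    fun_prop
  rw [lintegral_disc_polar hm]
  have key : ∀ r ∈ Ioo (0:ℝ) 1, (ENNReal.ofReal r * ∫⁻ t in Ioo (-Real.pi) Real.pi,
      ENNReal.ofReal (‖deriv k (r * bpt t)‖ ^ 2 * (1 - ‖r * bpt t‖ ^ 2))) =
      ∑' n : ℕ, ENNReal.ofReal (2 * Real.pi * ‖tc (deriv k) n‖ ^ 2) *
        ENNReal.ofReal (r * (1 - r ^ 2) * r ^ (2 * n)) := by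
    intro r ⟨h0, h1⟩
    have hr : 0 ≤ 1 - r ^ 2 := by nlinarith
    have hn : ∀ t, ‖(r : ℂ) * bpt t‖ = r := fun t => by
      rw [norm_mul, norm_bpt, mul_one, Complex.norm_real, Real.norm_of_nonneg h0.le]
    simp_rw [hn]
    rw [lintegral_Ioo_circle, ← ENNReal.ofReal_mul h0.le, integral_mul_const]
    · have hs := (parseval_circle hd h0.le h1).mul_left (2 * Real.pi * (r * (1 - r ^ 2)))
      rw [show r * (2 * Real.pi * ((∫ t, ‖deriv k (r * bpt t)‖ ^ 2 ∂cm) * (1 - r ^ 2))) =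
        2 * Real.pi * (r * (1 - r ^ 2)) * ∫ t, ‖deriv k (r * bpt t)‖ ^ 2 ∂cm by ring, ← hs.tsum_eq,
        ENNReal.ofReal_tsum_of_nonneg (fun n => by positivity) hs.summable]
      refine tsum_congr fun n => ?_
      rw [← ENNReal.ofReal_mul (by positivity)]
      congr 1
      ring
    · exact ((continuous_dilate hd h0.le h1).norm.pow 2).mul continuous_const
    · intro t
      simp only [bpt_periodic t]
    · intro t
      positivity
  rw [setLIntegral_congr_fun measurableSet_Ioo key, lintegral_tsum (fun n => by fun_prop)]
  refine tsum_congr fun n => ?_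
  rw [lintegral_const_mul _ (by fun_prop), integral_radial, ← ENNReal.ofReal_mul (by positivity)]
  congr 1
  rw [tc_deriv, norm_mul, show ((n : ℂ) + 1) = ((n + 1 : ℝ) : ℂ) by push_cast; rfl,
    Complex.norm_real, Real.norm_of_nonneg (by positivity)]
  have : (n:ℝ) + 1 ≠ 0 := by positivity
  have : (n:ℝ) + 2 ≠ 0 := by positivity
  field_simp

/-- The weighted area integral comparable to `Dw f w`. -/
def AwE (f : ℂ → ℂ) (w : ℂ) : ℝ≥0∞ :=
  ∫⁻ z in disc, ENNReal.ofReal (‖deriv f z‖ ^ 2 * ((1 - ‖z‖ ^ 2) / ‖1 - (starRingEnd ℂ) w * z‖ ^ 2))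

lemma abs_det_restrictScalars (c : ℂ) :
    |((ContinuousLinearMap.toSpanSingleton ℂ c).restrictScalars ℝ).det| = ‖c‖ ^ 2 := by
  have h : (((ContinuousLinearMap.toSpanSingleton ℂ c).restrictScalars ℝ : ℂ →L[ℝ] ℂ) : ℂ →ₗ[ℝ] ℂ) =
      (((ContinuousLinearMap.toSpanSingleton ℂ c : ℂ →L[ℂ] ℂ) : ℂ →ₗ[ℂ] ℂ)).restrictScalars ℝ := rfl
  rw [ContinuousLinearMap.det, h, LinearMap.det_restrictScalars, Algebra.norm_complex_apply,
    Complex.normSq_eq_norm_sq, abs_of_nonneg (by positivity)]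
  congr 2
  rw [LinearMap.det_ring]
  simp

lemma AwE_eq {f : ℂ → ℂ} (hf : DifferentiableOn ℂ f disc) {w : ℂ} (hw : w ∈ disc) :
    AwE f w = ENNReal.ofReal (1 / (1 - ‖w‖ ^ 2)) *
      ∫⁻ u in disc, ENNReal.ofReal (‖deriv (fun z => f (mob w z)) u‖ ^ 2 * (1 - ‖u‖ ^ 2)) := by
  have himg : mob w '' disc = disc := by
    refine Subset.antisymm (image_subset_iff.2 fun z hz => mob_mem hw hz) fun z hz => ?_
    exact ⟨mob w z, mob_mem hw hz, mob_mob hw hz⟩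
  have hinj : InjOn (mob w) disc := fun a ha b hb hab => by
    rw [← mob_mob hw ha, hab, mob_mob hw hb]
  have hm : Measurable fun z =>
      ENNReal.ofReal (‖deriv (fun z => f (mob w z)) z‖ ^ 2 * (1 - ‖z‖ ^ 2)) := by
    have := measurable_deriv (fun z => f (mob w z))
    fun_prop
  rw [AwE]
  conv_lhs => rw [← himg]
  rw [lintegral_image_eq_lintegral_abs_det_fderiv_mul volume isOpen_disc.measurableSet
    (fun z hz => ((hasDerivAt_mob hw hz).hasFDerivAt.restrictScalars ℝ).hasFDerivWithinAt) hinj,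
    ← lintegral_const_mul _ hm]
  refine setLIntegral_congr_fun isOpen_disc.measurableSet fun u hu => ?_
  have hw2 := one_sub_norm_sq_pos hw
  have hd := norm_pos_iff.2 (one_sub_conj_mul_ne hw hu)
  rw [abs_det_restrictScalars, ← ENNReal.ofReal_mul (by positivity),
    ← ENNReal.ofReal_mul (by positivity)]
  congr 1
  have hder : deriv (fun z => f (mob w z)) u = deriv f (mob w u) *
      (-((1 - ‖w‖ ^ 2 : ℝ) : ℂ) / (1 - (starRingEnd ℂ) w * u) ^ 2) :=
    ((hf.differentiableAt (disc_mem_nhds (mob_mem hw hu))).hasDerivAt.comp u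
      (hasDerivAt_mob hw hu)).deriv
  rw [hder, one_sub_mob_sq hw hu, one_sub_conj_mul_mob hw hu]
  simp only [norm_mul, norm_div, norm_neg, Complex.norm_real, norm_pow, Real.norm_of_nonneg hw2.le]
  generalize hA : ‖1 - (starRingEnd ℂ) w * u‖ = A at *
  generalize 1 - ‖w‖ ^ 2 = B at *
  field_simp

lemma tsum_tc_comp_mob {f : ℂ → ℂ} (hf : MemHardy2 f) {w : ℂ} (hw : w ∈ disc) :
    ∑' n : ℕ, ‖tc (fun z => f (mob w z)) (n + 1)‖ ^ 2 = Dw f w * (1 - ‖w‖ ^ 2) := by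
  have hk := hf.comp_mob hw
  rw [hf.Dw_mul hw, ← hf.hardyNormSq_comp_mob hw, hk.hardyNormSq_eq, hk.summable.tsum_eq_zero_add,
    tc_zero, mob_zero]
  ring

lemma AwE_le {f : ℂ → ℂ} (hf : MemHardy2 f) {w : ℂ} (hw : w ∈ disc) :
    AwE f w ≤ ENNReal.ofReal (Real.pi * Dw f w) := by
  have hk := hf.comp_mob hw
  have hw2 := one_sub_norm_sq_pos hw
  have hs : Summable fun n : ℕ => ‖tc (fun z => f (mob w z)) (n + 1)‖ ^ 2 :=
    (summable_nat_add_iff 1).2 hk.summable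
  rw [AwE_eq hf.1 hw, area_formula hk.1]
  calc _ ≤ ENNReal.ofReal (1 / (1 - ‖w‖ ^ 2)) *
        ∑' n : ℕ, ENNReal.ofReal (Real.pi * ‖tc (fun z => f (mob w z)) (n + 1)‖ ^ 2) := by
        gcongr with n
        have : ((n:ℝ) + 1) / (n + 2) ≤ 1 := (div_le_one (by positivity)).2 (by linarith)
        nlinarith [Real.pi_pos]
    _ = _ := by
        rw [← ENNReal.ofReal_tsum_of_nonneg (fun n => by positivity) (hs.mul_left _), tsum_mul_left,
          tsum_tc_comp_mob hf hw, ← ENNReal.ofReal_mul (by positivity)]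
        congr 1
        field_simp

lemma le_AwE {f : ℂ → ℂ} (hf : MemHardy2 f) {w : ℂ} (hw : w ∈ disc) :
    ENNReal.ofReal (Real.pi * Dw f w) ≤ 2 * AwE f w := by
  have hk := hf.comp_mob hw
  have hw2 := one_sub_norm_sq_pos hw
  have hs : Summable fun n : ℕ => ‖tc (fun z => f (mob w z)) (n + 1)‖ ^ 2 :=
    (summable_nat_add_iff 1).2 hk.summable
  rw [AwE_eq hf.1 hw, area_formula hk.1]
  calc ENNReal.ofReal (Real.pi * Dw f w) = 2 * (ENNReal.ofReal (1 / (1 - ‖w‖ ^ 2)) *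
        ∑' n : ℕ, ENNReal.ofReal (Real.pi * (1 / 2) * ‖tc (fun z => f (mob w z)) (n + 1)‖ ^ 2)) := by
        rw [← ENNReal.ofReal_tsum_of_nonneg (fun n => by positivity) (hs.mul_left _), tsum_mul_left,
          tsum_tc_comp_mob hf hw, ← ENNReal.ofReal_mul (by positivity),
          show (2 : ℝ≥0∞) = ENNReal.ofReal 2 by simp, ← ENNReal.ofReal_mul (by positivity)]
        congr 1
        field_simp
    _ ≤ _ := by
        gcongr 2 * (_ * ∑' n : ℕ, ENNReal.ofReal (Real.pi * ?_ * _)) with n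
        rw [div_le_div_iff₀ (by positivity) (by positivity)]
        have : (0:ℝ) ≤ n := by positivity
        linarith

lemma mem_circleT {ζ : ℂ} : ζ ∈ circleT ↔ ‖ζ‖ = 1 := by simp [circleT]

lemma ae_circle {μ : Measure ℂ} (hμ : OnCircle μ) : ∀ᵐ ζ ∂μ, ‖ζ‖ = 1 := by
  have : ∀ᵐ ζ ∂μ, ζ ∈ circleT := mem_ae_iff.2 hμ
  filter_upwards [this] with ζ h using mem_circleT.1 h

lemma mul_circle_mem {r : ℝ} (h0 : 0 ≤ r) (h1 : r < 1) {ζ : ℂ} (hζ : ‖ζ‖ = 1) :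
    (r : ℂ) * ζ ∈ disc := by
  rw [mem_disc, norm_mul, hζ, mul_one, Complex.norm_real, Real.norm_of_nonneg h0]
  exact h1

lemma norm_one_sub_le {ζ z : ℂ} (hζ : ‖ζ‖ = 1) (hz : z ∈ disc) {r : ℝ} (h0 : 0 ≤ r) (h1 : r < 1) :
    ‖1 - (starRingEnd ℂ) ζ * z‖ ≤ 2 * ‖1 - (starRingEnd ℂ) (r * ζ) * z‖ := by
  rw [mem_disc] at hz
  have e : 1 - (starRingEnd ℂ) ζ * z = (1 - (starRingEnd ℂ) (r * ζ) * z) -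
      ((1 - r : ℝ) : ℂ) * ((starRingEnd ℂ) ζ * z) := by
    rw [map_mul, Complex.conj_ofReal]; push_cast; ring
  have h2 : ‖((1 - r : ℝ) : ℂ) * ((starRingEnd ℂ) ζ * z)‖ = (1 - r) * ‖z‖ := by
    rw [norm_mul, norm_mul, Complex.norm_conj, hζ, one_mul, Complex.norm_real,
      Real.norm_of_nonneg (by linarith)]
  have h3 : 1 - r * ‖z‖ ≤ ‖1 - (starRingEnd ℂ) (r * ζ) * z‖ := by
    have := norm_sub_norm_le (1:ℂ) ((starRingEnd ℂ) (r * ζ) * z)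
    rwa [norm_one, norm_mul, Complex.norm_conj, norm_mul, hζ, mul_one, Complex.norm_real,
      Real.norm_of_nonneg h0] at this
  have h4 := norm_sub_le (1 - (starRingEnd ℂ) (r * ζ) * z)
    (((1 - r : ℝ) : ℂ) * ((starRingEnd ℂ) ζ * z))
  rw [← e, h2] at h4
  nlinarith [norm_nonneg z]

lemma one_sub_conj_mul_ne' {ζ z : ℂ} (hζ : ‖ζ‖ = 1) (hz : z ∈ disc) :
    1 - (starRingEnd ℂ) ζ * z ≠ 0 := by
  intro h
  rw [mem_disc] at hz
  have : ‖(starRingEnd ℂ) ζ * z‖ = 1 := by rw [← sub_eq_zero.1 h]; simp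
  rw [norm_mul, Complex.norm_conj, hζ] at this
  linarith

lemma AwE_radial_le (f : ℂ → ℂ) {ζ : ℂ} (hζ : ‖ζ‖ = 1) {r : ℝ} (h0 : 0 ≤ r) (h1 : r < 1) :
    AwE f (r * ζ) ≤ 4 * AwE f ζ := by
  have hm : Measurable fun z => ENNReal.ofReal (‖deriv f z‖ ^ 2 *
      ((1 - ‖z‖ ^ 2) / ‖1 - (starRingEnd ℂ) ζ * z‖ ^ 2)) := by
    have := measurable_deriv f
    fun_prop
  rw [AwE, AwE, ← lintegral_const_mul _ hm]
  refine setLIntegral_mono' isOpen_disc.measurableSet fun z hz => ?_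
  rw [show (4 : ℝ≥0∞) = ENNReal.ofReal 4 by simp, ← ENNReal.ofReal_mul (by norm_num)]
  refine ENNReal.ofReal_le_ofReal ?_
  have h2 := norm_one_sub_le hζ hz h0 h1
  have hz' := one_sub_norm_sq_pos hz
  have hA := norm_pos_iff.2 (one_sub_conj_mul_ne' hζ hz)
  have hB := norm_pos_iff.2 (one_sub_conj_mul_ne (mul_circle_mem h0 h1 hζ) hz)
  have : (1 - ‖z‖ ^ 2) / ‖1 - (starRingEnd ℂ) (r * ζ) * z‖ ^ 2 ≤
      4 * ((1 - ‖z‖ ^ 2) / ‖1 - (starRingEnd ℂ) ζ * z‖ ^ 2) := by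
    rw [← mul_div_assoc, div_le_div_iff₀ (by positivity) (by positivity)]
    nlinarith [mul_le_mul h2 h2 hA.le (by positivity)]
  nlinarith [sq_nonneg ‖deriv f z‖]

lemma Dw_radial_le {f : ℂ → ℂ} (hf : MemHardy2 f) {ζ : ℂ} (hζ : ‖ζ‖ = 1) {r : ℝ} (h0 : 0 ≤ r)
    (h1 : r < 1) : ENNReal.ofReal (Real.pi * Dw f (r * ζ)) ≤ 8 * AwE f ζ := by
  refine (le_AwE hf (mul_circle_mem h0 h1 hζ)).trans ?_
  rw [show (8 : ℝ≥0∞) = 2 * 4 by norm_num, mul_assoc]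
  gcongr
  exact AwE_radial_le f hζ h0 h1

lemma AwE_le_liminf {f : ℂ → ℂ} (hf : MemHardy2 f) {ζ : ℂ} (hζ : ‖ζ‖ = 1) :
    AwE f ζ ≤ liminf (fun n => ENNReal.ofReal (Real.pi * Dw f (rn n * ζ))) atTop := by
  have hm := measurable_deriv f
  calc AwE f ζ = ∫⁻ z in disc, liminf (fun n => ENNReal.ofReal (‖deriv f z‖ ^ 2 *
        ((1 - ‖z‖ ^ 2) / ‖1 - (starRingEnd ℂ) (rn n * ζ) * z‖ ^ 2))) atTop := by
        refine setLIntegral_congr_fun isOpen_disc.measurableSet fun z hz => ?_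
        refine (Tendsto.liminf_eq ?_).symm
        refine (ENNReal.continuous_ofReal.tendsto _).comp ?_
        have hA := norm_pos_iff.2 (one_sub_conj_mul_ne' hζ hz)
        have h1 : Tendsto (fun n => (rn n : ℂ)) atTop (𝓝 1) := by
          have := (Complex.continuous_ofReal.tendsto 1).comp
            (tendsto_rn.mono_right nhdsWithin_le_nhds)
          rwa [Complex.ofReal_one] at this
        have h2 : Tendsto (fun n => ‖1 - (starRingEnd ℂ) (rn n * ζ) * z‖ ^ 2) atTop
            (𝓝 (‖1 - (starRingEnd ℂ) ζ * z‖ ^ 2)) := by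
          have hc : Continuous fun x : ℂ => ‖1 - (starRingEnd ℂ) (x * ζ) * z‖ ^ 2 := by fun_prop
          have := (hc.tendsto 1).comp h1
          rwa [one_mul] at this
        exact (tendsto_const_nhds.div h2 (by positivity)).const_mul _
    _ ≤ liminf (fun n => AwE f (rn n * ζ)) atTop := by
        refine lintegral_liminf_le fun n => ?_
        fun_prop
    _ ≤ _ := liminf_le_liminf (Eventually.of_forall fun n =>
        AwE_le hf (mul_circle_mem (rn_nonneg n) (rn_lt_one n) hζ))

lemma measurable_AwE (f : ℂ → ℂ) : Measurable (AwE f) := by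
  have hm := measurable_deriv f
  refine Measurable.lintegral_prod_right' (ν := volume.restrict disc) (f := fun p : ℂ × ℂ =>
    ENNReal.ofReal (‖deriv f p.2‖ ^ 2 *
      ((1 - ‖p.2‖ ^ 2) / ‖1 - (starRingEnd ℂ) p.1 * p.2‖ ^ 2))) ?_
  fun_prop

/-- The (unnormalized) Dirichlet integral as an extended nonnegative number. -/
def DE (μ : Measure ℂ) (f : ℂ → ℂ) : ℝ≥0∞ := ∫⁻ ζ, AwE f ζ ∂μ

lemma dirichletDensity_nonneg {μ : Measure ℂ} (f : ℂ → ℂ) {z : ℂ} (hz : z ∈ disc) : 0 ≤ dirichletDensity μ f z := by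
  have := one_sub_norm_sq_pos hz
  refine mul_nonneg (by positivity) (integral_nonneg fun ζ => ?_)
  simp only [Pi.zero_apply]
  positivity

section
variable {μ : Measure ℂ} [IsFiniteMeasure μ]

lemma ofReal_poissonMu (hμ : OnCircle μ) {z : ℂ} (hz : z ∈ disc) : ENNReal.ofReal (poissonMu μ z) =
    ∫⁻ ζ, ENNReal.ofReal ((1 - ‖z‖ ^ 2) / ‖1 - (starRingEnd ℂ) ζ * z‖ ^ 2) ∂μ := by
  have hz' := one_sub_norm_sq_pos hz
  rw [poissonMu, ofReal_integral_eq_lintegral_ofReal]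
  · refine Integrable.of_bound (Measurable.aestronglyMeasurable (by fun_prop))
      ((1 - ‖z‖ ^ 2) / (1 - ‖z‖) ^ 2) ?_
    filter_upwards [ae_circle hμ] with ζ hζ
    have hA := norm_pos_iff.2 (one_sub_conj_mul_ne' hζ hz)
    rw [Real.norm_of_nonneg (by positivity)]
    have hz1 := mem_disc.1 hz
    have : 1 - ‖z‖ ≤ ‖1 - (starRingEnd ℂ) ζ * z‖ := by
      have := norm_sub_norm_le (1:ℂ) ((starRingEnd ℂ) ζ * z)
      rwa [norm_one, norm_mul, Complex.norm_conj, hζ, one_mul] at this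
    have h2 : 0 < 1 - ‖z‖ := by linarith
    gcongr
  · exact Eventually.of_forall fun ζ => by positivity

lemma lintegral_dirichletDensity (hμ : OnCircle μ) (f : ℂ → ℂ) :
    ∫⁻ z in disc, ENNReal.ofReal (dirichletDensity μ f z) = DE μ f := by
  have hm := measurable_deriv f
  rw [DE]
  unfold AwE
  rw [lintegral_lintegral_swap (Measurable.aemeasurable (by unfold Function.uncurry; fun_prop))]
  refine setLIntegral_congr_fun isOpen_disc.measurableSet fun z hz => ?_
  rw [dirichletDensity, ENNReal.ofReal_mul (by positivity), ofReal_poissonMu hμ hz,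
    ← lintegral_const_mul _ (by fun_prop)]
  refine lintegral_congr fun ζ => ?_
  rw [← ENNReal.ofReal_mul (by positivity)]

lemma aestronglyMeasurable_dirichletDensity (f : ℂ → ℂ) :
    AEStronglyMeasurable (dirichletDensity μ f) (volume.restrict disc) := by
  have hm := measurable_deriv f
  have h : StronglyMeasurable (poissonMu μ) := by
    refine StronglyMeasurable.integral_prod_right' (ν := μ) (f := fun p : ℂ × ℂ =>
      (1 - ‖p.1‖ ^ 2) / ‖1 - (starRingEnd ℂ) p.2 * p.1‖ ^ 2) ?_
    exact Measurable.stronglyMeasurable (by fun_prop)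
  have h2 := h.measurable
  unfold dirichletDensity
  exact Measurable.aestronglyMeasurable (by fun_prop)

lemma integrableOn_dirichletDensity_iff (hμ : OnCircle μ) (f : ℂ → ℂ) :
    IntegrableOn (dirichletDensity μ f) disc ↔ DE μ f < ∞ := by
  have h0 : 0 ≤ᵐ[volume.restrict disc] dirichletDensity μ f :=
    (ae_restrict_iff' isOpen_disc.measurableSet).2
      (Eventually.of_forall fun z hz => dirichletDensity_nonneg f hz)
  rw [IntegrableOn, Integrable, hasFiniteIntegral_iff_ofReal h0, lintegral_dirichletDensity hμ]
  exact and_iff_right (aestronglyMeasurable_dirichletDensity f)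

lemma dirichletIntegral_eq (hμ : OnCircle μ) (f : ℂ → ℂ) :
    dirichletIntegral μ f = (1 / Real.pi) * (DE μ f).toReal := by
  have h0 : 0 ≤ᵐ[volume.restrict disc] dirichletDensity μ f :=
    (ae_restrict_iff' isOpen_disc.measurableSet).2
      (Eventually.of_forall fun z hz => dirichletDensity_nonneg f hz)
  rw [dirichletIntegral, integral_eq_lintegral_of_nonneg_ae h0
    (aestronglyMeasurable_dirichletDensity f), lintegral_dirichletDensity hμ]

end

lemma continuousOn_Dw {f : ℂ → ℂ} (hf : MemHardy2 f) : ContinuousOn (Dw f) disc := by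
  have h : ∀ w ∈ disc, Dw f w =
      ((herg (fun t => ‖bdv f t‖ ^ 2) w).re - ‖f w‖ ^ 2) / (1 - ‖w‖ ^ 2) := fun w hw => by
    rw [re_herg hf.integrable_sq hw, ← hf.Dw_mul hw,
      mul_div_cancel_right₀ _ (one_sub_norm_sq_pos hw).ne']
  refine ContinuousOn.congr ?_ h
  refine ContinuousOn.div ?_ (by fun_prop) fun w hw => (one_sub_norm_sq_pos hw).ne'
  exact (Complex.continuous_re.comp_continuousOn
    (differentiableOn_herg hf.integrable_sq).continuousOn).sub (hf.1.continuousOn.norm.pow 2)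

lemma integrable_radial {μ : Measure ℂ} [IsFiniteMeasure μ] (hμ : OnCircle μ) {u : ℂ → ℝ}
    (hu : ContinuousOn u disc) (n : ℕ) : Integrable (fun ζ => u (rn n * ζ)) μ := by
  have h1 : μ.restrict circleT = μ := Measure.restrict_eq_self_of_ae_mem (mem_ae_iff.2 hμ)
  rw [← h1]
  refine ContinuousOn.integrableOn_compact (isCompact_sphere 0 1) ?_
  refine hu.comp (by fun_prop) fun ζ hζ => ?_
  exact mul_circle_mem (rn_nonneg n) (rn_lt_one n) (mem_circleT.1 hζ)

/-- Limit of a bounded real sequence along a fixed nonprincipal ultrafilter. -/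
def ul (a : ℕ → ℝ) : ℝ := limUnder (hyperfilter ℕ : Filter ℕ) a

lemma tendsto_ul {a : ℕ → ℝ} {C : ℝ} (h : ∀ n, |a n| ≤ C) :
    Tendsto a (hyperfilter ℕ) (𝓝 (ul a)) := by
  have hK : IsCompact (Icc (-C) C) := isCompact_Icc
  obtain ⟨x, -, hx⟩ := hK.ultrafilter_le_nhds ((hyperfilter ℕ).map a) (by
    refine le_principal_iff.2 (Filter.mem_map.2 ?_)
    exact Filter.univ_mem' fun n => abs_le.1 (h n))
  exact tendsto_nhds_limUnder ⟨x, hx⟩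

lemma ul_eq {a : ℕ → ℝ} {x : ℝ} (h : Tendsto a (hyperfilter ℕ) (𝓝 x)) : ul a = x := h.limUnder_eq

/-- Averages of `Dw f` over the circles of radius `rn n`. -/
def En (μ : Measure ℂ) (f : ℂ → ℂ) (n : ℕ) : ℝ := ∫ ζ, Dw f (rn n * ζ) ∂μ

/-- An equivalent Hilbert space norm (squared) on `D(μ)`, built from `Dw`. -/
def Q (μ : Measure ℂ) (f : ℂ → ℂ) : ℝ := hardyNormSq f + ul (En μ f)

/-- The limiting mean square of `f` with respect to `μ`. -/
def bet (μ : Measure ℂ) (f : ℂ → ℂ) : ℝ := ul fun n => ∫ ζ, ‖f (rn n * ζ)‖ ^ 2 ∂μ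

lemma hardyNormSq_nonneg {f : ℂ → ℂ} (hf : MemHardy2 f) : 0 ≤ hardyNormSq f := by
  rw [hf.norm_eq]
  exact integral_nonneg fun t => by positivity

lemma hardyNormSq_quadratic {f g : ℂ → ℂ} (hf : MemHardy2 f) (hg : MemHardy2 g) (x : ℝ) :
    hardyNormSq (fun z => f z + x * g z) = hardyNormSq f +
      x * (hardyNormSq (fun z => f z + g z) - hardyNormSq f - hardyNormSq g) +
      x ^ 2 * hardyNormSq g := by
  have hfg := hf.add hg
  have hxg := hg.const_mul (x : ℂ)
  rw [(hf.add hxg).norm_eq, hf.norm_eq, hg.norm_eq, hfg.norm_eq, ← integral_sub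
    hfg.integrable_sq hf.integrable_sq]
  have h1 : Integrable (fun t => ‖bdv (fun z => f z + g z) t‖ ^ 2 - ‖bdv f t‖ ^ 2) cm :=
    hfg.integrable_sq.sub hf.integrable_sq
  have h2 : Integrable (fun t => ‖bdv (fun z => f z + g z) t‖ ^ 2 - ‖bdv f t‖ ^ 2 -
    ‖bdv g t‖ ^ 2) cm := h1.sub hg.integrable_sq
  have h3 : Integrable (fun t => ‖bdv f t‖ ^ 2 + x * (‖bdv (fun z => f z + g z) t‖ ^ 2 -
    ‖bdv f t‖ ^ 2 - ‖bdv g t‖ ^ 2)) cm := hf.integrable_sq.add (h2.const_mul x)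
  rw [← integral_sub h1 hg.integrable_sq, ← integral_const_mul, ← integral_const_mul,
    ← integral_add hf.integrable_sq (h2.const_mul x), ← integral_add h3
    (hg.integrable_sq.const_mul _)]
  refine integral_congr_ae ?_
  filter_upwards [bdv_add hf hxg, bdv_const_mul hg (x : ℂ), bdv_add hf hg] with t e1 e2 e3
  rw [e1, e2, e3]
  exact norm_add_real_mul_sq _ _ _

lemma hardyNormSq_const_mul {f : ℂ → ℂ} (hf : MemHardy2 f) (c : ℂ) :
    hardyNormSq (fun z => c * f z) = ‖c‖ ^ 2 * hardyNormSq f := by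
  rw [(hf.const_mul c).norm_eq, hf.norm_eq, ← integral_const_mul]
  refine integral_congr_ae ?_
  filter_upwards [bdv_const_mul hf c] with t e
  rw [e, norm_mul, mul_pow]

lemma hardyNormSq_id_mul {f : ℂ → ℂ} (hf : MemHardy2 f) :
    hardyNormSq (fun z => z * f z) = hardyNormSq f := by
  rw [hf.id_mul.norm_eq, hf.norm_eq]
  refine integral_congr_ae ?_
  filter_upwards [bdv_id_mul hf] with t e
  rw [e, norm_mul, norm_bpt, one_mul]

lemma MemHardy2.norm_sq_le {f : ℂ → ℂ} (hf : MemHardy2 f) {z : ℂ} (hz : z ∈ disc) :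
    ‖f z‖ ^ 2 ≤ 2 / (1 - ‖z‖) * hardyNormSq f := by
  have h1 := mem_disc.1 hz
  refine (hf.sq_le hz).trans ?_
  rw [integral_pm hz, hf.norm_eq, ← integral_const_mul]
  have h2 := hf.integrable_sq
  refine integral_mono_of_nonneg (Eventually.of_forall fun t => ?_) (h2.const_mul _)
    (Eventually.of_forall fun t => ?_)
  · exact smul_nonneg (pk_pos hz t).le (by positivity)
  · simp only [smul_eq_mul]
    refine mul_le_mul_of_nonneg_right ((pk_le hz t).trans ?_) (by positivity)
    gcongr
    linarith

section
variable {μ : Measure ℂ}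

lemma En_nonneg (hμ : OnCircle μ) (f : ℂ → ℂ) (n : ℕ) : 0 ≤ En μ f n := by
  refine integral_nonneg_of_ae ?_
  filter_upwards [ae_circle hμ] with ζ hζ
  exact Dw_nonneg f (mul_circle_mem (rn_nonneg n) (rn_lt_one n) hζ)

lemma En_congr (hμ : OnCircle μ) {f g : ℂ → ℂ} (h : ∀ z ∈ disc, f z = g z) : En μ f = En μ g := by
  funext n
  refine integral_congr_ae ?_
  filter_upwards [ae_circle hμ] with ζ hζ
  exact Dw_congr h (mul_circle_mem (rn_nonneg n) (rn_lt_one n) hζ)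

lemma Q_congr (hμ : OnCircle μ) {f g : ℂ → ℂ} (h : ∀ z ∈ disc, f z = g z) : Q μ f = Q μ g := by
  rw [Q, Q, En_congr hμ h, hardyNormSq_congr h]

end

section
variable {μ : Measure ℂ} [IsFiniteMeasure μ]

lemma integrable_Dw (hμ : OnCircle μ) {f : ℂ → ℂ} (hf : MemHardy2 f) (n : ℕ) :
    Integrable (fun ζ => Dw f (rn n * ζ)) μ := integrable_radial hμ (continuousOn_Dw hf) n

lemma integrable_norm_sq (hμ : OnCircle μ) {f : ℂ → ℂ} (hf : DifferentiableOn ℂ f disc) (n : ℕ) :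
    Integrable (fun ζ => ‖f (rn n * ζ)‖ ^ 2) μ :=
  integrable_radial hμ (u := fun z => ‖f z‖ ^ 2) (hf.continuousOn.norm.pow 2) n

lemma ofReal_En (hμ : OnCircle μ) {f : ℂ → ℂ} (hf : MemHardy2 f) (n : ℕ) :
    ENNReal.ofReal (Real.pi * En μ f n) = ∫⁻ ζ, ENNReal.ofReal (Real.pi * Dw f (rn n * ζ)) ∂μ := by
  rw [En, ← integral_const_mul, ofReal_integral_eq_lintegral_ofReal
    ((integrable_Dw hμ hf n).const_mul _)]
  filter_upwards [ae_circle hμ] with ζ hζ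
  exact mul_nonneg Real.pi_pos.le (Dw_nonneg f (mul_circle_mem (rn_nonneg n) (rn_lt_one n) hζ))

lemma ofReal_En_le (hμ : OnCircle μ) {f : ℂ → ℂ} (hf : MemHardy2 f) (n : ℕ) :
    ENNReal.ofReal (Real.pi * En μ f n) ≤ 8 * DE μ f := by
  rw [ofReal_En hμ hf, DE, ← lintegral_const_mul _ (measurable_AwE f)]
  refine lintegral_mono_ae ?_
  filter_upwards [ae_circle hμ] with ζ hζ
  exact Dw_radial_le hf hζ (rn_nonneg n) (rn_lt_one n)

lemma DE_le_liminf (hμ : OnCircle μ) {f : ℂ → ℂ} (hf : MemHardy2 f) :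
    DE μ f ≤ liminf (fun n => ENNReal.ofReal (Real.pi * En μ f n)) atTop := by
  simp_rw [ofReal_En hμ hf]
  refine le_trans ?_ (lintegral_liminf_le' fun n =>
    ((integrable_Dw hμ hf n).const_mul _).aestronglyMeasurable.aemeasurable.ennreal_ofReal)
  refine lintegral_mono_ae ?_
  filter_upwards [ae_circle hμ] with ζ hζ
  exact AwE_le_liminf hf hζ

lemma memD_of_En_le (hμ : OnCircle μ) {f : ℂ → ℂ} (hf : MemHardy2 f) {C : ℝ}
    (h : ∀ n, En μ f n ≤ C) : MemD μ f := by
  refine ⟨hf, (integrableOn_dirichletDensity_iff hμ f).2 ?_⟩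
  refine (DE_le_liminf hμ hf).trans_lt ((liminf_le_of_le (by isBoundedDefault)
    (a := ENNReal.ofReal (Real.pi * C)) fun b hb => ?_).trans_lt ENNReal.ofReal_lt_top)
  obtain ⟨n, hn⟩ := hb.exists
  exact hn.trans (ENNReal.ofReal_le_ofReal (mul_le_mul_of_nonneg_left (h n) Real.pi_pos.le))

lemma MemD.DE_lt_top (hμ : OnCircle μ) {f : ℂ → ℂ} (hf : MemD μ f) : DE μ f < ∞ :=
  (integrableOn_dirichletDensity_iff hμ f).1 hf.2

lemma MemD.En_le (hμ : OnCircle μ) {f : ℂ → ℂ} (hf : MemD μ f) (n : ℕ) :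
    En μ f n ≤ 8 * dirichletIntegral μ f := by
  have h1 := ENNReal.toReal_mono (ENNReal.mul_ne_top (by simp) (hf.DE_lt_top hμ).ne)
    (ofReal_En_le hμ hf.1 n)
  rw [ENNReal.toReal_ofReal (mul_nonneg Real.pi_pos.le (En_nonneg hμ f n)), ENNReal.toReal_mul] at h1
  rw [dirichletIntegral_eq hμ]
  have hp := Real.pi_pos
  rw [← mul_assoc, mul_one_div, div_mul_eq_mul_div, le_div_iff₀ hp]
  simp at h1
  linarith

lemma MemD.tendsto_En (hμ : OnCircle μ) {f : ℂ → ℂ} (hf : MemD μ f) :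
    Tendsto (En μ f) (hyperfilter ℕ) (𝓝 (ul (En μ f))) :=
  tendsto_ul fun n => (abs_of_nonneg (En_nonneg hμ f n)).trans_le (hf.En_le hμ n)

lemma MemD.hardyNormSq_le_Q (hμ : OnCircle μ) {f : ℂ → ℂ} (hf : MemD μ f) :
    hardyNormSq f ≤ Q μ f :=
  le_add_of_nonneg_right (ge_of_tendsto' (hf.tendsto_En hμ) fun n => En_nonneg hμ f n)

lemma MemD.Q_nonneg (hμ : OnCircle μ) {f : ℂ → ℂ} (hf : MemD μ f) : 0 ≤ Q μ f :=
  (hardyNormSq_nonneg hf.1).trans (hf.hardyNormSq_le_Q hμ)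

lemma MemD.dNormSq_le_Q (hμ : OnCircle μ) {f : ℂ → ℂ} (hf : MemD μ f) :
    dNormSq μ f ≤ Q μ f := by
  refine add_le_add_right ?_ _
  have h0 := ge_of_tendsto' (hf.tendsto_En hμ) fun n => En_nonneg hμ f n
  have h1 : DE μ f ≤ ENNReal.ofReal (Real.pi * ul (En μ f)) := by
    refine (DE_le_liminf hμ hf.1).trans ?_
    rw [← ((ENNReal.continuous_ofReal.tendsto _).comp ((hf.tendsto_En hμ).const_mul Real.pi)).liminf_eq]
    exact liminf_le_liminf_of_le Nat.hyperfilter_le_atTop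
  have h2 := ENNReal.toReal_le_of_le_ofReal (by positivity) h1
  rw [dirichletIntegral_eq hμ, one_div, inv_mul_le_iff₀ Real.pi_pos]
  exact h2

lemma MemD.Q_le (hμ : OnCircle μ) {f : ℂ → ℂ} (hf : MemD μ f) : Q μ f ≤ 8 * dNormSq μ f := by
  have h1 := le_of_tendsto' (hf.tendsto_En hμ) fun n => hf.En_le hμ n
  have h2 := hardyNormSq_nonneg hf.1
  rw [Q, dNormSq]
  linarith

lemma MemD.congr (hμ : OnCircle μ) {f g : ℂ → ℂ} (hf : MemD μ f) (h : ∀ z ∈ disc, f z = g z) :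
    MemD μ g :=
  memD_of_En_le hμ (hf.1.congr h) fun n => (congrFun (En_congr hμ h) n).symm.trans_le (hf.En_le hμ n)

lemma MemD.add (hμ : OnCircle μ) {f g : ℂ → ℂ} (hf : MemD μ f) (hg : MemD μ g) :
    MemD μ fun z => f z + g z := by
  refine memD_of_En_le hμ (hf.1.add hg.1) (C := 2 * (8 * dirichletIntegral μ f) +
    2 * (8 * dirichletIntegral μ g)) fun n => ?_
  have h1 := hf.En_le hμ n
  have h2 := hg.En_le hμ n
  have : En μ (fun z => f z + g z) n ≤ 2 * En μ f n + 2 * En μ g n := by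
    rw [En, En, En, ← integral_const_mul, ← integral_const_mul, ← integral_add
      ((integrable_Dw hμ hf.1 n).const_mul 2) ((integrable_Dw hμ hg.1 n).const_mul 2)]
    refine integral_mono_ae (integrable_Dw hμ (hf.1.add hg.1) n)
      (((integrable_Dw hμ hf.1 n).const_mul 2).add ((integrable_Dw hμ hg.1 n).const_mul 2)) ?_
    filter_upwards [ae_circle hμ] with ζ hζ
    exact Dw_add_le hf.1 hg.1 (mul_circle_mem (rn_nonneg n) (rn_lt_one n) hζ)
  linarith

lemma En_const_mul (hμ : OnCircle μ) {f : ℂ → ℂ} (hf : MemHardy2 f) (c : ℂ) (n : ℕ) :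
    En μ (fun z => c * f z) n = ‖c‖ ^ 2 * En μ f n := by
  rw [En, En, ← integral_const_mul]
  refine integral_congr_ae ?_
  filter_upwards [ae_circle hμ] with ζ hζ
  exact Dw_const_mul hf c (mul_circle_mem (rn_nonneg n) (rn_lt_one n) hζ)

lemma MemD.const_mul (hμ : OnCircle μ) {f : ℂ → ℂ} (hf : MemD μ f) (c : ℂ) :
    MemD μ fun z => c * f z := by
  refine memD_of_En_le hμ (hf.1.const_mul c) (C := ‖c‖ ^ 2 * (8 * dirichletIntegral μ f)) fun n => ?_
  rw [En_const_mul hμ hf.1]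
  exact mul_le_mul_of_nonneg_left (hf.En_le hμ n) (by positivity)

lemma MemD.sub (hμ : OnCircle μ) {f g : ℂ → ℂ} (hf : MemD μ f) (hg : MemD μ g) :
    MemD μ fun z => f z - g z :=
  (hf.add hμ (hg.const_mul hμ (-1))).congr hμ fun z _ => by ring

lemma memD_const (hμ : OnCircle μ) (c : ℂ) : MemD μ fun _ => c :=
  memD_of_En_le hμ (memHardy2_const c) (C := 0) fun n => by simp [En, Dw_const]

lemma En_id_mul (hμ : OnCircle μ) {f : ℂ → ℂ} (hf : MemHardy2 f) (n : ℕ) :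
    En μ (fun z => z * f z) n = En μ f n + ∫ ζ, ‖f (rn n * ζ)‖ ^ 2 ∂μ := by
  rw [En, En, ← integral_add (integrable_Dw hμ hf n) (integrable_norm_sq hμ hf.1 n)]
  refine integral_congr_ae ?_
  filter_upwards [ae_circle hμ] with ζ hζ
  exact Dw_id_mul hf (mul_circle_mem (rn_nonneg n) (rn_lt_one n) hζ)

lemma MemD.mean_sq_le (hμ : OnCircle μ) {f : ℂ → ℂ} (hf : MemD μ f) (n : ℕ) :
    ∫ ζ, ‖f (rn n * ζ)‖ ^ 2 ∂μ ≤
      μ.real univ * (2 * hardyNormSq f) + 8 * (8 * dirichletIntegral μ f) := by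
  have h1 := hf.En_le hμ n
  have : ∫ ζ, ‖f (rn n * ζ)‖ ^ 2 ∂μ ≤ ∫ ζ, (2 * hardyNormSq f + 8 * Dw f (rn n * ζ)) ∂μ := by
    refine integral_mono_ae (integrable_norm_sq hμ hf.1.1 n) ((integrable_const _).add
      ((integrable_Dw hμ hf.1 n).const_mul 8)) ?_
    filter_upwards [ae_circle hμ] with ζ hζ
    exact norm_sq_le_hardy_Dw hf.1 (mul_circle_mem (rn_nonneg n) (rn_lt_one n) hζ)
  rw [integral_add (integrable_const _) ((integrable_Dw hμ hf.1 n).const_mul 8), integral_const,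
    integral_const_mul, smul_eq_mul] at this
  change _ ≤ _ + 8 * En μ f n at this
  linarith

lemma MemD.id_mul (hμ : OnCircle μ) {f : ℂ → ℂ} (hf : MemD μ f) : MemD μ fun z => z * f z :=
  memD_of_En_le hμ hf.1.id_mul fun n =>
    (En_id_mul hμ hf.1 n).trans_le (add_le_add (hf.En_le hμ n) (hf.mean_sq_le hμ n))

lemma MemD.tendsto_bet (hμ : OnCircle μ) {f : ℂ → ℂ} (hf : MemD μ f) :
    Tendsto (fun n => ∫ ζ, ‖f (rn n * ζ)‖ ^ 2 ∂μ) (hyperfilter ℕ) (𝓝 (bet μ f)) :=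
  tendsto_ul fun n => (abs_of_nonneg (integral_nonneg fun ζ => by positivity)).trans_le
    (hf.mean_sq_le hμ n)

lemma MemD.bet_nonneg (hμ : OnCircle μ) {f : ℂ → ℂ} (hf : MemD μ f) : 0 ≤ bet μ f :=
  ge_of_tendsto' (hf.tendsto_bet hμ) fun n => integral_nonneg fun ζ => by positivity

lemma MemD.Q_id_mul (hμ : OnCircle μ) {f : ℂ → ℂ} (hf : MemD μ f) :
    Q μ (fun z => z * f z) = Q μ f + bet μ f := by
  rw [Q, Q, hardyNormSq_id_mul hf.1, add_assoc]
  congr 1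
  exact ul_eq (((hf.tendsto_En hμ).add (hf.tendsto_bet hμ)).congr fun n => (En_id_mul hμ hf.1 n).symm)

lemma MemD.bet_id_mul (hμ : OnCircle μ) {f : ℂ → ℂ} (hf : MemD μ f) :
    bet μ (fun z => z * f z) = bet μ f := by
  have h1 : Tendsto (fun n => rn n ^ 2) (hyperfilter ℕ) (𝓝 1) := by
    have := (tendsto_rn.mono_right nhdsWithin_le_nhds).pow 2
    rw [one_pow] at this
    exact this.mono_left Nat.hyperfilter_le_atTop
  have h2 := h1.mul (hf.tendsto_bet hμ)
  rw [one_mul] at h2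
  refine ul_eq (h2.congr fun n => ?_)
  rw [← integral_const_mul]
  refine integral_congr_ae ?_
  filter_upwards [ae_circle hμ] with ζ hζ
  rw [norm_mul, norm_mul, hζ, mul_one, Complex.norm_real, Real.norm_of_nonneg (rn_nonneg n), mul_pow]

lemma MemD.Q_const_mul (hμ : OnCircle μ) {f : ℂ → ℂ} (hf : MemD μ f) (c : ℂ) :
    Q μ (fun z => c * f z) = ‖c‖ ^ 2 * Q μ f := by
  rw [Q, Q, hardyNormSq_const_mul hf.1, mul_add]
  congr 1
  exact ul_eq (((hf.tendsto_En hμ).const_mul _).congr fun n => (En_const_mul hμ hf.1 c n).symm)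

lemma MemD.Q_quadratic (hμ : OnCircle μ) {f g : ℂ → ℂ} (hf : MemD μ f) (hg : MemD μ g) (x : ℝ) :
    Q μ (fun z => f z + x * g z) =
      Q μ f + x * (Q μ (fun z => f z + g z) - Q μ f - Q μ g) + x ^ 2 * Q μ g := by
  have hfg := hf.add hμ hg
  have hE : ∀ n, En μ (fun z => f z + x * g z) n = En μ f n +
      x * (En μ (fun z => f z + g z) n - En μ f n - En μ g n) + x ^ 2 * En μ g n := by
    intro n
    have i1 := integrable_Dw hμ hf.1 n
    have i2 := integrable_Dw hμ hg.1 n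
    have i3 := integrable_Dw hμ hfg.1 n
    have h1 : Integrable (fun ζ => Dw (fun z => f z + g z) (rn n * ζ) - Dw f (rn n * ζ)) μ :=
      i3.sub i1
    have h2 : Integrable (fun ζ => Dw (fun z => f z + g z) (rn n * ζ) - Dw f (rn n * ζ) -
      Dw g (rn n * ζ)) μ := h1.sub i2
    have h3 : Integrable (fun ζ => Dw f (rn n * ζ) + x * (Dw (fun z => f z + g z) (rn n * ζ) -
      Dw f (rn n * ζ) - Dw g (rn n * ζ))) μ := i1.add (h2.const_mul x)
    simp only [En]
    rw [← integral_sub i3 i1, ← integral_sub h1 i2, ← integral_const_mul, ← integral_const_mul,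
      ← integral_add i1 (h2.const_mul x), ← integral_add h3 (i2.const_mul _)]
    refine integral_congr_ae ?_
    filter_upwards [ae_circle hμ] with ζ hζ
    exact Dw_quadratic hf.1 hg.1 x (mul_circle_mem (rn_nonneg n) (rn_lt_one n) hζ)
  have hl := ((hf.tendsto_En hμ).add ((((hfg.tendsto_En hμ).sub (hf.tendsto_En hμ)).sub
    (hg.tendsto_En hμ)).const_mul x)).add ((hg.tendsto_En hμ).const_mul (x ^ 2))
  have := ul_eq (hl.congr fun n => (hE n).symm)
  simp only [Q]
  rw [this, hardyNormSq_quadratic hf.1 hg.1]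
  ring

lemma MemD.parallelogram (hμ : OnCircle μ) {f g : ℂ → ℂ} (hf : MemD μ f) (hg : MemD μ g) :
    Q μ (fun z => f z + g z) + Q μ (fun z => f z - g z) = 2 * Q μ f + 2 * Q μ g := by
  have h := hf.Q_quadratic hμ hg (-1)
  have e : Q μ (fun z => f z + ((-1 : ℝ) : ℂ) * g z) = Q μ (fun z => f z - g z) :=
    Q_congr hμ fun z _ => by push_cast; ring
  rw [e] at h
  linarith

lemma MemD.Q_add_le (hμ : OnCircle μ) {f g : ℂ → ℂ} (hf : MemD μ f) (hg : MemD μ g) :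
    Q μ (fun z => f z + g z) ≤ 2 * Q μ f + 2 * Q μ g := by
  linarith [hf.parallelogram hμ hg, (hf.sub hμ hg).Q_nonneg hμ]

lemma MemD.Q_sub_le (hμ : OnCircle μ) {f g : ℂ → ℂ} (hf : MemD μ f) (hg : MemD μ g) :
    Q μ (fun z => f z - g z) ≤ 2 * Q μ f + 2 * Q μ g := by
  linarith [hf.parallelogram hμ hg, (hf.add hμ hg).Q_nonneg hμ]

lemma MemD.norm_sq_le_Q (hμ : OnCircle μ) {f : ℂ → ℂ} (hf : MemD μ f) {z : ℂ} (hz : z ∈ disc) :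
    ‖f z‖ ^ 2 ≤ 2 / (1 - ‖z‖) * Q μ f := by
  have h1 := mem_disc.1 hz
  refine (hf.1.norm_sq_le hz).trans (mul_le_mul_of_nonneg_left (hf.hardyNormSq_le_Q hμ) ?_)
  exact div_nonneg zero_le_two (by linarith)

lemma MemD.tc_sq_le_Q (hμ : OnCircle μ) {f : ℂ → ℂ} (hf : MemD μ f) (n : ℕ) :
    ‖tc f n‖ ^ 2 ≤ Q μ f := (hf.1.tc_sq_le n).trans (hf.hardyNormSq_le_Q hμ)

lemma En_mono (hμ : OnCircle μ) {f g : ℂ → ℂ} (hf : MemHardy2 f) (hg : MemHardy2 g)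
    (h : ∀ w ∈ disc, Dw f w ≤ Dw g w) (n : ℕ) : En μ f n ≤ En μ g n := by
  refine integral_mono_ae (integrable_Dw hμ hf n) (integrable_Dw hμ hg n) ?_
  filter_upwards [ae_circle hμ] with ζ hζ
  exact h _ (mul_circle_mem (rn_nonneg n) (rn_lt_one n) hζ)

lemma MemD.of_Dw_le (hμ : OnCircle μ) {f g : ℂ → ℂ} (hf : MemHardy2 f) (hg : MemD μ g)
    (h : ∀ w ∈ disc, Dw f w ≤ Dw g w) : MemD μ f :=
  memD_of_En_le hμ hf fun n => (En_mono hμ hf hg.1 h n).trans (hg.En_le hμ n)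

lemma MemD.dslope (hμ : OnCircle μ) {f : ℂ → ℂ} (hf : MemD μ f) : MemD μ (dslope f 0) :=
  .of_Dw_le hμ (hf.1.dslope zero_mem_disc) hf fun w hw => by
    rw [Dw_dslope_zero hf.1 hw]
    exact le_add_of_nonneg_right (by positivity)

end

lemma hardy_radius_lsc {Y : ℕ → ℂ → ℂ} {y : ℂ → ℂ} (hY : ∀ k, DifferentiableOn ℂ (Y k) disc)
    (hy : DifferentiableOn ℂ y disc)
    (hlim : ∀ z ∈ disc, Tendsto (fun k => Y k z) atTop (𝓝 (y z))) {r : ℝ} (h0 : 0 ≤ r)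
    (h1 : r < 1) : ENNReal.ofReal (∫ t, ‖y (r * bpt t)‖ ^ 2 ∂cm) ≤
      liminf (fun k => ENNReal.ofReal (∫ t, ‖Y k (r * bpt t)‖ ^ 2 ∂cm)) atTop := by
  have key : ∀ f : ℂ → ℂ, DifferentiableOn ℂ f disc →
      ENNReal.ofReal (∫ t, ‖f (r * bpt t)‖ ^ 2 ∂cm) =
        ∫⁻ t, ENNReal.ofReal (‖f (r * bpt t)‖ ^ 2) ∂cm := fun f hf =>
    ofReal_integral_eq_lintegral_ofReal
      ((memLp_of_continuous (((continuous_dilate hf h0 h1).norm.pow 2)) 1).integrable le_rfl)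
      (Eventually.of_forall fun t => by positivity)
  rw [key y hy]
  simp_rw [fun k => key (Y k) (hY k)]
  refine le_trans (lintegral_mono fun t => ?_) (lintegral_liminf_le fun k =>
    (((continuous_dilate (hY k) h0 h1).norm.pow 2)).measurable.ennreal_ofReal)
  refine (Tendsto.liminf_eq ?_).ge
  exact (ENNReal.continuous_ofReal.tendsto _).comp
    ((hlim _ (mul_bpt_mem_disc h0 h1 t)).norm.pow 2)

lemma MemHardy2.of_tendsto {Y : ℕ → ℂ → ℂ} {y : ℂ → ℂ} (hY : ∀ k, MemHardy2 (Y k)) {C : ℝ}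
    (hC : ∀ k, hardyNormSq (Y k) ≤ C) (hy : DifferentiableOn ℂ y disc)
    (hlim : ∀ z ∈ disc, Tendsto (fun k => Y k z) atTop (𝓝 (y z))) :
    MemHardy2 y ∧ hardyNormSq y ≤ C := by
  have hC0 : 0 ≤ C := (hardyNormSq_nonneg (hY 0)).trans (hC 0)
  have : ∀ x ∈ hardySet y, x ≤ C := by
    intro x hx
    obtain ⟨r, h0, h1, rfl⟩ := mem_hardySet.1 hx
    have h2 := hardy_radius_lsc (fun k => (hY k).1) hy hlim h0.le h1
    have h3 : liminf (fun k => ENNReal.ofReal (∫ t, ‖Y k (r * bpt t)‖ ^ 2 ∂cm)) atTop ≤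
        ENNReal.ofReal C := by
      refine liminf_le_of_frequently_le' (Frequently.of_forall fun k =>
        ENNReal.ofReal_le_ofReal (le_trans ?_ (hC k)))
      exact le_csSup (hY k).2 (mem_hardySet.2 ⟨r, h0, h1, rfl⟩)
    exact (ENNReal.ofReal_le_ofReal_iff hC0).1 (h2.trans h3)
  exact ⟨⟨hy, C, this⟩, csSup_le (hardySet_nonempty y) this⟩

lemma hardyNormSq_lsc {Y : ℕ → ℂ → ℂ} {y : ℂ → ℂ} (hY : ∀ k, MemHardy2 (Y k)) (hy : MemHardy2 y)
    (hlim : ∀ z ∈ disc, Tendsto (fun k => Y k z) atTop (𝓝 (y z))) :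
    ENNReal.ofReal (hardyNormSq y) ≤
      liminf (fun k => ENNReal.ofReal (hardyNormSq (Y k))) atTop := by
  refine le_of_forall_lt fun c hc => ?_
  have hc' : c ≠ ∞ := (hc.trans_le le_top).ne
  have h1 : c.toReal < hardyNormSq y := (ENNReal.lt_ofReal_iff_toReal_lt hc').1 hc
  obtain ⟨x, hx, hcx⟩ := exists_lt_of_lt_csSup (hardySet_nonempty y) h1
  obtain ⟨r, h0, h1, rfl⟩ := mem_hardySet.1 hx
  have h2 := hardy_radius_lsc (fun k => (hY k).1) hy.1 hlim h0.le h1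
  refine lt_of_lt_of_le ((ENNReal.lt_ofReal_iff_toReal_lt hc').2 hcx) (h2.trans ?_)
  refine liminf_le_liminf (Eventually.of_forall fun k => ENNReal.ofReal_le_ofReal ?_)
  exact le_csSup (hY k).2 (mem_hardySet.2 ⟨r, h0, h1, rfl⟩)

lemma MemHardy2.hardyNormSq_sub_comp_mob {f : ℂ → ℂ} (hf : MemHardy2 f) {w : ℂ} (hw : w ∈ disc) :
    hardyNormSq (fun z => f (mob w z) - f w) = (1 - ‖w‖ ^ 2) * Dw f w := by
  have h1 : MemHardy2 fun z => f z - f w := hf.sub (memHardy2_const _)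
  have h2 := h1.hardyNormSq_comp_mob hw
  have h3 := one_sub_norm_sq_pos hw
  rw [h2, Dw, mul_div_cancel₀ _ h3.ne']
  refine integral_congr_ae ?_
  rw [EventuallyEq, ae_pm hw]
  filter_upwards [bdv_sub hf (memHardy2_const (f w))] with t ht
  rw [ht, bdv_of_continuous continuous_const]

lemma Dw_lsc {Y : ℕ → ℂ → ℂ} {y : ℂ → ℂ} (hY : ∀ k, MemHardy2 (Y k)) (hy : MemHardy2 y)
    (hlim : ∀ z ∈ disc, Tendsto (fun k => Y k z) atTop (𝓝 (y z))) {w : ℂ} (hw : w ∈ disc)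
    {c : ℝ} (hc : 0 ≤ c) :
    ENNReal.ofReal (c * Dw y w) ≤ liminf (fun k => ENNReal.ofReal (c * Dw (Y k) w)) atTop := by
  have h3 := one_sub_norm_sq_pos hw
  have key : ∀ f : ℂ → ℂ, MemHardy2 f → ENNReal.ofReal (c * Dw f w) =
      ENNReal.ofReal (c / (1 - ‖w‖ ^ 2)) *
        ENNReal.ofReal (hardyNormSq (fun z => f (mob w z) - f w)) := fun f hf => by
    rw [hf.hardyNormSq_sub_comp_mob hw, ← ENNReal.ofReal_mul (by positivity)]
    congr 1
    field_simp
  rw [key y hy]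
  simp_rw [fun k => key (Y k) (hY k)]
  have hm : ∀ f : ℂ → ℂ, MemHardy2 f → MemHardy2 fun z => f (mob w z) - f w := fun f hf =>
    (hf.comp_mob hw).sub (memHardy2_const _)
  rw [ENNReal.liminf_const_mul_of_ne_top ENNReal.ofReal_ne_top]
  gcongr
  exact hardyNormSq_lsc (fun k => hm _ (hY k)) (hm _ hy) fun z hz =>
    (hlim _ (mob_mem hw hz)).sub (hlim _ hw)

section
variable {μ : Measure ℂ} [IsFiniteMeasure μ]

lemma En_lsc (hμ : OnCircle μ) {Y : ℕ → ℂ → ℂ} {y : ℂ → ℂ} (hY : ∀ k, MemHardy2 (Y k))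
    (hy : MemHardy2 y) (hlim : ∀ z ∈ disc, Tendsto (fun k => Y k z) atTop (𝓝 (y z))) {C : ℝ}
    (n : ℕ) (hC : ∀ k, En μ (Y k) n ≤ C) : En μ y n ≤ C := by
  have hC0 : 0 ≤ C := (En_nonneg hμ _ _).trans (hC 0)
  have hπ := Real.pi_pos
  have h1 : ENNReal.ofReal (Real.pi * En μ y n) ≤
      liminf (fun k => ENNReal.ofReal (Real.pi * En μ (Y k) n)) atTop := by
    rw [ofReal_En hμ hy]
    simp_rw [fun k => ofReal_En hμ (hY k) n]
    refine le_trans (lintegral_mono_ae ?_) (lintegral_liminf_le' fun k =>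
      ((integrable_Dw hμ (hY k) n).aestronglyMeasurable.aemeasurable.const_mul _).ennreal_ofReal)
    filter_upwards [ae_circle hμ] with ζ hζ
    exact Dw_lsc hY hy hlim (mul_circle_mem (rn_nonneg n) (rn_lt_one n) hζ) hπ.le
  have h2 : liminf (fun k => ENNReal.ofReal (Real.pi * En μ (Y k) n)) atTop ≤
      ENNReal.ofReal (Real.pi * C) :=
    liminf_le_of_frequently_le' (Frequently.of_forall fun k =>
      ENNReal.ofReal_le_ofReal (mul_le_mul_of_nonneg_left (hC k) hπ.le))
  exact le_of_mul_le_mul_left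
    ((ENNReal.ofReal_le_ofReal_iff (by positivity)).1 (h1.trans h2)) hπ

lemma MemD.En_le_Q (hμ : OnCircle μ) {f : ℂ → ℂ} (hf : MemD μ f) (n : ℕ) :
    En μ f n ≤ 8 * Q μ f := by
  have h1 := hf.En_le hμ n
  have h2 := hf.dNormSq_le_Q hμ
  have h3 := hardyNormSq_nonneg hf.1
  rw [dNormSq] at h2
  linarith

lemma memD_of_En_le_Q (hμ : OnCircle μ) {f : ℂ → ℂ} (hf : MemHardy2 f) {C : ℝ}
    (h : ∀ n, En μ f n ≤ C) : MemD μ f ∧ Q μ f ≤ hardyNormSq f + C := by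
  have h1 := memD_of_En_le hμ hf h
  refine ⟨h1, add_le_add le_rfl ?_⟩
  exact le_of_tendsto (h1.tendsto_En hμ) (Eventually.of_forall h)

lemma MemD.of_tendsto (hμ : OnCircle μ) {Y : ℕ → ℂ → ℂ} {y : ℂ → ℂ} (hY : ∀ k, MemD μ (Y k))
    {C : ℝ} (hC : ∀ k, Q μ (Y k) ≤ C) (hy : DifferentiableOn ℂ y disc)
    (hlim : ∀ z ∈ disc, Tendsto (fun k => Y k z) atTop (𝓝 (y z))) :
    MemD μ y ∧ Q μ y ≤ 9 * C := by
  obtain ⟨h1, h2⟩ := MemHardy2.of_tendsto (fun k => (hY k).1)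
    (fun k => ((hY k).hardyNormSq_le_Q hμ).trans (hC k)) hy hlim
  obtain ⟨h3, h4⟩ := memD_of_En_le_Q hμ h1 (C := 8 * C) fun n =>
    En_lsc hμ (fun k => (hY k).1) h1 hlim n fun k =>
      ((hY k).En_le_Q hμ n).trans (by linarith [hC k])
  exact ⟨h3, by linarith⟩

lemma exists_limit_of_cauchy (hμ : OnCircle μ) {Y : ℕ → ℂ → ℂ} (hY : ∀ k, MemD μ (Y k))
    (h : ∀ ε > 0, ∃ N, ∀ m ≥ N, ∀ n ≥ N, Q μ (fun z => Y m z - Y n z) ≤ ε) :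
    ∃ y, MemD μ y ∧ Tendsto (fun n => Q μ fun z => y z - Y n z) atTop (𝓝 0) ∧
      ∀ z ∈ disc, Tendsto (fun n => Y n z) atTop (𝓝 (y z)) := by
  have hdist : ∀ ρ : ℝ, ρ < 1 → ∀ ε > 0, ∃ N, ∀ m ≥ N, ∀ n ≥ N, ∀ z : ℂ, ‖z‖ ≤ ρ →
      dist (Y m z) (Y n z) < ε := by
    intro ρ hρ ε hε
    have hρ' : 0 < 1 - ρ := by linarith
    obtain ⟨N, hN⟩ := h ((1 - ρ) / 2 * (ε ^ 2 / 2)) (by positivity)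
    refine ⟨N, fun m hm n hn z hz => ?_⟩
    have hzd : z ∈ disc := mem_disc.2 (hz.trans_lt hρ)
    have hs := (hY m).sub hμ (hY n)
    have h1 := hs.norm_sq_le_Q hμ hzd
    have h2 : 2 / (1 - ‖z‖) ≤ 2 / (1 - ρ) := by gcongr
    have h3 : ‖Y m z - Y n z‖ ^ 2 ≤ 2 / (1 - ρ) * ((1 - ρ) / 2 * (ε ^ 2 / 2)) :=
      h1.trans (mul_le_mul h2 (hN m hm n hn) (hs.Q_nonneg hμ) (by positivity))
    have h4 : 2 / (1 - ρ) * ((1 - ρ) / 2 * (ε ^ 2 / 2)) = ε ^ 2 / 2 := by field_simp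
    rw [dist_eq_norm]
    refine lt_of_pow_lt_pow_left₀ 2 hε.le ?_
    have : 0 < ε ^ 2 := by positivity
    linarith
  have hconv : ∀ z ∈ disc, ∃ L, Tendsto (fun n => Y n z) atTop (𝓝 L) := by
    intro z hz
    refine cauchySeq_tendsto_of_complete (Metric.cauchySeq_iff.2 fun ε hε => ?_)
    obtain ⟨N, hN⟩ := hdist ‖z‖ (mem_disc.1 hz) ε hε
    exact ⟨N, fun m hm n hn => hN m hm n hn z le_rfl⟩
  set y : ℂ → ℂ := fun z => limUnder atTop fun n => Y n z with hy_def
  have hlim : ∀ z ∈ disc, Tendsto (fun n => Y n z) atTop (𝓝 (y z)) := fun z hz =>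
    tendsto_nhds_limUnder (hconv z hz)
  have hy : DifferentiableOn ℂ y disc := by
    have : TendstoLocallyUniformlyOn Y y atTop disc := by
      rw [tendstoLocallyUniformlyOn_iff_forall_isCompact isOpen_disc]
      intro K hK hKc
      have hρ : ∃ ρ < 1, ∀ z ∈ K, ‖z‖ ≤ ρ := by
        rcases K.eq_empty_or_nonempty with rfl | hne
        · exact ⟨0, one_pos, by simp⟩
        · obtain ⟨z0, hz0, hmax⟩ := hKc.exists_isMaxOn hne continuous_norm.continuousOn
          exact ⟨‖z0‖, mem_disc.1 (hK hz0), fun z hz => hmax hz⟩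
      obtain ⟨ρ, hρ1, hρ⟩ := hρ
      refine UniformCauchySeqOn.tendstoUniformlyOn_of_tendsto ?_ fun z hz => hlim z (hK hz)
      rw [Metric.uniformCauchySeqOn_iff]
      intro ε hε
      obtain ⟨N, hN⟩ := hdist ρ hρ1 ε hε
      exact ⟨N, fun m hm n hn z hz => hN m hm n hn z (hρ z hz)⟩
    exact this.differentiableOn (Eventually.of_forall fun n => (hY n).1.1) isOpen_disc
  have hmain : ∀ ε > 0, ∃ N, ∀ n ≥ N, MemD μ (fun z => y z - Y n z) ∧
      Q μ (fun z => y z - Y n z) ≤ 9 * ε := by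
    intro ε hε
    obtain ⟨N, hN⟩ := h ε hε
    refine ⟨N, fun n hn => ?_⟩
    refine MemD.of_tendsto hμ (Y := fun k z => Y (k + N) z - Y n z)
      (fun k => (hY _).sub hμ (hY _)) (fun k => hN _ (Nat.le_add_left _ _) _ hn)
      (hy.sub (hY n).1.1) fun z hz => ?_
    exact ((tendsto_add_atTop_iff_nat N).2 (hlim z hz)).sub_const _
  refine ⟨y, ?_, ?_, hlim⟩
  · obtain ⟨N, hN⟩ := hmain 1 one_pos
    exact (((hN N le_rfl).1.add hμ (hY N))).congr hμ fun z _ => by ring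
  · rw [Metric.tendsto_atTop]
    intro ε hε
    obtain ⟨N, hN⟩ := hmain (ε / 10) (by positivity)
    refine ⟨N, fun n hn => ?_⟩
    obtain ⟨h1, h2⟩ := hN n hn
    rw [Real.dist_eq, sub_zero, abs_of_nonneg (h1.Q_nonneg hμ)]
    linarith

lemma MemD.Q_add_le_weight (hμ : OnCircle μ) {f g : ℂ → ℂ} (hf : MemD μ f) (hg : MemD μ g) {t : ℝ}
    (ht : 0 < t) : Q μ (fun z => f z + g z) ≤ (1 + t) * Q μ f + (1 + 1 / t) * Q μ g := by
  have h1 := hg.Q_quadratic hμ hf (-t)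
  have h2 : 0 ≤ Q μ (fun z => g z + ((-t : ℝ) : ℂ) * f z) :=
    (hg.add hμ (hf.const_mul hμ _)).Q_nonneg hμ
  have h3 : Q μ (fun z => g z + f z) = Q μ (fun z => f z + g z) :=
    Q_congr hμ fun z _ => add_comm _ _
  rw [h1, h3] at h2
  have h4 : t * (Q μ (fun z => f z + g z) - Q μ g - Q μ f) ≤ Q μ g + t ^ 2 * Q μ f := by
    nlinarith
  have h5 : Q μ (fun z => f z + g z) - Q μ g - Q μ f ≤ (Q μ g + t ^ 2 * Q μ f) / t := by
    rw [le_div_iff₀ ht]; linarith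
  have h6 : (Q μ g + t ^ 2 * Q μ f) / t = 1 / t * Q μ g + t * Q μ f := by field_simp
  linarith

/-- A sequence which almost minimises `Q` over decreasing midpoint-convex sets is Cauchy. -/
lemma exists_limit_of_almost_min (hμ : OnCircle μ) {S : ℕ → Set (ℂ → ℂ)} (hS : Antitone S)
    (hD : ∀ n, ∀ x ∈ S n, MemD μ x)
    (hmid : ∀ n, ∀ x ∈ S n, ∀ y ∈ S n, ∃ u ∈ S n, ∀ z ∈ disc, u z = 2⁻¹ * (x z + y z))
    {C : ℝ} (hC : ∀ n, ∃ x ∈ S n, Q μ x ≤ C) :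
    ∃ Y : ℕ → ℂ → ℂ, (∀ n, Y n ∈ S n) ∧ (∀ n, ∀ x ∈ S n, Q μ (Y n) ≤ Q μ x + 1 / (n + 1)) ∧
    ∃ y, MemD μ y ∧ Tendsto (fun n => Q μ fun z => y z - Y n z) atTop (𝓝 0) ∧
      ∀ z ∈ disc, Tendsto (fun n => Y n z) atTop (𝓝 (y z)) := by
  set d : ℕ → ℝ := fun n => sInf (Q μ '' S n) with hd
  have hbdd : ∀ n, BddBelow (Q μ '' S n) := fun n =>
    ⟨0, by rintro _ ⟨x, hx, rfl⟩; exact (hD n x hx).Q_nonneg hμ⟩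
  have hne : ∀ n, (Q μ '' S n).Nonempty := fun n =>
    let ⟨x, hx, _⟩ := hC n; ⟨_, x, hx, rfl⟩
  have hd_le : ∀ n, ∀ x ∈ S n, d n ≤ Q μ x := fun n x hx => csInf_le (hbdd n) ⟨x, hx, rfl⟩
  have hmono : Monotone d := fun m n hmn =>
    csInf_le_csInf (hbdd m) (hne n) (image_mono (hS hmn))
  have hdC : ∀ n, d n ≤ C := fun n => let ⟨x, hx, hxC⟩ := hC n; (hd_le n x hx).trans hxC
  have hpos : ∀ n : ℕ, (0:ℝ) < 1 / (n + 1) := fun n => by positivity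
  have hY : ∀ n, ∃ x ∈ S n, Q μ x < d n + 1 / (n + 1) := fun n => by
    obtain ⟨_, ⟨x, hx, rfl⟩, h⟩ := exists_lt_of_csInf_lt (hne n) (lt_add_of_pos_right (d n) (hpos n))
    exact ⟨x, hx, h⟩
  choose Y hYS hYQ using hY
  refine ⟨Y, hYS, fun n x hx => by linarith [hd_le n x hx, hYQ n], ?_⟩
  have hYD : ∀ n, MemD μ (Y n) := fun n => hD n _ (hYS n)
  have hcauchy : CauchySeq d :=
    (tendsto_atTop_ciSup hmono ⟨C, by rintro _ ⟨n, rfl⟩; exact hdC n⟩).cauchySeq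
  have hkey : ∀ n m, n ≤ m → Q μ (fun z => Y n z - Y m z) ≤
      2 * (d m - d n) + 2 / (n + 1) + 2 / (m + 1) := by
    intro n m hnm
    obtain ⟨u, hu, huz⟩ := hmid n _ (hYS n) _ (hS hnm (hYS m))
    have h1 := hd_le n u hu
    have h2 : Q μ u = 4⁻¹ * Q μ (fun z => Y n z + Y m z) := by
      rw [Q_congr hμ huz, ((hYD n).add hμ (hYD m)).Q_const_mul hμ]
      norm_num
    have h3 := (hYD n).parallelogram hμ (hYD m)
    have h4 := hYQ n
    have h5 := hYQ m
    have h6 : (2:ℝ) / (n + 1) = 2 * (1 / (n + 1)) := by ring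
    have h7 : (2:ℝ) / (m + 1) = 2 * (1 / (m + 1)) := by ring
    linarith
  refine exists_limit_of_cauchy hμ hYD fun ε hε => ?_
  obtain ⟨N1, hN1⟩ := Metric.cauchySeq_iff.1 hcauchy (ε / 4) (by positivity)
  obtain ⟨N2, hN2⟩ := exists_nat_one_div_lt (show 0 < ε / 8 by positivity)
  have hN2' : ∀ n ≥ N2, (2:ℝ) / (n + 1) ≤ ε / 4 := fun n hn => by
    have h1 : (1:ℝ) / (n + 1) ≤ 1 / (N2 + 1) := by gcongr
    have h6 : (2:ℝ) / (n + 1) = 2 * (1 / (n + 1)) := by ring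
    linarith
  have hle : ∀ n m, max N1 N2 ≤ n → n ≤ m → Q μ (fun z => Y n z - Y m z) ≤ ε := by
    intro n m hn hnm
    have h1 := hkey n m hnm
    have h2 := hN2' n ((le_max_right _ _).trans hn)
    have h3 := hN2' m (((le_max_right _ _).trans hn).trans hnm)
    have h4 := hN1 m (((le_max_left _ _).trans hn).trans hnm) n ((le_max_left _ _).trans hn)
    rw [Real.dist_eq] at h4
    have h5 := le_abs_self (d m - d n)
    linarith
  refine ⟨max N1 N2, fun m hm n hn => ?_⟩
  rcases le_total n m with hnm | hnm
  · have h1 : Q μ (fun z => Y m z - Y n z) = Q μ (fun z => Y n z - Y m z) := by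
      rw [show (fun z => Y m z - Y n z) = fun z => (-1 : ℂ) * (Y n z - Y m z) by ext z; ring,
        ((hYD n).sub hμ (hYD m)).Q_const_mul hμ]
      simp
    rw [h1]
    exact hle n m hn hnm
  · exact hle m n hm hnm

variable {M : Set (ℂ → ℂ)}

lemma ClosedInvSubspace.memD (hM : ClosedInvSubspace μ M) {f : ℂ → ℂ} (hf : f ∈ M) : MemD μ f :=
  hM.subset hf

lemma ClosedInvSubspace.mem_of_tendsto (hμ : OnCircle μ) (hM : ClosedInvSubspace μ M)
    {Y : ℕ → ℂ → ℂ} (hY : ∀ n, Y n ∈ M) {y : ℂ → ℂ} (hy : MemD μ y)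
    (h : Tendsto (fun n => Q μ fun z => y z - Y n z) atTop (𝓝 0)) : y ∈ M := by
  refine hM.closed y hy fun ε hε => ?_
  obtain ⟨n, hn⟩ := (h.eventually (gt_mem_nhds hε)).exists
  exact ⟨Y n, hY n, ((hy.sub hμ (hM.memD (hY n))).dNormSq_le_Q hμ).trans_lt hn⟩

lemma ClosedInvSubspace.congr (hμ : OnCircle μ) (hM : ClosedInvSubspace μ M) {f g : ℂ → ℂ}
    (hf : f ∈ M) (h : ∀ z ∈ disc, f z = g z) : g ∈ M := by
  have hg : MemD μ g := (hM.memD hf).congr hμ h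
  refine hM.mem_of_tendsto hμ (fun _ => hf) hg ?_
  have : Q μ (fun z => g z - f z) = 0 := by
    rw [Q_congr hμ (g := fun z => (0:ℂ) * f z) fun z hz => by rw [h z hz]; ring,
      (hM.memD hf).Q_const_mul hμ]
    simp
  simp [this]

lemma ClosedInvSubspace.sub_mem (hM : ClosedInvSubspace μ M) {f g : ℂ → ℂ} (hf : f ∈ M)
    (hg : g ∈ M) : (fun z => f z - g z) ∈ M := by
  have := hM.add_mem _ hf _ (hM.smul_mem (-1) _ hg)
  rwa [show (fun z => f z + -1 * g z) = fun z => f z - g z by ext z; ring] at this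

lemma ClosedInvSubspace.poly_mul_mem (hM : ClosedInvSubspace μ M) {f : ℂ → ℂ} (hf : f ∈ M)
    (p : Polynomial ℂ) : (fun z => p.eval z * f z) ∈ M := by
  induction p using Polynomial.induction_on' with
  | add p q hp hq =>
    simp_rw [Polynomial.eval_add, add_mul]
    exact hM.add_mem _ hp _ hq
  | monomial n a =>
    simp_rw [Polynomial.eval_monomial, mul_assoc]
    refine hM.smul_mem a _ ?_
    induction n with
    | zero => simpa using hf
    | succ n ih =>
      simp_rw [pow_succ', mul_assoc]
      exact hM.shift_mem _ ih

lemma ClosedInvSubspace.convex (hM : ClosedInvSubspace μ M) : Convex ℝ M := by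
  intro x hx y hy a b _ _ _
  have := hM.add_mem _ (hM.smul_mem a _ hx) _ (hM.smul_mem b _ hy)
  rwa [show (fun z => (a : ℂ) * x z + (b : ℂ) * y z) = a • x + b • y by ext z; simp] at this

/-- Weak compactness: a bounded sequence in a closed subspace which converges pointwise on a set
has its limit attained by an element of the subspace. -/
lemma ClosedInvSubspace.exists_weak_limit (hμ : OnCircle μ) (hM : ClosedInvSubspace μ M)
    {h : ℕ → ℂ → ℂ} (hh : ∀ k, h k ∈ M) {C : ℝ} (hC : ∀ k, Q μ (h k) ≤ C) {E : Set ℂ}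
    (hE : E ⊆ disc) {l : ℂ → ℂ} (hl : ∀ z ∈ E, Tendsto (fun k => h k z) atTop (𝓝 (l z))) :
    ∃ y ∈ M, ∀ z ∈ E, y z = l z := by
  set S : ℕ → Set (ℂ → ℂ) := fun n => convexHull ℝ (h '' Ici n)
  have hSM : ∀ n, S n ⊆ M := fun n => convexHull_min (by rintro _ ⟨k, -, rfl⟩; exact hh k) hM.convex
  obtain ⟨Y, hYS, -, y, hyD, hyQ, hlim⟩ := exists_limit_of_almost_min hμ (S := S) (C := C)
    (fun m n hmn => convexHull_mono (image_mono (Ici_subset_Ici.2 hmn)))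
    (fun n x hx => hM.memD (hSM n hx))
    (fun n x hx y hy => ⟨_, (convex_convexHull ℝ _) hx hy (a := 2⁻¹) (b := 2⁻¹) (by norm_num)
      (by norm_num) (by norm_num), fun z _ => by simp; ring⟩)
    (fun n => ⟨h n, subset_convexHull ℝ _ ⟨n, self_mem_Ici, rfl⟩, hC n⟩)
  refine ⟨y, hM.mem_of_tendsto hμ (fun n => hSM n (hYS n)) hyD hyQ, fun z hz => ?_⟩
  refine tendsto_nhds_unique (hlim z (hE hz)) ?_
  rw [Metric.tendsto_atTop]
  intro ε hε
  obtain ⟨N, hN⟩ := Metric.tendsto_atTop.1 (hl z hz) ε hε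
  refine ⟨N, fun n hn => ?_⟩
  have hconv : Convex ℝ {x : ℂ → ℂ | x z ∈ ball (l z) ε} :=
    (convex_ball (l z) ε).is_linear_preimage (f := fun x : ℂ → ℂ => x z)
      ⟨fun _ _ => rfl, fun _ _ => rfl⟩
  have : S n ⊆ {x : ℂ → ℂ | x z ∈ ball (l z) ε} := by
    refine convexHull_min ?_ hconv
    rintro _ ⟨k, hk, rfl⟩
    exact hN k (hn.trans hk)
  exact this (hYS n)
end

lemma hardyNormSq_add_le {f g : ℂ → ℂ} (hf : MemHardy2 f) (hg : MemHardy2 g) :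
    hardyNormSq (fun z => f z + g z) ≤ 2 * hardyNormSq f + 2 * hardyNormSq g := by
  have h1 := hardyNormSq_quadratic hf hg (-1)
  have h2 := hardyNormSq_nonneg (hf.add (hg.const_mul ((-1 : ℝ) : ℂ)))
  rw [h1] at h2
  linarith

lemma differentiableOn_dilate {f : ℂ → ℂ} (hf : DifferentiableOn ℂ f disc) {r : ℝ} (h0 : 0 ≤ r)
    (h1 : r < 1) : DifferentiableOn ℂ (fun z => f (r * z)) disc :=
  (diffContOnCl_dilate hf h0 h1).differentiableOn

lemma MemHardy2.dilate_aux {f : ℂ → ℂ} (hf : MemHardy2 f) {r : ℝ} (h0 : 0 < r) (h1 : r < 1) :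
    ∀ x ∈ hardySet (fun z => f (r * z)), x ≤ hardyNormSq f := by
  intro x hx
  obtain ⟨s, hs0, hs1, rfl⟩ := mem_hardySet.1 hx
  refine le_csSup hf.2 (mem_hardySet.2 ⟨r * s, by positivity, by nlinarith, ?_⟩)
  simp only [ofReal_mul, mul_assoc]

lemma MemHardy2.dilate {f : ℂ → ℂ} (hf : MemHardy2 f) {r : ℝ} (h0 : 0 < r) (h1 : r < 1) :
    MemHardy2 fun z => f (r * z) :=
  ⟨differentiableOn_dilate hf.1 h0.le h1, _, hf.dilate_aux h0 h1⟩

lemma MemHardy2.hardyNormSq_dilate_le {f : ℂ → ℂ} (hf : MemHardy2 f) {r : ℝ} (h0 : 0 < r)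
    (h1 : r < 1) : hardyNormSq (fun z => f (r * z)) ≤ hardyNormSq f :=
  csSup_le (hardySet_nonempty _) (hf.dilate_aux h0 h1)

lemma MemHardy2.Dw_le {f : ℂ → ℂ} (hf : MemHardy2 f) {w : ℂ} (hw : w ∈ disc) :
    Dw f w ≤ hardyNormSq f / (1 - ‖w‖) ^ 2 := by
  have h1 := hf.Dw_mul hw
  have h2 := one_sub_norm_sq_pos hw
  have h3 : 0 < 1 - ‖w‖ := by linarith [mem_disc.1 hw]
  have h4 : ∫ t, ‖bdv f t‖ ^ 2 ∂(pm w) ≤ (1 + ‖w‖) / (1 - ‖w‖) * hardyNormSq f := by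
    rw [integral_pm hw, hf.norm_eq, ← integral_const_mul]
    refine integral_mono_of_nonneg (Eventually.of_forall fun t => ?_)
      (hf.integrable_sq.const_mul _) (Eventually.of_forall fun t => ?_)
    · exact smul_nonneg (pk_pos hw t).le (by positivity)
    · exact mul_le_mul_of_nonneg_right (pk_le hw t) (by positivity)
  have h5 : Dw f w * (1 - ‖w‖ ^ 2) ≤ (1 + ‖w‖) / (1 - ‖w‖) * hardyNormSq f := by
    have : 0 ≤ ‖f w‖ ^ 2 := by positivity
    linarith
  have h6 : Dw f w ≤ (1 + ‖w‖) / (1 - ‖w‖) * hardyNormSq f / (1 - ‖w‖ ^ 2) := by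
    rwa [le_div_iff₀ h2]
  refine h6.trans_eq ?_
  have h7 : 1 - ‖w‖ ^ 2 = (1 - ‖w‖) * (1 + ‖w‖) := by ring
  have h8 : 0 < 1 + ‖w‖ := by positivity
  rw [h7]
  field_simp

lemma Dw_dilate_le {h : ℂ → ℂ} (hh : MemHardy2 h) {r : ℝ} (h0 : 0 < r) (h1 : r < 1) {w : ℂ}
    (hw : w ∈ disc) : Dw (fun z => h (r * z)) w ≤ 4 * Dw h w := by
  have hrw : (r : ℂ) * w ∈ disc := mul_mem_disc h0.le h1 hw
  set q := dslope h w with hq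
  have hqH : MemHardy2 q := hh.dslope hw
  set s := dslope q (r * w) with hs
  have hsH : MemHardy2 s := hqH.dslope hrw
  set k : ℂ → ℂ := fun z => r * q (r * z) + -((1 - r : ℝ) * w * r) * s (r * z) with hk
  have hkH : MemHardy2 k := ((hqH.dilate h0 h1).const_mul _).add ((hsH.dilate h0 h1).const_mul _)
  have hid : ∀ z, h (r * z) = h (r * w) + (z - w) * k z := by
    intro z
    have e1 := sub_mul_dslope h w (r * z)
    have e2 := sub_mul_dslope h w (r * w)
    have e3 := sub_mul_dslope q (r * w) (r * z)
    rw [← hq] at e1 e2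
    rw [← hs] at e3
    rw [e1, e2]
    simp only [hk]
    push_cast
    linear_combination ((r : ℂ) - 1) * w * e3
  have hslope : ∀ z ∈ disc, dslope (fun z => h (r * z)) w z = k z := by
    have h2 : ∀ z, z ≠ w → dslope (fun z => h (r * z)) w z = k z := by
      intro z hz
      have e1 := sub_mul_dslope (fun z => h (r * z)) w z
      rw [hid z] at e1
      exact (mul_left_cancel₀ (sub_ne_zero.2 hz) (by linear_combination e1)).symm
    intro z hz
    rcases eq_or_ne z w with rfl | hne
    · have hd := differentiableOn_dslope_disc (differentiableOn_dilate hh.1 h0.le h1) hw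
      refine tendsto_nhds_unique
        ((hd.continuousOn.continuousAt (disc_mem_nhds hw)).tendsto.mono_left
          (nhdsWithin_le_nhds (s := {z}ᶜ))) ?_
      refine (((hkH.1.continuousOn.continuousAt (disc_mem_nhds hw)).tendsto.mono_left
          (nhdsWithin_le_nhds (s := {z}ᶜ)))).congr' ?_
      filter_upwards [self_mem_nhdsWithin] with x hx
      exact (h2 x hx).symm
    · exact h2 z hne
  rw [← (hh.dilate h0 h1).hardyNormSq_dslope hw, hardyNormSq_congr hslope]
  have a1 := hardyNormSq_add_le ((hqH.dilate h0 h1).const_mul (r : ℂ))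
    ((hsH.dilate h0 h1).const_mul (-((1 - r : ℝ) * w * r)))
  rw [hardyNormSq_const_mul (hqH.dilate h0 h1), hardyNormSq_const_mul (hsH.dilate h0 h1)] at a1
  have a2 := hqH.hardyNormSq_dilate_le h0 h1
  have a3 := hsH.hardyNormSq_dilate_le h0 h1
  have a4 : hardyNormSq s ≤ hardyNormSq q / (1 - r) ^ 2 := by
    rw [hqH.hardyNormSq_dslope hrw]
    refine (hqH.Dw_le hrw).trans ?_
    have hle : ‖(r : ℂ) * w‖ ≤ r := by
      rw [norm_mul, norm_real, Real.norm_of_nonneg h0.le]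
      exact mul_le_of_le_one_right h0.le (mem_disc.1 hw).le
    have h5 : 0 < 1 - r := by linarith
    have h6 := hardyNormSq_nonneg hqH
    gcongr
  have a5 : hardyNormSq q = Dw h w := hh.hardyNormSq_dslope hw
  have a6 := hardyNormSq_nonneg hqH
  have b1 : ‖(r : ℂ)‖ ^ 2 ≤ 1 := by
    rw [norm_real, Real.norm_of_nonneg h0.le]; nlinarith
  have b2 : ‖-(((1 - r : ℝ) : ℂ) * w * r)‖ ^ 2 ≤ (1 - r) ^ 2 := by
    have h5 : 0 < 1 - r := by linarith
    rw [norm_neg, norm_mul, norm_mul, norm_real, norm_real, Real.norm_of_nonneg h0.le,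
      Real.norm_of_nonneg h5.le]
    have hw' := (mem_disc.1 hw).le
    have : (1 - r) * ‖w‖ * r ≤ (1 - r) * 1 * 1 := by gcongr
    refine pow_le_pow_left₀ (by positivity) (this.trans_eq (by ring)) 2
  have h5 : 0 < (1 - r) ^ 2 := by have : 0 < 1 - r := by linarith
                                  positivity
  have c1 : ‖(r : ℂ)‖ ^ 2 * hardyNormSq (fun z => q (r * z)) ≤ 1 * hardyNormSq q :=
    mul_le_mul b1 a2 (hardyNormSq_nonneg (hqH.dilate h0 h1)) one_pos.le
  have c2 : ‖-(((1 - r : ℝ) : ℂ) * w * r)‖ ^ 2 * hardyNormSq (fun z => s (r * z)) ≤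
      (1 - r) ^ 2 * (hardyNormSq q / (1 - r) ^ 2) :=
    mul_le_mul b2 (a3.trans a4) (hardyNormSq_nonneg (hsH.dilate h0 h1)) h5.le
  rw [mul_div_cancel₀ _ h5.ne'] at c2
  linarith

lemma norm_pow_sub_pow_le {z w : ℂ} (hz : ‖z‖ ≤ 1) (hw : ‖w‖ ≤ 1) (n : ℕ) :
    ‖z ^ n - w ^ n‖ ≤ n * ‖z - w‖ := by
  induction n with
  | zero => simp
  | succ n ih =>
    have : z ^ (n + 1) - w ^ (n + 1) = z * (z ^ n - w ^ n) + (z - w) * w ^ n := by ring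
    rw [this]
    refine (norm_add_le _ _).trans ?_
    rw [norm_mul, norm_mul, norm_pow]
    have h1 : ‖z‖ * ‖z ^ n - w ^ n‖ ≤ 1 * (n * ‖z - w‖) := by gcongr
    have h2 : ‖z - w‖ * ‖w‖ ^ n ≤ ‖z - w‖ * 1 := by
      gcongr; exact pow_le_one₀ (norm_nonneg _) hw
    push_cast
    linarith

lemma memHardy2_poly (p : Polynomial ℂ) : MemHardy2 fun z => p.eval z := by
  refine MemHinf.memHardy2 ⟨p.differentiable.differentiableOn, ?_⟩
  obtain ⟨C, hC⟩ := (isCompact_closedBall (0:ℂ) 1).exists_bound_of_continuousOn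
    p.continuous.continuousOn
  exact ⟨C, fun z hz => hC z (ball_subset_closedBall hz)⟩

/-- Uniform polynomial approximation of a dilation, with small Lipschitz error. -/
lemma exists_poly_approx_dilate {h : ℂ → ℂ} (hh : MemHardy2 h) {r : ℝ} (h0 : 0 < r) (h1 : r < 1)
    {ε : ℝ} (hε : 0 < ε) : ∃ p : Polynomial ℂ, (∀ z ∈ disc, ‖h (r * z) - p.eval z‖ ≤ ε) ∧
      ∀ z ∈ disc, ∀ w ∈ disc,
        ‖(h (r * z) - p.eval z) - (h (r * w) - p.eval w)‖ ≤ ε * ‖z - w‖ := by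
  set a : ℕ → ℂ := fun n => tc h n * (r : ℂ) ^ n with ha
  have hsum : ∀ z ∈ disc, HasSum (fun n => a n * z ^ n) (h (r * z)) := fun z hz => by
    have := hasSum_tc hh.1 (mul_mem_disc h0.le h1 hz)
    simpa only [ha, mul_pow, mul_assoc] using this
  set c : ℕ → ℝ := fun n => (n + 1) * ‖a n‖ with hc
  have hcs : Summable c := by
    have hA : ∀ n, ‖tc h n‖ ≤ √(hardyNormSq h) := fun n => Real.le_sqrt_of_sq_le (hh.tc_sq_le n)
    have hr : ‖r‖ < 1 := by rwa [Real.norm_of_nonneg h0.le]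
    have s1 := (summable_pow_mul_geometric_of_norm_lt_one 1 hr).add
      (summable_geometric_of_norm_lt_one hr)
    refine Summable.of_nonneg_of_le (fun n => by positivity) (fun n => ?_)
      (s1.mul_left (√(hardyNormSq h)))
    have : ‖a n‖ = ‖tc h n‖ * r ^ n := by
      simp [ha, norm_pow, abs_of_nonneg h0.le]
    simp only [hc]
    rw [this]
    have h3 : ((n:ℝ) + 1) * (‖tc h n‖ * r ^ n) ≤ ((n:ℝ) + 1) * (√(hardyNormSq h) * r ^ n) := by
      gcongr; exact hA n
    refine h3.trans_eq ?_
    ring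
  obtain ⟨N, hN⟩ := ((tendsto_sum_nat_add c).eventually (gt_mem_nhds hε)).exists
  set p : Polynomial ℂ := ∑ n ∈ Finset.range N, Polynomial.monomial n (a n) with hp
  have hpe : ∀ z, p.eval z = ∑ n ∈ Finset.range N, a n * z ^ n := fun z => by
    simp [hp, Polynomial.eval_finsetSum, Polynomial.eval_monomial]
  have htail : ∀ z ∈ disc, HasSum (fun n => a (n + N) * z ^ (n + N)) (h (r * z) - p.eval z) :=
    fun z hz => by
      rw [hpe]
      exact (hasSum_nat_add_iff' N).2 (hsum z hz)
  have hcN : HasSum (fun n => c (n + N)) (∑' n, c (n + N)) :=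
    ((summable_nat_add_iff N).2 hcs).hasSum
  refine ⟨p, fun z hz => ?_, fun z hz w hw => ?_⟩
  · rw [← (htail z hz).tsum_eq]
    refine (tsum_of_norm_bounded hcN fun n => ?_).trans hN.le
    rw [norm_mul, norm_pow]
    have h3 : ‖z‖ ^ (n + N) ≤ 1 := pow_le_one₀ (norm_nonneg _) (mem_disc.1 hz).le
    have h4 : (1:ℝ) ≤ ((n + N : ℕ) : ℝ) + 1 := by
      have : (0:ℝ) ≤ ((n + N : ℕ) : ℝ) := by positivity
      linarith
    have h5 := norm_nonneg (a (n + N))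
    calc ‖a (n + N)‖ * ‖z‖ ^ (n + N) ≤ ‖a (n + N)‖ * 1 := by gcongr
      _ ≤ c (n + N) := by simp only [hc]; nlinarith
  · have hdiff := (htail z hz).sub (htail w hw)
    rw [← hdiff.tsum_eq]
    refine (tsum_of_norm_bounded (hcN.mul_right ‖z - w‖) fun n => ?_).trans
      (mul_le_mul_of_nonneg_right hN.le (norm_nonneg _))
    rw [← mul_sub, norm_mul]
    have h3 := norm_pow_sub_pow_le (mem_disc.1 hz).le (mem_disc.1 hw).le (n + N)
    have h5 := norm_nonneg (a (n + N))
    calc ‖a (n + N)‖ * ‖z ^ (n + N) - w ^ (n + N)‖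
        ≤ ‖a (n + N)‖ * (((n + N : ℕ) : ℝ) * ‖z - w‖) := by gcongr
      _ ≤ c (n + N) * ‖z - w‖ := by
        simp only [hc]
        nlinarith [mul_nonneg h5 (norm_nonneg (z - w))]

lemma tendsto_dilate_rn {f : ℂ → ℂ} (hf : DifferentiableOn ℂ f disc) {w : ℂ} (hw : w ∈ disc) :
    Tendsto (fun n => f (rn n * w)) atTop (𝓝 (f w)) :=
  (tendsto_dilate_at hf hw).comp tendsto_rn

lemma rn_pos (n : ℕ) : 0 < rn n := by
  have : ((1:ℝ) / 2) ^ (n + 1) < 1 := pow_lt_one₀ (by norm_num) (by norm_num) (by omega)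
  simp only [rn]; linarith

/-- Polynomial approximation with uniform control of `Dw`. -/
lemma MemHardy2.exists_poly {h : ℂ → ℂ} (hh : MemHardy2 h) : ∃ q : ℕ → Polynomial ℂ,
    (∀ z ∈ disc, Tendsto (fun j => (q j).eval z) atTop (𝓝 (h z))) ∧
    (∀ j, ∀ w ∈ disc, Dw (fun z => (q j).eval z) w ≤ 8 * Dw h w + 2) ∧
    (∀ j, hardyNormSq (fun z => (q j).eval z) ≤ 2 * hardyNormSq h + 2) ∧
    ∀ C, (∀ z ∈ disc, ‖h z‖ ≤ C) → ∀ j, ∀ z ∈ disc, ‖(q j).eval z‖ ≤ C + 1 := by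
  have hpos : ∀ j : ℕ, (0:ℝ) < 1 / (j + 1) := fun j => by positivity
  have hle : ∀ j : ℕ, (1:ℝ) / (j + 1) ≤ 1 := fun j => by
    rw [div_le_one (by positivity)]; have : (0:ℝ) ≤ j := by positivity
    linarith
  choose q hq1 hq2 using fun j => exists_poly_approx_dilate hh (rn_pos j) (rn_lt_one j) (hpos j)
  have hd := fun j => hh.dilate (rn_pos j) (rn_lt_one j)
  have he : ∀ j, MemHardy2 fun z => h (rn j * z) - (q j).eval z := fun j =>
    (hd j).sub (memHardy2_poly _)
  have heq : ∀ j z, (q j).eval z = h (rn j * z) + (-1) * (h (rn j * z) - (q j).eval z) :=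
    fun j z => by ring
  refine ⟨q, fun z hz => ?_, fun j w hw => ?_, fun j => ?_, fun C hC j z hz => ?_⟩
  · have h1 := tendsto_dilate_rn hh.1 hz
    have h2 : Tendsto (fun j => h (rn j * z) - (q j).eval z) atTop (𝓝 0) :=
      squeeze_zero_norm (fun j => hq1 j z hz) tendsto_one_div_add_atTop_nhds_zero_nat
    simpa using h1.sub h2
  · rw [funext (heq j)]
    refine (Dw_add_le (hd j) ((he j).const_mul (-1)) hw).trans ?_
    rw [Dw_const_mul (he j) _ hw]
    have h1 := Dw_dilate_le hh (rn_pos j) (rn_lt_one j) hw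
    have h2 := Dw_le_of_lipschitz (he j) hw fun z hz => hq2 j z hz w hw
    have h3 : ((1:ℝ) / (j + 1)) ^ 2 ≤ 1 := pow_le_one₀ (hpos j).le (hle j)
    norm_num
    simp only [one_div] at h2 h3
    linarith
  · rw [funext (heq j)]
    refine (hardyNormSq_add_le (hd j) ((he j).const_mul (-1))).trans ?_
    rw [hardyNormSq_const_mul (he j)]
    have h1 := hh.hardyNormSq_dilate_le (rn_pos j) (rn_lt_one j)
    have h2 : hardyNormSq (fun z => h (rn j * z) - (q j).eval z) ≤ 1 := by
      refine csSup_le (hardySet_nonempty _) fun x hx => ?_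
      obtain ⟨s, hs0, hs1, rfl⟩ := mem_hardySet.1 hx
      have : ∫ t, ‖h (rn j * (s * bpt t)) - (q j).eval (s * bpt t)‖ ^ 2 ∂cm ≤ ∫ _, (1:ℝ) ∂cm := by
        refine integral_mono_of_nonneg (Eventually.of_forall fun t => by positivity)
          (integrable_const _) (Eventually.of_forall fun t => ?_)
        exact pow_le_one₀ (norm_nonneg _)
          ((hq1 j _ (mul_bpt_mem_disc hs0.le hs1 t)).trans (hle j))
      simpa using this
    norm_num
    linarith
  · have h1 := hC _ (mul_mem_disc (rn_nonneg j) (rn_lt_one j) hz)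
    have h2 := hq1 j z hz
    calc ‖(q j).eval z‖ = ‖h (rn j * z) - (h (rn j * z) - (q j).eval z)‖ := by congr 1; ring
      _ ≤ C + 1 := (norm_sub_le _ _).trans (add_le_add h1 (h2.trans (hle j)))

lemma Dw_mul_le {f g : ℂ → ℂ} (hf : MemHardy2 f) (hg : MemHinf g) {C : ℝ}
    (hC : ∀ z ∈ disc, ‖g z‖ ≤ C) {w : ℂ} (hw : w ∈ disc) :
    Dw (fun z => g z * f z) w ≤ 2 * C ^ 2 * Dw f w + 2 * (‖f w‖ ^ 2 * Dw g w) := by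
  have hg2 := hg.memHardy2
  have h3 := one_sub_norm_sq_pos hw
  have i1 := hf.integrable_sub_sq (f w) hw
  have i2 := hg2.integrable_sub_sq (g w) hw
  have key : ∫ t, ‖bdv (fun z => g z * f z) t - g w * f w‖ ^ 2 ∂(pm w) ≤
      ∫ t, (2 * C ^ 2 * ‖bdv f t - f w‖ ^ 2 + 2 * ‖f w‖ ^ 2 * ‖bdv g t - g w‖ ^ 2) ∂(pm w) := by
    refine integral_mono_of_nonneg (Eventually.of_forall fun t => by positivity)
      ((i1.const_mul _).add (i2.const_mul _)) ?_
    rw [EventuallyLE, ae_pm hw]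
    filter_upwards [bdv_mul hg2 hf, norm_bdv_le hg2 hC] with t h1 h2
    rw [h1, show bdv g t * bdv f t - g w * f w =
      bdv g t * (bdv f t - f w) + f w * (bdv g t - g w) by ring]
    have h4 : ‖bdv g t * (bdv f t - f w) + f w * (bdv g t - g w)‖ ≤
        C * ‖bdv f t - f w‖ + ‖f w‖ * ‖bdv g t - g w‖ := by
      refine (norm_add_le _ _).trans ?_
      rw [norm_mul, norm_mul]
      gcongr
    refine (pow_le_pow_left₀ (norm_nonneg _) h4 2).trans ?_
    nlinarith [sq_nonneg (C * ‖bdv f t - f w‖ - ‖f w‖ * ‖bdv g t - g w‖)]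
  rw [integral_add (i1.const_mul _) (i2.const_mul _), integral_const_mul, integral_const_mul] at key
  unfold Dw
  rw [div_le_iff₀ h3]
  refine key.trans_eq ?_
  field_simp

lemma norm_sq_mul_Dw_le {f g : ℂ → ℂ} (hf : MemHardy2 f) (hg : MemHinf g) {C : ℝ}
    (hC : ∀ z ∈ disc, ‖g z‖ ≤ C) {w : ℂ} (hw : w ∈ disc) :
    ‖f w‖ ^ 2 * Dw g w ≤ 2 * Dw (fun z => g z * f z) w + 2 * C ^ 2 * Dw f w := by
  have hg2 := hg.memHardy2
  have h3 := one_sub_norm_sq_pos hw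
  have hgf : MemHardy2 fun z => g z * f z := hf.bdd_mul hg.1 hC
  have i1 := hf.integrable_sub_sq (f w) hw
  have i2 := hgf.integrable_sub_sq (g w * f w) hw
  have key : ∫ t, ‖f w‖ ^ 2 * ‖bdv g t - g w‖ ^ 2 ∂(pm w) ≤
      ∫ t, (2 * ‖bdv (fun z => g z * f z) t - g w * f w‖ ^ 2 +
        2 * C ^ 2 * ‖bdv f t - f w‖ ^ 2) ∂(pm w) := by
    refine integral_mono_of_nonneg (Eventually.of_forall fun t => by positivity)
      ((i2.const_mul _).add (i1.const_mul _)) ?_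
    rw [EventuallyLE, ae_pm hw]
    filter_upwards [bdv_mul hg2 hf, norm_bdv_le hg2 hC] with t h1 h2
    rw [h1, ← mul_pow, ← norm_mul, show f w * (bdv g t - g w) =
      (bdv g t * bdv f t - g w * f w) - bdv g t * (bdv f t - f w) by ring]
    have h4 : ‖(bdv g t * bdv f t - g w * f w) - bdv g t * (bdv f t - f w)‖ ≤
        ‖bdv g t * bdv f t - g w * f w‖ + C * ‖bdv f t - f w‖ := by
      refine (norm_sub_le _ _).trans ?_
      rw [norm_mul (bdv g t)]
      gcongr
    refine (pow_le_pow_left₀ (norm_nonneg _) h4 2).trans ?_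
    nlinarith [sq_nonneg (‖bdv g t * bdv f t - g w * f w‖ - C * ‖bdv f t - f w‖)]
  rw [integral_add (i2.const_mul _) (i1.const_mul _), integral_const_mul, integral_const_mul,
    integral_const_mul] at key
  unfold Dw
  rw [← mul_div_assoc, div_le_iff₀ h3]
  refine key.trans_eq ?_
  field_simp

section
variable {μ : Measure ℂ} [IsFiniteMeasure μ]

lemma En_le_of_Dw_le (hμ : OnCircle μ) {F G H K : ℂ → ℂ} (hF : MemHardy2 F) (hG : MemHardy2 G)
    (hH : MemHardy2 H) (hK : DifferentiableOn ℂ K disc) {a b c : ℝ}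
    (h : ∀ w ∈ disc, Dw F w ≤ a * Dw G w + b * Dw H w + c * ‖K w‖ ^ 2) (n : ℕ) :
    En μ F n ≤ a * En μ G n + b * En μ H n + c * ∫ ζ, ‖K (rn n * ζ)‖ ^ 2 ∂μ := by
  have i1 := (integrable_Dw hμ hG n).const_mul a
  have i2 := (integrable_Dw hμ hH n).const_mul b
  have i3 := (integrable_norm_sq hμ hK n).const_mul c
  have i12 : Integrable (fun ζ => a * Dw G (rn n * ζ) + b * Dw H (rn n * ζ)) μ := i1.add i2
  unfold En
  rw [← integral_const_mul, ← integral_const_mul, ← integral_const_mul, ← integral_add i1 i2,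
    ← integral_add i12 i3]
  refine integral_mono_ae (integrable_Dw hμ hF n) (i12.add i3) ?_
  filter_upwards [ae_circle hμ] with ζ hζ
  exact h _ (mul_circle_mem (rn_nonneg n) (rn_lt_one n) hζ)

/-- A pointwise bound on `Dw` gives membership in `D(μ)` and a bound on the norm. -/
lemma exists_Q_bound (hμ : OnCircle μ) {G H K : ℂ → ℂ} (hG : MemD μ G) (hH : MemD μ H)
    (hK : MemD μ K) {a b c : ℝ} (ha : 0 ≤ a) (hb : 0 ≤ b) (hc : 0 ≤ c) :
    ∃ B, ∀ F, MemHardy2 F →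
      (∀ w ∈ disc, Dw F w ≤ a * Dw G w + b * Dw H w + c * ‖K w‖ ^ 2) →
      MemD μ F ∧ Q μ F ≤ hardyNormSq F + B := by
  refine ⟨a * (8 * dirichletIntegral μ G) + b * (8 * dirichletIntegral μ H) +
    c * (μ.real univ * (2 * hardyNormSq K) + 8 * (8 * dirichletIntegral μ K)), fun F hF h => ?_⟩
  refine memD_of_En_le_Q hμ hF fun n => ?_
  refine (En_le_of_Dw_le hμ hF hG.1 hH.1 hK.1.1 h n).trans ?_
  have h1 := hG.En_le hμ n
  have h2 := hH.En_le hμ n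
  have h3 := hK.mean_sq_le hμ n
  gcongr

lemma hardyNormSq_bdd_mul_le {f g : ℂ → ℂ} (hf : MemHardy2 f) (hg : MemHinf g) {C : ℝ}
    (hC : ∀ z ∈ disc, ‖g z‖ ≤ C) : hardyNormSq (fun z => g z * f z) ≤ C ^ 2 * hardyNormSq f := by
  rw [(hf.bdd_mul hg.1 hC).norm_eq, hf.norm_eq, ← integral_const_mul]
  refine integral_mono_of_nonneg (Eventually.of_forall fun t => by positivity)
    (hf.integrable_sq.const_mul _) ?_
  filter_upwards [bdv_mul hg.memHardy2 hf, norm_bdv_le hg.memHardy2 hC] with t h1 h2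
  rw [h1, norm_mul, mul_pow]
  gcongr

lemma memHinf_poly (p : Polynomial ℂ) : MemHinf fun z => p.eval z := by
  refine ⟨p.differentiable.differentiableOn, ?_⟩
  obtain ⟨C, hC⟩ := (isCompact_closedBall (0:ℂ) 1).exists_bound_of_continuousOn
    p.continuous.continuousOn
  exact ⟨C, fun z hz => hC z (ball_subset_closedBall hz)⟩

variable {M : Set (ℂ → ℂ)}

/-- A closed invariant subspace absorbs bounded multiples which stay in `D(μ)`. -/
lemma ClosedInvSubspace.bdd_mul_mem (hμ : OnCircle μ) (hM : ClosedInvSubspace μ M) {f h : ℂ → ℂ}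
    (hf : f ∈ M) (hh : MemHinf h) (hhf : MemD μ fun z => h z * f z) :
    (fun z => h z * f z) ∈ M := by
  have hfD := hM.memD hf
  obtain ⟨C, hC⟩ := hh.2
  have hC0 : 0 ≤ C := (norm_nonneg _).trans (hC 0 zero_mem_disc)
  obtain ⟨q, hq1, hq2, -, hq4⟩ := hh.memHardy2.exists_poly
  replace hq4 := hq4 C hC
  have hb : ∀ j, ∀ w ∈ disc, Dw (fun z => (q j).eval z * f z) w ≤
      (2 * (C + 1) ^ 2 + 32 * C ^ 2) * Dw f w + 32 * Dw (fun z => h z * f z) w +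
        4 * ‖f w‖ ^ 2 := by
    intro j w hw
    have h1 := Dw_mul_le hfD.1 (memHinf_poly (q j)) (hq4 j) hw
    have h2 := norm_sq_mul_Dw_le hfD.1 hh hC hw
    have h3 : ‖f w‖ ^ 2 * Dw (fun z => (q j).eval z) w ≤ ‖f w‖ ^ 2 * (8 * Dw h w + 2) := by
      gcongr; exact hq2 j w hw
    linarith
  obtain ⟨B, hB⟩ := exists_Q_bound hμ hfD hhf hfD (a := 2 * (C + 1) ^ 2 + 32 * C ^ 2)
    (b := 32) (c := 4) (by positivity) (by positivity) (by positivity)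
  have hH : ∀ j, MemHardy2 fun z => (q j).eval z * f z := fun j =>
    hfD.1.bdd_mul (memHinf_poly (q j)).1 (hq4 j)
  obtain ⟨y, hy, hye⟩ := hM.exists_weak_limit hμ (h := fun j z => (q j).eval z * f z)
    (fun j => hM.poly_mul_mem hf (q j)) (C := (C + 1) ^ 2 * hardyNormSq f + B)
    (fun j => (hB _ (hH j) (hb j)).2.trans (by
      have := hardyNormSq_bdd_mul_le hfD.1 (memHinf_poly (q j)) (hq4 j)
      linarith)) subset_rfl (l := fun z => h z * f z)
    (fun z hz => (hq1 z hz).mul_const _)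
  exact hM.congr hμ hy hye

lemma MemD.mul_of_bounded (hμ : OnCircle μ) {f g : ℂ → ℂ} (hf : MemD μ f) (hg : MemD μ g)
    (hf' : MemHinf f) (hg' : MemHinf g) : MemD μ fun z => g z * f z := by
  obtain ⟨A, hA⟩ := hf'.2
  obtain ⟨C, hC⟩ := hg'.2
  obtain ⟨B, hB⟩ := exists_Q_bound hμ hf hg hf (a := 2 * C ^ 2)
    (b := 2 * A ^ 2) (c := 0) (by positivity) (by positivity) le_rfl
  refine (hB _ (hf.1.bdd_mul hg'.1 hC) fun w hw => ?_).1
  have h1 := Dw_mul_le hf.1 hg' hC hw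
  have h2 : ‖f w‖ ^ 2 * Dw g w ≤ A ^ 2 * Dw g w :=
    mul_le_mul_of_nonneg_right (pow_le_pow_left₀ (norm_nonneg _) (hA w hw) 2) (Dw_nonneg _ hw)
  linarith

lemma MemD.poly_mul (hμ : OnCircle μ) {f : ℂ → ℂ} (hf : MemD μ f) (p : Polynomial ℂ) :
    MemD μ fun z => p.eval z * f z := by
  induction p using Polynomial.induction_on' with
  | add p q hp hq =>
    simp_rw [Polynomial.eval_add, add_mul]
    exact hp.add hμ hq
  | monomial n a =>
    simp_rw [Polynomial.eval_monomial, mul_assoc]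
    refine MemD.const_mul hμ ?_ a
    induction n with
    | zero => simpa using hf
    | succ n ih =>
      simp_rw [pow_succ', mul_assoc]
      exact ih.id_mul hμ

end

section

variable {μ : Measure ℂ} [IsFiniteMeasure μ] {M : Set (ℂ → ℂ)}

lemma mem_closedSpan_iff (hμ : OnCircle μ) {f g : ℂ → ℂ} (hf : MemD μ f) :
    g ∈ closedSpan μ f ↔ MemD μ g ∧ ∀ ε > 0, ∃ q : Polynomial ℂ,
      Q μ (fun z => g z - q.eval z * f z) < ε := by
  refine and_congr_right fun hg => ⟨fun h ε hε => ?_, fun h ε hε => ?_⟩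
  · obtain ⟨q, hq⟩ := h (ε / 8) (by positivity)
    refine ⟨q, ((hg.sub hμ (hf.poly_mul hμ q)).Q_le hμ).trans_lt (by linarith)⟩
  · obtain ⟨q, hq⟩ := h ε hε
    exact ⟨q, ((hg.sub hμ (hf.poly_mul hμ q)).dNormSq_le_Q hμ).trans_lt hq⟩

lemma poly_mul_mem_closedSpan (hμ : OnCircle μ) {f : ℂ → ℂ} (hf : MemD μ f) (p : Polynomial ℂ) :
    (fun z => p.eval z * f z) ∈ closedSpan μ f := by
  refine (mem_closedSpan_iff hμ hf).2 ⟨hf.poly_mul hμ p, fun ε hε => ⟨p, ?_⟩⟩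
  have h0 := (hf.Q_const_mul hμ 0)
  simp only [sub_self]
  simp only [zero_mul, norm_zero, ne_eq, OfNat.ofNat_ne_zero, not_false_eq_true, zero_pow] at h0
  rwa [h0]

lemma self_mem_closedSpan (hμ : OnCircle μ) {f : ℂ → ℂ} (hf : MemD μ f) : f ∈ closedSpan μ f := by
  simpa using poly_mul_mem_closedSpan hμ hf 1

lemma closedInvSubspace_closedSpan (hμ : OnCircle μ) {f : ℂ → ℂ} (hf : MemD μ f) :
    ClosedInvSubspace μ (closedSpan μ f) where
  subset := fun g hg => hg.1
  zero_mem := by simpa using poly_mul_mem_closedSpan hμ hf 0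
  add_mem := by
    intro g hg h hh
    rw [mem_closedSpan_iff hμ hf] at *
    refine ⟨hg.1.add hμ hh.1, fun ε hε => ?_⟩
    obtain ⟨p, hp⟩ := hg.2 (ε / 4) (by positivity)
    obtain ⟨q, hq⟩ := hh.2 (ε / 4) (by positivity)
    refine ⟨p + q, ?_⟩
    have := (hg.1.sub hμ (hf.poly_mul hμ p)).Q_add_le hμ (hh.1.sub hμ (hf.poly_mul hμ q))
    rw [show (fun z => g z + h z - (p + q).eval z * f z) = fun z =>
      (g z - p.eval z * f z) + (h z - q.eval z * f z) by ext z; simp; ring]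
    linarith
  smul_mem := by
    intro c g hg
    rw [mem_closedSpan_iff hμ hf] at *
    refine ⟨hg.1.const_mul hμ c, fun ε hε => ?_⟩
    obtain ⟨p, hp⟩ := hg.2 (ε / (‖c‖ ^ 2 + 1)) (by positivity)
    refine ⟨Polynomial.C c * p, ?_⟩
    rw [show (fun z => c * g z - (Polynomial.C c * p).eval z * f z) = fun z =>
      c * (g z - p.eval z * f z) by ext z; simp; ring,
      (hg.1.sub hμ (hf.poly_mul hμ p)).Q_const_mul hμ]
    have h0 := (hg.1.sub hμ (hf.poly_mul hμ p)).Q_nonneg hμ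
    rw [lt_div_iff₀ (by positivity)] at hp
    nlinarith
  shift_mem := by
    intro g hg
    rw [mem_closedSpan_iff hμ hf]
    refine ⟨hg.1.id_mul hμ, fun ε hε => ?_⟩
    have hE : ∃ K, 0 ≤ K ∧ ∀ h, MemD μ h → Q μ (fun z => z * h z) ≤ K * Q μ h := by
      refine ⟨1 + (μ.real univ * 2 + 64), by positivity, fun h hh => ?_⟩
      have h1 : bet μ h ≤ (μ.real univ * 2 + 64) * Q μ h := by
        refine le_of_tendsto (hh.tendsto_bet hμ) (Eventually.of_forall fun n => ?_)
        have h2 := hh.mean_sq_le hμ n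
        have h3 := hh.hardyNormSq_le_Q hμ
        have h4 := hh.dNormSq_le_Q hμ
        have h5 := hardyNormSq_nonneg hh.1
        have h6 : 0 ≤ μ.real univ := by positivity
        unfold dNormSq at h4
        nlinarith [mul_le_mul_of_nonneg_left h3 h6]
      rw [hh.Q_id_mul hμ]
      linarith
    obtain ⟨K, hK, hE⟩ := hE
    obtain ⟨p, hp⟩ := ((mem_closedSpan_iff hμ hf).1 hg).2 (ε / (K + 1)) (by positivity)
    refine ⟨Polynomial.X * p, ?_⟩
    have h1 := hg.1.sub hμ (hf.poly_mul hμ p)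
    rw [show (fun z => z * g z - Polynomial.eval z (Polynomial.X * p) * f z) = fun z =>
      z * (g z - p.eval z * f z) by ext z; simp; ring]
    have h0 := h1.Q_nonneg hμ
    have h2 := hE _ h1
    rw [lt_div_iff₀ (by positivity)] at hp
    nlinarith
  closed := by
    intro g hg h
    refine ⟨hg, fun ε hε => ?_⟩
    obtain ⟨y, hy, hyε⟩ := h (ε / 64) (by positivity)
    obtain ⟨q, hq⟩ := ((mem_closedSpan_iff hμ hf).1 hy).2 (ε / 4) (by positivity)
    refine ⟨q, ?_⟩
    have h1 := hg.sub hμ hy.1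
    have h2 := hy.1.sub hμ (hf.poly_mul hμ q)
    have h3 := h1.Q_le hμ
    have h4 := h1.Q_add_le hμ h2
    have h5 := (hg.sub hμ (hf.poly_mul hμ q)).dNormSq_le_Q hμ
    rw [show (fun z => g z - y z + (y z - q.eval z * f z)) = fun z => g z - q.eval z * f z by
      ext z; ring] at h4
    linarith

lemma ClosedInvSubspace.closedSpan_subset (hM : ClosedInvSubspace μ M)
    {f : ℂ → ℂ} (hf : f ∈ M) : closedSpan μ f ⊆ M := by
  intro g hg
  refine hM.closed g hg.1 fun ε hε => ?_
  obtain ⟨q, hq⟩ := hg.2 ε hε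
  exact ⟨_, hM.poly_mul_mem hf q, hq⟩

lemma exists_poly_of_mem_closedSpan (hμ : OnCircle μ) {f x : ℂ → ℂ} (hf : MemD μ f)
    (hx : x ∈ closedSpan μ f) : ∃ p : ℕ → Polynomial ℂ,
      ∀ k, Q μ (fun z => x z - (p k).eval z * f z) < 1 / (k + 1) := by
  have h := ((mem_closedSpan_iff hμ hf).1 hx).2
  choose p hp using fun k : ℕ => h (1 / (k + 1)) (by positivity)
  exact ⟨p, hp⟩

/-- Convergence in `D(μ)` implies pointwise convergence. -/
lemma tendsto_of_Q_tendsto (hμ : OnCircle μ) {x : ℂ → ℂ} {y : ℕ → ℂ → ℂ} (hx : MemD μ x)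
    (hy : ∀ k, MemD μ (y k)) (h : Tendsto (fun k => Q μ fun z => x z - y k z) atTop (𝓝 0))
    {z : ℂ} (hz : z ∈ disc) : Tendsto (fun k => y k z) atTop (𝓝 (x z)) := by
  rw [tendsto_iff_norm_sub_tendsto_zero]
  have h1 : Tendsto (fun k => ‖y k z - x z‖ ^ 2) atTop (𝓝 0) := by
    refine squeeze_zero (fun _ => by positivity) (fun k => ?_) (by
      simpa using h.const_mul (2 / (1 - ‖z‖)))
    rw [norm_sub_rev]
    exact (hx.sub hμ (hy k)).norm_sq_le_Q hμ hz
  have h2 := h1.sqrt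
  simpa using h2

end

lemma bregman_nonneg (x y : ℝ) : 0 ≤ Real.exp x - Real.exp y - Real.exp y * (x - y) := by
  have h1 := Real.add_one_le_exp (x - y)
  have h2 : Real.exp x = Real.exp y * Real.exp (x - y) := by rw [← Real.exp_add]; ring_nf
  have h3 := Real.exp_pos y
  rw [h2]
  nlinarith

lemma bregman_min_of_le (u v : ℝ) {α β : ℝ} (h : α ≤ β) :
    Real.exp (min u v) - Real.exp α - Real.exp α * (min u v - α) ≤
      (Real.exp u - Real.exp α - Real.exp α * (u - α)) +
      (Real.exp v - Real.exp β - Real.exp β * (v - β)) := by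
  rcases le_total u v with huv | huv
  · rw [min_eq_left huv]
    linarith [bregman_nonneg v β]
  · rw [min_eq_right huv]
    rcases le_total α v with hv | hv
    · have h1 := bregman_nonneg u v
      have h2 := mul_nonneg (sub_nonneg.2 (Real.exp_le_exp.2 hv)) (sub_nonneg.2 huv)
      linarith [bregman_nonneg v β]
    · have h1 := bregman_nonneg α β
      have h2 := mul_nonneg (sub_nonneg.2 (Real.exp_le_exp.2 h)) (sub_nonneg.2 hv)
      linarith [bregman_nonneg u α]

lemma integrable_exp_min {P : Measure ℝ} {a b : ℝ → ℝ} (ha : Integrable a P)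
    (hb : Integrable b P) (hea : Integrable (fun t => Real.exp (a t)) P) :
    Integrable (fun t => Real.exp (min (a t) (b t))) P := by
  refine hea.mono' (Real.continuous_exp.comp_aestronglyMeasurable (ha.inf hb).1)
    (Eventually.of_forall fun t => ?_)
  rw [Real.norm_eq_abs, Real.abs_exp]
  exact Real.exp_le_exp.2 (min_le_left _ _)

lemma jensen_gap_min {P : Measure ℝ} [IsProbabilityMeasure P] {a b : ℝ → ℝ} (ha : Integrable a P)
    (hb : Integrable b P) (hea : Integrable (fun t => Real.exp (a t)) P)
    (heb : Integrable (fun t => Real.exp (b t)) P) :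
    ∫ t, Real.exp (min (a t) (b t)) ∂P - Real.exp (∫ t, min (a t) (b t) ∂P) ≤
      (∫ t, Real.exp (a t) ∂P - Real.exp (∫ t, a t ∂P)) +
      (∫ t, Real.exp (b t) ∂P - Real.exp (∫ t, b t ∂P)) := by
  wlog h : ∫ t, a t ∂P ≤ ∫ t, b t ∂P generalizing a b
  · have := this hb ha heb hea (le_of_not_ge h)
    simp_rw [min_comm (b _) (a _)] at this
    linarith
  have hm : Integrable (fun t => min (a t) (b t)) P := ha.inf hb
  have hem := integrable_exp_min ha hb hea
  set α := ∫ t, a t ∂P with hα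
  set β := ∫ t, b t ∂P with hβ
  have hB : ∀ {c : ℝ → ℝ} (γ : ℝ), Integrable c P → Integrable (fun t => Real.exp (c t)) P →
      Integrable (fun t => Real.exp (c t) - Real.exp γ - Real.exp γ * (c t - γ)) P ∧
      ∫ t, (Real.exp (c t) - Real.exp γ - Real.exp γ * (c t - γ)) ∂P =
        ∫ t, Real.exp (c t) ∂P - Real.exp γ - Real.exp γ * (∫ t, c t ∂P - γ) := by
    intro c γ hc hec
    have i1 : Integrable (fun t => Real.exp (c t) - Real.exp γ) P := hec.sub (integrable_const _)
    have i2 : Integrable (fun t => Real.exp γ * (c t - γ)) P :=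
      (hc.sub (integrable_const _)).const_mul _
    refine ⟨i1.sub i2, ?_⟩
    rw [integral_sub i1 i2, integral_sub hec (integrable_const _), integral_const_mul,
      integral_sub hc (integrable_const _)]
    simp
  have h1 := integral_mono (hB α hm hem).1 ((hB α ha hea).1.add (hB β hb heb).1)
    fun t => bregman_min_of_le (a t) (b t) h
  simp only [Pi.add_apply] at h1
  rw [integral_add (hB α ha hea).1 (hB β hb heb).1, (hB α hm hem).2, (hB α ha hea).2,
    (hB β hb heb).2, ← hα, ← hβ] at h1
  have h2 := bregman_nonneg (∫ t, min (a t) (b t) ∂P) α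
  simp only [sub_self, mul_zero, sub_zero] at h1
  linarith

/-- The outer function whose product with `x` has boundary modulus `min |x*| |g*|`. -/
def cut (x g : ℂ → ℂ) : ℂ → ℂ := outr fun t => min 0 (lg g t - lg x t)

section

variable {x g : ℂ → ℂ}

lemma integrable_cut (hx : MemHardy2 x) (hx0 : NZ x) (hg : MemHardy2 g) (hg0 : NZ g) :
    Integrable (fun t => min 0 (lg g t - lg x t)) cm :=
  (integrable_zero _ _ _).inf ((hg.integrable_lg hg0).sub (hx.integrable_lg hx0))

lemma norm_cut_le (hx : MemHardy2 x) (hx0 : NZ x) (hg : MemHardy2 g) (hg0 : NZ g) {w : ℂ}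
    (hw : w ∈ disc) : ‖cut x g w‖ ≤ 1 := by
  simpa [cut] using norm_outr_le (integrable_cut hx hx0 hg hg0) (c := 0)
    (Eventually.of_forall fun t => min_le_left _ _) hw

lemma memHinf_cut (hx : MemHardy2 x) (hx0 : NZ x) (hg : MemHardy2 g) (hg0 : NZ g) :
    MemHinf (cut x g) :=
  ⟨differentiableOn_outr (integrable_cut hx hx0 hg hg0), 1,
    fun _ hw => norm_cut_le hx hx0 hg hg0 hw⟩

lemma memHardy2_cut_mul (hx : MemHardy2 x) (hx0 : NZ x) (hg : MemHardy2 g) (hg0 : NZ g) :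
    MemHardy2 fun z => cut x g z * x z :=
  hx.bdd_mul (memHinf_cut hx hx0 hg hg0).1 fun _ hw => norm_cut_le hx hx0 hg hg0 hw

lemma norm_bdv_cut (hx : MemHardy2 x) (hx0 : NZ x) (hg : MemHardy2 g) (hg0 : NZ g) :
    ∀ᵐ t ∂cm, ‖bdv (cut x g) t‖ = Real.exp (min 0 (lg g t - lg x t)) :=
  norm_bdv_outr (integrable_cut hx hx0 hg hg0) (memHinf_cut hx hx0 hg hg0).memHardy2

lemma norm_bdv_cut_mul (hx : MemHardy2 x) (hx0 : NZ x) (hg : MemHardy2 g) (hg0 : NZ g) :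
    ∀ᵐ t ∂cm, ‖bdv (fun z => cut x g z * x z) t‖ = Real.exp (min (lg x t) (lg g t)) := by
  filter_upwards [bdv_mul (memHinf_cut hx hx0 hg hg0).memHardy2 hx, norm_bdv_cut hx hx0 hg hg0,
    hx.exp_lg hx0] with t h1 h2 h3
  rw [h1, norm_mul, h2, ← h3, ← Real.exp_add, ← min_add_add_right]
  simp

lemma norm_outr_lg_mul_cut (hx : MemHardy2 x) (hx0 : NZ x) (hg : MemHardy2 g) (hg0 : NZ g) {w : ℂ}
    (hw : w ∈ disc) : ‖outr (lg x) w‖ * ‖cut x g w‖ =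
      Real.exp (∫ t, min (lg x t) (lg g t) ∂(pm w)) := by
  have h1 := (integrable_pm_iff hw).2 (hx.integrable_lg hx0)
  have h2 := (integrable_pm_iff hw).2 (integrable_cut hx hx0 hg hg0)
  rw [norm_outr (hx.integrable_lg hx0) hw, cut, norm_outr (integrable_cut hx hx0 hg hg0) hw,
    ← Real.exp_add, ← integral_add h1 h2]
  congr 2 with t
  rw [← min_add_add_left]
  simp

lemma norm_cut_mul (hx : MemHardy2 x) (hx0 : NZ x) (hg : MemHardy2 g) (hg0 : NZ g) {w : ℂ}
    (hw : w ∈ disc) : ‖cut x g w * x w‖ =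
      ‖gin x w‖ * Real.exp (∫ t, min (lg x t) (lg g t) ∂(pm w)) := by
  rw [← norm_outr_lg_mul_cut hx hx0 hg hg0 hw, norm_mul]
  conv_lhs => rw [hx.gin_mul hx0 hw, norm_mul]
  ring

lemma MemHardy2.integrable_exp_two_lg (hx : MemHardy2 x) (hx0 : NZ x) {w : ℂ} (hw : w ∈ disc) :
    Integrable (fun t => Real.exp (2 * lg x t)) (pm w) ∧
    ∫ t, Real.exp (2 * lg x t) ∂(pm w) = ∫ t, ‖bdv x t‖ ^ 2 ∂(pm w) := by
  have h : (fun t => ‖bdv x t‖ ^ 2) =ᵐ[pm w] fun t => Real.exp (2 * lg x t) := by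
    rw [EventuallyEq, ae_pm hw]
    filter_upwards [hx.exp_lg hx0] with t ht
    rw [two_mul, Real.exp_add, ht, sq]
  exact ⟨(hx.integrable_sq_pm hw).congr h, (integral_congr_ae h).symm⟩

/-- The cut-off inequality. -/
lemma Dw_cut_mul_le (hx : MemHardy2 x) (hx0 : NZ x) (hg : MemHardy2 g) (hg0 : NZ g) {w : ℂ}
    (hw : w ∈ disc) : Dw (fun z => cut x g z * x z) w ≤ Dw x w + Dw g w := by
  have hs := one_sub_norm_sq_pos hw
  have : IsProbabilityMeasure (pm w) := isProbabilityMeasure_pm hw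
  refine le_of_mul_le_mul_right ?_ hs
  rw [add_mul, (memHardy2_cut_mul hx hx0 hg hg0).Dw_mul hw, hx.Dw_mul hw, hg.Dw_mul hw,
    norm_cut_mul hx hx0 hg hg0 hw]
  obtain ⟨ix, ex⟩ := hx.integrable_exp_two_lg hx0 hw
  obtain ⟨ig, eg⟩ := hg.integrable_exp_two_lg hg0 hw
  have ia := (integrable_pm_iff hw).2 (hx.integrable_lg hx0)
  have ib := (integrable_pm_iff hw).2 (hg.integrable_lg hg0)
  have hJ := jensen_gap_min (ia.const_mul 2) (ib.const_mul 2) ix ig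
  have hmin : ∀ t, min (2 * lg x t) (2 * lg g t) = 2 * min (lg x t) (lg g t) := fun t =>
    (mul_min_of_nonneg _ _ zero_le_two).symm
  simp_rw [hmin, integral_const_mul] at hJ
  rw [ex, eg] at hJ
  have e2 : ∀ y : ℝ, Real.exp (2 * y) = Real.exp y ^ 2 := fun y => by
    rw [two_mul, Real.exp_add, sq]
  have hF : ∫ t, ‖bdv (fun z => cut x g z * x z) t‖ ^ 2 ∂(pm w) =
      ∫ t, Real.exp (2 * min (lg x t) (lg g t)) ∂(pm w) := by
    refine integral_congr_ae ?_
    rw [EventuallyEq, ae_pm hw]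
    filter_upwards [norm_bdv_cut_mul hx hx0 hg hg0] with t ht
    rw [ht, e2]
  rw [hF]
  rw [e2 (∫ t, min _ _ ∂(pm w)), e2 (∫ t, lg x t ∂(pm w)), e2 (∫ t, lg g t ∂(pm w)),
    ← norm_outr (hg.integrable_lg hg0) hw, ← norm_outr (hx.integrable_lg hx0) hw] at hJ
  have h1 := hg.norm_le_outr hg0 hw
  have h2 := hx.norm_gin_le hx0 hw
  have h3 : ‖x w‖ = ‖gin x w‖ * ‖outr (lg x) w‖ := by
    rw [← norm_mul, ← hx.gin_mul hx0 hw]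
  have h4 : Real.exp (∫ t, min (lg x t) (lg g t) ∂(pm w)) ≤ ‖outr (lg x) w‖ := by
    rw [← norm_outr_lg_mul_cut hx hx0 hg hg0 hw]
    exact mul_le_of_le_one_right (norm_nonneg _) (norm_cut_le hx hx0 hg hg0 hw)
  have h5 : Real.exp (∫ t, min (lg x t) (lg g t) ∂(pm w)) ^ 2 ≤ ‖outr (lg x) w‖ ^ 2 :=
    pow_le_pow_left₀ (Real.exp_pos _).le h4 2
  have h6 : ‖gin x w‖ ^ 2 ≤ 1 := pow_le_one₀ (norm_nonneg _) h2
  have h7 : ‖g w‖ ^ 2 ≤ ‖outr (lg g) w‖ ^ 2 := pow_le_pow_left₀ (norm_nonneg _) h1 2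
  rw [h3, mul_pow, mul_pow]
  nlinarith

end

section

variable {μ : Measure ℂ} [IsFiniteMeasure μ] {M : Set (ℂ → ℂ)}

lemma nz_const {c : ℂ} (hc : c ≠ 0) : NZ fun _ => c := ⟨0, zero_mem_disc, hc⟩

lemma lg_const (c : ℂ) (t : ℝ) : lg (fun _ => c) t = Real.log ‖c‖ := by
  rw [lg, bdv_of_continuous continuous_const]

lemma tendsto_outr {u : ℕ → ℝ → ℝ} {v bound : ℝ → ℝ} (hu : ∀ k, Integrable (u k) cm)
    (hb : Integrable bound cm) (hub : ∀ k, ∀ᵐ t ∂cm, |u k t| ≤ bound t)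
    (h : ∀ᵐ t ∂cm, Tendsto (fun k => u k t) atTop (𝓝 (v t))) {z : ℂ} (hz : z ∈ disc) :
    Tendsto (fun k => outr (u k) z) atTop (𝓝 (outr v z)) := by
  refine (Complex.continuous_exp.tendsto _).comp ?_
  refine tendsto_integral_of_dominated_convergence
    (fun t => ‖(bpt t + z) / (bpt t - z)‖ * bound t) (fun k => (integrable_herg (hu k) hz).1)
    ?_ (fun k => ?_) ?_
  · have := integrable_continuous_mul (k := fun t => (‖(bpt t + z) / (bpt t - z)‖ : ℂ))
      (Complex.continuous_ofReal.comp (continuous_herg_kernel hz).norm) hb.ofReal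
    simpa using this.re
  · filter_upwards [hub k] with t ht
    rw [norm_mul, Complex.norm_real, Real.norm_eq_abs]
    exact mul_le_mul_of_nonneg_left ht (norm_nonneg _)
  · filter_upwards [h] with t ht
    exact ((Complex.continuous_ofReal.tendsto _).comp ht).const_mul _

lemma tendsto_cut_const {g : ℂ → ℂ} (hg : MemHardy2 g) (hg0 : NZ g) {z : ℂ} (hz : z ∈ disc) :
    Tendsto (fun k : ℕ => cut g (fun _ => (k + 1 : ℂ)) z) atTop (𝓝 1) := by
  have hk : ∀ k : ℕ, (k + 1 : ℂ) ≠ 0 := fun k => Nat.cast_add_one_ne_zero k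
  rw [show (𝓝 (1 : ℂ)) = 𝓝 (outr (fun _ => 0) z) by rw [outr_zero]]
  refine tendsto_outr (bound := fun t => |lg g t|)
    (fun k => integrable_cut hg hg0 (memHardy2_const _) (nz_const (hk k)))
    (hg.integrable_lg hg0).abs (fun k => Eventually.of_forall fun t => ?_)
    (Eventually.of_forall fun t => ?_) hz
  · rw [lg_const]
    have h1 : 0 ≤ Real.log ‖(k + 1 : ℂ)‖ := by
      apply Real.log_nonneg
      rw [show (k + 1 : ℂ) = ((k + 1 : ℝ) : ℂ) by push_cast; rfl, Complex.norm_real,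
        Real.norm_of_nonneg (by positivity)]
      linarith [(k.cast_nonneg : (0:ℝ) ≤ k)]
    rw [abs_of_nonpos (min_le_left _ _)]
    rcases min_choice 0 (Real.log ‖(k + 1 : ℂ)‖ - lg g t) with h | h <;> rw [h]
    · simp
    · linarith [le_abs_self (lg g t)]
  · refine tendsto_const_nhds.congr' ?_
    have h1 : Tendsto (fun k : ℕ => Real.log ‖(k + 1 : ℂ)‖) atTop atTop := by
      refine Real.tendsto_log_atTop.comp ?_
      refine tendsto_atTop_mono (fun k => ?_) tendsto_natCast_atTop_atTop
      rw [show (k + 1 : ℂ) = ((k + 1 : ℝ) : ℂ) by push_cast; rfl, Complex.norm_real,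
        Real.norm_of_nonneg (by positivity)]
      linarith
    filter_upwards [h1.eventually_ge_atTop (lg g t)] with k hk
    rw [lg_const, min_eq_left (by linarith)]

lemma Dw_cut_const_mul_le {g : ℂ → ℂ} (hg : MemHardy2 g) (hg0 : NZ g) {c : ℂ} (hc : c ≠ 0)
    {w : ℂ} (hw : w ∈ disc) : Dw (fun z => cut g (fun _ => c) z * g z) w ≤ Dw g w := by
  simpa [Dw_const] using Dw_cut_mul_le hg hg0 (memHardy2_const c) (nz_const hc) hw

lemma norm_cut_const_mul_le {g : ℂ → ℂ} (hg : MemHardy2 g) (hg0 : NZ g) {c : ℂ} (hc : c ≠ 0)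
    {w : ℂ} (hw : w ∈ disc) : ‖cut g (fun _ => c) w * g w‖ ≤ ‖c‖ := by
  refine (memHardy2_cut_mul hg hg0 (memHardy2_const c) (nz_const hc)).norm_le_of_bdv ?_ hw
  filter_upwards [norm_bdv_cut_mul hg hg0 (memHardy2_const c) (nz_const hc)] with t ht
  rw [ht, lg_const, ← Real.exp_log (norm_pos_iff.2 hc)]
  simp

lemma MemD.cut_const_mul (hμ : OnCircle μ) {g : ℂ → ℂ} (hg : MemD μ g) (hg0 : NZ g) {c : ℂ}
    (hc : c ≠ 0) : MemD μ (fun z => cut g (fun _ => c) z * g z) ∧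
      Q μ (fun z => cut g (fun _ => c) z * g z) ≤ 9 * Q μ g := by
  have h1 := memHardy2_cut_mul hg.1 hg0 (memHardy2_const c) (nz_const hc)
  obtain ⟨h2, h3⟩ := memD_of_En_le_Q hμ h1 (C := 8 * Q μ g) fun n =>
    (En_mono hμ h1 hg.1 (fun w hw => Dw_cut_const_mul_le hg.1 hg0 hc hw) n).trans
      (hg.En_le_Q hμ n)
  refine ⟨h2, h3.trans ?_⟩
  have h4 := hardyNormSq_bdd_mul_le hg.1 (memHinf_cut hg.1 hg0 (memHardy2_const c) (nz_const hc))
    fun _ hw => norm_cut_le hg.1 hg0 (memHardy2_const c) (nz_const hc) hw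
  have h5 := hg.hardyNormSq_le_Q hμ
  linarith

/-- Elements of an invariant subspace are weak limits of bounded elements obtained by multiplying
with zero-free functions. -/
lemma ClosedInvSubspace.exists_bounded_approx (hμ : OnCircle μ) (hM : ClosedInvSubspace μ M)
    {g : ℂ → ℂ} (hg : g ∈ M) (hg0 : NZ g) : ∃ G : ℕ → ℂ → ℂ, ∀ k, MemHinf (G k) ∧
      (∀ z, G k z ≠ 0) ∧ (fun z => G k z * g z) ∈ M ∧ MemHinf (fun z => G k z * g z) ∧
      Q μ (fun z => G k z * g z) ≤ 9 * Q μ g ∧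
      ∀ z ∈ disc, Tendsto (fun k => G k z) atTop (𝓝 1) := by
  have hk : ∀ k : ℕ, (k + 1 : ℂ) ≠ 0 := fun k => Nat.cast_add_one_ne_zero k
  have hD := hM.memD hg
  refine ⟨fun k => cut g fun _ => (k + 1 : ℂ), fun k => ?_⟩
  have hb := memHinf_cut hD.1 hg0 (memHardy2_const _) (nz_const (hk k))
  obtain ⟨h1, h2⟩ := hD.cut_const_mul hμ hg0 (hk k)
  exact ⟨hb, fun z => outr_ne_zero _ z, hM.bdd_mul_mem hμ hg hb h1, ⟨h1.1.1, _, fun z hz =>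
    norm_cut_const_mul_le hD.1 hg0 (hk k) hz⟩, h2, fun z hz => tendsto_cut_const hD.1 hg0 hz⟩

lemma MemHinf.dslope {f : ℂ → ℂ} (hf : MemHinf f) : MemHinf (dslope f 0) := by
  obtain ⟨C, hC⟩ := hf.2
  have h1 := hf.memHardy2.dslope zero_mem_disc
  refine ⟨h1.1, C + ‖f 0‖, fun z hz => h1.norm_le_of_bdv ?_ hz⟩
  filter_upwards [hf.memHardy2.bdv_dslope zero_mem_disc, norm_bdv_le hf.memHardy2 hC] with t h2 h3
  have h4 := congrArg norm h2
  rw [sub_zero, norm_mul, norm_bpt, one_mul] at h4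
  rw [← h4]
  exact (norm_sub_le _ _).trans (by linarith)

lemma eqOn_of_id_mul_eq {f g : ℂ → ℂ} (hf : DifferentiableOn ℂ f disc)
    (hg : DifferentiableOn ℂ g disc) (h : ∀ z ∈ disc, z * f z = z * g z) :
    ∀ z ∈ disc, f z = g z := by
  intro z hz
  by_cases hz0 : z = 0
  · subst hz0
    have h1 := (hf.continuousOn.continuousAt (disc_mem_nhds zero_mem_disc)).tendsto.mono_left
      (nhdsWithin_le_nhds (s := {0}ᶜ))
    have h2 := (hg.continuousOn.continuousAt (disc_mem_nhds zero_mem_disc)).tendsto.mono_left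
      (nhdsWithin_le_nhds (s := {0}ᶜ))
    refine tendsto_nhds_unique h1 (h2.congr' ?_)
    filter_upwards [self_mem_nhdsWithin,
      nhdsWithin_le_nhds (disc_mem_nhds zero_mem_disc)] with w hw hwd
    exact (mul_left_cancel₀ hw (h w hwd)).symm
  · exact mul_left_cancel₀ hz0 (h z hz)

lemma exists_eq_pow_mul {m : ℕ} {f : ℂ → ℂ} (hf : DifferentiableOn ℂ f disc)
    (h : ∀ n < m, tc f n = 0) : ∃ g, DifferentiableOn ℂ g disc ∧
      (∀ μ : Measure ℂ, IsFiniteMeasure μ → OnCircle μ → MemD μ f → MemD μ g) ∧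
      (MemHinf f → MemHinf g) ∧ (∀ z ∈ disc, f z = z ^ m * g z) ∧ g 0 = tc f m := by
  induction m generalizing f with
  | zero => exact ⟨f, hf, fun _ _ _ h => h, fun h => h, fun z _ => by simp, (tc_zero f).symm⟩
  | succ m ih =>
    obtain ⟨g, h1, h2, h3, h4, h5⟩ := ih (f := dslope f 0)
      (differentiableOn_dslope_disc hf zero_mem_disc) fun n hn => by
        rw [tc_dslope hf]; exact h _ (by omega)
    refine ⟨g, h1, fun μ _ hμ hD => h2 μ inferInstance hμ (hD.dslope hμ), fun hb => h3 hb.dslope,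
      fun z hz => ?_, by rw [h5, tc_dslope hf]⟩
    rw [eq_add_mul_dslope f z, ← tc_zero f, h 0 (by omega), h4 z hz]
    ring

lemma tc_pow_mul {h : ℂ → ℂ} (hh : DifferentiableOn ℂ h disc) (m : ℕ) :
    (∀ n < m, tc (fun z => z ^ m * h z) n = 0) ∧ tc (fun z => z ^ m * h z) m = h 0 := by
  induction m with
  | zero => simp [tc_zero]
  | succ m ih =>
    have hd : DifferentiableOn ℂ (fun z => z ^ m * h z) disc :=
      ((differentiableOn_id.pow m).mul hh :)
    have he : (fun z => z ^ (m + 1) * h z) = fun z => z * (z ^ m * h z) := by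
      ext z; ring
    rw [he, tc_id_mul_succ hd]
    refine ⟨fun n hn => ?_, ih.2⟩
    cases n with
    | zero => simp [tc_zero]
    | succ n => rw [tc_id_mul_succ hd]; exact ih.1 n (by omega)

lemma tc_mul_of_vanish {G f : ℂ → ℂ} (hG : DifferentiableOn ℂ G disc)
    (hf : DifferentiableOn ℂ f disc) {m : ℕ} (h : ∀ n < m, tc f n = 0) :
    (∀ n < m, tc (fun z => G z * f z) n = 0) ∧ tc (fun z => G z * f z) m = G 0 * tc f m := by
  obtain ⟨g, h1, -, -, h4, h5⟩ := exists_eq_pow_mul hf h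
  have he : ∀ z ∈ disc, G z * f z = z ^ m * (G z * g z) := fun z hz => by rw [h4 z hz]; ring
  have h6 := tc_pow_mul (h := fun z => G z * g z) (hG.mul h1) m
  have hGf : DifferentiableOn ℂ (fun z => G z * f z) disc := hG.mul hf
  refine ⟨fun n hn => ?_, ?_⟩
  · rw [tc_congr hGf he]; exact h6.1 n hn
  · rw [tc_congr hGf he, ← h5]; exact h6.2

end

/-- `m` is the minimal order of vanishing at `0` of the elements of `M`. -/
def MinOrd (M : Set (ℂ → ℂ)) (m : ℕ) : Prop :=
  (∀ f ∈ M, ∀ n < m, tc f n = 0) ∧ ∃ f ∈ M, tc f m ≠ 0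

section

variable {μ : Measure ℂ} [IsFiniteMeasure μ] {M : Set (ℂ → ℂ)}

lemma nz_of_tc_ne {f : ℂ → ℂ} (hf : DifferentiableOn ℂ f disc) {n : ℕ} (h : tc f n ≠ 0) : NZ f := by
  by_contra h0
  refine h ?_
  have h1 : ∀ z ∈ disc, f z = (fun _ => (0 : ℂ)) z := fun z hz => by
    by_contra h2
    exact h0 ⟨z, hz, h2⟩
  rw [tc_congr hf h1]
  cases n with
  | zero => rw [tc_zero]
  | succ n => rw [tc_const_succ]

lemma ClosedInvSubspace.exists_minOrd (hM : ClosedInvSubspace μ M) {f : ℂ → ℂ} (hf : f ∈ M)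
    (hf0 : NZ f) : ∃ m, MinOrd M m := by
  classical
  have hex : ∃ n, ∃ g ∈ M, tc g n ≠ 0 := by
    by_contra! h
    obtain ⟨z, hz, hfz⟩ := hf0
    have h1 := hasSum_tc (hM.memD hf).1.1 hz
    simp_rw [h _ f hf, zero_mul] at h1
    exact hfz (h1.unique hasSum_zero)
  refine ⟨Nat.find hex, fun g hg n hn => ?_, Nat.find_spec hex⟩
  by_contra h
  exact Nat.find_min hex hn ⟨g, hg, h⟩

lemma ClosedInvSubspace.div_mem_of_bounded (hμ : OnCircle μ) (hM : ClosedInvSubspace μ M) {m : ℕ}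
    (hm : MinOrd M m) {h : ℂ → ℂ} (hh : DifferentiableOn ℂ h disc)
    (hzh : (fun z => z * h z) ∈ M) (hb : MemHinf fun z => z * h z)
    (h0 : tc (fun z => z * h z) m = 0) : h ∈ M := by
  obtain ⟨f₀, hf₀, hf₀m⟩ := hm.2
  have hf₀D := hM.memD hf₀
  obtain ⟨G, hG⟩ := hM.exists_bounded_approx hμ hf₀ (nz_of_tc_ne hf₀D.1.1 hf₀m)
  obtain ⟨hGb, hG0, hfM, hfb, -, -⟩ := hG 0
  set f : ℂ → ℂ := fun z => G 0 z * f₀ z with hf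
  have hfm : tc f m ≠ 0 := by
    rw [(tc_mul_of_vanish hGb.1 hf₀D.1.1 (hm.1 f₀ hf₀)).2]
    exact mul_ne_zero (hG0 0) hf₀m
  obtain ⟨f₁, -, hf₁D, hf₁b, hff₁, hf₁0⟩ := exists_eq_pow_mul (hM.memD hfM).1.1 (hm.1 f hfM)
  have hgv : ∀ n < m + 1, tc (fun z => z * h z) n = 0 := fun n hn => by
    rcases Nat.lt_succ_iff_lt_or_eq.1 hn with hn | rfl
    · exact hm.1 _ hzh n hn
    · exact h0
  obtain ⟨g₁, hg₁, hg₁D, hg₁b, hgg₁, -⟩ := exists_eq_pow_mul (hM.memD hzh).1.1 hgv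
  have D1 := hf₁D μ inferInstance hμ (hM.memD hfM)
  have D2 := hg₁D μ inferInstance hμ (hM.memD hzh)
  have m1 := hM.bdd_mul_mem hμ hfM (hg₁b hb)
    ((hM.memD hfM).mul_of_bounded hμ D2 hfb (hg₁b hb))
  have m2 := hM.bdd_mul_mem hμ hzh (hf₁b hfb).dslope
    ((hM.memD hzh).mul_of_bounded hμ (D1.dslope hμ) hb (hf₁b hfb).dslope)
  have m3 := hM.smul_mem (f₁ 0)⁻¹ _ (hM.sub_mem m1 m2)
  have hf₁0' : f₁ 0 ≠ 0 := hf₁0 ▸ hfm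
  have hhe : ∀ z ∈ disc, h z = z ^ m * g₁ z :=
    eqOn_of_id_mul_eq hh ((differentiableOn_id.pow m).mul hg₁) fun z hz => by
      rw [hgg₁ z hz]
      ring
  refine hM.congr hμ m3 fun z hz => ?_
  rw [hff₁ z hz, hhe z hz, eq_add_mul_dslope f₁ z]
  field_simp
  ring

/-- Division by `z` in an invariant subspace. -/
lemma ClosedInvSubspace.div_mem (hμ : OnCircle μ) (hM : ClosedInvSubspace μ M) {m : ℕ}
    (hm : MinOrd M m) {h : ℂ → ℂ} (hh : DifferentiableOn ℂ h disc)
    (hzh : (fun z => z * h z) ∈ M) (h0 : tc (fun z => z * h z) m = 0) : h ∈ M := by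
  by_cases hnz : NZ fun z => z * h z
  · obtain ⟨G, hG⟩ := hM.exists_bounded_approx hμ hzh hnz
    have hmem : ∀ k, (fun z => G k z * h z) ∈ M := fun k => by
      obtain ⟨h1, h2, h3, h4, h5, h6⟩ := hG k
      have he : (fun z => G k z * (z * h z)) = fun z => z * (G k z * h z) := by ext z; ring
      refine hM.div_mem_of_bounded hμ hm (h1.1.mul hh) (he ▸ h3) (he ▸ h4) ?_
      rw [← he, (tc_mul_of_vanish h1.1 (hM.memD hzh).1.1 (hm.1 _ hzh)).2, h0, mul_zero]
    have hQ : ∀ k, Q μ (fun z => G k z * h z) ≤ 9 * Q μ fun z => z * h z := fun k => by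
      have h1 := (hG k).2.2.2.2.1
      rw [show (fun z => G k z * (z * h z)) = fun z => z * (G k z * h z) by ext z; ring,
        (hM.memD (hmem k)).Q_id_mul hμ] at h1
      linarith [(hM.memD (hmem k)).bet_nonneg hμ]
    obtain ⟨y, hy, hye⟩ := hM.exists_weak_limit hμ hmem hQ subset_rfl (l := h) fun z hz => by
      simpa using ((hG 0).2.2.2.2.2 z hz).mul_const (h z)
    exact hM.congr hμ hy hye
  · refine hM.congr hμ hM.zero_mem (eqOn_of_id_mul_eq (differentiableOn_const _) hh fun z hz => ?_)
    by_contra h1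
    refine hnz ⟨z, hz, fun h2 => h1 ?_⟩
    change z * h z = 0 at h2
    rw [h2, mul_zero]

end

section

variable {μ : Measure ℂ} [IsFiniteMeasure μ] {M : Set (ℂ → ℂ)}

lemma tc_sub {f g : ℂ → ℂ} (hf : DifferentiableOn ℂ f disc) (hg : DifferentiableOn ℂ g disc)
    (n : ℕ) : tc (fun z => f z - g z) n = tc f n - tc g n := by
  have h := tc_add hf (g := fun z => (-1) * g z) (hg.const_mul _) n
  rw [tc_const_mul hg] at h
  rw [show (fun z => f z - g z) = fun z => f z + (-1) * g z by ext z; ring, h]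
  ring

lemma Q_le_of_tendsto (hμ : OnCircle μ) {Y : ℕ → ℂ → ℂ} {y : ℂ → ℂ} (hY : ∀ n, MemD μ (Y n))
    (hy : MemD μ y) (h : Tendsto (fun n => Q μ fun z => y z - Y n z) atTop (𝓝 0)) {C : ℝ}
    (hC0 : 0 ≤ C) (hC : ∀ n : ℕ, Q μ (Y n) ≤ C + 1 / (n + 1)) : Q μ y ≤ C := by
  refine le_of_forall_pos_le_add fun ε hε => ?_
  set t := ε / (C + 1) with ht
  have ht0 : 0 < t := by positivity
  have h1 : Tendsto (fun n : ℕ => (1 + t) * (C + 1 / ((n : ℝ) + 1)) +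
      (1 + 1 / t) * Q μ fun z => y z - Y n z) atTop (𝓝 ((1 + t) * (C + 0) + (1 + 1 / t) * 0)) :=
    ((tendsto_one_div_add_atTop_nhds_zero_nat.const_add C).const_mul _).add (h.const_mul _)
  have h2 : Q μ y ≤ (1 + t) * (C + 0) + (1 + 1 / t) * 0 := by
    refine ge_of_tendsto' h1 fun n => ?_
    have h3 := (hY n).Q_add_le_weight hμ (hy.sub hμ (hY n)) ht0
    rw [show (fun z => Y n z + (y z - Y n z)) = y by ext z; ring] at h3
    have h4 := mul_le_mul_of_nonneg_left (hC n) (by positivity : 0 ≤ 1 + t)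
    linarith
  have h5 : t * C ≤ ε := by
    rw [ht, div_mul_eq_mul_div, div_le_iff₀ (by positivity)]
    nlinarith
  linarith

/-- `φ` is an extremal function of `M` at order `m`. -/
structure Extremal (μ : Measure ℂ) (M : Set (ℂ → ℂ)) (m : ℕ) (φ : ℂ → ℂ) : Prop where
  mem : φ ∈ M
  tc_ne : tc φ m ≠ 0
  Q_eq : Q μ φ = 1
  le : ∀ x ∈ M, ‖tc x m‖ ^ 2 ≤ ‖tc φ m‖ ^ 2 * Q μ x

lemma ClosedInvSubspace.exists_extremal (hμ : OnCircle μ) (hM : ClosedInvSubspace μ M) {m : ℕ}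
    (hm : MinOrd M m) : ∃ φ, Extremal μ M m φ := by
  obtain ⟨f, hf, hfm⟩ := hm.2
  set S : Set (ℂ → ℂ) := {g | g ∈ M ∧ tc g m = 1} with hS
  have hsc : ∀ g ∈ M, tc g m ≠ 0 → (fun z => (tc g m)⁻¹ * g z) ∈ S := fun g hg h =>
    ⟨hM.smul_mem _ _ hg, by rw [tc_const_mul (hM.memD hg).1.1, inv_mul_cancel₀ h]⟩
  obtain ⟨Y, hYS, hYm, y, hy, hyY, -⟩ := exists_limit_of_almost_min hμ (S := fun _ => S)
    (fun _ _ _ => le_rfl) (fun _ x hx => hM.memD hx.1)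
    (fun _ x hx u hu => ⟨fun z => 2⁻¹ * (x z + u z), ⟨hM.smul_mem _ _ (hM.add_mem _ hx.1 _ hu.1), by
      have hd : DifferentiableOn ℂ (fun z => x z + u z) disc :=
        (hM.memD hx.1).1.1.add (hM.memD hu.1).1.1
      rw [tc_const_mul hd, tc_add (hM.memD hx.1).1.1 (hM.memD hu.1).1.1, hx.2, hu.2]; norm_num⟩, fun _ _ => rfl⟩)
    (fun _ => ⟨_, hsc f hf hfm, le_rfl⟩)
  have hyM : y ∈ M := hM.mem_of_tendsto hμ (fun n => (hYS n).1) hy hyY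
  have hYD : ∀ n, MemD μ (Y n) := fun n => hM.memD (hYS n).1
  have hty : tc y m = 1 := by
    have h1 : ‖tc y m - 1‖ ^ 2 ≤ 0 := by
      refine ge_of_tendsto' hyY fun n => ?_
      have h2 := (hy.sub hμ (hYD n)).tc_sq_le_Q hμ m
      rwa [tc_sub hy.1.1 (hYD n).1.1, (hYS n).2] at h2
    have h2 : ‖tc y m - 1‖ = 0 := by
      have := norm_nonneg (tc y m - 1)
      nlinarith
    exact sub_eq_zero.1 (norm_eq_zero.1 h2)
  have hQy : ∀ x ∈ S, Q μ y ≤ Q μ x := fun x hx =>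
    Q_le_of_tendsto hμ hYD hy hyY ((hM.memD hx.1).Q_nonneg hμ) fun n => hYm n x hx
  have h1Q : 1 ≤ Q μ y := by
    have := hy.tc_sq_le_Q hμ m
    rwa [hty, norm_one, one_pow] at this
  set c : ℝ := (Real.sqrt (Q μ y))⁻¹ with hc
  have hc2 : c ^ 2 * Q μ y = 1 := by
    rw [hc, inv_pow, Real.sq_sqrt (by linarith), inv_mul_cancel₀ (by linarith)]
  have hc0 : c ≠ 0 := fun h => by rw [h] at hc2; norm_num at hc2
  have hnc : ‖(c : ℂ)‖ ^ 2 = c ^ 2 := by rw [Complex.norm_real, Real.norm_eq_abs, sq_abs]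
  have htφ : tc (fun z => (c : ℂ) * y z) m = c := by rw [tc_const_mul hy.1.1, hty, mul_one]
  refine ⟨fun z => c * y z, hM.smul_mem _ _ hyM, ?_, ?_, fun x hx => ?_⟩
  · rw [htφ]; exact_mod_cast hc0
  · rw [hy.Q_const_mul hμ, hnc, hc2]
  · rw [htφ, hnc]
    by_cases h : tc x m = 0
    · rw [h]
      have := (hM.memD hx).Q_nonneg hμ
      rw [norm_zero, zero_pow two_ne_zero]
      exact mul_nonneg (sq_nonneg c) this
    · have h3 := hQy _ (hsc x hx h)
      rw [(hM.memD hx).Q_const_mul hμ, norm_inv, inv_pow, inv_mul_eq_div,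
        le_div_iff₀ (by positivity)] at h3
      have h4 := mul_le_mul_of_nonneg_left h3 (sq_nonneg c)
      rwa [← mul_assoc, hc2, one_mul] at h4

variable {m : ℕ} {φ : ℂ → ℂ}

lemma Extremal.Q_add (hμ : OnCircle μ) (hM : ClosedInvSubspace μ M) (hφ : Extremal μ M m φ)
    {y : ℂ → ℂ} (hy : y ∈ M) (hy0 : tc y m = 0) (c : ℂ) :
    Q μ (fun z => c * φ z + y z) = ‖c‖ ^ 2 + Q μ y := by
  have hφD := hM.memD hφ.mem
  have key : ∀ u ∈ M, tc u m = 0 → Q μ (fun z => φ z + u z) = 1 + Q μ u := by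
    intro u hu hu0
    have huD := hM.memD hu
    have h1 : ∀ x : ℝ, 0 ≤ x * (Q μ (fun z => φ z + u z) - Q μ φ - Q μ u) + x ^ 2 * Q μ u := by
      intro x
      have hxu := hM.smul_mem x u hu
      have h2 := hφ.le _ (hM.add_mem _ hφ.mem _ hxu)
      rw [tc_add hφD.1.1 (huD.1.1.const_mul _), tc_const_mul huD.1.1, hu0, mul_zero, add_zero,
        hφD.Q_quadratic hμ huD, hφ.Q_eq] at h2
      have h3 : 0 < ‖tc φ m‖ ^ 2 := by have := hφ.tc_ne; positivity
      have h4 := le_of_mul_le_mul_left ((mul_one _).trans_le h2) h3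
      rw [hφ.Q_eq]
      linarith
    set B := Q μ (fun z => φ z + u z) - Q μ φ - Q μ u with hB
    have hq := huD.Q_nonneg hμ
    have h5 : B = 0 := by
      by_contra hB0
      have h6 := h1 (-B / (Q μ u + 1))
      have h7 : -B / (Q μ u + 1) * B + (-B / (Q μ u + 1)) ^ 2 * Q μ u =
          - (B ^ 2 / (Q μ u + 1) ^ 2) := by
        field_simp
        ring
      rw [h7] at h6
      have : 0 < B ^ 2 / (Q μ u + 1) ^ 2 := by positivity
      linarith
    rw [hB, hφ.Q_eq] at h5
    linarith
  by_cases hc : c = 0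
  · simp [hc]
  · have h1 := key _ (hM.smul_mem c⁻¹ y hy) (by rw [tc_const_mul (hM.memD hy).1.1, hy0, mul_zero])
    have h2 := (hφD.add hμ ((hM.memD hy).const_mul hμ c⁻¹)).Q_const_mul hμ c
    rw [h1, (hM.memD hy).Q_const_mul hμ] at h2
    have hcn : ‖c‖ ≠ 0 := norm_ne_zero_iff.2 hc
    rw [show (fun z => c * φ z + y z) = fun z => c * (φ z + c⁻¹ * y z) by
      ext z; field_simp, h2, norm_inv]
    field_simp

lemma Extremal.nz (hM : ClosedInvSubspace μ M) (hφ : Extremal μ M m φ) : NZ φ :=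
  nz_of_tc_ne (hM.memD hφ.mem).1.1 hφ.tc_ne

lemma Extremal.norm_le_one (hμ : OnCircle μ) (hM : ClosedInvSubspace μ M) (hm : MinOrd M m)
    (hφ : Extremal μ M m φ) : ∀ z ∈ disc, ‖φ z‖ ≤ 1 := by
  have hφD := hM.memD hφ.mem
  have hφ0 := hφ.nz hM
  have h10 : (1 : ℂ) ≠ 0 := one_ne_zero
  have hGb := memHinf_cut hφD.1 hφ0 (memHardy2_const 1) (nz_const h10)
  have hFD := (hφD.cut_const_mul hμ hφ0 h10).1
  have hFM := hM.bdd_mul_mem hμ hφ.mem hGb hFD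
  have ia := hφD.1.integrable_lg hφ0
  have hp : Integrable (fun t => max 0 (lg φ t)) cm := (integrable_zero _ _ _).sup ia
  have h1 := hφ.le _ hFM
  rw [(tc_mul_of_vanish hGb.1 hφD.1.1 (hm.1 φ hφ.mem)).2, norm_mul, mul_pow, mul_comm] at h1
  have h3 : 0 < ‖tc φ m‖ ^ 2 := by have := hφ.tc_ne; positivity
  have h2 := le_of_mul_le_mul_left h1 h3
  have h4 : ul (En μ fun z => cut φ (fun _ => 1) z * φ z) ≤ ul (En μ φ) :=
    le_of_tendsto_of_tendsto' (hFD.tendsto_En hμ) (hφD.tendsto_En hμ) fun n =>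
      En_mono hμ hFD.1 hφD.1 (fun w hw => Dw_cut_const_mul_le hφD.1 hφ0 h10 hw) n
  have h5 : ‖cut φ (fun _ => 1) 0‖ ^ 2 = Real.exp (-(2 * ∫ t, max 0 (lg φ t) ∂cm)) := by
    rw [cut, norm_outr (integrable_cut hφD.1 hφ0 (memHardy2_const 1) (nz_const h10)) zero_mem_disc,
      pm_zero, sq, ← Real.exp_add, ← two_mul, ← mul_neg, ← integral_neg]
    congr 3 with t
    rw [lg_const, norm_one, Real.log_one, zero_sub]
    rcases le_total (lg φ t) 0 with h | h
    · rw [max_eq_left h, min_eq_left (by linarith), neg_zero]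
    · rw [max_eq_right h, min_eq_right (by linarith)]
  have h6 : Q μ (fun z => cut φ (fun _ => 1) z * φ z) = hardyNormSq (fun z =>
    cut φ (fun _ => 1) z * φ z) + ul (En μ fun z => cut φ (fun _ => 1) z * φ z) := rfl
  have h7 : 1 = hardyNormSq φ + ul (En μ φ) := hφ.Q_eq.symm
  obtain ⟨i1, e1⟩ := hφD.1.integrable_exp_two_lg hφ0 zero_mem_disc
  rw [pm_zero] at i1 e1
  have i2 : Integrable (fun t => ‖bdv (fun z => cut φ (fun _ => 1) z * φ z) t‖ ^ 2) cm :=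
    hFD.1.integrable_sq
  have i12 : Integrable (fun t => Real.exp (2 * lg φ t) -
      ‖bdv (fun z => cut φ (fun _ => 1) z * φ z) t‖ ^ 2) cm := i1.sub i2
  have h8 : ∫ t, (Real.exp (2 * lg φ t) - ‖bdv (fun z => cut φ (fun _ => 1) z * φ z) t‖ ^ 2 -
      2 * max 0 (lg φ t)) ∂cm ≤ 0 := by
    rw [integral_sub i12 (hp.const_mul 2), integral_sub i1 i2, integral_const_mul, e1,
      ← hφD.1.norm_eq, ← hFD.1.norm_eq]
    have := Real.add_one_le_exp (-(2 * ∫ t, max 0 (lg φ t) ∂cm))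
    linarith
  have h9 : ∀ᵐ t ∂cm, 0 ≤ Real.exp (2 * lg φ t) -
      ‖bdv (fun z => cut φ (fun _ => 1) z * φ z) t‖ ^ 2 - 2 * max 0 (lg φ t) ∧
      (Real.exp (2 * lg φ t) -
      ‖bdv (fun z => cut φ (fun _ => 1) z * φ z) t‖ ^ 2 - 2 * max 0 (lg φ t) = 0 →
      lg φ t ≤ 0) := by
    filter_upwards [norm_bdv_cut_mul hφD.1 hφ0 (memHardy2_const 1) (nz_const h10)] with t ht
    rw [ht, lg_const, norm_one, Real.log_one, sq, ← Real.exp_add]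
    rcases le_total (lg φ t) 0 with h | h
    · rw [min_eq_left h, max_eq_left h, two_mul]
      simp [h]
    · rw [min_eq_right h, max_eq_right h, add_zero, Real.exp_zero]
      have h10 := Real.add_one_le_exp (2 * lg φ t)
      refine ⟨by linarith, fun he => ?_⟩
      by_contra hne
      have := Real.add_one_lt_exp (x := 2 * lg φ t) (by intro h; apply hne; linarith)
      linarith
  have i3 := i12.sub (hp.const_mul 2)
  have h11 := (integral_eq_zero_iff_of_nonneg_ae (h9.mono fun t ht => ht.1) i3).1
    (le_antisymm h8 (integral_nonneg_of_ae (h9.mono fun t ht => ht.1)))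
  refine fun z hz => hφD.1.norm_le_of_bdv ?_ hz
  filter_upwards [h9, h11, hφD.1.exp_lg hφ0] with t h12 h13 h14
  rw [← h14]
  exact Real.exp_le_one_iff.2 (h12.2 h13)

end

section

variable {μ : Measure ℂ} [IsFiniteMeasure μ] {M : Set (ℂ → ℂ)} {m : ℕ} {φ : ℂ → ℂ}

lemma Dw_add_const {f : ℂ → ℂ} (hf : MemHardy2 f) (c : ℂ) {w : ℂ} (hw : w ∈ disc) :
    Dw (fun z => f z + c) w = Dw f w := by
  rw [← (hf.add (memHardy2_const c)).hardyNormSq_dslope hw, ← hf.hardyNormSq_dslope hw]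
  congr 1
  ext z
  by_cases h : z = w
  · rw [h, dslope_same, dslope_same, deriv_add_const]
  · rw [dslope_of_ne _ h, dslope_of_ne _ h, slope_def_field, slope_def_field, add_sub_add_right_eq_sub]

lemma MemHardy2.hardyNormSq_eq_Dw_zero {f : ℂ → ℂ} (hf : MemHardy2 f) :
    hardyNormSq f = Dw f 0 + ‖f 0‖ ^ 2 := by
  have h := hf.Dw_mul zero_mem_disc
  rw [pm_zero, ← hf.norm_eq] at h
  simp at h
  linarith

lemma hardyNormSq_add_const {f : ℂ → ℂ} (hf : MemHardy2 f) (h0 : f 0 = 0) (c : ℂ) :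
    hardyNormSq (fun z => f z + c) = hardyNormSq f + ‖c‖ ^ 2 := by
  rw [(hf.add (memHardy2_const c)).hardyNormSq_eq_Dw_zero, hf.hardyNormSq_eq_Dw_zero,
    Dw_add_const hf c zero_mem_disc, h0]
  simp

lemma Extremal.tendsto_poly_mul (hμ : OnCircle μ) (hM : ClosedInvSubspace μ M)
    (hm : MinOrd M m) (hφ : Extremal μ M m φ) (p : Polynomial ℂ) :
    Tendsto (fun n => ∫ ζ, Dw (fun z => p.eval z) (rn n * ζ) * ‖φ (rn n * ζ)‖ ^ 2 ∂μ)
      (hyperfilter ℕ)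
      (𝓝 (Q μ (fun z => p.eval z * φ z) - hardyNormSq fun z => p.eval z)) := by
  have hφD := hM.memD hφ.mem
  have hmem : ∀ n : ℕ, ∀ᵐ ζ ∂μ, (rn n : ℂ) * ζ ∈ disc := fun n => by
    filter_upwards [ae_circle hμ] with ζ hζ
    exact mul_circle_mem (rn_nonneg n) (rn_lt_one n) hζ
  induction p using Polynomial.recOnHorner with
  | M0 =>
    have h1 := hφD.Q_const_mul hμ 0
    have h2 := hardyNormSq_const_mul (memHardy2_const 1) 0
    simp only [zero_mul, norm_zero, ne_eq, OfNat.ofNat_ne_zero, not_false_eq_true, zero_pow] at h1 h2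
    simp only [Polynomial.eval_zero, zero_mul, Dw_const, h1, h2, integral_zero, sub_zero]
    exact tendsto_const_nhds
  | MC p a hp0 _ ih =>
    have hp : p.eval 0 = 0 := by rwa [← Polynomial.coeff_zero_eq_eval_zero]
    have hpM := hM.poly_mul_mem hφ.mem p
    have h1 := (tc_mul_of_vanish (memHardy2_poly p).1 hφD.1.1 (hm.1 φ hφ.mem)).2
    rw [hp, zero_mul] at h1
    have h2 := hφ.Q_add hμ hM hpM h1 a
    simp only [Polynomial.eval_add, Polynomial.eval_C]
    rw [hardyNormSq_add_const (memHardy2_poly p) hp, show (fun z => (p.eval z + a) * φ z) =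
      fun z => a * φ z + p.eval z * φ z by ext z; ring, h2,
      show ∀ x y z : ℝ, x + y - (z + x) = y - z by intros; ring]
    refine ih.congr fun n => integral_congr_ae ?_
    filter_upwards [hmem n] with ζ hζ
    rw [Dw_add_const (memHardy2_poly p) a hζ]
  | MX p _ ih =>
    have hpD := hφD.poly_mul hμ p
    have h1 := hpD.Q_id_mul hμ
    have e1 : (fun z => Polynomial.eval z (p * Polynomial.X)) = fun z => z * p.eval z := by
      ext z; simp [mul_comm]
    rw [show (fun z => Polynomial.eval z (p * Polynomial.X) * φ z) = fun z => z * (p.eval z * φ z) by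
      ext z; simp; ring, e1, h1, hardyNormSq_id_mul (memHardy2_poly p), add_sub_right_comm]
    refine (ih.add (hpD.tendsto_bet hμ)).congr fun n => ?_
    have hc : ContinuousOn (fun z => Dw (fun z => p.eval z) z * ‖φ z‖ ^ 2) disc :=
      (continuousOn_Dw (memHardy2_poly p)).mul (hφD.1.1.continuousOn.norm.pow 2)
    rw [← integral_add (integrable_radial hμ hc n) (integrable_norm_sq hμ hpD.1.1 n)]
    refine integral_congr_ae ?_
    filter_upwards [hmem n] with ζ hζ
    rw [Dw_id_mul (memHardy2_poly p) hζ, norm_mul]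
    ring

lemma memD_poly (hμ : OnCircle μ) (p : Polynomial ℂ) : MemD μ fun z => p.eval z :=
  ((memD_const hμ 1).poly_mul hμ p).congr hμ fun _ _ => mul_one _

lemma Extremal.Q_poly_mul_le (hμ : OnCircle μ) (hM : ClosedInvSubspace μ M)
    (hm : MinOrd M m) (hφ : Extremal μ M m φ) (p : Polynomial ℂ) :
    Q μ (fun z => p.eval z * φ z) ≤ Q μ fun z => p.eval z := by
  have hφD := hM.memD hφ.mem
  have h1 : Q μ (fun z => p.eval z * φ z) - (hardyNormSq fun z => p.eval z) ≤
      ul (En μ fun z => p.eval z) := by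
    refine le_of_tendsto_of_tendsto' (hφ.tendsto_poly_mul hμ hM hm p)
      ((memD_poly hμ p).tendsto_En hμ) fun n => ?_
    have hc : ContinuousOn (fun z => Dw (fun z => p.eval z) z * ‖φ z‖ ^ 2) disc :=
      (continuousOn_Dw (memHardy2_poly p)).mul (hφD.1.1.continuousOn.norm.pow 2)
    refine integral_mono_ae (integrable_radial hμ hc n) (integrable_Dw hμ (memHardy2_poly p) n) ?_
    filter_upwards [ae_circle hμ] with ζ hζ
    have hd := mul_circle_mem (rn_nonneg n) (rn_lt_one n) hζ
    exact mul_le_of_le_one_right (Dw_nonneg _ hd)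
      (pow_le_one₀ (norm_nonneg _) (hφ.norm_le_one hμ hM hm _ hd))
  have h2 : (Q μ fun z => p.eval z) = (hardyNormSq fun z => p.eval z) +
    ul (En μ fun z => p.eval z) := rfl
  linarith

lemma Extremal.isMultiplier (hμ : OnCircle μ) (hM : ClosedInvSubspace μ M)
    (hm : MinOrd M m) (hφ : Extremal μ M m φ) : IsMultiplier μ φ := by
  have hφD := hM.memD hφ.mem
  refine ⟨hφD.1.1, fun g hg => ?_⟩
  obtain ⟨q, hq1, hq2, hq3, -⟩ := hg.1.exists_poly
  obtain ⟨B, hB⟩ := exists_Q_bound hμ hg (memD_const hμ 0) (memD_const hμ 1) (a := 8) (b := 0)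
    (c := 2) (by norm_num) le_rfl (by norm_num)
  refine (MemD.of_tendsto hμ (Y := fun j z => φ z * (q j).eval z)
    (C := 2 * hardyNormSq g + 2 + B) (fun j => ?_) (fun j => ?_) ?_ ?_).1
  · exact (hφD.poly_mul hμ (q j)).congr hμ fun z _ => mul_comm _ _
  · have h1 := hφ.Q_poly_mul_le hμ hM hm (q j)
    have h2 := (hB _ (memHardy2_poly (q j)) fun w hw => by
      have := hq2 j w hw; simpa using this).2
    have h3 := hq3 j
    rw [show (fun z => φ z * (q j).eval z) = fun z => (q j).eval z * φ z by ext z; ring]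
    linarith
  · exact hφD.1.1.mul hg.1.1
  · exact fun z hz => (hq1 z hz).const_mul _

end

section

variable {μ : Measure ℂ} [IsFiniteMeasure μ] {M : Set (ℂ → ℂ)} {m : ℕ} {φ : ℂ → ℂ}

/-- The backward shift relative to `φ`: subtract the multiple of `φ` cancelling the coefficient of
order `m`, then divide by `z`. -/
def relShift (φ : ℂ → ℂ) (m : ℕ) (x : ℂ → ℂ) : ℂ → ℂ :=
  dslope (fun z => x z - tc x m / tc φ m * φ z) 0

lemma Extremal.relShift_spec (hμ : OnCircle μ) (hM : ClosedInvSubspace μ M) (hm : MinOrd M m)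
    (hφ : Extremal μ M m φ) {x : ℂ → ℂ} (hx : x ∈ M) :
    relShift φ m x ∈ M ∧ (∀ z ∈ disc, z * relShift φ m x z = x z - tc x m / tc φ m * φ z) ∧
      Q μ (relShift φ m x) + bet μ (relShift φ m x) ≤ Q μ x := by
  have hφD := hM.memD hφ.mem
  have hxD := hM.memD hx
  set y : ℂ → ℂ := fun z => x z - tc x m / tc φ m * φ z with hy
  have hyM : y ∈ M := hM.sub_mem hx (hM.smul_mem _ _ hφ.mem)
  have hyD := hM.memD hyM
  have hty : tc y m = 0 := by
    rw [hy, tc_sub hxD.1.1 (hφD.1.1.const_mul _), tc_const_mul hφD.1.1,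
      div_mul_cancel₀ _ hφ.tc_ne, sub_self]
  have hy0 : y 0 = 0 := by
    rw [← tc_zero y]
    rcases Nat.eq_zero_or_pos m with h | h
    · rw [← h]; exact hty
    · exact hm.1 y hyM 0 h
  have hz : ∀ z ∈ disc, z * dslope y 0 z = y z := fun z _ => by
    have := sub_smul_dslope y 0 z
    rwa [sub_zero, hy0, sub_zero, smul_eq_mul] at this
  have hd := (hyD.dslope hμ).1.1
  have hzM : (fun z => z * dslope y 0 z) ∈ M := hM.congr hμ hyM fun z h => (hz z h).symm
  have htz : tc (fun z => z * dslope y 0 z) m = 0 := by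
    rw [tc_congr (hM.memD hzM).1.1 hz m, hty]
  have hLM : dslope y 0 ∈ M := hM.div_mem hμ hm hd hzM htz
  refine ⟨hLM, hz, ?_⟩
  have h1 := hφ.Q_add hμ hM hzM htz (tc x m / tc φ m)
  rw [(hM.memD hLM).Q_id_mul hμ, Q_congr hμ (g := x) fun z h => by rw [hz z h, hy]; ring] at h1
  change Q μ (dslope y 0) + bet μ (dslope y 0) ≤ _
  have := sq_nonneg ‖tc x m / tc φ m‖
  linarith

lemma MemD.Q_pow_mul (hμ : OnCircle μ) {f : ℂ → ℂ} (hf : MemD μ f) (n : ℕ) :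
    MemD μ (fun z => z ^ n * f z) ∧ Q μ (fun z => z ^ n * f z) = Q μ f + n * bet μ f ∧
      bet μ (fun z => z ^ n * f z) = bet μ f := by
  induction n with
  | zero => simpa using hf
  | succ n ih =>
    rw [show (fun z => z ^ (n + 1) * f z) = fun z => z * (z ^ n * f z) by ext z; ring]
    refine ⟨ih.1.id_mul hμ, ?_, ?_⟩
    · rw [ih.1.Q_id_mul hμ, ih.2.1, ih.2.2]; push_cast; ring
    · rw [ih.1.bet_id_mul hμ, ih.2.2]

lemma exists_mul_le_one {b : ℕ → ℝ} (hb : ∀ n, 0 ≤ b n) {C : ℝ}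
    (h : ∀ n, ∑ k ∈ Finset.range n, b k ≤ C) (N : ℕ) : ∃ n ≥ N, n * b n ≤ 1 := by
  by_contra! hc
  have hs : Summable b := summable_of_sum_range_le hb h
  refine Real.not_summable_one_div_natCast (hs.of_norm_bounded_eventually_nat ?_)
  filter_upwards [eventually_ge_atTop (N + 1)] with n hn
  have hn0 : (0 : ℝ) < n := by exact_mod_cast (by omega : 0 < n)
  rw [Real.norm_of_nonneg (by positivity), div_le_iff₀ hn0, mul_comm]
  exact (hc n (by omega)).le

lemma Extremal.eq_closedSpan (hμ : OnCircle μ) (hM : ClosedInvSubspace μ M) (hm : MinOrd M m)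
    (hφ : Extremal μ M m φ) : M = closedSpan μ φ := by
  have hφD := hM.memD hφ.mem
  refine Subset.antisymm (fun x hx => ?_) (hM.closedSpan_subset hφ.mem)
  have hN := closedInvSubspace_closedSpan hμ hφD
  set s : ℕ → ℂ → ℂ := fun n => (relShift φ m)^[n] x with hs
  have hs1 : ∀ n, s (n + 1) = relShift φ m (s n) := fun n => Function.iterate_succ_apply' _ _ _
  have hsM : ∀ n, s n ∈ M := by
    intro n
    induction n with
    | zero => exact hx
    | succ n ih => rw [hs1]; exact (hφ.relShift_spec hμ hM hm ih).1
  have hsD := fun n => hM.memD (hsM n)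
  have hstep : ∀ n, Q μ (s (n + 1)) + bet μ (s (n + 1)) ≤ Q μ (s n) := fun n => by
    rw [hs1]; exact (hφ.relShift_spec hμ hM hm (hsM n)).2.2
  have hsum : ∀ n, Q μ (s n) + ∑ k ∈ Finset.range n, bet μ (s (k + 1)) ≤ Q μ x := by
    intro n
    induction n with
    | zero => simp [hs]
    | succ n ih =>
      rw [Finset.sum_range_succ]
      have := hstep n
      linarith
  have hb : ∀ n, 0 ≤ bet μ (s n) := fun n => (hsD n).bet_nonneg hμ
  have hsQ : ∀ n, Q μ (s n) ≤ Q μ x := fun n => by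
    have := Finset.sum_nonneg fun k (_ : k ∈ Finset.range n) => hb (k + 1)
    have := hsum n
    linarith
  have hmem : ∀ n, (fun z => x z - z ^ n * s n z) ∈ closedSpan μ φ := by
    intro n
    induction n with
    | zero =>
      refine hN.congr hμ (hN.smul_mem 0 _ (self_mem_closedSpan hμ hφD)) fun z _ => ?_
      simp [hs]
    | succ n ih =>
      have h1 := poly_mul_mem_closedSpan hμ hφD
        (Polynomial.C (tc (s n) m / tc φ m) * Polynomial.X ^ n)
      refine hN.congr hμ (hN.add_mem _ ih _ h1) fun z hz => ?_
      have h2 := (hφ.relShift_spec hμ hM hm (hsM n)).2.1 z hz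
      rw [← hs1] at h2
      simp only [Polynomial.eval_mul, Polynomial.eval_C, Polynomial.eval_pow, Polynomial.eval_X]
      linear_combination z ^ n * h2
  have hex : ∀ N : ℕ, ∃ n ≥ N, n * bet μ (s n) ≤ 2 := by
    intro N
    obtain ⟨n, hn, h1⟩ := exists_mul_le_one (fun n => hb (n + 1)) (C := Q μ x) (fun n => by
      have := hsum n
      have := (hsD n).Q_nonneg hμ
      linarith) (N + 1)
    refine ⟨n + 1, by omega, ?_⟩
    push_cast
    have hn1 : (1 : ℝ) ≤ n := by exact_mod_cast (by omega : 1 ≤ n)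
    nlinarith [hb (n + 1)]
  choose n hn hn2 using hex
  obtain ⟨y, hy, hyx⟩ := hN.exists_weak_limit hμ (h := fun k z => x z - z ^ n k * s (n k) z)
    (fun k => hmem _) (C := 2 * Q μ x + 2 * (Q μ x + 2)) (fun k => by
      have h1 := (hsD (n k)).Q_pow_mul hμ (n k)
      have h2 := (hM.memD hx).Q_sub_le hμ h1.1
      have h3 := hsQ (n k)
      have h4 := hn2 k
      rw [h1.2.1] at h2
      linarith) Subset.rfl (l := x) (fun z hz => by
      have hz1 : ‖z‖ < 1 := mem_disc.1 hz
      have h1 : Tendsto (fun k => ‖z‖ ^ k * Real.sqrt (2 / (1 - ‖z‖) * Q μ x)) atTop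
          (𝓝 (0 * Real.sqrt (2 / (1 - ‖z‖) * Q μ x))) :=
        (tendsto_pow_atTop_nhds_zero_of_lt_one (norm_nonneg z) hz1).mul_const _
      rw [zero_mul] at h1
      have h2 : Tendsto (fun k => z ^ n k * s (n k) z) atTop (𝓝 0) := by
        refine squeeze_zero_norm (fun k => ?_) h1
        rw [norm_mul, norm_pow]
        refine mul_le_mul (pow_le_pow_of_le_one (norm_nonneg z) hz1.le (hn k))
          (Real.le_sqrt_of_sq_le ?_) (norm_nonneg _) (by positivity)
        refine ((hsD (n k)).norm_sq_le_Q hμ hz).trans ?_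
        have : 0 < 1 - ‖z‖ := by linarith
        exact mul_le_mul_of_nonneg_left (hsQ _) (by positivity)
      simpa using h2.const_sub (x z))
  exact hN.congr hμ hy hyx

end

section HardyLimit

lemma onCircle_zero : OnCircle (0 : Measure ℂ) := by simp [OnCircle]

lemma memD_zero_measure {f : ℂ → ℂ} (hf : MemHardy2 f) : MemD 0 f :=
  memD_of_En_le onCircle_zero hf (C := 0) fun n => by simp [En]

lemma Q_zero_measure (f : ℂ → ℂ) : Q 0 f = hardyNormSq f := by
  rw [Q, ul_eq (x := 0) (by simp [show En 0 f = fun _ => 0 by ext n; simp [En]]), add_zero]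

lemma exists_hardy_limit {Y : ℕ → ℂ → ℂ} (hY : ∀ k, MemHardy2 (Y k))
    (h : ∀ ε > 0, ∃ N, ∀ m ≥ N, ∀ n ≥ N, hardyNormSq (fun z => Y m z - Y n z) ≤ ε) :
    ∃ y, MemHardy2 y ∧ Tendsto (fun n => hardyNormSq fun z => y z - Y n z) atTop (𝓝 0) ∧
      ∀ z ∈ disc, Tendsto (fun n => Y n z) atTop (𝓝 (y z)) := by
  obtain ⟨y, h1, h2, h3⟩ := exists_limit_of_cauchy onCircle_zero
    (fun k => memD_zero_measure (hY k)) (by simpa only [Q_zero_measure] using h)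
  exact ⟨y, h1.1, by simpa only [Q_zero_measure] using h2, h3⟩

end HardyLimit

section

variable {μ : Measure ℂ} [IsFiniteMeasure μ] {M : Set (ℂ → ℂ)} {m : ℕ} {φ : ℂ → ℂ}

lemma cauchy_of_Q_lt (hμ : OnCircle μ) {x : ℂ → ℂ} {y : ℕ → ℂ → ℂ} (hx : MemD μ x)
    (hy : ∀ k, MemD μ (y k)) (h : ∀ k : ℕ, Q μ (fun z => x z - y k z) < 1 / (k + 1)) {ε : ℝ}
    (hε : 0 < ε) : ∃ N, ∀ m ≥ N, ∀ n ≥ N, Q μ (fun z => y m z - y n z) ≤ ε := by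
  obtain ⟨N, hN⟩ := exists_nat_one_div_lt (show 0 < ε / 4 by positivity)
  have h1 : ∀ n ≥ N, Q μ (fun z => x z - y n z) ≤ ε / 4 := fun n hn =>
    (h n).le.trans ((one_div_le_one_div_of_le (by positivity) (by gcongr)).trans hN.le)
  refine ⟨N, fun m hm n hn => ?_⟩
  have h2 := (hx.sub hμ (hy n)).Q_sub_le hμ (hx.sub hμ (hy m))
  rw [show (fun z => (x z - y n z) - (x z - y m z)) = fun z => y m z - y n z by ext z; ring] at h2
  have := h1 m hm
  have := h1 n hn
  linarith

lemma tendsto_of_Q_lt (hμ : OnCircle μ) {x : ℂ → ℂ} {y : ℕ → ℂ → ℂ} (hx : MemD μ x)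
    (hy : ∀ k, MemD μ (y k)) (h : ∀ k : ℕ, Q μ (fun z => x z - y k z) < 1 / (k + 1)) {z : ℂ}
    (hz : z ∈ disc) : Tendsto (fun k => y k z) atTop (𝓝 (x z)) :=
  tendsto_of_Q_tendsto hμ hx hy (squeeze_zero (fun k => (hx.sub hμ (hy k)).Q_nonneg hμ)
    (fun k => (h k).le) tendsto_one_div_add_atTop_nhds_zero_nat) hz

lemma hardyNormSq_inner_mul {I f : ℂ → ℂ} (hI : IsInner I) (hf : MemHardy2 f) :
    hardyNormSq (fun z => I z * f z) = hardyNormSq f := by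
  rw [hf.norm_eq, (hf.bdd_mul hI.1 hI.2.1).norm_eq]
  refine integral_congr_ae ?_
  filter_upwards [bdv_mul hI.memHardy2 hf, hI.norm_bdv] with t h1 h2
  rw [h1, norm_mul, h2, one_mul]

lemma innerDivides_of_mem_closedSpan (hμ : OnCircle μ) {I F x : ℂ → ℂ} (hφ : MemD μ φ)
    (hI : IsInner I) (hF : MemHardy2 F) (hφF : ∀ z ∈ disc, φ z = I z * F z)
    (hx : x ∈ closedSpan μ φ) : InnerDivides I x := by
  obtain ⟨p, hp⟩ := exists_poly_of_mem_closedSpan hμ hφ hx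
  have hpF : ∀ q : Polynomial ℂ, MemHardy2 fun z => q.eval z * F z := fun q => by
    obtain ⟨hd, C, hC⟩ := memHinf_poly q
    exact hF.bdd_mul hd hC
  have hD := fun k => hφ.poly_mul hμ (p k)
  obtain ⟨y, hy, -, hlim⟩ := exists_hardy_limit (fun k => hpF (p k)) fun ε hε => by
    obtain ⟨N, hN⟩ := cauchy_of_Q_lt hμ hx.1 hD hp hε
    refine ⟨N, fun m hm n hn => le_trans ?_ (hN m hm n hn)⟩
    rw [← hardyNormSq_inner_mul hI ((hpF _).sub (hpF _)), hardyNormSq_congr (g := fun z =>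
      (p m).eval z * φ z - (p n).eval z * φ z) fun z hz => by rw [hφF z hz]; ring]
    exact ((hD m).sub hμ (hD n)).hardyNormSq_le_Q hμ
  refine ⟨y, hy, fun z hz => tendsto_nhds_unique (tendsto_of_Q_lt hμ hx.1 hD hp hz) ?_⟩
  refine ((hlim z hz).const_mul (I z)).congr fun k => ?_
  rw [hφF z hz]
  ring

lemma Extremal.const_mul (hμ : OnCircle μ) (hM : ClosedInvSubspace μ M)
    (hφ : Extremal μ M m φ) {c : ℂ} (hc : ‖c‖ = 1) : Extremal μ M m fun z => c * φ z := by
  have hd := (hM.memD hφ.mem).1.1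
  have hc0 : c ≠ 0 := fun h => by simp [h] at hc
  refine ⟨hM.smul_mem _ _ hφ.mem, ?_, ?_, fun x hx => ?_⟩
  · rw [tc_const_mul hd]
    exact mul_ne_zero hc0 hφ.tc_ne
  · rw [(hM.memD hφ.mem).Q_const_mul hμ, hc, hφ.Q_eq, one_pow, one_mul]
  · rw [tc_const_mul hd, norm_mul, hc, one_mul]
    exact hφ.le x hx

lemma ClosedInvSubspace.exists_extremal_inner_mul_outr (hμ : OnCircle μ)
    (hM : ClosedInvSubspace μ M) (hm : MinOrd M m) {Θ : ℂ → ℂ} (hΘ : IsGCDInner M Θ) :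
    ∃ φ, Extremal μ M m φ ∧ ∀ z ∈ disc, φ z = Θ z * outr (lg φ) z := by
  obtain ⟨φ, hφ⟩ := hM.exists_extremal hμ hm
  have hφD := hM.memD hφ.mem
  have hφ0 := hφ.nz hM
  have hspan := hφ.eq_closedSpan hμ hM hm
  have hI := hφD.1.isInner_gin hφ0
  obtain ⟨g, hg, hΘg⟩ := hΘ.2.2 _ hI fun x hx => innerDivides_of_mem_closedSpan hμ hφD hI
    (hφD.1.outr_lg hφ0) (fun z hz => hφD.1.gin_mul hφ0 hz) (hspan ▸ hx)
  obtain ⟨k, hk, hφk⟩ := hΘ.2.1 φ hφ.mem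
  obtain ⟨z0, hz0, hφz0⟩ := hφ0
  have hk0 : NZ k := ⟨z0, hz0, fun h => hφz0 (by rw [hφk z0 hz0, h, mul_zero])⟩
  have hφ0 := hφ.nz hM
  have hlk : ∀ᵐ t ∂cm, lg k t = lg φ t := by
    filter_upwards [bdv_mul hΘ.1.memHardy2 hk, hΘ.1.norm_bdv] with t h1 h2
    rw [lg, lg, bdv_congr hφk, h1, norm_mul, h2, one_mul]
  have hkle : ∀ z ∈ disc, ‖k z‖ ≤ ‖outr (lg φ) z‖ := fun z hz => by
    rw [← outr_congr hlk]
    exact hk.norm_le_outr hk0 hz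
  have hg1 : ∀ z ∈ disc, ‖g z‖ ≤ 1 := fun z hz => hg.memHardy2.norm_le_of_bdv (by
    filter_upwards [bdv_mul hI.memHardy2 hg.memHardy2, hΘ.1.norm_bdv, hI.norm_bdv] with t h1 h2 h3
    rw [bdv_congr hΘg, h1, norm_mul, h3, one_mul] at h2
    exact h2.le) hz
  obtain ⟨z1, hz1, hIz1⟩ : NZ (gin φ) := ⟨z0, hz0, fun h => hφz0 (by
    rw [hφD.1.gin_mul hφ0 hz0, h, zero_mul])⟩
  have hfo : ‖outr (lg φ) z1‖ = ‖g z1‖ * ‖k z1‖ := by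
    rw [← norm_mul]
    congr 1
    refine mul_left_cancel₀ hIz1 ?_
    rw [← hφD.1.gin_mul hφ0 hz1, hφk z1 hz1, hΘg z1 hz1]
    ring
  have hgz1 : ‖g z1‖ = 1 := by
    refine le_antisymm (hg1 z1 hz1) ?_
    have h1 : 0 < ‖outr (lg φ) z1‖ := norm_pos_iff.2 (outr_ne_zero _ _)
    have h2 := mul_le_mul_of_nonneg_left (hkle z1 hz1) (norm_nonneg (g z1))
    rw [← hfo] at h2
    exact le_of_mul_le_mul_right (by linarith) h1
  have hconst : EqOn g (Function.const ℂ (g z1)) disc := by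
    refine Complex.eqOn_of_isPreconnected_of_isMaxOn_norm (convex_ball 0 1).isPreconnected
      isOpen_disc hg.1 hz1 fun z hz => ?_
    change ‖g z‖ ≤ ‖g z1‖
    rw [hgz1]
    exact hg1 z hz
  refine ⟨fun z => g z1 * φ z, hφ.const_mul hμ hM hgz1, fun z hz => ?_⟩
  have hl : ∀ᵐ t ∂cm, lg (fun z => g z1 * φ z) t = lg φ t := by
    filter_upwards [bdv_const_mul hφD.1 (g z1)] with t h1
    rw [lg, lg, h1, norm_mul, hgz1, one_mul]
  rw [outr_congr hl, hΘg z hz, hconst hz, Function.const_apply]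
  linear_combination g z1 * hφD.1.gin_mul hφ0 hz

end

section

variable {μ : Measure ℂ} [IsFiniteMeasure μ] {M : Set (ℂ → ℂ)} {m : ℕ} {φ : ℂ → ℂ}

lemma MemHardy2.norm_sub_sq_le {f : ℂ → ℂ} (hf : MemHardy2 f) {w z : ℂ} (hw : w ∈ disc)
    (hz : z ∈ disc) : ‖f z - f w‖ ^ 2 ≤ ‖z - w‖ ^ 2 * (2 / (1 - ‖z‖) * Dw f w) := by
  have h := (hf.dslope hw).norm_sq_le hz
  rw [hf.hardyNormSq_dslope hw] at h
  rw [sub_mul_dslope f w z, add_sub_cancel_left, norm_mul, mul_pow]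
  gcongr

lemma rn_succ_sub (n : ℕ) : rn (n + 1) - rn n = (1 / 2) ^ (n + 2) := by
  simp only [rn]; ring

lemma exists_radial_limit {f : ℂ → ℂ} (hf : MemHardy2 f) {ζ : ℂ} (hζ : ‖ζ‖ = 1)
    (h : AwE f ζ < ∞) : ∃ l, Tendsto (fun n => f (rn n * ζ)) atTop (𝓝 l) := by
  have hd : ∀ n, (rn n : ℂ) * ζ ∈ disc := fun n => mul_circle_mem (rn_nonneg n) (rn_lt_one n) hζ
  set K : ℝ := (8 * AwE f ζ).toReal / Real.pi with hK
  have hb : ∀ n, Dw f (rn n * ζ) ≤ K := fun n => by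
    rw [hK, le_div_iff₀ Real.pi_pos, mul_comm]
    exact (ENNReal.ofReal_le_iff_le_toReal (ENNReal.mul_lt_top (by simp) h).ne).1
      (Dw_radial_le hf hζ (rn_nonneg n) (rn_lt_one n))
  have hq : √(1 / 2) < 1 := by
    rw [Real.sqrt_lt' one_pos]; norm_num
  refine cauchySeq_tendsto_of_complete
    (cauchySeq_of_le_geometric (√(1 / 2)) (√(K / 2)) hq fun n => ?_)
  have h1 := hf.norm_sub_sq_le (hd n) (hd (n + 1))
  have e1 : ‖(rn (n + 1) : ℂ) * ζ - rn n * ζ‖ = (1 / 2) ^ (n + 2) := by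
    rw [← sub_mul, norm_mul, hζ, mul_one, ← Complex.ofReal_sub, rn_succ_sub, Complex.norm_real,
      Real.norm_of_nonneg (by positivity)]
  have e2 : 1 - ‖(rn (n + 1) : ℂ) * ζ‖ = (1 / 2) ^ (n + 2) := by
    rw [norm_mul, hζ, mul_one, Complex.norm_real, Real.norm_of_nonneg (rn_nonneg _)]
    simp only [rn]; ring
  rw [e1, e2] at h1
  rw [dist_comm, dist_eq_norm]
  refine abs_le_of_sq_le_sq' (a := ‖f (rn (n + 1) * ζ) - f (rn n * ζ)‖) ?_ (by positivity) |>.2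
  have hK0 : 0 ≤ K := (Dw_nonneg f (hd 0)).trans (hb 0)
  rw [mul_pow, Real.sq_sqrt (by positivity), ← pow_mul, mul_comm n, pow_mul,
    Real.sq_sqrt (by norm_num)]
  refine h1.trans ?_
  have e3 : ((1 / 2 : ℝ) ^ (n + 2)) ^ 2 * (2 / (1 / 2) ^ (n + 2) * Dw f (rn n * ζ)) =
      (1 / 2) ^ n / 2 * Dw f (rn n * ζ) := by
    field_simp
    ring
  rw [e3]
  calc (1 / 2 : ℝ) ^ n / 2 * Dw f (rn n * ζ) ≤ (1 / 2) ^ n / 2 * K := by gcongr; exact hb n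
    _ = _ := by ring

lemma MemD.ae_radial_limit (hμ : OnCircle μ) {f : ℂ → ℂ} (hf : MemD μ f) :
    ∀ᵐ ζ ∂μ, ∃ l, Tendsto (fun n => f (rn n * ζ)) atTop (𝓝 l) := by
  filter_upwards [ae_circle hμ, ae_lt_top (measurable_AwE f) (hf.DE_lt_top hμ).ne] with ζ hζ h
  exact exists_radial_limit hf.1 hζ h

lemma exists_Dw_poly_le (p : Polynomial ℂ) :
    ∃ C, 0 ≤ C ∧ ∀ w ∈ disc, Dw (fun z => p.eval z) w ≤ C := by
  induction p using Polynomial.recOnHorner with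
  | M0 => exact ⟨0, le_rfl, fun w _ => by simp [Dw_const]⟩
  | MC p a hp0 _ ih =>
    obtain ⟨C, hC0, hC⟩ := ih
    refine ⟨C, hC0, fun w hw => ?_⟩
    simp only [Polynomial.eval_add, Polynomial.eval_C]
    rw [Dw_add_const (memHardy2_poly p) a hw]
    exact hC w hw
  | MX p _ ih =>
    obtain ⟨C, hC0, hC⟩ := ih
    obtain ⟨B, hB⟩ := (memHinf_poly p).2
    refine ⟨C + B ^ 2, by positivity, fun w hw => ?_⟩
    have e1 : (fun z => Polynomial.eval z (p * Polynomial.X)) = fun z => z * p.eval z := by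
      ext z; simp [mul_comm]
    rw [e1, Dw_id_mul (memHardy2_poly p) hw]
    have := hB w hw
    have := hC w hw
    gcongr

lemma AwE_le_of_Dw_le {f g : ℂ → ℂ} (hf : MemHardy2 f) (hg : MemHardy2 g) {a : ℝ} (ha : 0 ≤ a)
    {b : ℝ} (h : ∀ w ∈ disc, Dw f w ≤ a * Dw g w + b) {ζ : ℂ} (hζ : ‖ζ‖ = 1) :
    AwE f ζ ≤ ENNReal.ofReal a * (8 * AwE g ζ) + ENNReal.ofReal (Real.pi * b) := by
  refine (AwE_le_liminf hf hζ).trans ?_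
  refine (liminf_le_liminf (Eventually.of_forall fun n => ?_)).trans (liminf_const _).le
  have hd := mul_circle_mem (rn_nonneg n) (rn_lt_one n) hζ
  calc ENNReal.ofReal (Real.pi * Dw f (rn n * ζ)) ≤
      ENNReal.ofReal (a * (Real.pi * Dw g (rn n * ζ)) + Real.pi * b) := by
        refine ENNReal.ofReal_le_ofReal ?_
        have := mul_le_mul_of_nonneg_left (h _ hd) Real.pi_pos.le
        linarith
    _ ≤ ENNReal.ofReal (a * (Real.pi * Dw g (rn n * ζ))) + ENNReal.ofReal (Real.pi * b) :=
        ENNReal.ofReal_add_le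
    _ ≤ _ := by
        rw [ENNReal.ofReal_mul ha]
        gcongr
        exact Dw_radial_le hg hζ (rn_nonneg n) (rn_lt_one n)

lemma AwE_lsc {Y : ℕ → ℂ → ℂ} {y : ℂ → ℂ} (hY : ∀ k, MemHardy2 (Y k)) (hy : MemHardy2 y)
    (hlim : ∀ z ∈ disc, Tendsto (fun k => Y k z) atTop (𝓝 (y z))) {ζ : ℂ} (hζ : ‖ζ‖ = 1) :
    AwE y ζ ≤ liminf (fun k => 8 * AwE (Y k) ζ) atTop := by
  refine (AwE_le_liminf hy hζ).trans ?_
  refine (liminf_le_liminf (Eventually.of_forall fun n => ?_)).trans (liminf_const _).le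
  refine (Dw_lsc hY hy hlim (mul_circle_mem (rn_nonneg n) (rn_lt_one n) hζ) Real.pi_pos.le).trans ?_
  exact liminf_le_liminf (Eventually.of_forall fun k =>
    Dw_radial_le (hY k) hζ (rn_nonneg n) (rn_lt_one n))

/-- The squared modulus of the radial limit of `f` at the points of the circle. -/
def radSq (f : ℂ → ℂ) (ζ : ℂ) : ℝ≥0∞ :=
  liminf (fun n => ENNReal.ofReal (‖f (rn n * ζ)‖ ^ 2)) atTop

lemma MemD.tendsto_radSq (hμ : OnCircle μ) {f : ℂ → ℂ} (hf : MemD μ f) :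
    ∀ᵐ ζ ∂μ, Tendsto (fun n => ENNReal.ofReal (‖f (rn n * ζ)‖ ^ 2)) atTop (𝓝 (radSq f ζ)) := by
  filter_upwards [hf.ae_radial_limit hμ] with ζ ⟨l, hl⟩
  have h := (ENNReal.continuous_ofReal.tendsto _).comp (hl.norm.pow 2)
  have e : radSq f ζ = ENNReal.ofReal (‖l‖ ^ 2) := h.liminf_eq
  rw [e]
  exact h

lemma aemeasurable_ofReal_norm_sq (hμ : OnCircle μ) {f : ℂ → ℂ} (hf : DifferentiableOn ℂ f disc)
    (n : ℕ) : AEMeasurable (fun ζ => ENNReal.ofReal (‖f (rn n * ζ)‖ ^ 2)) μ :=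
  (integrable_norm_sq hμ hf n).aestronglyMeasurable.aemeasurable.ennreal_ofReal

lemma MemD.aemeasurable_radSq (hμ : OnCircle μ) {f : ℂ → ℂ} (hf : MemD μ f) :
    AEMeasurable (radSq f) μ :=
  aemeasurable_of_tendsto_metrizable_ae atTop
    (fun n => aemeasurable_ofReal_norm_sq hμ hf.1.1 n) (hf.tendsto_radSq hμ)

lemma radSq_le_one {f : ℂ → ℂ} (hf : ∀ z ∈ disc, ‖f z‖ ≤ 1) {ζ : ℂ} (hζ : ‖ζ‖ = 1) :
    radSq f ζ ≤ 1 := by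
  refine (liminf_le_liminf (Eventually.of_forall fun n => ?_)).trans (liminf_const (1:ℝ≥0∞)).le
  rw [ENNReal.ofReal_le_one]
  exact pow_le_one₀ (norm_nonneg _) (hf _ (mul_circle_mem (rn_nonneg n) (rn_lt_one n) hζ))

lemma ofReal_integral_Dw_mul (hμ : OnCircle μ) {p f : ℂ → ℂ} (hp : MemHardy2 p)
    (hf : DifferentiableOn ℂ f disc) (n : ℕ) :
    ENNReal.ofReal (Real.pi * ∫ ζ, Dw p (rn n * ζ) * ‖f (rn n * ζ)‖ ^ 2 ∂μ) =
      ∫⁻ ζ, ENNReal.ofReal (Real.pi * Dw p (rn n * ζ)) * ENNReal.ofReal (‖f (rn n * ζ)‖ ^ 2) ∂μ := by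
  have hc : ContinuousOn (fun z => Dw p z * ‖f z‖ ^ 2) disc :=
    (continuousOn_Dw hp).mul (hf.continuousOn.norm.pow 2)
  have hnn : ∀ᵐ ζ ∂μ, 0 ≤ Dw p (rn n * ζ) := by
    filter_upwards [ae_circle hμ] with ζ hζ
    exact Dw_nonneg p (mul_circle_mem (rn_nonneg n) (rn_lt_one n) hζ)
  rw [← integral_const_mul, ofReal_integral_eq_lintegral_ofReal
    ((integrable_radial hμ hc n).const_mul _)]
  · refine lintegral_congr_ae ?_
    filter_upwards [hnn] with ζ h
    rw [← ENNReal.ofReal_mul (by positivity), mul_assoc]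
  · filter_upwards [hnn] with ζ h
    have := Real.pi_pos
    positivity

lemma Extremal.lintegral_AwE_radSq_le (hμ : OnCircle μ) (hM : ClosedInvSubspace μ M)
    (hm : MinOrd M m) (hφ : Extremal μ M m φ) (p : Polynomial ℂ) :
    ∫⁻ ζ, AwE (fun z => p.eval z) ζ * radSq φ ζ ∂μ ≤
      ENNReal.ofReal (Real.pi * Q μ fun z => p.eval z * φ z) := by
  have hφD := hM.memD hφ.mem
  have hlim := (ENNReal.continuous_ofReal.tendsto _).comp
    ((hφ.tendsto_poly_mul hμ hM hm p).const_mul Real.pi)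
  calc ∫⁻ ζ, AwE (fun z => p.eval z) ζ * radSq φ ζ ∂μ ≤
      ∫⁻ ζ, liminf (fun n => ENNReal.ofReal (Real.pi * Dw (fun z => p.eval z) (rn n * ζ)) *
        ENNReal.ofReal (‖φ (rn n * ζ)‖ ^ 2)) atTop ∂μ := by
        refine lintegral_mono_ae ?_
        filter_upwards [ae_circle hμ] with ζ hζ
        refine (mul_le_mul_left (AwE_le_liminf (memHardy2_poly p) hζ) _).trans ?_
        exact ENNReal.le_liminf_mul
    _ ≤ liminf (fun n => ∫⁻ ζ, ENNReal.ofReal (Real.pi * Dw (fun z => p.eval z) (rn n * ζ)) *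
        ENNReal.ofReal (‖φ (rn n * ζ)‖ ^ 2) ∂μ) atTop := by
        refine lintegral_liminf_le' fun n => ?_
        exact ((integrable_Dw hμ (memHardy2_poly p) n).aestronglyMeasurable.aemeasurable.const_mul
          _).ennreal_ofReal.mul (aemeasurable_ofReal_norm_sq hμ hφD.1.1 n)
    _ ≤ ENNReal.ofReal (Real.pi * (Q μ (fun z => p.eval z * φ z) -
        hardyNormSq fun z => p.eval z)) := by
        rw [← hlim.liminf_eq]
        simp_rw [← ofReal_integral_Dw_mul hμ (memHardy2_poly p) hφD.1.1]
        exact liminf_le_liminf_of_le Nat.hyperfilter_le_atTop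
    _ ≤ _ := by
        refine ENNReal.ofReal_le_ofReal ?_
        have := hardyNormSq_nonneg (memHardy2_poly p)
        have := Real.pi_pos
        gcongr
        linarith

lemma Extremal.Q_poly_mul_le_lintegral (hμ : OnCircle μ) (hM : ClosedInvSubspace μ M)
    (hm : MinOrd M m) (hφ : Extremal μ M m φ) (p : Polynomial ℂ) :
    ENNReal.ofReal (Real.pi * (Q μ (fun z => p.eval z * φ z) - hardyNormSq fun z => p.eval z)) ≤
      ∫⁻ ζ, 8 * AwE (fun z => p.eval z) ζ * radSq φ ζ ∂μ := by
  have hφD := hM.memD hφ.mem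
  have hφ1 := hφ.norm_le_one hμ hM hm
  have hlim := (ENNReal.continuous_ofReal.tendsto _).comp
    ((hφ.tendsto_poly_mul hμ hM hm p).const_mul Real.pi)
  obtain ⟨C, hC0, hC⟩ := exists_Dw_poly_le p
  have hA : ∀ᵐ ζ ∂μ, AwE (fun z => p.eval z) ζ ≤ ENNReal.ofReal (Real.pi * C) := by
    filter_upwards [ae_circle hμ] with ζ hζ
    have := AwE_le_of_Dw_le (memHardy2_poly p) (memHardy2_const 0) (a := 0) le_rfl (b := C)
      (fun w hw => by simpa using hC w hw) hζ
    simpa using this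
  have hdct : Tendsto (fun n => ∫⁻ ζ, 8 * AwE (fun z => p.eval z) ζ *
      ENNReal.ofReal (‖φ (rn n * ζ)‖ ^ 2) ∂μ) atTop
      (𝓝 (∫⁻ ζ, 8 * AwE (fun z => p.eval z) ζ * radSq φ ζ ∂μ)) := by
    refine tendsto_lintegral_of_dominated_convergence'
      (fun _ => 8 * ENNReal.ofReal (Real.pi * C)) (fun n => ?_) (fun n => ?_) ?_ ?_
    · exact ((measurable_AwE _).const_mul 8).aemeasurable.mul
        (aemeasurable_ofReal_norm_sq hμ hφD.1.1 n)
    · filter_upwards [hA, ae_circle hμ] with ζ h hζ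
      have h1 : ENNReal.ofReal (‖φ (rn n * ζ)‖ ^ 2) ≤ 1 := by
        rw [ENNReal.ofReal_le_one]
        exact pow_le_one₀ (norm_nonneg _) (hφ1 _ (mul_circle_mem (rn_nonneg n) (rn_lt_one n) hζ))
      calc _ ≤ 8 * ENNReal.ofReal (Real.pi * C) * 1 := by gcongr
        _ = _ := mul_one _
    · rw [lintegral_const]
      exact ENNReal.mul_ne_top (ENNReal.mul_ne_top (by simp) (by simp)) (measure_ne_top μ _)
    · filter_upwards [hA, hφD.tendsto_radSq hμ] with ζ h hζ
      refine ENNReal.Tendsto.const_mul hζ (Or.inr ?_)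
      exact ENNReal.mul_ne_top (by simp) (h.trans_lt (by simp)).ne
  refine le_of_tendsto_of_tendsto' hlim (hdct.mono_left Nat.hyperfilter_le_atTop) fun n => ?_
  simp only [Function.comp]
  rw [ofReal_integral_Dw_mul hμ (memHardy2_poly p) hφD.1.1]
  refine lintegral_mono_ae ?_
  filter_upwards [ae_circle hμ] with ζ hζ
  gcongr
  exact Dw_radial_le (memHardy2_poly p) hζ (rn_nonneg n) (rn_lt_one n)

lemma Extremal.outer_part_mul_mem (hμ : OnCircle μ) (hM : ClosedInvSubspace μ M)
    (hm : MinOrd M m) (hφ : Extremal μ M m φ) {p : ℕ → Polynomial ℂ} {C : ℝ}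
    (hC : ∀ k, Q μ (fun z => (p k).eval z * φ z) ≤ C) {g : ℂ → ℂ} (hg : MemHardy2 g)
    (hpg : ∀ z ∈ disc, Tendsto (fun k => (p k).eval z) atTop (𝓝 (g z))) {J g' : ℂ → ℂ}
    (hJ : IsInner J) (hg' : MemHardy2 g') (h : ∀ z ∈ disc, g z = J z * g' z) :
    (fun z => φ z * g' z) ∈ M := by
  have hφD := hM.memD hφ.mem
  have hφ1 := hφ.norm_le_one hμ hM hm
  have hB := hφD.aemeasurable_radSq hμ
  have h1 : ∫⁻ ζ, AwE g ζ * radSq φ ζ ∂μ ≤ 8 * ENNReal.ofReal (Real.pi * C) := by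
    calc ∫⁻ ζ, AwE g ζ * radSq φ ζ ∂μ ≤
        ∫⁻ ζ, liminf (fun k => 8 * AwE (fun z => (p k).eval z) ζ * radSq φ ζ) atTop ∂μ := by
          refine lintegral_mono_ae ?_
          filter_upwards [ae_circle hμ] with ζ hζ
          refine (mul_le_mul_left (AwE_lsc (fun k => memHardy2_poly (p k)) hg hpg hζ) _).trans ?_
          refine le_trans ?_ ENNReal.le_liminf_mul
          rw [liminf_const]
      _ ≤ liminf (fun k => ∫⁻ ζ, 8 * AwE (fun z => (p k).eval z) ζ * radSq φ ζ ∂μ) atTop :=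
          lintegral_liminf_le' fun k => ((measurable_AwE _).const_mul 8).aemeasurable.mul hB
      _ ≤ liminf (fun _ : ℕ => 8 * ENNReal.ofReal (Real.pi * C)) atTop := by
          refine liminf_le_liminf (Eventually.of_forall fun k => ?_)
          simp_rw [mul_assoc]
          rw [lintegral_const_mul' _ _ (by simp)]
          gcongr
          refine (hφ.lintegral_AwE_radSq_le hμ hM hm (p k)).trans (ENNReal.ofReal_le_ofReal ?_)
          have := hC k
          have := Real.pi_pos
          gcongr
      _ = _ := liminf_const _
  obtain ⟨q, hq1, hq2, hq3, -⟩ := hg'.exists_poly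
  have hq4 : ∀ j, ∀ w ∈ disc, Dw (fun z => (q j).eval z) w ≤ 8 * Dw g w + 2 := fun j w hw => by
    have h1 := hq2 j w hw
    have h2 := Dw_le_inner_mul hJ hg' hw
    rw [← Dw_congr h hw] at h2
    linarith
  set D : ℝ≥0∞ := 8 * (64 * (8 * ENNReal.ofReal (Real.pi * C)) +
    ENNReal.ofReal (Real.pi * 2) * μ univ) with hD
  have hDtop : D ≠ ∞ := by
    refine ENNReal.mul_ne_top (by simp) (ENNReal.add_ne_top.2 ⟨?_, ?_⟩)
    · exact ENNReal.mul_ne_top (by simp) (ENNReal.mul_ne_top (by simp) (by simp))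
    · exact ENNReal.mul_ne_top (by simp) (measure_ne_top μ _)
  have h2 : ∀ j, ∫⁻ ζ, 8 * AwE (fun z => (q j).eval z) ζ * radSq φ ζ ∂μ ≤ D := fun j => by
    simp_rw [mul_assoc]
    rw [lintegral_const_mul' _ _ (by simp), hD]
    gcongr
    calc ∫⁻ ζ, AwE (fun z => (q j).eval z) ζ * radSq φ ζ ∂μ ≤
        ∫⁻ ζ, (64 * (AwE g ζ * radSq φ ζ) + ENNReal.ofReal (Real.pi * 2)) ∂μ := by
          refine lintegral_mono_ae ?_
          filter_upwards [ae_circle hμ] with ζ hζ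
          have h3 := AwE_le_of_Dw_le (memHardy2_poly (q j)) hg (by norm_num) (hq4 j) hζ
          have h4 : ENNReal.ofReal 8 * (8 * AwE g ζ) = 64 * AwE g ζ := by
            rw [← mul_assoc]; norm_num
          rw [h4] at h3
          calc _ ≤ (64 * AwE g ζ + ENNReal.ofReal (Real.pi * 2)) * radSq φ ζ := by gcongr
            _ = 64 * (AwE g ζ * radSq φ ζ) + ENNReal.ofReal (Real.pi * 2) * radSq φ ζ := by ring
            _ ≤ 64 * (AwE g ζ * radSq φ ζ) + ENNReal.ofReal (Real.pi * 2) * 1 := by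
              gcongr; exact radSq_le_one hφ1 hζ
            _ = _ := by rw [mul_one]
      _ = 64 * ∫⁻ ζ, AwE g ζ * radSq φ ζ ∂μ + ENNReal.ofReal (Real.pi * 2) * μ univ := by
          rw [lintegral_add_right _ measurable_const, lintegral_const_mul' _ _ (by simp),
            lintegral_const]
      _ ≤ _ := by gcongr
  have hQ : ∀ j, Q μ (fun z => (q j).eval z * φ z) ≤
      D.toReal / Real.pi + (2 * hardyNormSq g' + 2) := fun j => by
    have h3 := (hφ.Q_poly_mul_le_lintegral hμ hM hm (q j)).trans (h2 j)
    rw [ENNReal.ofReal_le_iff_le_toReal hDtop, mul_comm, ← le_div_iff₀ Real.pi_pos] at h3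
    have := hq3 j
    linarith
  have hlim : ∀ z ∈ disc, Tendsto (fun j => (q j).eval z * φ z) atTop (𝓝 (φ z * g' z)) :=
    fun z hz => by simpa [mul_comm] using (hq1 z hz).const_mul (φ z)
  obtain ⟨y, hyM, hy⟩ := hM.exists_weak_limit hμ (h := fun j z => (q j).eval z * φ z)
    (fun j => hM.poly_mul_mem hφ.mem (q j)) hQ subset_rfl (l := fun z => φ z * g' z) hlim
  exact hM.congr hμ hyM hy

end

lemma norm_bdv_le_of_norm_le {F H : ℂ → ℂ} (hF : MemHardy2 F) (hH : MemHardy2 H)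
    (h : ∀ z ∈ disc, ‖F z‖ ≤ ‖H z‖) : ∀ᵐ t ∂cm, ‖bdv F t‖ ≤ ‖bdv H t‖ := by
  filter_upwards [hF.ae_radial, hH.ae_radial] with t h1 h2
  refine le_of_tendsto_of_tendsto h1.norm h2.norm ?_
  filter_upwards [self_mem_nhdsWithin, (eventually_gt_nhds one_pos).filter_mono nhdsWithin_le_nhds]
    with r hr1 hr0
  exact h _ (mul_bpt_mem_disc (le_of_lt hr0) hr1 t)

lemma norm_le_of_dense {F H : ℂ → ℂ} (hF : ContinuousOn F disc) (hH : ContinuousOn H disc)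
    {s : Set ℂ} (hs : Dense s) (h : ∀ z ∈ disc ∩ s, ‖F z‖ ≤ ‖H z‖) :
    ∀ z ∈ disc, ‖F z‖ ≤ ‖H z‖ := fun z hz => by
  have hcl : z ∈ closure (disc ∩ s) := hs.open_subset_closure_inter isOpen_disc hz
  have : (𝓝[disc ∩ s] z).NeBot := mem_closure_iff_nhdsWithin_neBot.1 hcl
  have h1 : Tendsto F (𝓝[disc ∩ s] z) (𝓝 (F z)) := (hF z hz).mono inter_subset_left
  have h2 : Tendsto H (𝓝[disc ∩ s] z) (𝓝 (H z)) := (hH z hz).mono inter_subset_left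
  refine le_of_tendsto_of_tendsto h1.norm h2.norm ?_
  filter_upwards [self_mem_nhdsWithin] with w hw using h w hw

lemma MemHardy2.integral_sq_pm_le {f : ℂ → ℂ} (hf : MemHardy2 f) {w : ℂ} (hw : w ∈ disc) :
    ∫ t, ‖bdv f t‖ ^ 2 ∂(pm w) ≤ (1 + ‖w‖) / (1 - ‖w‖) * hardyNormSq f := by
  rw [integral_pm hw, hf.norm_eq, ← integral_const_mul]
  refine integral_mono_of_nonneg (Eventually.of_forall fun t => ?_)
    (hf.integrable_sq.const_mul _) (Eventually.of_forall fun t => ?_)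
  · have := (pk_pos hw t).le
    simp only [Pi.zero_apply, smul_eq_mul]
    positivity
  · simp only [smul_eq_mul]
    gcongr
    exact pk_le hw t

lemma MemHardy2.integral_norm_pm_sq_le {f : ℂ → ℂ} (hf : MemHardy2 f) {w : ℂ} (hw : w ∈ disc) :
    (∫ t, ‖bdv f t‖ ∂(pm w)) ^ 2 ≤ (1 + ‖w‖) / (1 - ‖w‖) * hardyNormSq f := by
  have := isProbabilityMeasure_pm hw
  have h := integral_norm_sub_sq (P := pm w) (F := fun t => ((‖bdv f t‖ : ℝ) : ℂ))
    ((hf.memLp_pm hw).norm.ofReal)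
  have h0 : 0 ≤ ∫ t, ‖((‖bdv f t‖ : ℝ) : ℂ) - ∫ s, ((‖bdv f s‖ : ℝ) : ℂ) ∂(pm w)‖ ^ 2 ∂(pm w) :=
    integral_nonneg fun t => by positivity
  rw [h, integral_complex_ofReal] at h0
  simp only [Complex.norm_real, Real.norm_eq_abs, sq_abs] at h0
  have := hf.integral_sq_pm_le hw
  linarith

lemma log_max_le {a b : ℝ} (ha : 0 < a) (hb : 0 < b) {d ε : ℝ} (hε : 0 < ε) (hd : b ≤ a + d)
    (hd0 : 0 ≤ d) : max (Real.log a) (Real.log b) ≤ Real.log (a + ε) + d / ε := by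
  refine max_le ?_ ?_
  · have := Real.log_le_log ha (le_add_of_nonneg_right hε.le : a ≤ a + ε)
    have : 0 ≤ d / ε := by positivity
    linarith
  · have h1 : b ≤ (a + ε) * (1 + d / ε) := by
      have : (a + ε) * (1 + d / ε) = a + ε + d + a * (d / ε) := by field_simp; ring
      rw [this]
      have : 0 ≤ a * (d / ε) := by positivity
      linarith
    calc Real.log b ≤ Real.log ((a + ε) * (1 + d / ε)) := Real.log_le_log hb h1
      _ = Real.log (a + ε) + Real.log (1 + d / ε) := Real.log_mul (by positivity) (by positivity)
      _ ≤ _ := by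
        have := Real.log_le_sub_one_of_pos (show 0 < 1 + d / ε by positivity)
        linarith

lemma exp_integral_min_lg_ge {x u : ℂ → ℂ} (hx : MemHardy2 x) (hx0 : NZ x) (hu : MemHardy2 u)
    (hu0 : NZ u) {ε : ℝ} (hε : 0 < ε) {w : ℂ} (hw : w ∈ disc) :
    ‖u w‖ * Real.exp (∫ t, lg x t ∂(pm w) - ∫ t, Real.log (‖bdv x t‖ + ε) ∂(pm w) -
      (∫ t, ‖bdv (fun z => x z - u z) t‖ ∂(pm w)) / ε) ≤
    Real.exp (∫ t, min (lg x t) (lg u t) ∂(pm w)) := by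
  have h1 := hu.norm_le_outr hu0 hw
  rw [norm_outr (hu.integrable_lg hu0) hw] at h1
  have ia := (integrable_pm_iff hw).2 (hx.integrable_lg hx0)
  have ib := (integrable_pm_iff hw).2 (hu.integrable_lg hu0)
  have il := (integrable_pm_iff hw).2
    (integrable_log_add hx.integrable.norm (fun t => norm_nonneg _) hε)
  have id := ((hx.sub hu).integrable_pm hw).norm
  have imin : Integrable (fun t => min (lg x t) (lg u t)) (pm w) := ia.inf ib
  have imax : Integrable (fun t => max (lg x t) (lg u t)) (pm w) := ia.sup ib
  have h2 : ∫ t, min (lg x t) (lg u t) ∂(pm w) + ∫ t, max (lg x t) (lg u t) ∂(pm w) =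
      ∫ t, lg x t ∂(pm w) + ∫ t, lg u t ∂(pm w) := by
    rw [← integral_add imin imax, ← integral_add ia ib]
    simp_rw [min_add_max]
  have h3 : ∫ t, max (lg x t) (lg u t) ∂(pm w) ≤ ∫ t, Real.log (‖bdv x t‖ + ε) ∂(pm w) +
      (∫ t, ‖bdv (fun z => x z - u z) t‖ ∂(pm w)) / ε := by
    rw [← integral_div, ← integral_add il (id.div_const ε)]
    refine integral_mono_ae imax (il.add (id.div_const ε)) ?_
    rw [EventuallyLE, ae_pm hw]
    filter_upwards [hx.bdv_ne hx0, hu.bdv_ne hu0, bdv_sub hx hu] with t t1 t2 t3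
    refine log_max_le (norm_pos_iff.2 t1) (norm_pos_iff.2 t2) hε ?_ (norm_nonneg _)
    rw [t3]
    have := norm_sub_norm_le (bdv u t) (bdv x t)
    rw [norm_sub_rev] at this
    linarith
  refine (mul_le_mul_of_nonneg_right h1 (Real.exp_pos _).le).trans ?_
  rw [← Real.exp_add, Real.exp_le_exp]
  linarith

lemma tendsto_integral_log_add {x : ℂ → ℂ} (hx : MemHardy2 x) (hx0 : NZ x) {w : ℂ}
    (hw : w ∈ disc) : Tendsto (fun n : ℕ => ∫ t, Real.log (‖bdv x t‖ + 1 / (n + 1)) ∂(pm w)) atTop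
      (𝓝 (∫ t, lg x t ∂(pm w))) := by
  have ia := (integrable_pm_iff hw).2 (hx.integrable_lg hx0)
  have iv := (hx.integrable_pm hw).norm
  refine tendsto_integral_of_dominated_convergence (fun t => |lg x t| + ‖bdv x t‖) (fun n => ?_)
    (ia.abs.add iv) (fun n => ?_) ?_
  · exact ((integrable_pm_iff hw).2 (integrable_log_add hx.integrable.norm
      (fun t => norm_nonneg _) (by positivity))).aestronglyMeasurable
  · rw [ae_pm hw]
    filter_upwards [hx.bdv_ne hx0] with t ht
    have hp := norm_pos_iff.2 ht
    have hn : (0:ℝ) < 1 / (n + 1) := by positivity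
    have hn1 : (1:ℝ) / (n + 1) ≤ 1 := by
      rw [div_le_one (by positivity)]; linarith [n.cast_nonneg (α := ℝ)]
    have h1 := Real.log_le_log hp (le_add_of_nonneg_right hn.le : ‖bdv x t‖ ≤ ‖bdv x t‖ + 1 / (n + 1))
    have h2 := Real.log_le_sub_one_of_pos (show 0 < ‖bdv x t‖ + 1 / ((n:ℝ) + 1) by positivity)
    rw [Real.norm_eq_abs, abs_le]
    have h3 := neg_abs_le (lg x t)
    have h4 := abs_nonneg (lg x t)
    have h5 : lg x t = Real.log ‖bdv x t‖ := rfl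
    constructor <;> linarith
  · rw [ae_pm hw]
    filter_upwards [hx.bdv_ne hx0] with t ht
    have h := (tendsto_one_div_add_atTop_nhds_zero_nat (𝕜 := ℝ)).const_add ‖bdv x t‖
    rw [add_zero] at h
    exact h.log (norm_ne_zero_iff.2 ht)

lemma norm_le_of_tendsto_exp_integral_min {x : ℂ → ℂ} (hx : MemHardy2 x) (hx0 : NZ x)
    {u : ℕ → ℂ → ℂ} (hu : ∀ k, MemHardy2 (u k)) (hu0 : ∀ k, NZ (u k)) {w : ℂ} (hw : w ∈ disc)
    (hux : Tendsto (fun k => hardyNormSq fun z => x z - u k z) atTop (𝓝 0))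
    (huw : Tendsto (fun k => u k w) atTop (𝓝 (x w))) {L : ℝ}
    (hL : Tendsto (fun k => Real.exp (∫ t, min (lg x t) (lg (u k) t) ∂(pm w))) atTop (𝓝 L)) :
    ‖x w‖ ≤ L := by
  have hd : Tendsto (fun k => ∫ t, ‖bdv (fun z => x z - u k z) t‖ ∂(pm w)) atTop (𝓝 0) := by
    have h1 : Tendsto (fun k => (∫ t, ‖bdv (fun z => x z - u k z) t‖ ∂(pm w)) ^ 2) atTop (𝓝 0) := by
      have := hux.const_mul ((1 + ‖w‖) / (1 - ‖w‖))
      rw [mul_zero] at this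
      exact squeeze_zero (fun k => by positivity)
        (fun k => (hx.sub (hu k)).integral_norm_pm_sq_le hw) this
    have h2 := h1.sqrt
    rw [Real.sqrt_zero] at h2
    refine h2.congr fun k => Real.sqrt_sq (integral_nonneg fun t => norm_nonneg _)
  have h1 : ∀ n : ℕ, ‖x w‖ * Real.exp (∫ t, lg x t ∂(pm w) -
      ∫ t, Real.log (‖bdv x t‖ + 1 / (n + 1)) ∂(pm w)) ≤ L := fun n => by
    refine le_of_tendsto_of_tendsto' (huw.norm.mul ((Real.continuous_exp.tendsto _).comp
      (f := fun k => ∫ t, lg x t ∂(pm w) - ∫ t, Real.log (‖bdv x t‖ + 1 / (n + 1)) ∂(pm w) -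
      (∫ t, ‖bdv (fun z => x z - u k z) t‖ ∂(pm w)) / (1 / (n + 1))) ?_)) hL
      fun k => exp_integral_min_lg_ge hx hx0 (hu k) (hu0 k) (by positivity) hw
    simpa using (hd.div_const (1 / ((n:ℝ) + 1))).const_sub
      (∫ t, lg x t ∂(pm w) - ∫ t, Real.log (‖bdv x t‖ + 1 / (n + 1)) ∂(pm w))
  have h2 : Tendsto (fun n : ℕ => ‖x w‖ * Real.exp (∫ t, lg x t ∂(pm w) -
      ∫ t, Real.log (‖bdv x t‖ + 1 / (n + 1)) ∂(pm w))) atTop (𝓝 (‖x w‖ * Real.exp 0)) := by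
    refine ((Real.continuous_exp.tendsto _).comp ?_).const_mul _
    simpa using (tendsto_integral_log_add hx hx0 hw).const_sub (∫ t, lg x t ∂(pm w))
  simpa using le_of_tendsto' h2 h1

section

variable {μ : Measure ℂ} [IsFiniteMeasure μ] {M : Set (ℂ → ℂ)}

lemma ClosedInvSubspace.cut_mul_mem (hμ : OnCircle μ) (hM : ClosedInvSubspace μ M)
    {Θ φ : ℂ → ℂ} (hφ : φ ∈ M) (hφ0 : NZ φ) (hφf : ∀ z ∈ disc, φ z = Θ z * outr (lg φ) z)
    {x : ℂ → ℂ} (hx : MemD μ x) (hx0 : NZ x) (hxf : ∀ z ∈ disc, x z = Θ z * outr (lg x) z)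
    {p : ℂ → ℂ} (hp : MemHinf p) (hu : MemD μ fun z => p z * outr (lg φ) z)
    (hu0 : NZ fun z => p z * outr (lg φ) z) :
    (fun z => cut x (fun z => p z * outr (lg φ) z) z * x z) ∈ M ∧
      Q μ (fun z => cut x (fun z => p z * outr (lg φ) z) z * x z) ≤
        hardyNormSq x + (8 * Q μ x + 8 * Q μ fun z => p z * outr (lg φ) z) := by
  set u : ℂ → ℂ := fun z => p z * outr (lg φ) z with hu'
  have hφH := (hM.memD hφ).1
  have hc := memHardy2_cut_mul hx.1 hx0 hu.1 hu0
  have hE : ∀ n, En μ (fun z => cut x u z * x z) n ≤ 8 * Q μ x + 8 * Q μ u := fun n => by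
    have h1 := En_le_of_Dw_le hμ hc hx.1 hu.1 (differentiableOn_const (0 : ℂ)) (a := 1) (b := 1)
      (c := 0) (fun w hw => by
        have := Dw_cut_mul_le hx.1 hx0 hu.1 hu0 hw
        linarith) n
    have h2 := hx.En_le_Q hμ n
    have h3 := hu.En_le_Q hμ n
    linarith
  obtain ⟨hcD, hcQ⟩ := memD_of_En_le_Q hμ hc hE
  have hcle : hardyNormSq (fun z => cut x u z * x z) ≤ hardyNormSq x := by
    have := hardyNormSq_bdd_mul_le hx.1 (memHinf_cut hx.1 hx0 hu.1 hu0)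
      (fun z hz => norm_cut_le hx.1 hx0 hu.1 hu0 hz)
    rwa [one_pow, one_mul] at this
  refine ⟨?_, hcQ.trans (by gcongr)⟩
  obtain ⟨C, hC⟩ := hp.2
  have hix := hx.1.integrable_lg hx0
  have hiu := hu.1.integrable_lg hu0
  have hiφ := hφH.integrable_lg hφ0
  have him : Integrable (fun t => min (lg x t) (lg u t)) cm := hix.inf hiu
  have hiH : Integrable (fun t => min (lg x t) (lg u t) - lg φ t) cm := him.sub hiφ
  have hle : ∀ᵐ t ∂cm, min (lg x t) (lg u t) - lg φ t ≤ Real.log C := by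
    filter_upwards [bdv_mul hp.memHardy2 (hφH.outr_lg hφ0), hφH.norm_bdv_outr_lg hφ0,
      hu.1.bdv_ne hu0, norm_bdv_le hp.memHardy2 hC] with t h1 h2 h3 h4
    have h5 : lg u t = Real.log ‖bdv p t‖ + lg φ t := by
      have hne : ‖bdv u t‖ ≠ 0 := norm_ne_zero_iff.2 h3
      have he : ‖bdv u t‖ = ‖bdv p t‖ * ‖bdv φ t‖ := by rw [h1, norm_mul, h2]
      rw [he] at hne
      rw [lg, lg, he, Real.log_mul (left_ne_zero_of_mul hne) (right_ne_zero_of_mul hne)]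
    have h6 : 0 < ‖bdv p t‖ := by
      refine norm_pos_iff.2 fun h => h3 ?_
      rw [h1, h, zero_mul]
    have h7 := Real.log_le_log h6 h4
    have h8 := min_le_right (lg x t) (lg u t)
    linarith
  have hEq : ∀ z ∈ disc, outr (fun t => min (lg x t) (lg u t) - lg φ t) z * φ z =
      cut x u z * x z := fun z hz => by
    have h1 : outr (fun t => min (lg x t) (lg u t)) z =
        outr (fun t => min (lg x t) (lg u t) - lg φ t) z * outr (lg φ) z := by
      rw [← outr_add hiH hiφ hz]
      exact outr_congr (Eventually.of_forall fun t => by ring) z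
    have h2 : outr (fun t => min (lg x t) (lg u t)) z = cut x u z * outr (lg x) z := by
      rw [cut, ← outr_add (integrable_cut hx.1 hx0 hu.1 hu0) hix hz]
      refine outr_congr (Eventually.of_forall fun t => ?_) z
      simp only [← min_add_add_right, zero_add, sub_add_cancel]
    rw [hφf z hz, hxf z hz]
    linear_combination Θ z * (h2 - h1)
  exact hM.congr hμ (hM.bdd_mul_mem hμ hφ (memHinf_outr hiH hle)
    (hcD.congr hμ fun z hz => (hEq z hz).symm)) hEq

lemma Extremal.hardyNormSq_le_Q (hμ : OnCircle μ) (hM : ClosedInvSubspace μ M) {m : ℕ}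
    (hm : MinOrd M m) {φ : ℂ → ℂ} (hφ : Extremal μ M m φ) (p : Polynomial ℂ) :
    hardyNormSq (fun z => p.eval z) ≤ Q μ (fun z => p.eval z * φ z) := by
  have h := ge_of_tendsto (hφ.tendsto_poly_mul hμ hM hm p) (b := 0)
    (Eventually.of_forall fun n => integral_nonneg_of_ae ?_)
  · linarith
  · filter_upwards [ae_circle hμ] with ζ hζ
    exact mul_nonneg (Dw_nonneg _ (mul_circle_mem (rn_nonneg n) (rn_lt_one n) hζ)) (by positivity)

lemma Extremal.exists_eq_mul (hμ : OnCircle μ) (hM : ClosedInvSubspace μ M) {m : ℕ}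
    (hm : MinOrd M m) {φ : ℂ → ℂ} (hφ : Extremal μ M m φ) {y : ℂ → ℂ} (hy : y ∈ M) :
    ∃ (p : ℕ → Polynomial ℂ) (C : ℝ) (g : ℂ → ℂ), MemHardy2 g ∧
      (∀ k, Q μ (fun z => (p k).eval z * φ z) ≤ C) ∧
      (∀ z ∈ disc, Tendsto (fun k => (p k).eval z) atTop (𝓝 (g z))) ∧
      ∀ z ∈ disc, y z = φ z * g z := by
  have hφD := hM.memD hφ.mem
  have hyD := hM.memD hy
  rw [hφ.eq_closedSpan hμ hM hm] at hy
  obtain ⟨p, hp⟩ := exists_poly_of_mem_closedSpan hμ hφD hy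
  have hpD : ∀ k, MemD μ fun z => (p k).eval z * φ z := fun k => hφD.poly_mul hμ (p k)
  obtain ⟨g, hg, -, hpg⟩ := exists_hardy_limit (Y := fun k z => (p k).eval z)
    (fun k => (memHinf_poly (p k)).memHardy2) (fun ε hε => by
      obtain ⟨N, hN⟩ := cauchy_of_Q_lt hμ hyD hpD hp hε
      refine ⟨N, fun a ha b hb => ?_⟩
      have h1 := hφ.hardyNormSq_le_Q hμ hM hm (p a - p b)
      simp only [Polynomial.eval_sub, sub_mul] at h1
      exact h1.trans (hN a ha b hb))
  refine ⟨p, 2 * Q μ y + 2, g, hg, fun k => ?_, hpg, fun z hz => ?_⟩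
  · have h1 := hyD.Q_sub_le hμ (hyD.sub hμ (hpD k))
    simp only [sub_sub_cancel] at h1
    have h2 := hp k
    have h3 : (1 : ℝ) / (k + 1) ≤ 1 := by
      rw [div_le_one (by positivity)]
      linarith [(k.cast_nonneg : (0 : ℝ) ≤ k)]
    linarith
  · refine tendsto_nhds_unique (tendsto_of_Q_lt hμ hyD hpD hp hz) ?_
    have := (hpg z hz).mul_const (φ z)
    rwa [mul_comm] at this

end

lemma MemHardy2.nz_of_norm_bdv {f g : ℂ → ℂ} (hg : MemHardy2 g) (hg0 : NZ g)
    (h : ∀ᵐ t ∂cm, ‖bdv f t‖ = ‖bdv g t‖) : NZ f := by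
  by_contra! hf
  have h0 : bdv f = bdv fun _ => 0 :=
    bdv_congr fun z hz => by_contra fun hz0 => hf ⟨z, hz, hz0⟩
  obtain ⟨t, h1, h2⟩ := (h.and (hg.bdv_ne hg0)).exists
  rw [h0, bdv_of_continuous continuous_const, norm_zero, eq_comm, norm_eq_zero] at h1
  exact h2 h1

lemma lg_inner_mul {I f g : ℂ → ℂ} (hI : IsInner I) (hf : MemHardy2 f)
    (h : ∀ z ∈ disc, g z = I z * f z) : ∀ᵐ t ∂cm, lg g t = lg f t := by
  filter_upwards [bdv_mul hI.memHardy2 hf, hI.norm_bdv] with t h1 h2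
  rw [lg, lg, bdv_congr h, h1, norm_mul, h2, one_mul]

lemma nz_mul {I f g : ℂ → ℂ} (hg : NZ g) (h : ∀ z ∈ disc, g z = I z * f z) : NZ I ∧ NZ f := by
  obtain ⟨z, hz, hgz⟩ := hg
  rw [h z hz] at hgz
  exact ⟨⟨z, hz, left_ne_zero_of_mul hgz⟩, ⟨z, hz, right_ne_zero_of_mul hgz⟩⟩

section

variable {μ : Measure ℂ} [IsFiniteMeasure μ] {M : Set (ℂ → ℂ)} {m : ℕ} {Θ φ : ℂ → ℂ}

lemma Extremal.mem_of_norm_bdv_eq (hμ : OnCircle μ) (hM : ClosedInvSubspace μ M)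
    (hm : MinOrd M m) (hφ : Extremal μ M m φ)
    (hφf : ∀ z ∈ disc, φ z = Θ z * outr (lg φ) z) {x y : ℂ → ℂ} (hx : MemHardy2 x) (hx0 : NZ x)
    (hxf : ∀ z ∈ disc, x z = Θ z * outr (lg x) z) (hy : y ∈ M)
    (h : ∀ᵐ t ∂cm, ‖bdv y t‖ = ‖bdv x t‖) : x ∈ M := by
  obtain ⟨p, C, g, hg, hC, hpg, hyg⟩ := hφ.exists_eq_mul hμ hM hm hy
  obtain ⟨hφ0, hg0⟩ := nz_mul (hx.nz_of_norm_bdv hx0 h) hyg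
  have hφH := (hM.memD hφ.mem).1
  refine hM.congr hμ (hφ.outer_part_mul_mem hμ hM hm hC hg hpg (hg.isInner_gin hg0)
    (hg.outr_lg hg0) fun z hz => hg.gin_mul hg0 hz) fun z hz => ?_
  rw [hφf z hz, hxf z hz, mul_assoc,
    ← outr_add (hφH.integrable_lg hφ0) (hg.integrable_lg hg0) hz]
  refine congrArg _ (outr_congr ?_ z)
  filter_upwards [h, bdv_mul hφH hg, hφH.bdv_ne hφ0, hg.bdv_ne hg0] with t h1 h2 h3 h4
  rw [lg, lg, lg, ← h1, bdv_congr hyg, h2, norm_mul,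
    Real.log_mul (norm_ne_zero_iff.2 h3) (norm_ne_zero_iff.2 h4)]

lemma exists_subseq_tendsto {h : ℕ → ℂ → ℂ} {b : ℂ → ℝ} {E : Set ℂ}
    (hb : ∀ k, ∀ z ∈ E, ‖h k z‖ ≤ b z) (hE : E.Countable) :
    ∃ σ : ℕ → ℕ, StrictMono σ ∧ ∃ l : ℂ → ℂ, ∀ z ∈ E, Tendsto (fun k => h (σ k) z) atTop (𝓝 (l z)) := by
  classical
  have := hE.to_subtype
  have hK : IsCompact (Set.pi univ fun z : E => closedBall (0 : ℂ) (b z)) :=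
    isCompact_univ_pi fun z => isCompact_closedBall _ _
  obtain ⟨l, -, σ, hσ, hl⟩ := hK.tendsto_subseq (x := fun k (z : E) => h k z) fun k z _ => by
    simpa using hb k z z.2
  refine ⟨σ, hσ, fun z => if hz : z ∈ E then l ⟨z, hz⟩ else 0, fun z hz => ?_⟩
  simp only [dif_pos hz]
  exact (tendsto_pi_nhds.1 hl) ⟨z, hz⟩

end

section

variable {μ : Measure ℂ} [IsFiniteMeasure μ] {M : Set (ℂ → ℂ)} {m : ℕ} {Θ φ : ℂ → ℂ}

lemma norm_bdv_inner_mul {I f g : ℂ → ℂ} (hI : IsInner I) (hf : MemHardy2 f)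
    (h : ∀ z ∈ disc, g z = I z * f z) : ∀ᵐ t ∂cm, ‖bdv g t‖ = ‖bdv f t‖ := by
  filter_upwards [bdv_mul hI.memHardy2 hf, hI.norm_bdv] with t h1 h2
  rw [bdv_congr h, h1, norm_mul, h2, one_mul]

lemma exists_approx_nz (hμ : OnCircle μ) {f x : ℂ → ℂ} (hf : MemD μ f) (hx : x ∈ closedSpan μ f)
    (hx0 : NZ x) : ∃ p : ℕ → Polynomial ℂ,
      (∀ k, NZ fun z => (p k).eval z * f z) ∧
      (∀ k, Q μ (fun z => (p k).eval z * f z) ≤ 2 * Q μ x + 2) ∧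
      Tendsto (fun k => hardyNormSq fun z => x z - (p k).eval z * f z) atTop (𝓝 0) ∧
      ∀ z ∈ disc, Tendsto (fun k => (p k).eval z * f z) atTop (𝓝 (x z)) := by
  have hxD := hx.1
  obtain ⟨p, hp⟩ := exists_poly_of_mem_closedSpan hμ hf hx
  have hpD : ∀ k, MemD μ fun z => (p k).eval z * f z := fun k => hf.poly_mul hμ (p k)
  have hlim := fun z hz => tendsto_of_Q_lt hμ hxD hpD hp (z := z) hz
  have h0 : Tendsto (fun k => hardyNormSq fun z => x z - (p k).eval z * f z) atTop (𝓝 0) :=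
    squeeze_zero (fun k => hardyNormSq_nonneg (hxD.1.sub (hpD k).1))
      (fun k => ((hxD.sub hμ (hpD k)).hardyNormSq_le_Q hμ).trans (hp k).le)
      tendsto_one_div_add_atTop_nhds_zero_nat
  obtain ⟨z, hz, hxz⟩ := hx0
  obtain ⟨n, hn⟩ := eventually_atTop.1 ((hlim z hz).eventually_ne hxz)
  refine ⟨fun k => p (k + n), fun k => ⟨z, hz, hn _ (Nat.le_add_left _ _)⟩, fun k => ?_,
    h0.comp (tendsto_add_atTop_nat n), fun z hz => (hlim z hz).comp (tendsto_add_atTop_nat n)⟩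
  have h1 := hxD.Q_sub_le hμ (hxD.sub hμ (hpD (k + n)))
  simp only [sub_sub_cancel] at h1
  have h2 := hp (k + n)
  have h3 : (1 : ℝ) / ((k + n : ℕ) + 1) ≤ 1 := by
    rw [div_le_one (by positivity)]
    linarith [((k + n : ℕ).cast_nonneg : (0 : ℝ) ≤ (k + n : ℕ))]
  linarith

lemma Extremal.mem_of_mem_closedSpan (hμ : OnCircle μ) (hM : ClosedInvSubspace μ M)
    (hm : MinOrd M m) (hφ : Extremal μ M m φ) (hΘ : IsInner Θ)
    (hφf : ∀ z ∈ disc, φ z = Θ z * outr (lg φ) z) (hf : MemD μ (outr (lg φ))) {x : ℂ → ℂ}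
    (hxΘ : x ∈ innerMulH2 Θ) (hxf : x ∈ closedSpan μ (outr (lg φ))) : x ∈ M := by
  by_cases hx0 : NZ x
  swap
  · exact hM.congr hμ hM.zero_mem fun z hz => (by_contra fun h => hx0 ⟨z, hz, h⟩ : x z = 0).symm
  have hxD := hxf.1
  have hx := hxD.1
  obtain ⟨y, hy, hxy⟩ := hxΘ
  have hy0 := (nz_mul hx0 hxy).2
  set X : ℂ → ℂ := fun z => Θ z * outr (lg x) z 
  have hX' : ∀ z, X z = Θ z * outr (lg x) z := fun _ => rfl
  have hX : MemHardy2 X := (hx.outr_lg hx0).bdd_mul hΘ.1 hΘ.2.1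
  have hJ := hy.isInner_gin hy0
  have hxX : ∀ z ∈ disc, x z = gin y z * X z := fun z hz => by
    rw [hxy z hz, hX' z, outr_congr (lg_inner_mul hΘ hy hxy) z, hy.gin_mul hy0 hz]
    ring
  have hXD : MemD μ X := MemD.of_Dw_le hμ hX hxD fun w hw =>
    (Dw_le_inner_mul hJ hX hw).trans_eq (Dw_congr hxX hw).symm
  have hX0 := (nz_mul hx0 hxX).2
  have hlg := lg_inner_mul hJ hX hxX
  have hXf : ∀ z ∈ disc, X z = Θ z * outr (lg X) z := fun z hz => by
    rw [hX' z, outr_congr hlg z]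
  obtain ⟨p, hu0, hQ, hux, huw⟩ := exists_approx_nz hμ hf hxf hx0
  set u : ℕ → ℂ → ℂ := fun k z => (p k).eval z * outr (lg φ) z with hu'
  have hu : ∀ k, MemD μ (u k) := fun k => hf.poly_mul hμ (p k)
  have hh := fun k => hM.cut_mul_mem hμ hφ.mem (hφ.nz hM) hφf hXD hX0 hXf (memHinf_poly (p k))
    (hu k) (hu0 k)
  obtain ⟨s, hs, hsd⟩ := TopologicalSpace.exists_countable_dense ℂ
  obtain ⟨σ, hσ, l, hl⟩ := exists_subseq_tendsto (h := fun k z => cut X (u k) z * X z)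
    (b := fun z => ‖X z‖) (E := disc ∩ s) (fun k z hz => by
      rw [norm_mul]
      exact mul_le_of_le_one_left (norm_nonneg _) (norm_cut_le hX hX0 (hu k).1 (hu0 k) hz.1))
    (hs.mono inter_subset_right)
  obtain ⟨v, hv, hvl⟩ := hM.exists_weak_limit hμ (h := fun k z => cut X (u (σ k)) z * X z)
    (fun k => (hh (σ k)).1)
    (C := hardyNormSq X + (8 * Q μ X + 8 * (2 * Q μ x + 2)))
    (fun k => (hh (σ k)).2.trans (by gcongr; exact hQ _)) inter_subset_left hl
  have hvH := (hM.memD hv).1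
  have hvX : ∀ z ∈ disc, ‖v z‖ ≤ ‖X z‖ :=
    norm_le_of_dense hvH.1.continuousOn hX.1.continuousOn hsd fun z hz => by
      rw [hvl z hz]
      refine le_of_tendsto (hl z hz).norm (Eventually.of_forall fun k => ?_)
      rw [norm_mul]
      exact mul_le_of_le_one_left (norm_nonneg _) (norm_cut_le hX hX0 (hu _).1 (hu0 _) hz.1)
  have hΘx : MemHardy2 fun z => Θ z * x z := hx.bdd_mul hΘ.1 hΘ.2.1
  have hxv : ∀ z ∈ disc, ‖Θ z * x z‖ ≤ ‖v z‖ :=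
    norm_le_of_dense hΘx.1.continuousOn hvH.1.continuousOn hsd fun w hw => by
      by_cases hΘw : Θ w = 0
      · rw [hΘw, zero_mul, norm_zero]
        exact norm_nonneg _
      have hpos : 0 < ‖Θ w‖ := norm_pos_iff.2 hΘw
      rw [hvl w hw, norm_mul, mul_comm, ← le_div_iff₀ hpos]
      refine norm_le_of_tendsto_exp_integral_min hx hx0 (u := fun k => u (σ k))
        (fun k => (hu _).1) (fun k => hu0 _) hw.1 (hux.comp hσ.tendsto_atTop)
        ((huw w hw.1).comp hσ.tendsto_atTop) (((hl w hw).norm.div_const ‖Θ w‖).congr fun k => ?_)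
      have h1 : ∫ t, min (lg x t) (lg (u (σ k)) t) ∂(pm w) =
          ∫ t, min (lg X t) (lg (u (σ k)) t) ∂(pm w) := by
        refine integral_congr_ae ?_
        rw [EventuallyEq, ae_pm hw.1]
        filter_upwards [hlg] with t ht
        rw [ht]
      rw [h1, ← norm_outr_lg_mul_cut hX hX0 (hu _).1 (hu0 _) hw.1, hXf w hw.1, norm_mul, norm_mul]
      field_simp
  have hXM : X ∈ M := hφ.mem_of_norm_bdv_eq hμ hM hm hφf hX hX0 hXf hv <| by
    filter_upwards [norm_bdv_le_of_norm_le hvH hX hvX, norm_bdv_le_of_norm_le hΘx hvH hxv,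
      norm_bdv_inner_mul hΘ hx (g := fun z => Θ z * x z) fun z _ => rfl,
      norm_bdv_inner_mul hJ hX hxX] with t h1 h2 h3 h4
    rw [h3, h4] at h2
    exact le_antisymm h1 h2
  exact hM.congr hμ (hM.bdd_mul_mem hμ hXM (hy.gin_memHinf hy0) (hxD.congr hμ hxX))
    fun z hz => (hxX z hz).symm

end

/-- **Richter–Sundberg representation.** For a nonzero closed shift-invariant
subspace `M` of `D(μ)` with greatest common inner divisor `Θ_M`, there is an outer
`f ∈ D(μ) ∩ H^∞` with `M = Θ_M H² ∩ [f]_{D(μ)}`, where `f` and `Θ_M f` can be taken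
to be multipliers of `D(μ)`. -/
theorem richter_sundberg_representation
    (μ : Measure ℂ) [IsFiniteMeasure μ] (hμ : OnCircle μ)
    (M : Set (ℂ → ℂ)) (hM : ClosedInvSubspace μ M)
    (hM0 : ∃ f ∈ M, ∃ z ∈ disc, f z ≠ 0)
    (Θ : ℂ → ℂ) (hΘ : IsGCDInner M Θ) :
    ∃ f : ℂ → ℂ, IsOuter f ∧ MemD μ f ∧ MemHinf f ∧
      M = innerMulH2 Θ ∩ closedSpan μ f ∧
      IsMultiplier μ f ∧ IsMultiplier μ (fun z => Θ z * f z) := by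
  obtain ⟨f₀, hf₀, hf₀0⟩ := hM0
  obtain ⟨m, hm⟩ := hM.exists_minOrd hf₀ hf₀0
  obtain ⟨φ, hφ, hφf⟩ := hM.exists_extremal_inner_mul_outr hμ hm hΘ
  have hφ0 := hφ.nz hM
  have hφH := (hM.memD hφ.mem).1
  have hi := hφH.integrable_lg hφ0
  have hle : ∀ᵐ t ∂cm, lg φ t ≤ 0 := by
    filter_upwards [norm_bdv_le hφH fun z hz => hφ.norm_le_one hμ hM hm z hz] with t ht
    exact Real.log_nonpos (norm_nonneg _) ht
  have hfb : MemHinf (outr (lg φ)) := memHinf_outr hi hle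
  have hmul : IsMultiplier μ (outr (lg φ)) := by
    obtain ⟨C, hC⟩ := hfb.2
    refine ⟨hfb.1, fun g hg => ?_⟩
    have hfg : MemHardy2 fun z => outr (lg φ) z * g z := hg.1.bdd_mul hfb.1 hC
    refine MemD.of_Dw_le hμ hfg ((hφ.isMultiplier hμ hM hm).2 g hg) fun w hw => ?_
    refine (Dw_le_inner_mul hΘ.1 hfg hw).trans_eq (Dw_congr (fun z hz => ?_) hw)
    rw [hφf z hz, mul_assoc]
  have hfD : MemD μ (outr (lg φ)) := by
    have := hmul.2 _ (memD_poly hμ 1)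
    simpa using this
  refine ⟨outr (lg φ), isOuter_outr hi, hfD, hfb, ?_, hmul, ?_⟩
  · refine Subset.antisymm (fun x hx => ⟨hΘ.2.1 x hx, ?_⟩) fun x hx =>
      hφ.mem_of_mem_closedSpan hμ hM hm hΘ.1 hφf hfD hx.1 hx.2
    have hs := closedInvSubspace_closedSpan hμ hfD
    have hφs : φ ∈ closedSpan μ (outr (lg φ)) :=
      hs.congr hμ (hs.bdd_mul_mem hμ (self_mem_closedSpan hμ hfD) hΘ.1.memHinf
        ((hM.memD hφ.mem).congr hμ hφf)) fun z hz => (hφf z hz).symm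
    rw [hφ.eq_closedSpan hμ hM hm] at hx
    exact hs.closedSpan_subset hφs hx
  · have h := hφ.isMultiplier hμ hM hm
    refine ⟨h.1.congr fun z hz => (hφf z hz).symm, fun g hg => (h.2 g hg).congr hμ fun z hz => ?_⟩
    rw [hφf z hz]

end DirichletMu
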